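/- Let k ≥ 2 be a fixed integer. There exist constants c = c(k) > 0 and C = C(k) > 0 such that for every integer N ≥ 2, every real α, and all integers a and q with 1 ≤ q ≤ N^k, gcd(a, q) = 1, and |q·α − a| < 1/q, the exponential sum f(α) = ∑_{p ≤ N} e(α·p^k) over primes p satisfies |f(α)| ≤ C·N·(log N)^c·(q^{−1} + N^{−1/2} + q·N^{−k})^{4^{1−k}}. -/

import Mathlib

/-- `e(α) = exp(2πiα)`. -/
noncomputable def eAdd (α : ℝ) : ℂ := Complex.exp (2 * Real.pi * Complex.I * α)

/-- The exponential sum `f(α) = ∑_{p ≤ N} e(α p^k)` over primes `p ≤ N`. -/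
noncomputable def primePowerExpSum (k N : ℕ) (α : ℝ) : ℂ :=
  ∑ p ∈ (Finset.range (N + 1)).filter Nat.Prime, eAdd (α * (p : ℝ) ^ k)

open Finset

theorem eAdd_add (x y : ℝ) : eAdd (x + y) = eAdd x * eAdd y := by
  unfold eAdd; rw [← Complex.exp_add]; congr 1; push_cast; ring

theorem eAdd_zero : eAdd 0 = 1 := by simp [eAdd]

theorem eAdd_eq (x : ℝ) : eAdd x = Complex.exp (Complex.I * (2 * Real.pi * x : ℝ)) := by
  unfold eAdd; congr 1; push_cast; ring

theorem norm_eAdd (x : ℝ) : ‖eAdd x‖ = 1 := by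
  rw [eAdd_eq, Complex.norm_exp_I_mul_ofReal]

theorem eAdd_neg (x : ℝ) : eAdd (-x) = (starRingEnd ℂ) (eAdd x) := by
  unfold eAdd
  rw [← Complex.exp_conj]
  congr 1
  have h2 : (starRingEnd ℂ) 2 = 2 := Complex.conj_ofNat 2
  simp [h2]

theorem eAdd_sub (x y : ℝ) : eAdd (x - y) = eAdd x * (starRingEnd ℂ) (eAdd y) := by
  rw [sub_eq_add_neg, eAdd_add, eAdd_neg]

theorem eAdd_int (n : ℤ) : eAdd n = 1 := by
  unfold eAdd
  rw [Complex.exp_eq_one_iff]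
  exact ⟨n, by push_cast; ring⟩

theorem eAdd_add_int (x : ℝ) (n : ℤ) : eAdd (x + n) = eAdd x := by
  rw [eAdd_add, eAdd_int, mul_one]

theorem eAdd_nat_mul (n : ℕ) (x : ℝ) : eAdd (n * x) = eAdd x ^ n := by
  unfold eAdd
  rw [← Complex.exp_nat_mul]; congr 1; push_cast; ring

/-- Distance to the nearest integer. -/
noncomputable def distInt (x : ℝ) : ℝ := |x - round x|

theorem distInt_nonneg (x : ℝ) : 0 ≤ distInt x := abs_nonneg _

theorem distInt_le (x : ℝ) (n : ℤ) : distInt x ≤ |x - n| := round_le x n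

theorem distInt_add_int (x : ℝ) (n : ℤ) : distInt (x + n) = distInt x := by
  unfold distInt; rw [round_add_intCast]; congr 1; push_cast; ring

theorem distInt_add_le (x y : ℝ) : distInt (x + y) ≤ distInt x + distInt y := by
  refine (distInt_le (x + y) (round x + round y)).trans ?_
  unfold distInt
  refine le_trans (le_of_eq ?_) (abs_add_le _ _)
  congr 1; push_cast; ring

theorem distInt_neg (x : ℝ) : distInt (-x) = distInt x := by
  apply le_antisymm
  · refine (distInt_le (-x) (-round x)).trans (le_of_eq ?_)
    unfold distInt
    rw [← abs_neg]; congr 1; push_cast; ring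
  · refine (distInt_le x (-round (-x))).trans (le_of_eq ?_)
    unfold distInt
    rw [← abs_neg]; congr 1; push_cast; ring

theorem distInt_le_abs (x : ℝ) : distInt x ≤ |x| := by
  simpa using distInt_le x 0

theorem distInt_zero : distInt 0 = 0 :=
  le_antisymm (by simpa using distInt_le_abs 0) (distInt_nonneg 0)

theorem distInt_int (n : ℤ) : distInt n = 0 := by
  have := distInt_add_int 0 n
  rwa [zero_add, distInt_zero] at this

theorem distInt_eq_abs {x : ℝ} (h : |x| ≤ 1 / 2) : distInt x = |x| := by
  apply le_antisymm (distInt_le_abs x)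
  unfold distInt
  by_cases h0 : round x = 0
  · simp [h0]
  · have h1 : (1 : ℝ) ≤ |(round x : ℝ)| := by
      rw [← Int.cast_abs]; exact_mod_cast Int.one_le_abs h0
    have h2 := abs_sub_abs_le_abs_sub (round x : ℝ) x
    rw [abs_sub_comm] at h2
    linarith

/-- A distance bound from below for rationals: `‖b/r‖ ≥ 1/r` unless `r ∣ b`. -/
theorem one_div_le_distInt_div {b : ℤ} {r : ℕ} (hr : 0 < r) (h : ¬ (r : ℤ) ∣ b) :
    1 / (r : ℝ) ≤ distInt (b / r) := by
  unfold distInt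
  have hr' : (0 : ℝ) < r := by exact_mod_cast hr
  set m := round ((b : ℝ) / r)
  have h1 : b - m * r ≠ 0 := fun h0 => h ⟨m, by linarith⟩
  have h2 : (1 : ℝ) ≤ |((b - m * r : ℤ) : ℝ)| := by
    rw [← Int.cast_abs]; exact_mod_cast Int.one_le_abs h1
  have h3 : (b : ℝ) / r - m = ((b - m * r : ℤ) : ℝ) / r := by
    push_cast; field_simp
  rw [h3, abs_div, abs_of_pos hr']
  gcongr

theorem four_mul_distInt_le (θ : ℝ) : 4 * distInt θ ≤ ‖eAdd θ - 1‖ := by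
  have h1 : eAdd θ = eAdd (θ - round θ) := by
    have := eAdd_add_int (θ - round θ) (round θ)
    rw [← this]; congr 1; ring
  rw [h1, eAdd_eq, Complex.norm_exp_I_mul_ofReal_sub_one]
  set t := θ - round θ with ht
  have h2 : |t| ≤ 1 / 2 := abs_sub_round θ
  have h3 : distInt θ = |t| := rfl
  rw [h3]
  have h4 : 2 * Real.pi * t / 2 = Real.pi * t := by ring
  rw [h4, norm_mul, Real.norm_eq_abs, Real.norm_eq_abs, abs_of_pos (by norm_num : (0:ℝ) < 2)]
  have h5 : |Real.sin (Real.pi * t)| = Real.sin (Real.pi * |t|) := by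
    have hnn : 0 ≤ Real.sin (Real.pi * |t|) := by
      apply Real.sin_nonneg_of_nonneg_of_le_pi
      · positivity
      · nlinarith [Real.pi_pos]
    rcases abs_cases t with ⟨h, _⟩ | ⟨h, _⟩
    · rw [h] at hnn ⊢; exact abs_of_nonneg hnn
    · rw [h] at hnn ⊢
      rw [mul_neg, Real.sin_neg] at hnn ⊢
      exact abs_of_nonpos (by linarith)
  rw [h5]
  have h6 := Real.mul_le_sin (x := Real.pi * |t|) (by positivity) (by nlinarith [Real.pi_pos])
  have h7 : 2 / Real.pi * (Real.pi * |t|) = 2 * |t| := by field_simp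
  linarith

/-- The smooth replacement `X / (1 + X‖θ‖)` of `min(X, 1/‖θ‖)`. -/
noncomputable def bd (X θ : ℝ) : ℝ := X / (1 + X * distInt θ)

theorem bd_pos_den {X : ℝ} (hX : 0 ≤ X) (θ : ℝ) : 0 < 1 + X * distInt θ := by
  have := mul_nonneg hX (distInt_nonneg θ); linarith

theorem bd_nonneg {X : ℝ} (hX : 0 ≤ X) (θ : ℝ) : 0 ≤ bd X θ :=
  div_nonneg hX (bd_pos_den hX θ).le

theorem bd_le_self {X : ℝ} (hX : 0 ≤ X) (θ : ℝ) : bd X θ ≤ X :=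
  div_le_self hX (by have := mul_nonneg hX (distInt_nonneg θ); linarith)

theorem bd_mul_distInt_le {X : ℝ} (hX : 0 ≤ X) (θ : ℝ) : bd X θ * distInt θ ≤ 1 := by
  unfold bd
  rw [div_mul_eq_mul_div, div_le_one (bd_pos_den hX θ)]; linarith

theorem bd_le_one_div {X : ℝ} (hX : 0 ≤ X) {θ t : ℝ} (ht : 0 < t) (h : t ≤ distInt θ) :
    bd X θ ≤ 1 / t := by
  rw [le_div_iff₀ ht]
  exact (mul_le_mul_of_nonneg_left h (bd_nonneg hX θ)).trans (bd_mul_distInt_le hX θ)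

theorem bd_mono {X Y : ℝ} (hX : 0 ≤ X) (hXY : X ≤ Y) (θ : ℝ) : bd X θ ≤ bd Y θ := by
  unfold bd
  rw [div_le_div_iff₀ (bd_pos_den hX θ) (bd_pos_den (hX.trans hXY) θ)]
  nlinarith [distInt_nonneg θ]

theorem bd_neg (X θ : ℝ) : bd X (-θ) = bd X θ := by simp [bd, distInt_neg]

/-- From `S ≤ X` and `S ‖θ‖ ≤ c` one gets `S ≤ (1 + c) bd X θ`. -/
theorem le_bd_of_le {X θ S c : ℝ} (hX : 0 ≤ X) (h1 : S ≤ X) (h2 : S * distInt θ ≤ c) :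
    S ≤ (1 + c) * bd X θ := by
  unfold bd
  rw [mul_div_assoc', le_div_iff₀ (bd_pos_den hX θ)]
  nlinarith

theorem norm_geom_eAdd_mul_le (θ : ℝ) (n : ℕ) :
    ‖∑ i ∈ range n, eAdd (θ * i)‖ * distInt θ ≤ 1 / 2 := by
  have h1 : ∑ i ∈ range n, eAdd (θ * i) = ∑ i ∈ range n, eAdd θ ^ i := by
    refine sum_congr rfl fun i _ => ?_
    rw [mul_comm, eAdd_nat_mul]
  have h2 : (∑ i ∈ range n, eAdd (θ * i)) * (eAdd θ - 1) = eAdd θ ^ n - 1 := by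
    rw [h1]; exact geom_sum_mul _ _
  have h3 : ‖eAdd θ ^ n - 1‖ ≤ 2 := by
    refine (norm_sub_le _ _).trans ?_
    rw [norm_pow, norm_eAdd]; norm_num
  rw [← h2, norm_mul] at h3
  have := mul_le_mul_of_nonneg_left (four_mul_distInt_le θ) (norm_nonneg (∑ i ∈ range n, eAdd (θ * i)))
  linarith

theorem sum_Icc_int_eq_sum_range {M : Type*} [AddCommMonoid M] (a b : ℤ) (f : ℤ → M) :
    ∑ x ∈ Icc a b, f x = ∑ i ∈ range (b + 1 - a).toNat, f (a + i) := by
  refine (sum_bij (fun (i : ℕ) _ => a + (i : ℤ)) ?_ ?_ ?_ ?_).symm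
  · intro i hi; simp only [mem_range, mem_Icc] at *; omega
  · intro i _ j _ h; simpa using h
  · intro x hx; simp only [mem_Icc] at hx
    exact ⟨(x - a).toNat, by simp only [mem_range]; omega, by omega⟩
  · intro i _; rfl

/-- A filtered interval by an order-connected predicate is an interval. -/
theorem exists_Icc_eq_filter (s : Set ℤ) (hs : s.OrdConnected) [DecidablePred (· ∈ s)] (A B : ℤ) :
    ∃ a b : ℤ, (Icc A B).filter (· ∈ s) = Icc a b := by
  by_cases h : ((Icc A B).filter (· ∈ s)).Nonempty
  · refine ⟨((Icc A B).filter (· ∈ s)).min' h, ((Icc A B).filter (· ∈ s)).max' h, ?_⟩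
    ext x
    constructor
    · intro hx; rw [mem_Icc]; exact ⟨min'_le _ _ hx, le_max' _ _ hx⟩
    · intro hx
      rw [mem_Icc] at hx
      have h1 := mem_filter.1 (min'_mem _ h)
      have h2 := mem_filter.1 (max'_mem _ h)
      rw [mem_Icc] at h1 h2
      rw [mem_filter, mem_Icc]
      exact ⟨⟨by linarith [h1.1.1, hx.1], by linarith [h2.1.2, hx.2]⟩, hs.out h1.2 h2.2 hx⟩
  · refine ⟨1, 0, ?_⟩
    rw [not_nonempty_iff_eq_empty] at h
    rw [h]; simp

/-- Linear exponential sums over an interval piece. -/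
theorem norm_linear_sum_le {X : ℕ} (s : Set ℤ) (hs : s.OrdConnected) [DecidablePred (· ∈ s)]
    (θ c : ℝ) (A : ℤ) :
    ‖∑ x ∈ (Icc (A + 1) (A + X)).filter (· ∈ s), eAdd (θ * x + c)‖ ≤ 3 / 2 * bd X θ := by
  have hc : ‖∑ x ∈ (Icc (A + 1) (A + X)).filter (· ∈ s), eAdd (θ * x + c)‖ ≤ X := by
    refine (norm_sum_le _ _).trans ?_
    simp only [norm_eAdd, sum_const, nsmul_eq_mul, mul_one]
    have : #((Icc (A + 1) (A + X)).filter (· ∈ s)) ≤ X := by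
      refine (card_filter_le _ _).trans ?_
      simp
    exact_mod_cast this
  have h2 : ‖∑ x ∈ (Icc (A + 1) (A + X)).filter (· ∈ s), eAdd (θ * x + c)‖ * distInt θ ≤ 1 / 2 := by
    obtain ⟨a, b, hab⟩ := exists_Icc_eq_filter s hs (A + 1) (A + X)
    rw [hab, sum_Icc_int_eq_sum_range]
    have : ∀ i ∈ range (b + 1 - a).toNat, eAdd (θ * ((a + i : ℤ) : ℝ) + c)
        = eAdd (θ * a + c) * eAdd (θ * i) := by
      intro i _; rw [← eAdd_add]; congr 1; push_cast; ring
    rw [sum_congr rfl this, ← mul_sum, norm_mul, norm_eAdd, one_mul]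
    exact norm_geom_eAdd_mul_le _ _
  have := le_bd_of_le (Nat.cast_nonneg X) hc h2
  linarith

/-- Differences of an integer polynomial are divisible by the step, with a quotient polynomial of
smaller degree and explicit leading coefficient. -/
theorem exists_polynomial_diff (d : ℕ) (p : Polynomial ℤ) (hp : p.natDegree ≤ d + 1) (h : ℤ) :
    ∃ g : Polynomial ℤ, g.natDegree ≤ d ∧ g.coeff d = (d + 1) * p.coeff (d + 1) ∧
      ∀ y, p.eval (y + h) - p.eval y = h * g.eval y := by
  have key : ∀ i, ∃ g : Polynomial ℤ, g.natDegree ≤ i ∧ g.coeff i = i + 1 ∧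
      ∀ y : ℤ, (y + h) ^ (i + 1) - y ^ (i + 1) = h * g.eval y := by
    intro i
    have hm : ∀ j ∈ range (i + 1), ((Polynomial.X + Polynomial.C h) ^ j * Polynomial.X ^ (i - j) :
        Polynomial ℤ).Monic ∧
        ((Polynomial.X + Polynomial.C h) ^ j * Polynomial.X ^ (i - j) :
        Polynomial ℤ).natDegree = i := by
      intro j hj
      have hm1 : ((Polynomial.X + Polynomial.C h) ^ j : Polynomial ℤ).Monic :=
        (Polynomial.monic_X_add_C h).pow j
      have hm2 : (Polynomial.X ^ (i - j) : Polynomial ℤ).Monic := Polynomial.monic_X_pow _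
      refine ⟨hm1.mul hm2, ?_⟩
      rw [hm1.natDegree_mul hm2, (Polynomial.monic_X_add_C h).natDegree_pow,
        Polynomial.natDegree_X_add_C, Polynomial.natDegree_X_pow]
      rw [mem_range] at hj; omega
    refine ⟨∑ j ∈ range (i + 1), (Polynomial.X + Polynomial.C h) ^ j * Polynomial.X ^ (i - j),
      ?_, ?_, ?_⟩
    · exact Polynomial.natDegree_sum_le_of_forall_le _ _ fun j hj => (hm j hj).2.le
    · rw [Polynomial.finsetSum_coeff]
      rw [sum_congr rfl (g := fun _ => (1 : ℤ))]
      · simp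
      · intro j hj
        have := (hm j hj).1.coeff_natDegree
        rwa [(hm j hj).2] at this
    · intro y
      rw [Polynomial.eval_finsetSum]
      have h1 := (Commute.all (y + h) y).geom_sum₂_mul (i + 1)
      rw [← h1]
      simp only [Polynomial.eval_mul, Polynomial.eval_pow, Polynomial.eval_add, Polynomial.eval_X,
        Polynomial.eval_C]
      rw [mul_comm]
      congr 1
      ring
  choose g hg1 hg2 hg3 using key
  refine ⟨∑ i ∈ range (d + 1), Polynomial.C (p.coeff (i + 1)) * g i, ?_, ?_, ?_⟩
  · refine Polynomial.natDegree_sum_le_of_forall_le _ _ fun i hi => ?_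
    refine (Polynomial.natDegree_C_mul_le _ _).trans ((hg1 i).trans ?_)
    rw [mem_range] at hi; omega
  · rw [Polynomial.finsetSum_coeff, sum_range_succ, sum_eq_zero]
    · rw [Polynomial.coeff_C_mul, hg2]; ring
    · intro i hi
      rw [mem_range] at hi
      rw [Polynomial.coeff_C_mul, Polynomial.coeff_eq_zero_of_natDegree_lt
        (lt_of_le_of_lt (hg1 i) hi), mul_zero]
  · intro y
    rw [Polynomial.eval_eq_sum_range' (n := d + 2) (by omega) y,
      Polynomial.eval_eq_sum_range' (n := d + 2) (by omega) (y + h), ← sum_sub_distrib,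
      Polynomial.eval_finsetSum, mul_sum, sum_range_succ']
    simp only [pow_zero, sub_self, add_zero]
    refine sum_congr rfl fun i _ => ?_
    rw [← mul_sub, hg3, Polynomial.eval_mul, Polynomial.eval_C]; ring

theorem card_Ioo_neg_le (X : ℕ) : ((#(Ioo (-(X : ℤ)) X) : ℕ) : ℝ) ≤ 2 * X := by
  have : #(Ioo (-(X : ℤ)) X) ≤ 2 * X := by rw [Int.card_Ioo]; omega
  exact_mod_cast this

/-- Weyl differencing: expanding a square of a sum over a finite set in `[1, X]`. -/
theorem sum_mul_conj_eq {X : ℕ} {A : Finset ℤ} (hA : A ⊆ Icc 1 (X : ℤ)) (F : ℤ → ℂ) :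
    (∑ x ∈ A, F x) * (starRingEnd ℂ) (∑ x ∈ A, F x) =
      ∑ h ∈ Ioo (-(X : ℤ)) X, ∑ x ∈ A.filter (fun x => x + h ∈ A),
        F (x + h) * (starRingEnd ℂ) (F x) := by
  rw [map_sum, sum_mul_sum, sum_comm]
  simp only [sum_filter]
  conv_rhs => rw [sum_comm]
  refine sum_congr rfl fun x hx => ?_
  rw [← sum_filter]
  refine sum_bij' (fun y _ => y - x) (fun h _ => x + h) ?_ ?_ ?_ ?_ ?_
  · intro y hy
    have h1 := mem_Icc.1 (hA hx)
    have h2 := mem_Icc.1 (hA hy)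
    simp only [mem_filter, mem_Ioo, add_sub_cancel]
    exact ⟨by omega, hy⟩
  · intro h hh; exact (mem_filter.1 hh).2
  · intro y _; ring
  · intro h _; ring
  · intro y _; simp

theorem norm_sq_sum_le {X : ℕ} {A : Finset ℤ} (hA : A ⊆ Icc 1 (X : ℤ)) (F : ℤ → ℂ) :
    ‖∑ x ∈ A, F x‖ ^ 2 ≤ ∑ h ∈ Ioo (-(X : ℤ)) X, ‖∑ x ∈ A.filter (fun x => x + h ∈ A),
        F (x + h) * (starRingEnd ℂ) (F x)‖ := by
  refine le_trans (le_of_eq ?_) (norm_sum_le _ _)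
  rw [← sum_mul_conj_eq hA, norm_mul, Complex.norm_conj, sq]

theorem ordConnected_filter_shift {A : Finset ℤ} (hA : (A : Set ℤ).OrdConnected) (h : ℤ) :
    ((A.filter (fun x => x + h ∈ A) : Finset ℤ) : Set ℤ).OrdConnected := by
  constructor
  intro x hx y hy z hz
  simp only [coe_filter, Set.mem_ofPred_eq] at hx hy ⊢
  refine ⟨hA.out hx.1 hy.1 hz, hA.out hx.2 hy.2 ⟨by linarith [hz.1], by linarith [hz.2]⟩⟩

/-- The iterated sum `∑_{|l₁|,…,|l_j| < X} bd X (θ l₁ ⋯ l_j)`. -/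
noncomputable def multiBd : ℕ → ℕ → ℝ → ℝ
  | 0, X, θ => bd X θ
  | j + 1, X, θ => ∑ l ∈ Ioo (-(X : ℤ)) X, multiBd j X (θ * l)

theorem multiBd_nonneg (j X : ℕ) (θ : ℝ) : 0 ≤ multiBd j X θ := by
  induction j generalizing θ with
  | zero => exact bd_nonneg (Nat.cast_nonneg X) θ
  | succ j ih => exact sum_nonneg fun l _ => ih _

theorem multiBd_neg (j X : ℕ) (θ : ℝ) : multiBd j X (-θ) = multiBd j X θ := by
  induction j generalizing θ with
  | zero => exact bd_neg _ _
  | succ j ih => exact sum_congr rfl fun l _ => by rw [neg_mul]; exact ih _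

theorem multiBd_le (j X : ℕ) (θ : ℝ) : multiBd j X θ ≤ (2 * X) ^ j * X := by
  induction j generalizing θ with
  | zero => simpa [multiBd] using bd_le_self (Nat.cast_nonneg X) θ
  | succ j ih =>
    refine (sum_le_card_nsmul _ _ _ fun l _ => ih _).trans ?_
    rw [nsmul_eq_mul, pow_succ]
    have := card_Ioo_neg_le X
    calc _ ≤ (2 * X : ℝ) * ((2 * X) ^ j * X) := by gcongr
      _ = _ := by ring

theorem norm_linear_sum_finset_le {X : ℕ} {A : Finset ℤ} (hA : A ⊆ Icc 1 (X : ℤ))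
    (hc : (A : Set ℤ).OrdConnected) (θ c : ℝ) :
    ‖∑ x ∈ A, eAdd (θ * x + c)‖ ≤ 3 / 2 * bd X θ := by
  classical
  have h := norm_linear_sum_le (X := X) (A : Set ℤ) hc θ c 0
  have h2 : (Icc ((0 : ℤ) + 1) (0 + X)).filter (· ∈ (A : Set ℤ)) = A := by
    ext x
    simp only [mem_filter, mem_coe, zero_add]
    exact ⟨fun h => h.2, fun h => ⟨hA h, h⟩⟩
  rwa [h2] at h

/-- Weyl's inequality. -/
theorem weyl_inequality (j : ℕ) {X : ℕ} (p : Polynomial ℤ) (hp : p.natDegree ≤ j + 1) (θ : ℝ)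
    {A : Finset ℤ} (hA : A ⊆ Icc 1 (X : ℤ)) (hc : (A : Set ℤ).OrdConnected) :
    (2 * X : ℝ) ^ (j + 1) * ‖∑ x ∈ A, eAdd (θ * (p.eval x : ℤ))‖ ^ 2 ^ j ≤
      3 / 2 * (2 * X : ℝ) ^ 2 ^ j * multiBd j X (θ * ((p.coeff (j + 1) : ℤ) * (j + 1).factorial)) := by
  induction j generalizing p θ A with
  | zero =>
    have h1 : ∀ x : ℤ, p.eval x = p.coeff 1 * x + p.coeff 0 := by
      intro x
      rw [Polynomial.eval_eq_sum_range' (n := 2) (by omega) x]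
      simp [sum_range_succ]; ring
    have h2 : ∑ x ∈ A, eAdd (θ * (p.eval x : ℤ)) =
        ∑ x ∈ A, eAdd ((θ * p.coeff 1) * x + θ * p.coeff 0) := by
      refine sum_congr rfl fun x _ => ?_
      rw [h1]; congr 1; push_cast; ring
    have h3 := norm_linear_sum_finset_le hA hc (θ * p.coeff 1) (θ * p.coeff 0)
    rw [h2]
    simp only [zero_add, pow_one, pow_zero, Nat.factorial_one, Nat.cast_one, mul_one, multiBd]
    calc _ ≤ 2 * (X : ℝ) * (3 / 2 * bd X (θ * p.coeff 1)) := by gcongr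
      _ = _ := by ring
  | succ j ih =>
    set S := ∑ x ∈ A, eAdd (θ * (p.eval x : ℤ)) with hS
    have hX0 : (0 : ℝ) ≤ 2 * X := by positivity
    have h1 : ∀ h : ℤ, (2 * X : ℝ) ^ (j + 1) * ‖∑ x ∈ A.filter (fun x => x + h ∈ A),
        eAdd (θ * (p.eval (x + h) : ℤ)) * (starRingEnd ℂ) (eAdd (θ * (p.eval x : ℤ)))‖ ^ 2 ^ j
        ≤ 3 / 2 * (2 * X : ℝ) ^ 2 ^ j *
          multiBd j X (θ * ((p.coeff (j + 1 + 1) : ℤ) * (j + 1 + 1).factorial) * h) := by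
      intro h
      obtain ⟨g, hg1, hg2, hg3⟩ := exists_polynomial_diff (j + 1) p hp h
      have := ih g hg1 (θ * h) (A := A.filter (fun x => x + h ∈ A))
        ((filter_subset _ _).trans hA) (ordConnected_filter_shift hc h)
      have e1 : ∀ x ∈ A.filter (fun x => x + h ∈ A), eAdd (θ * (p.eval (x + h) : ℤ)) *
          (starRingEnd ℂ) (eAdd (θ * (p.eval x : ℤ))) = eAdd (θ * h * (g.eval x : ℤ)) := by
        intro x _
        rw [← eAdd_sub, ← mul_sub, ← Int.cast_sub, hg3]
        congr 1; push_cast; ring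
      have e2 : θ * ((p.coeff (j + 1 + 1) : ℤ) * (j + 1 + 1).factorial) * h =
          θ * h * ((g.coeff (j + 1) : ℤ) * (j + 1).factorial) := by
        rw [hg2, Nat.factorial_succ (j + 1)]; push_cast; ring
      rw [sum_congr rfl e1, e2]
      exact this
    have h2 : ‖S‖ ^ 2 ^ (j + 1) ≤ (2 * X : ℝ) ^ (2 ^ j - 1) * ∑ h ∈ Ioo (-(X : ℤ)) X,
        ‖∑ x ∈ A.filter (fun x => x + h ∈ A),
        eAdd (θ * (p.eval (x + h) : ℤ)) * (starRingEnd ℂ) (eAdd (θ * (p.eval x : ℤ)))‖ ^ 2 ^ j := by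
      have e1 : ‖S‖ ^ 2 ^ (j + 1) = (‖S‖ ^ 2) ^ 2 ^ j := by rw [← pow_mul]; congr 1; ring
      rw [e1]
      refine (pow_le_pow_left₀ (by positivity)
        (norm_sq_sum_le hA (fun x => eAdd (θ * (p.eval x : ℤ)))) _).trans ?_
      obtain ⟨m, hm⟩ : ∃ m, 2 ^ j = m + 1 := ⟨2 ^ j - 1, by have := Nat.one_le_two_pow (n := j); omega⟩
      rw [hm, Nat.add_sub_cancel]
      refine (pow_sum_le_card_mul_sum_pow (fun _ _ => norm_nonneg _) _).trans ?_
      gcongr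
      exact card_Ioo_neg_le X
    have e2 : (2 * X : ℝ) ^ 2 ^ (j + 1) = (2 * X : ℝ) ^ 2 ^ j * (2 * X : ℝ) ^ 2 ^ j := by
      rw [← pow_add]; congr 1; ring
    have e3 : (2 * X : ℝ) ^ 2 ^ j = (2 * X : ℝ) ^ (2 ^ j - 1) * (2 * X) := by
      rw [← pow_succ]; congr 1; have := Nat.one_le_two_pow (n := j); omega
    calc (2 * X : ℝ) ^ (j + 1 + 1) * ‖S‖ ^ 2 ^ (j + 1)
        ≤ (2 * X : ℝ) ^ (j + 1 + 1) * ((2 * X : ℝ) ^ (2 ^ j - 1) * ∑ h ∈ Ioo (-(X : ℤ)) X,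
        ‖∑ x ∈ A.filter (fun x => x + h ∈ A),
        eAdd (θ * (p.eval (x + h) : ℤ)) * (starRingEnd ℂ) (eAdd (θ * (p.eval x : ℤ)))‖ ^ 2 ^ j) := by
          gcongr
      _ = (2 * X : ℝ) ^ 2 ^ j * ∑ h ∈ Ioo (-(X : ℤ)) X, (2 * X : ℝ) ^ (j + 1) *
        ‖∑ x ∈ A.filter (fun x => x + h ∈ A),
        eAdd (θ * (p.eval (x + h) : ℤ)) * (starRingEnd ℂ) (eAdd (θ * (p.eval x : ℤ)))‖ ^ 2 ^ j := by
          rw [← mul_sum, e3, pow_succ]; ring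
      _ ≤ (2 * X : ℝ) ^ 2 ^ j * ∑ h ∈ Ioo (-(X : ℤ)) X, 3 / 2 * (2 * X : ℝ) ^ 2 ^ j *
          multiBd j X (θ * ((p.coeff (j + 1 + 1) : ℤ) * (j + 1 + 1).factorial) * h) := by
          exact mul_le_mul_of_nonneg_left (sum_le_sum fun h _ => h1 h) (by positivity)
      _ = _ := by
          rw [← mul_sum, e2, multiBd]; ring

/-- Weyl's inequality for the monomial `x ^ k` with `k = j + 1`. -/
theorem weyl_monomial (j : ℕ) {X : ℕ} (θ : ℝ)
    {A : Finset ℤ} (hA : A ⊆ Icc 1 (X : ℤ)) (hc : (A : Set ℤ).OrdConnected) :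
    (2 * X : ℝ) ^ (j + 1) * ‖∑ x ∈ A, eAdd (θ * (x : ℝ) ^ (j + 1))‖ ^ 2 ^ j ≤
      3 / 2 * (2 * X : ℝ) ^ 2 ^ j * multiBd j X (θ * (j + 1).factorial) := by
  have := weyl_inequality j (X := X) (Polynomial.X ^ (j + 1)) (by simp) θ hA hc
  simpa using this

theorem sum_divisorsAntidiagonal_Icc {M : Type*} [AddCommMonoid M] (N : ℕ) (g : ℕ × ℕ → M) :
    ∑ n ∈ Icc 1 N, ∑ p ∈ n.divisorsAntidiagonal, g p =
      ∑ m ∈ Icc 1 N, ∑ l ∈ Icc 1 (N / m), g (m, l) := by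
  rw [sum_sigma', sum_sigma']
  refine sum_bij' (fun x _ => ⟨x.2.1, x.2.2⟩) (fun y _ => ⟨y.1 * y.2, (y.1, y.2)⟩) ?_ ?_ ?_ ?_ ?_
  · rintro ⟨n, m, l⟩ h
    simp only [mem_sigma, mem_Icc, Nat.mem_divisorsAntidiagonal] at h ⊢
    obtain ⟨⟨h1, h2⟩, h3, h4⟩ := h
    have hm : 0 < m := Nat.pos_of_ne_zero (by rintro rfl; simp at h3; omega)
    have hl : 0 < l := Nat.pos_of_ne_zero (by rintro rfl; simp at h3; omega)
    refine ⟨⟨hm, le_trans ?_ h2⟩, hl, (Nat.le_div_iff_mul_le hm).2 ?_⟩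
    · rw [← h3]; exact Nat.le_mul_of_pos_right _ hl
    · rw [mul_comm, h3]; exact h2
  · rintro ⟨m, l⟩ h
    simp only [mem_sigma, mem_Icc, Nat.mem_divisorsAntidiagonal] at h ⊢
    obtain ⟨⟨h1, h2⟩, h3, h4⟩ := h
    have := (Nat.le_div_iff_mul_le (by omega)).1 h4
    have h5 : 0 < m * l := Nat.mul_pos h1 h3
    exact ⟨⟨h5, by rw [mul_comm]; exact this⟩, trivial, h5.ne'⟩
  · rintro ⟨n, m, l⟩ h
    simp only [mem_sigma, Nat.mem_divisorsAntidiagonal] at h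
    obtain ⟨_, rfl, _⟩ := h
    rfl
  · rintro ⟨m, l⟩ _; rfl
  · rintro ⟨n, m, l⟩ _; rfl

/-- The logarithmic factor `1 + log N`. -/
noncomputable def lg (N : ℕ) : ℝ := 1 + Real.log N

theorem one_le_lg (N : ℕ) : 1 ≤ lg N := by
  have := Real.log_natCast_nonneg N
  unfold lg; linarith

theorem lg_pos (N : ℕ) : 0 < lg N := lt_of_lt_of_le one_pos (one_le_lg N)

theorem lg_mono {m n : ℕ} (h : m ≤ n) : lg m ≤ lg n := by
  rcases Nat.eq_zero_or_pos m with rfl | hm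
  · simpa [lg] using Real.log_natCast_nonneg n
  · unfold lg
    have : Real.log m ≤ Real.log n := Real.log_le_log (by exact_mod_cast hm) (by exact_mod_cast h)
    linarith

theorem lg_pow_le (n k : ℕ) : lg (n ^ (k + 1)) ≤ (k + 1) * lg n := by
  unfold lg
  rw [Nat.cast_pow, Real.log_pow]; push_cast; nlinarith [(Nat.cast_nonneg k : (0 : ℝ) ≤ k)]

theorem lg_mul_le (m n : ℕ) : lg (m * n) ≤ lg m + lg n := by
  rcases Nat.eq_zero_or_pos m with rfl | hm
  · have := one_le_lg n
    simp [lg] at this ⊢; linarith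
  rcases Nat.eq_zero_or_pos n with rfl | hn
  · have := one_le_lg m
    simp [lg] at this ⊢; linarith
  unfold lg
  rw [Nat.cast_mul, Real.log_mul (by positivity) (by positivity)]; linarith

/-- The number of divisors, as a real number. -/
noncomputable def tau (n : ℕ) : ℝ := #n.divisors

theorem tau_nonneg (n : ℕ) : 0 ≤ tau n := Nat.cast_nonneg _

theorem one_le_tau {n : ℕ} (hn : n ≠ 0) : 1 ≤ tau n := by
  unfold tau
  exact_mod_cast Finset.card_pos.2 ⟨1, Nat.one_mem_divisors.2 hn⟩

theorem tau_le_of_dvd {m n : ℕ} (h : m ∣ n) (hn : n ≠ 0) : tau m ≤ tau n := by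
  unfold tau
  exact_mod_cast card_le_card (Nat.divisors_subset_of_dvd hn h)

theorem tau_mul_le (m n : ℕ) : tau (m * n) ≤ tau m * tau n := by
  unfold tau
  rw [Nat.divisors_mul]
  exact_mod_cast card_mul_le

theorem sum_one_div_le_lg (D : ℕ) : ∑ d ∈ Icc 1 D, 1 / (d : ℝ) ≤ lg D := by
  have h := harmonic_le_one_add_log D
  rw [harmonic_eq_sum_Icc] at h
  push_cast at h
  simpa [lg, one_div] using h

theorem sum_tau_pow_div_le (B D : ℕ) : ∑ d ∈ Icc 1 D, tau d ^ B / d ≤ lg D ^ 2 ^ B := by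
  induction B with
  | zero => simpa using sum_one_div_le_lg D
  | succ B ih =>
    calc ∑ d ∈ Icc 1 D, tau d ^ (B + 1) / d
        = ∑ d ∈ Icc 1 D, ∑ p ∈ d.divisorsAntidiagonal, tau d ^ B / d := by
          refine sum_congr rfl fun d _ => ?_
          rw [sum_const, nsmul_eq_mul, ← Nat.map_div_right_divisors, card_map, pow_succ]
          change _ = tau d * _
          ring
      _ ≤ ∑ d ∈ Icc 1 D, ∑ p ∈ d.divisorsAntidiagonal,
            (tau p.1 ^ B / p.1) * (tau p.2 ^ B / p.2) := by
          refine sum_le_sum fun d _ => sum_le_sum fun p hp => ?_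
          rw [Nat.mem_divisorsAntidiagonal] at hp
          rw [← hp.1, div_mul_div_comm, ← mul_pow, Nat.cast_mul]
          have := tau_mul_le p.1 p.2
          have := tau_nonneg (p.1 * p.2)
          gcongr
      _ = ∑ m ∈ Icc 1 D, ∑ l ∈ Icc 1 (D / m), (tau m ^ B / m) * (tau l ^ B / l) :=
          sum_divisorsAntidiagonal_Icc D _
      _ ≤ ∑ m ∈ Icc 1 D, ∑ l ∈ Icc 1 D, (tau m ^ B / m) * (tau l ^ B / l) := by
          refine sum_le_sum fun m _ => sum_le_sum_of_subset_of_nonneg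
            (Icc_subset_Icc_right (Nat.div_le_self _ _)) fun l _ _ => ?_
          have := tau_nonneg m
          have := tau_nonneg l
          positivity
      _ = (∑ d ∈ Icc 1 D, tau d ^ B / d) ^ 2 := by rw [sq, sum_mul_sum]
      _ ≤ (lg D ^ 2 ^ B) ^ 2 := by
          refine pow_le_pow_left₀ (sum_nonneg fun d _ => ?_) ih 2
          have := tau_nonneg d
          positivity
      _ = lg D ^ 2 ^ (B + 1) := by rw [← pow_mul]; congr 1

theorem sum_tau_pow_le (B D : ℕ) : ∑ d ∈ Icc 1 D, tau d ^ B ≤ D * lg D ^ 2 ^ B := by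
  refine le_trans ?_ (mul_le_mul_of_nonneg_left (sum_tau_pow_div_le B D) (Nat.cast_nonneg D))
  rw [mul_sum]
  refine sum_le_sum fun d hd => ?_
  rw [mem_Icc] at hd
  have h1 : (0 : ℝ) < d := by exact_mod_cast hd.1
  have h2 : (d : ℝ) ≤ D := by exact_mod_cast hd.2
  rw [mul_div_assoc', le_div_iff₀ h1, mul_comm]
  exact mul_le_mul_of_nonneg_right h2 (pow_nonneg (tau_nonneg d) _)

/-- A form of the divisor bound with logarithmic loss. -/
theorem tau_pow_le (B : ℕ) {n : ℕ} (hn : 1 ≤ n) : tau n ^ B ≤ n * lg n ^ 2 ^ B := by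
  refine le_trans ?_ (sum_tau_pow_le B n)
  exact single_le_sum (f := fun d => tau d ^ B) (fun d _ => pow_nonneg (tau_nonneg d) _)
    (mem_Icc.2 ⟨hn, le_rfl⟩)

/-- Every `n ≤ D ^ s` has a divisor `d ≤ D` with `τ(n) ≤ (2 τ(d)) ^ s`. -/
theorem exists_small_divisor (s : ℕ) {D : ℕ} (hD : 1 ≤ D) {n : ℕ} (hn : 1 ≤ n) (h : n ≤ D ^ s) :
    ∃ d, d ∣ n ∧ 1 ≤ d ∧ d ≤ D ∧ tau n ≤ (2 * tau d) ^ s := by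
  induction s generalizing n with
  | zero =>
    have : n = 1 := by rw [pow_zero] at h; omega
    subst this
    exact ⟨1, dvd_rfl, le_rfl, hD, by simp [tau]⟩
  | succ s ih =>
    by_cases hnD : n ≤ D
    · refine ⟨n, dvd_rfl, hn, hnD, ?_⟩
      have h1 := one_le_tau (n := n) (by omega)
      calc tau n ≤ (2 * tau n) ^ 1 := by linarith
        _ ≤ (2 * tau n) ^ (s + 1) := pow_le_pow_right₀ (by linarith) (by omega)
    · push Not at hnD
      obtain ⟨d₁, hd₁, hmax⟩ := exists_max_image (n.divisors.filter (· ≤ D)) id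
        ⟨1, by simp [hD]; omega⟩
      simp only [mem_filter, Nat.mem_divisors, id] at hd₁ hmax
      obtain ⟨⟨⟨e, he⟩, -⟩, hd₁D⟩ := hd₁
      have hd₁0 : 0 < d₁ := Nat.pos_of_ne_zero (by rintro rfl; simp at he; omega)
      have he1 : e ≠ 1 := by rintro rfl; omega
      have hp := Nat.minFac_prime he1
      obtain ⟨m, hm⟩ := Nat.minFac_dvd e
      set p := e.minFac
      have hm0 : 0 < m := Nat.pos_of_ne_zero (by rintro rfl; simp at hm; simp [hm] at he; omega)
      have hlt : D < d₁ * p := by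
        by_contra hcon
        push Not at hcon
        have := hmax (d₁ * p) ⟨⟨⟨m, by rw [he, hm]; ring⟩, by omega⟩, hcon⟩
        have := hp.two_le
        nlinarith
      have hmD : m ≤ D ^ s := by
        have h1 : D * m ≤ D * D ^ s := by
          calc D * m ≤ (d₁ * p) * m := Nat.mul_le_mul_right _ hlt.le
            _ = n := by rw [he, hm]; ring
            _ ≤ D * D ^ s := by rw [← pow_succ']; exact h
        exact Nat.le_of_mul_le_mul_left h1 hD
      obtain ⟨d₂, hd₂, hd₂0, hd₂D, hτ⟩ := ih hm0 hmD
      have key : tau n ≤ 2 * tau d₁ * (2 * tau d₂) ^ s := by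
        have hpt : tau p = 2 := by
          unfold tau; rw [hp.divisors, card_pair hp.one_lt.ne]; norm_num
        have e1 : n = d₁ * (p * m) := by rw [he, hm]
        rw [e1]
        calc tau (d₁ * (p * m)) ≤ tau d₁ * tau (p * m) := tau_mul_le _ _
          _ ≤ tau d₁ * (tau p * tau m) := by
              have := tau_nonneg d₁
              gcongr; exact tau_mul_le _ _
          _ ≤ tau d₁ * (2 * (2 * tau d₂) ^ s) := by
              have := tau_nonneg d₁
              rw [hpt]; gcongr
          _ = _ := by ring
      have t1 := tau_nonneg d₁
      have t2 := tau_nonneg d₂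
      rcases le_total (tau d₁) (tau d₂) with hle | hle
      · refine ⟨d₂, hd₂.trans ⟨d₁ * p, by rw [he, hm]; ring⟩, hd₂0, hd₂D, key.trans ?_⟩
        rw [pow_succ']; gcongr
      · refine ⟨d₁, ⟨e, he⟩, hd₁0, hd₁D, key.trans ?_⟩
        rw [pow_succ']; gcongr

/-- Sums weighted by divisor functions are dominated by sums over multiples of small numbers. -/
theorem sum_tau_pow_mul_le (s A : ℕ) {D : ℕ} (hD : 1 ≤ D) {Z : ℕ} (hZ : Z ≤ D ^ s) (w : ℕ → ℝ)
    (hw : ∀ n, 0 ≤ w n) :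
    ∑ n ∈ Icc 1 Z, tau n ^ A * w n ≤
      ∑ d ∈ Icc 1 D, (2 * tau d) ^ (s * A) * ∑ m ∈ Icc 1 (Z / d), w (d * m) := by
  have h0 : ∀ d : ℕ, 0 ≤ (2 * tau d) ^ (s * A) := fun d =>
    pow_nonneg (by have := tau_nonneg d; linarith) _
  calc ∑ n ∈ Icc 1 Z, tau n ^ A * w n
      ≤ ∑ n ∈ Icc 1 Z, ∑ p ∈ n.divisorsAntidiagonal,
          (if p.1 ≤ D then (2 * tau p.1) ^ (s * A) * w (p.1 * p.2) else 0) := by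
        refine sum_le_sum fun n hn => ?_
        rw [mem_Icc] at hn
        obtain ⟨d, ⟨m, hm⟩, hd1, hdD, hτ⟩ := exists_small_divisor s hD hn.1 (hn.2.trans hZ)
        have hmem : (d, m) ∈ n.divisorsAntidiagonal :=
          Nat.mem_divisorsAntidiagonal.2 ⟨hm.symm, by omega⟩
        refine le_trans ?_ (single_le_sum (fun p _ => ?_) hmem)
        · simp only [hdD, if_true]
          rw [← hm, pow_mul]
          have := tau_nonneg n
          have := hw n
          gcongr
        · split_ifs
          · exact mul_nonneg (h0 _) (hw _)
          · exact le_rfl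
    _ = ∑ m ∈ Icc 1 Z, ∑ l ∈ Icc 1 (Z / m),
          (if m ≤ D then (2 * tau m) ^ (s * A) * w (m * l) else 0) :=
        sum_divisorsAntidiagonal_Icc Z _
    _ = ∑ m ∈ (Icc 1 Z).filter (· ≤ D), ∑ l ∈ Icc 1 (Z / m), (2 * tau m) ^ (s * A) * w (m * l) := by
        rw [sum_filter]
        refine sum_congr rfl fun m _ => ?_
        split_ifs <;> simp
    _ ≤ ∑ d ∈ Icc 1 D, ∑ l ∈ Icc 1 (Z / d), (2 * tau d) ^ (s * A) * w (d * l) := by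
        refine sum_le_sum_of_subset_of_nonneg ?_ fun d _ _ => sum_nonneg fun l _ =>
          mul_nonneg (h0 _) (hw _)
        intro m hm
        simp only [mem_filter, mem_Icc] at hm ⊢
        exact ⟨hm.1.1, hm.2⟩
    _ = _ := by simp_rw [mul_sum]

theorem distInt_eq_min_fract (x : ℝ) : distInt x = min (Int.fract x) (1 - Int.fract x) := by
  unfold distInt; exact abs_sub_round_eq_min x

theorem sum_bd_separated_le {ι : Type*} (J : Finset ι) (t : ι → ℝ) {M : ℕ} (hM : 1 ≤ M)
    (hsep : ∀ i ∈ J, ∀ j ∈ J, i ≠ j → 1 / (M : ℝ) ≤ distInt (t i - t j)) {X : ℝ} (hX : 0 ≤ X) :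
    ∑ i ∈ J, bd X (t i) ≤ 2 * (X + M * lg M) := by
  have hM0 : (0 : ℝ) < M := by exact_mod_cast hM
  set φ : ℕ → ℝ := fun m => X / (1 + X * (m / M)) with hφ
  have hden : ∀ m : ℕ, 0 < 1 + X * ((m : ℝ) / M) := fun m => by positivity
  have hφ0 : ∀ m, 0 ≤ φ m := fun m => div_nonneg hX (hden m).le
  set f : ι → ℕ := fun i => ⌊M * Int.fract (t i)⌋₊ with hf
  have hfr : ∀ i, 0 ≤ Int.fract (t i) ∧ Int.fract (t i) < 1 := fun i =>
    ⟨Int.fract_nonneg _, Int.fract_lt_one _⟩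
  have hf1 : ∀ i, (f i : ℝ) ≤ M * Int.fract (t i) := fun i =>
    Nat.floor_le (mul_nonneg hM0.le (hfr i).1)
  have hf2 : ∀ i, M * Int.fract (t i) < f i + 1 := fun i => Nat.lt_floor_add_one _
  have hflt : ∀ i, f i < M := fun i => by
    have : (f i : ℝ) < M := by nlinarith [hf1 i, hfr i]
    exact_mod_cast this
  have hinj : Set.InjOn f J := by
    intro i hi j hj hij
    by_contra hne
    have h1 := hsep i hi j hj hne
    have h2 : distInt (t i - t j) ≤ |Int.fract (t i) - Int.fract (t j)| := by
      refine (distInt_le _ (⌊t i⌋ - ⌊t j⌋)).trans (le_of_eq ?_)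
      congr 1
      have := Int.floor_add_fract (t i)
      have := Int.floor_add_fract (t j)
      push_cast; linarith
    have h3 : |Int.fract (t i) - Int.fract (t j)| < 1 / M := by
      rw [abs_lt, lt_div_iff₀ hM0, ← neg_div, div_lt_iff₀ hM0]
      have a1 := hf1 i
      have a2 := hf2 i
      have b1 := hf1 j
      have b2 := hf2 j
      rw [hij] at a1 a2
      constructor <;> nlinarith
    linarith
  have hbd : ∀ i ∈ J, bd X (t i) ≤ φ (f i) + φ (M - 1 - f i) := by
    intro i _
    unfold bd
    rw [distInt_eq_min_fract]
    rcases le_total (Int.fract (t i)) (1 - Int.fract (t i)) with h | h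
    · rw [min_eq_left h]
      refine le_trans ?_ (le_add_of_nonneg_right (hφ0 _))
      refine div_le_div_of_nonneg_left hX (hden _) ?_
      gcongr
      rw [div_le_iff₀ hM0]; linarith [hf1 i]
    · rw [min_eq_right h]
      refine le_trans ?_ (le_add_of_nonneg_left (hφ0 _))
      refine div_le_div_of_nonneg_left hX (hden _) ?_
      gcongr
      rw [div_le_iff₀ hM0]
      have e : ((M - 1 - f i : ℕ) : ℝ) = M - 1 - f i := by
        rw [Nat.cast_sub (by have := hflt i; omega), Nat.cast_sub hM]; simp
      rw [e]; nlinarith [hf2 i]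
  have hsum : ∑ m ∈ range M, φ m ≤ X + M * lg M := by
    obtain ⟨m', rfl⟩ : ∃ m', M = m' + 1 := ⟨M - 1, by omega⟩
    rw [sum_range_succ']
    have e1 : φ 0 = X := by simp [hφ]
    have e2 : ∑ m ∈ range m', φ (m + 1) ≤ ((m' + 1 : ℕ) : ℝ) * lg (m' + 1) := by
      calc ∑ m ∈ range m', φ (m + 1) ≤
            ∑ m ∈ range m', ((m' + 1 : ℕ) : ℝ) * (1 / ((m + 1 : ℕ) : ℝ)) := by
            refine sum_le_sum fun m _ => ?_
            have hm : (0 : ℝ) < ((m + 1 : ℕ) : ℝ) := by positivity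
            rw [hφ, div_le_iff₀ (hden _)]
            have : ((m' + 1 : ℕ) : ℝ) * (1 / ((m + 1 : ℕ) : ℝ)) *
                (1 + X * (((m + 1 : ℕ) : ℝ) / ((m' + 1 : ℕ) : ℝ)))
              = ((m' + 1 : ℕ) : ℝ) * (1 / ((m + 1 : ℕ) : ℝ)) + X := by field_simp
            rw [this]
            have : 0 ≤ ((m' + 1 : ℕ) : ℝ) * (1 / ((m + 1 : ℕ) : ℝ)) := by positivity
            linarith
        _ = ((m' + 1 : ℕ) : ℝ) * ∑ m ∈ Icc 1 m', 1 / (m : ℝ) := by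
            rw [← mul_sum, range_eq_Ico, sum_Ico_add' (fun m : ℕ => 1 / (m : ℝ)) 0 m' 1]
            rfl
        _ ≤ _ := by
            refine mul_le_mul_of_nonneg_left ((sum_one_div_le_lg m').trans (lg_mono (by omega))) ?_
            positivity
    rw [e1]; linarith
  calc ∑ i ∈ J, bd X (t i) ≤ ∑ i ∈ J, (φ (f i) + φ (M - 1 - f i)) := sum_le_sum hbd
    _ = ∑ m ∈ J.image f, (φ m + φ (M - 1 - m)) :=
        (sum_image (f := fun m => φ m + φ (M - 1 - m)) hinj).symm
    _ ≤ ∑ m ∈ range M, (φ m + φ (M - 1 - m)) := by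
        refine sum_le_sum_of_subset_of_nonneg ?_ fun m _ _ => add_nonneg (hφ0 _) (hφ0 _)
        intro m hm
        obtain ⟨i, _, rfl⟩ := mem_image.1 hm
        exact mem_range.2 (hflt i)
    _ = 2 * ∑ m ∈ range M, φ m := by rw [sum_add_distrib, sum_range_reflect]; ring
    _ ≤ _ := by linarith

/-- The hypothesis that `b / r` is a reduced fraction with `|θ - b / r| ≤ 1 / r ^ 2`. -/
def IsApprox (θ : ℝ) (b : ℤ) (r : ℕ) : Prop :=
  1 ≤ r ∧ IsCoprime b (r : ℤ) ∧ |θ - b / r| ≤ 1 / (r : ℝ) ^ 2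

theorem IsApprox.half_le_distInt {θ : ℝ} {b : ℤ} {r : ℕ} (h : IsApprox θ b r) {n : ℤ}
    (hn : ¬ (r : ℤ) ∣ n) (hn2 : |(n : ℝ)| ≤ r / 2) : 1 / (2 * r : ℝ) ≤ distInt (θ * n) := by
  obtain ⟨hr, hcop, hap⟩ := h
  have hr0 : (0 : ℝ) < r := by exact_mod_cast hr
  have h1 : ¬ (r : ℤ) ∣ b * n := fun hd => hn (hcop.symm.dvd_of_dvd_mul_left hd)
  have h2 := one_div_le_distInt_div hr h1
  have h3 := distInt_add_le (θ * n) (((b * n : ℤ) : ℝ) / r - θ * n)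
  rw [add_sub_cancel] at h3
  have h4 := distInt_le_abs (((b * n : ℤ) : ℝ) / r - θ * n)
  have h5 : |((b * n : ℤ) : ℝ) / r - θ * n| ≤ 1 / (2 * r) := by
    have e : ((b * n : ℤ) : ℝ) / r - θ * n = -((θ - b / r) * n) := by push_cast; ring
    rw [e, abs_neg, abs_mul]
    calc |θ - b / r| * |(n : ℝ)| ≤ 1 / (r : ℝ) ^ 2 * (r / 2) := by gcongr
      _ = 1 / (2 * r) := by field_simp
  have h6 : 1 / (r : ℝ) = 1 / (2 * r) + 1 / (2 * r) := by field_simp; norm_num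
  linarith

theorem lg_two_mul_le (r : ℕ) : lg (2 * r) ≤ 2 * lg r := by
  have h := lg_mul_le 2 r
  rcases Nat.eq_zero_or_pos r with rfl | hr
  · simp [lg]
  · unfold lg
    rw [Nat.cast_mul, Real.log_mul (by norm_num) (by positivity)]
    have := Real.log_two_lt_d9
    have := Real.log_natCast_nonneg r
    push_cast; linarith

theorem IsApprox.sum_bd_le {θ : ℝ} {b : ℤ} {r : ℕ} (h : IsApprox θ b r) (H : ℕ) {X : ℝ}
    (hX : 0 ≤ X) :
    ∑ n ∈ Icc 1 H, bd X (θ * n) ≤ 16 * ((H : ℝ) / r + 1) * (X + r * lg r) := by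
  have hr0 : (0 : ℝ) < r := by exact_mod_cast h.1
  set B := r / 2 + 1 with hB
  have hmaps : ∀ n ∈ Icc 1 H, n / B ∈ range (H / B + 1) := fun n hn => by
    rw [mem_range, Nat.lt_succ_iff]; exact Nat.div_le_div_right (mem_Icc.1 hn).2
  rw [← sum_fiberwise_of_maps_to hmaps]
  have hblock : ∀ i ∈ range (H / B + 1), ∑ n ∈ Icc 1 H with n / B = i, bd X (θ * n) ≤
      2 * (X + (2 * r : ℕ) * lg (2 * r)) := by
    intro i _
    refine sum_bd_separated_le _ (fun n : ℕ => θ * n) (by have := h.1; omega) ?_ hX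
    intro m hm n hn hmn
    have e : θ * (m : ℝ) - θ * n = θ * ((m - n : ℤ) : ℝ) := by push_cast; ring
    rw [e]
    have hm1 := (mem_filter.1 hm).2
    have hn1 := (mem_filter.1 hn).2
    have hlt : |(m : ℤ) - n| ≤ (r / 2 : ℕ) := by
      have a1 := Nat.div_add_mod m B
      have a2 := Nat.div_add_mod n B
      have a3 := Nat.mod_lt m (show 0 < B by omega)
      have a4 := Nat.mod_lt n (show 0 < B by omega)
      rw [hm1] at a1
      rw [hn1] at a2
      rw [abs_le]; constructor <;> omega
    have := h.half_le_distInt (n := (m : ℤ) - n) ?_ ?_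
    · push_cast at this ⊢; exact this
    · intro hd
      have hz : (m : ℤ) - n ≠ 0 := by omega
      have := Int.le_of_dvd (abs_pos.2 hz) ((dvd_abs _ _).2 hd)
      have := h.1
      omega
    · have e2 : ((r / 2 : ℕ) : ℝ) ≤ r / 2 := Nat.cast_div_le
      refine le_trans ?_ e2
      rw [← Int.cast_abs]
      calc ((|(m : ℤ) - n| : ℤ) : ℝ) ≤ (((r / 2 : ℕ) : ℤ) : ℝ) := Int.cast_le.2 hlt
        _ = _ := Int.cast_natCast _
  have hl0 := lg_pos r
  refine (sum_le_card_nsmul _ _ _ hblock).trans ?_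
  rw [card_range, nsmul_eq_mul]
  have h1 : ((H / B + 1 : ℕ) : ℝ) ≤ 2 * (H / r + 1) := by
    push_cast
    have : ((H / B : ℕ) : ℝ) ≤ H / B := Nat.cast_div_le
    have hB2 : (r : ℝ) / 2 ≤ B := by
      have : r ≤ 2 * B := by omega
      have : (r : ℝ) ≤ 2 * B := by exact_mod_cast this
      linarith
    have : (H : ℝ) / B ≤ H / (r / 2) := div_le_div_of_nonneg_left (by positivity) (by positivity) hB2
    have e : (H : ℝ) / (r / 2) = 2 * (H / r) := by field_simp
    linarith
  have h2 : 2 * (X + (2 * r : ℕ) * lg (2 * r)) ≤ 8 * (X + r * lg r) := by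
    push_cast
    have := lg_two_mul_le r
    nlinarith
  calc _ ≤ (2 * ((H : ℝ) / r + 1)) * (8 * (X + r * lg r)) := by
        gcongr
        have := lg_pos (2 * r); positivity
    _ = _ := by ring

/-- Transfer of a rational approximation of `α` to one of `α d`. -/
theorem IsApprox.exists_mul {α : ℝ} {a : ℤ} {q : ℕ} (h : IsApprox α a q) {d : ℕ} (hd : 1 ≤ d) :
    ∃ (b : ℤ) (r : ℕ), IsApprox (α * d) b r ∧ r ≤ 2 * q ∧ q ≤ 2 * d * r := by
  obtain ⟨hq, hcop, hap⟩ := h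
  have hq0 : (0 : ℝ) < q := by exact_mod_cast hq
  have hd0 : (0 : ℝ) < d := by exact_mod_cast hd
  obtain ⟨x, hx1, hx2⟩ := Real.exists_rat_abs_sub_le_and_den_le (α * d) (n := 2 * q) (by omega)
  have hr0 : (0 : ℝ) < x.den := by exact_mod_cast x.den_pos
  have hxe : (x : ℝ) = x.num / x.den := Rat.cast_def x
  rw [hxe] at hx1
  have hx2' : (x.den : ℝ) ≤ 2 * q := by exact_mod_cast hx2
  refine ⟨x.num, x.den, ⟨x.den_pos, ?_, hx1.trans ?_⟩, hx2, ?_⟩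
  · exact Int.isCoprime_iff_gcd_eq_one.2 (by simpa [Int.gcd] using x.reduced)
  · push_cast
    rw [sq]; gcongr; linarith
  · by_cases heq : x.num * q = a * (x.den * d)
    · have : (q : ℤ) ∣ (x.den * d : ℕ) := by
        refine hcop.symm.dvd_of_dvd_mul_left ⟨x.num, ?_⟩
        push_cast; rw [← heq]; ring
      have := Nat.le_of_dvd (Nat.mul_pos x.den_pos hd) (Int.natCast_dvd_natCast.1 this)
      nlinarith [x.den_pos]
    · have h1 : (1 : ℝ) ≤ |((x.num * q - a * (x.den * d) : ℤ) : ℝ)| := by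
        rw [← Int.cast_abs]; exact_mod_cast Int.one_le_abs (sub_ne_zero.2 heq)
      have h2 : ((x.num * q - a * (x.den * d) : ℤ) : ℝ) =
          (x.den * d * q) * (α - a / q) - q * x.den * (α * d - x.num / x.den) := by
        push_cast; field_simp; ring
      rw [h2] at h1
      have h3 := h1.trans (abs_sub _ _)
      rw [abs_mul _ (α - a / q), abs_mul _ (α * d - x.num / x.den),
        abs_of_pos (show (0 : ℝ) < x.den * d * q by positivity),
        abs_of_pos (show (0 : ℝ) < q * x.den by positivity)] at h3
      have h4 : (x.den * d * q : ℝ) * |α - a / q| ≤ x.den * d / q := by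
        calc (x.den * d * q : ℝ) * |α - a / q| ≤ (x.den * d * q) * (1 / (q : ℝ) ^ 2) := by gcongr
          _ = _ := by field_simp
      have h5 : (q * x.den : ℝ) * |α * d - x.num / x.den| ≤ 1 / 2 := by
        calc (q * x.den : ℝ) * |α * d - x.num / x.den| ≤
              (q * x.den : ℝ) * (1 / (((2 * q : ℕ) + 1) * x.den)) := by
              gcongr
          _ = q / (2 * q + 1) := by push_cast; field_simp
          _ ≤ 1 / 2 := by rw [div_le_div_iff₀ (by positivity) (by norm_num)]; linarith
      have h6 : 1 / 2 ≤ (x.den * d : ℝ) / q := by linarith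
      rw [le_div_iff₀ hq0] at h6
      have : (q : ℝ) ≤ 2 * d * x.den := by linarith
      exact_mod_cast this

theorem sum_tau_pow_bd_le {α : ℝ} {a : ℤ} {q : ℕ} (h : IsApprox α a q) (s A : ℕ) {D : ℕ}
    (hD : 1 ≤ D) {Z : ℕ} (hZ : Z ≤ D ^ s) {X : ℝ} (hX : 0 ≤ X) :
    ∑ n ∈ Icc 1 Z, tau n ^ A * bd X (α * n) ≤
      2 ^ (s * A + 5) * lg D ^ 2 ^ (s * A) * lg (2 * q) * (Z + D * (Z * X / q + X + q)) := by
  have hq0 : (0 : ℝ) < q := by exact_mod_cast h.1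
  have hl := lg_pos (2 * q)
  have hl1 := one_le_lg (2 * q)
  refine (sum_tau_pow_mul_le s A hD hZ (fun n => bd X (α * n)) fun n => bd_nonneg hX _).trans ?_
  set E := s * A
  set c := (Z : ℝ) * X / q + X + q with hc
  have hc0 : 0 ≤ c := by positivity
  have hinner : ∀ d ∈ Icc 1 D, ∑ m ∈ Icc 1 (Z / d), bd X (α * (d * m : ℕ)) ≤
      32 * lg (2 * q) * (c + Z * (1 / d)) := by
    intro d hd
    have hd1 := (mem_Icc.1 hd).1
    have hd0 : (0 : ℝ) < d := by exact_mod_cast hd1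
    obtain ⟨b, r, hb, hr1, hr2⟩ := h.exists_mul hd1
    have hr0 : (0 : ℝ) < r := by exact_mod_cast hb.1
    have hr1' : (r : ℝ) ≤ 2 * q := by exact_mod_cast hr1
    have hr2' : (q : ℝ) ≤ 2 * d * r := by exact_mod_cast hr2
    have h1 := hb.sum_bd_le (Z / d) hX
    have e1 : ∀ m ∈ Icc 1 (Z / d), bd X (α * (d * m : ℕ)) = bd X (α * d * m) := fun m _ => by
      congr 1; push_cast; ring
    rw [sum_congr rfl e1]
    refine h1.trans ?_
    have h2 : ((Z / d : ℕ) : ℝ) ≤ Z / d := Nat.cast_div_le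
    have h3 : lg r ≤ lg (2 * q) := lg_mono hr1
    have h4 : ((Z / d : ℕ) : ℝ) / r ≤ 2 * Z / q := by
      calc ((Z / d : ℕ) : ℝ) / r ≤ (Z / d) / r := by gcongr
        _ = 2 * Z / (2 * d * r) := by field_simp
        _ ≤ 2 * Z / q := by gcongr
    have h5 : ((Z / d : ℕ) : ℝ) / r * r ≤ Z / d := by rw [div_mul_cancel₀ _ hr0.ne']; exact h2
    have h6 : 0 ≤ ((Z / d : ℕ) : ℝ) / r := by positivity
    have h7 := lg_pos r
    calc 16 * (((Z / d : ℕ) : ℝ) / r + 1) * (X + r * lg r)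
        ≤ 16 * (((Z / d : ℕ) : ℝ) / r + 1) * (X + r * lg (2 * q)) := by gcongr
      _ = 16 * (((Z / d : ℕ) : ℝ) / r * X + (((Z / d : ℕ) : ℝ) / r * r) * lg (2 * q) + X
            + r * lg (2 * q)) := by ring
      _ ≤ 16 * (2 * Z / q * X + (Z / d) * lg (2 * q) + X + 2 * q * lg (2 * q)) := by gcongr
      _ ≤ 32 * lg (2 * q) * (c + Z * (1 / d)) := by
          have e2 : 2 * (Z : ℝ) / q * X = 2 * (Z * X / q) := by ring
          have e3 : (Z : ℝ) * (1 / d) = Z / d := by ring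
          rw [e2, e3, hc]
          have p1 : 0 ≤ (Z : ℝ) * X / q := by positivity
          have p2 : 0 ≤ (Z : ℝ) / d := by positivity
          nlinarith
  have ht : ∀ d, 0 ≤ (2 * tau d) ^ E := fun d => pow_nonneg (by have := tau_nonneg d; linarith) _
  calc _ ≤ ∑ d ∈ Icc 1 D, (2 * tau d) ^ E * (32 * lg (2 * q) * (c + Z * (1 / d))) :=
        sum_le_sum fun d hd => mul_le_mul_of_nonneg_left (hinner d hd) (ht d)
    _ = 2 ^ (E + 5) * lg (2 * q) * (c * ∑ d ∈ Icc 1 D, tau d ^ E + Z * ∑ d ∈ Icc 1 D, tau d ^ E / d) := by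
        rw [mul_sum, mul_sum, ← sum_add_distrib, mul_sum]
        refine sum_congr rfl fun d _ => ?_
        rw [mul_pow, pow_add]; ring
    _ ≤ 2 ^ (E + 5) * lg (2 * q) * (c * (D * lg D ^ 2 ^ E) + Z * lg D ^ 2 ^ E) := by
        have := sum_tau_pow_le E D
        have := sum_tau_pow_div_le E D
        gcongr
    _ = _ := by ring

theorem sum_Ioo_neg_even (X : ℕ) (f : ℤ → ℝ) (hf : ∀ l, f (-l) = f l) :
    ∑ l ∈ Ioo (-(X : ℤ)) X, f l ≤ |f 0| + 2 * ∑ l ∈ Ico 1 X, f (l : ℕ) := by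
  rcases Nat.eq_zero_or_pos X with rfl | hX
  · simp
  have h1 : Ioo (-(X : ℤ)) X = insert 0 (((Ico 1 X).image (fun l : ℕ => (l : ℤ))) ∪
      ((Ico 1 X).image (fun l : ℕ => -(l : ℤ)))) := by
    ext z
    simp only [mem_Ioo, mem_insert, mem_union, mem_image, mem_Ico]
    constructor
    · intro h
      rcases lt_trichotomy z 0 with hz | hz | hz
      · exact Or.inr (Or.inr ⟨(-z).toNat, by omega, by omega⟩)
      · exact Or.inl hz
      · exact Or.inr (Or.inl ⟨z.toNat, by omega, by omega⟩)
    · rintro (h | ⟨l, h, rfl⟩ | ⟨l, h, rfl⟩) <;> omega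
  rw [h1, sum_insert, sum_union, sum_image, sum_image]
  · simp only [hf]
    have := le_abs_self (f 0)
    linarith
  · intro a _ b _ h; simpa using h
  · intro a _ b _ h; simpa using h
  · rw [disjoint_left]
    intro z h1 h2
    simp only [mem_image, mem_Ico] at h1 h2
    obtain ⟨l, h3, rfl⟩ := h1
    obtain ⟨l', h4, h5⟩ := h2
    omega
  · simp only [mem_union, mem_image, mem_Ico]
    rintro (⟨l, h, h2⟩ | ⟨l, h, h2⟩) <;> omega

/-- Regrouping a double sum by the value of the product. -/
theorem sum_sum_mul_le (U X A : ℕ) (w : ℕ → ℝ) (hw : ∀ n, 0 ≤ w n) :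
    ∑ u ∈ Icc 1 U, ∑ l ∈ Icc 1 X, tau u ^ A * w (u * l) ≤
      ∑ n ∈ Icc 1 (U * X), tau n ^ (A + 1) * w n := by
  calc ∑ u ∈ Icc 1 U, ∑ l ∈ Icc 1 X, tau u ^ A * w (u * l)
      ≤ ∑ u ∈ Icc 1 (U * X), ∑ l ∈ Icc 1 (U * X / u),
          tau (u * l) ^ A * w (u * l) := by
        rcases Nat.eq_zero_or_pos X with rfl | hX
        · simp
        have hsub : Icc 1 U ⊆ Icc 1 (U * X) := Icc_subset_Icc_right (Nat.le_mul_of_pos_right _ hX)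
        have hnn : ∀ n, 0 ≤ tau n ^ A * w n := fun n =>
          mul_nonneg (pow_nonneg (tau_nonneg n) _) (hw n)
        refine le_trans (sum_le_sum fun u hu => ?_) (sum_le_sum_of_subset_of_nonneg hsub fun u _ _ =>
          sum_nonneg fun l _ => hnn _)
        rw [mem_Icc] at hu
        have hsub2 : Icc 1 X ⊆ Icc 1 (U * X / u) := by
          refine Icc_subset_Icc_right ((Nat.le_div_iff_mul_le (by omega)).2 ?_)
          rw [mul_comm]; exact Nat.mul_le_mul_right _ hu.2
        refine le_trans (sum_le_sum fun l hl => ?_) (sum_le_sum_of_subset_of_nonneg hsub2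
          fun l _ _ => hnn _)
        rw [mem_Icc] at hl
        have : tau u ≤ tau (u * l) := tau_le_of_dvd (Dvd.intro _ rfl)
          (Nat.mul_ne_zero (by omega) (by omega))
        have := tau_nonneg u
        have := hw (u * l)
        gcongr
    _ = ∑ n ∈ Icc 1 (U * X), ∑ p ∈ n.divisorsAntidiagonal, tau (p.1 * p.2) ^ A * w (p.1 * p.2) :=
        (sum_divisorsAntidiagonal_Icc _ (fun p : ℕ × ℕ => tau (p.1 * p.2) ^ A * w (p.1 * p.2))).symm
    _ = _ := by
        refine sum_congr rfl fun n _ => ?_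
        rw [sum_congr rfl (g := fun _ => tau n ^ A * w n)]
        · rw [sum_const, nsmul_eq_mul, ← Nat.map_div_right_divisors, card_map, pow_succ]
          change tau n * _ = _
          ring
        · intro p hp
          rw [(Nat.mem_divisorsAntidiagonal.1 hp).1]

theorem sum_tau_multiBd_le (j A U X : ℕ) (hX : 1 ≤ X) (θ : ℝ) :
    ∑ u ∈ Icc 1 U, tau u ^ A * multiBd j X (θ * u) ≤
      j * 2 ^ j * (U * X ^ j) * lg (U * X ^ j) ^ 2 ^ (A + j) +
        2 ^ j * ∑ n ∈ Icc 1 (U * X ^ j), tau n ^ (A + j) * bd X (θ * n) := by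
  induction j generalizing A U with
  | zero => simp [multiBd]
  | succ j ih =>
    have hstep : ∑ u ∈ Icc 1 U, tau u ^ A * multiBd (j + 1) X (θ * u) ≤
        (2 * X) ^ j * X * ∑ u ∈ Icc 1 U, tau u ^ A +
        2 * ∑ n ∈ Icc 1 (U * X), tau n ^ (A + 1) * multiBd j X (θ * n) := by
      refine le_trans ?_ (add_le_add_right (mul_le_mul_of_nonneg_left
        (sum_sum_mul_le U X A (fun n => multiBd j X (θ * n)) fun n => multiBd_nonneg _ _ _)
        (by norm_num)) _)
      rw [mul_sum, mul_sum, ← sum_add_distrib]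
      refine sum_le_sum fun u _ => ?_
      have h1 := sum_Ioo_neg_even X (fun l => multiBd j X (θ * u * l)) fun l => by
        rw [Int.cast_neg, mul_neg, multiBd_neg]
      rw [abs_of_nonneg (multiBd_nonneg _ _ _)] at h1
      have h2 := multiBd_le j X (θ * u * (0 : ℤ))
      have h3 : ∑ l ∈ Ico 1 X, multiBd j X (θ * u * ((l : ℕ) : ℤ)) ≤
          ∑ l ∈ Icc 1 X, multiBd j X (θ * (u * l : ℕ)) := by
        refine le_trans (le_of_eq (sum_congr rfl fun l _ => ?_))
          (sum_le_sum_of_subset_of_nonneg Ico_subset_Icc_self fun l _ _ => multiBd_nonneg _ _ _)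
        congr 1; push_cast; ring
      rw [← mul_sum]
      have h4 : 0 ≤ tau u ^ A := pow_nonneg (tau_nonneg u) _
      calc tau u ^ A * multiBd (j + 1) X (θ * u)
          ≤ tau u ^ A * ((2 * X) ^ j * X + 2 * ∑ l ∈ Icc 1 X, multiBd j X (θ * (u * l : ℕ))) := by
            refine mul_le_mul_of_nonneg_left ?_ h4
            rw [multiBd]; linarith
        _ = _ := by ring
    have hrec := ih (A + 1) (U * X)
    have hZ : U * X * X ^ j = U * X ^ (j + 1) := by ring
    have hA : A + 1 + j = A + (j + 1) := by ring
    rw [hZ, hA] at hrec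
    have hZ' : ((U * X : ℕ) : ℝ) * X ^ j = U * X ^ (j + 1) := by push_cast; ring
    rw [hZ'] at hrec
    have hle : ∑ u ∈ Icc 1 U, tau u ^ A ≤ U * lg (U * X ^ (j + 1)) ^ 2 ^ (A + (j + 1)) := by
      refine (sum_tau_pow_le A U).trans ?_
      refine mul_le_mul_of_nonneg_left ?_ (Nat.cast_nonneg U)
      calc lg U ^ 2 ^ A ≤ lg (U * X ^ (j + 1)) ^ 2 ^ A :=
            pow_le_pow_left₀ (lg_pos _).le (lg_mono (Nat.le_mul_of_pos_right _ (by positivity))) _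
        _ ≤ _ := pow_le_pow_right₀ (one_le_lg _) (Nat.pow_le_pow_right (by norm_num) (by omega))
    set P := lg (U * X ^ (j + 1)) ^ 2 ^ (A + (j + 1)) with hP
    have hP0 : 0 ≤ P := pow_nonneg (lg_pos _).le _
    calc _ ≤ (2 * X) ^ j * X * (U * P) + 2 * (j * 2 ^ j * (U * X ^ (j + 1)) * P +
            2 ^ j * ∑ n ∈ Icc 1 (U * X ^ (j + 1)), tau n ^ (A + (j + 1)) * bd X (θ * n)) := by
          refine hstep.trans ?_
          gcongr
      _ ≤ _ := by
          have e : (2 * X : ℝ) ^ j * X * (U * P) = 2 ^ j * (U * X ^ (j + 1)) * P := by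
            rw [mul_pow]; ring
          rw [e, pow_succ 2 j]
          have : 0 ≤ 2 ^ j * ((U : ℝ) * X ^ (j + 1)) * P := by positivity
          push_cast
          nlinarith

/-- A constant times a power of a logarithmic factor. -/
noncomputable def pl (C : ℕ) (L : ℝ) : ℝ := (C + 1) * L ^ C

theorem pl_mono {C C' : ℕ} (h : C ≤ C') {L : ℝ} (hL : 1 ≤ L) : pl C L ≤ pl C' L := by
  unfold pl
  have h1 : L ^ C ≤ L ^ C' := pow_le_pow_right₀ hL h
  have h2 : (C : ℝ) ≤ C' := by exact_mod_cast h
  have h3 : 0 ≤ L ^ C := by positivity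
  gcongr

theorem one_le_pl (C : ℕ) {L : ℝ} (hL : 1 ≤ L) : 1 ≤ pl C L := by
  have := pl_mono (Nat.zero_le C) hL
  simpa [pl] using this

theorem pl_nonneg (C : ℕ) {L : ℝ} (hL : 1 ≤ L) : 0 ≤ pl C L := zero_le_one.trans (one_le_pl C hL)

theorem pl_mul_le (C C' : ℕ) {L : ℝ} (hL : 1 ≤ L) : pl C L * pl C' L ≤ pl (C * C' + C + C') L := by
  have h1 : L ^ (C + C') ≤ L ^ (C * C' + C + C') := pow_le_pow_right₀ hL (by nlinarith)
  unfold pl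
  calc ((C : ℝ) + 1) * L ^ C * ((C' + 1) * L ^ C') = (C * C' + C + C' + 1) * L ^ (C + C') := by
        rw [pow_add]; ring
    _ ≤ _ := by push_cast; gcongr

theorem pl_add_le (C C' : ℕ) {L : ℝ} (hL : 1 ≤ L) : pl C L + pl C' L ≤ pl (C + C' + 1) L := by
  have h1 : L ^ C ≤ L ^ (C + C' + 1) := pow_le_pow_right₀ hL (by omega)
  have h2 : L ^ C' ≤ L ^ (C + C' + 1) := pow_le_pow_right₀ hL (by omega)
  unfold pl
  push_cast
  nlinarith [(Nat.cast_nonneg C : (0 : ℝ) ≤ C), (Nat.cast_nonneg C' : (0 : ℝ) ≤ C')]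

theorem exists_pl_const (c : ℝ) (n : ℕ) : ∃ C, ∀ L : ℝ, 1 ≤ L → c * L ^ n ≤ pl C L := by
  refine ⟨max ⌈c⌉₊ n, fun L hL => ?_⟩
  unfold pl
  have h1 : L ^ n ≤ L ^ max ⌈c⌉₊ n := pow_le_pow_right₀ hL (le_max_right _ _)
  have h2 : c ≤ ((max ⌈c⌉₊ n : ℕ) : ℝ) + 1 :=
    (Nat.le_ceil c).trans (by
      have : ((⌈c⌉₊ : ℕ) : ℝ) ≤ ((max ⌈c⌉₊ n : ℕ) : ℝ) := by exact_mod_cast le_max_left _ _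
      linarith)
  have h3 : 0 ≤ L ^ n := by positivity
  calc c * L ^ n ≤ (((max ⌈c⌉₊ n : ℕ) : ℝ) + 1) * L ^ n := by gcongr
    _ ≤ _ := by gcongr

theorem sum_tau_pow_bd_mul_le (A F Z : ℕ) (hF : 1 ≤ F) (α : ℝ) {X : ℝ} (hX : 0 ≤ X) :
    ∑ n ∈ Icc 1 Z, tau n ^ A * bd X (α * F * n) ≤
      ∑ n ∈ Icc 1 (F * Z), tau n ^ A * bd X (α * n) := by
  have hinj : Set.InjOn (fun n => F * n) (Icc 1 Z : Finset ℕ) := fun a _ b _ hab =>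
    Nat.eq_of_mul_eq_mul_left hF hab
  have hsub : (Icc 1 Z).image (fun n => F * n) ⊆ Icc 1 (F * Z) := by
    intro m hm
    obtain ⟨n, hn, rfl⟩ := mem_image.1 hm
    rw [mem_Icc] at hn ⊢
    exact ⟨Nat.mul_pos hF hn.1, Nat.mul_le_mul_left _ hn.2⟩
  calc ∑ n ∈ Icc 1 Z, tau n ^ A * bd X (α * F * n)
      ≤ ∑ n ∈ Icc 1 Z, tau (F * n) ^ A * bd X (α * (F * n : ℕ)) := by
        refine sum_le_sum fun n hn => ?_
        rw [mem_Icc] at hn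
        have h1 : tau n ≤ tau (F * n) :=
          tau_le_of_dvd (Dvd.intro_left _ rfl) (Nat.mul_ne_zero (by omega) (by omega))
        have h2 := tau_nonneg n
        have e : α * F * n = α * (F * n : ℕ) := by push_cast; ring
        rw [e]
        have := bd_nonneg hX (α * (F * n : ℕ))
        gcongr
    _ = ∑ m ∈ (Icc 1 Z).image (fun n => F * n), tau m ^ A * bd X (α * m) :=
        (sum_image (f := fun m : ℕ => tau m ^ A * bd X (α * m)) hinj).symm
    _ ≤ _ := sum_le_sum_of_subset_of_nonneg hsub fun m _ _ =>
        mul_nonneg (pow_nonneg (tau_nonneg m) _) (bd_nonneg hX _)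

/-- Mean value estimate for `multiBd` with divisor weights. -/
theorem exists_mean_value (j A s : ℕ) : ∃ C : ℕ, ∀ (α : ℝ) (a : ℤ) (q : ℕ), IsApprox α a q →
    ∀ D U X : ℕ, 1 ≤ D → 1 ≤ X → (j + 1).factorial * (U * X ^ j) ≤ D ^ s →
    ∀ L : ℝ, lg D ≤ L → lg (2 * q) ≤ L → lg (U * X ^ j) ≤ L →
    ∑ u ∈ Icc 1 U, tau u ^ A * multiBd j X (α * (j + 1).factorial * u) ≤
      pl C L * (U * X ^ j + D * (U * X ^ (j + 1) / q + X + q)) := by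
  set F := (j + 1).factorial
  have hF : 1 ≤ F := Nat.factorial_pos _
  set E := s * (A + j)
  obtain ⟨C₁, hC₁⟩ := exists_pl_const (j * 2 ^ j : ℝ) (2 ^ (A + j))
  obtain ⟨C₂, hC₂⟩ := exists_pl_const (2 ^ j * 2 ^ (E + 5) * F : ℝ) (2 ^ E + 1)
  refine ⟨C₁ + C₂ + 1, fun α a q h D U X hD hX hZ L hL1 hL2 hL3 => ?_⟩
  have hL : 1 ≤ L := (one_le_lg D).trans hL1
  have hq0 : (0 : ℝ) < q := by exact_mod_cast h.1
  have hF0 : (1 : ℝ) ≤ F := by exact_mod_cast hF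
  have h1 := sum_tau_multiBd_le j A U X hX (α * F)
  have h2 := sum_tau_pow_bd_mul_le (A + j) F (U * X ^ j) hF α (Nat.cast_nonneg X : (0 : ℝ) ≤ X)
  have h3 := sum_tau_pow_bd_le h s (A + j) hD hZ (Nat.cast_nonneg X : (0 : ℝ) ≤ X)
  set G := (U : ℝ) * X ^ j + D * (U * X ^ (j + 1) / q + X + q) with hG
  have hG1 : (U : ℝ) * X ^ j ≤ G := by
    rw [hG]; have : 0 ≤ (D : ℝ) * (U * X ^ (j + 1) / q + X + q) := by positivity
    linarith
  have hG0 : 0 ≤ G := le_trans (by positivity) hG1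
  have hp : lg (U * X ^ j) ^ 2 ^ (A + j) ≤ L ^ 2 ^ (A + j) := pow_le_pow_left₀ (lg_pos _).le hL3 _
  have t1 : (j : ℝ) * 2 ^ j * (U * X ^ j) * lg (U * X ^ j) ^ 2 ^ (A + j) ≤ pl C₁ L * G := by
    calc (j : ℝ) * 2 ^ j * (U * X ^ j) * lg (U * X ^ j) ^ 2 ^ (A + j)
        ≤ (j : ℝ) * 2 ^ j * G * L ^ 2 ^ (A + j) := by
          gcongr
          exact pow_nonneg (lg_pos _).le _
      _ = ((j : ℝ) * 2 ^ j * L ^ 2 ^ (A + j)) * G := by ring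
      _ ≤ _ := mul_le_mul_of_nonneg_right (hC₁ L hL) hG0
  have t2 : 2 ^ j * ∑ n ∈ Icc 1 (U * X ^ j), tau n ^ (A + j) * bd X (α * F * n) ≤ pl C₂ L * G := by
    have e1 : (((F * (U * X ^ j) : ℕ) : ℝ) + D * ((F * (U * X ^ j) : ℕ) * X / q + X + q)) ≤ F * G := by
      rw [hG]; push_cast
      have e2 : (F : ℝ) * (U * X ^ j) * X / q = F * (U * X ^ (j + 1) / q) := by
        rw [pow_succ]; ring
      rw [e2]
      have : (D : ℝ) * (F * (U * X ^ (j + 1) / q) + X + q) ≤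
          D * (F * (U * X ^ (j + 1) / q) + F * X + F * q) := by
        gcongr
        · exact le_mul_of_one_le_left (by positivity) hF0
        · exact le_mul_of_one_le_left (by positivity) hF0
      linarith
    have e3 : lg D ^ 2 ^ E * lg (2 * q) ≤ L ^ (2 ^ E + 1) := by
      rw [pow_succ]
      have := lg_pos D
      have := lg_pos (2 * q)
      gcongr
    calc 2 ^ j * ∑ n ∈ Icc 1 (U * X ^ j), tau n ^ (A + j) * bd X (α * F * n)
        ≤ 2 ^ j * (2 ^ (E + 5) * lg D ^ 2 ^ E * lg (2 * q) * (F * G)) := by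
          refine mul_le_mul_of_nonneg_left ((h2.trans h3).trans ?_) (by positivity)
          refine mul_le_mul_of_nonneg_left e1 ?_
          have := lg_pos D
          have := lg_pos (2 * q)
          positivity
      _ = (2 ^ j * 2 ^ (E + 5) * F * (lg D ^ 2 ^ E * lg (2 * q))) * G := by ring
      _ ≤ (2 ^ j * 2 ^ (E + 5) * F * L ^ (2 ^ E + 1)) * G := by gcongr
      _ ≤ _ := mul_le_mul_of_nonneg_right (hC₂ L hL) hG0
  calc _ ≤ _ := h1
    _ ≤ pl C₁ L * G + pl C₂ L * G := add_le_add t1 t2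
    _ = (pl C₁ L + pl C₂ L) * G := by ring
    _ ≤ _ := mul_le_mul_of_nonneg_right (pl_add_le _ _ hL) hG0

/-- Iterated sum over lists of differences in `(-Y, Y)`. -/
noncomputable def listSum (Y : ℕ) : ℕ → (List ℤ → ℝ) → ℝ
  | 0, g => g []
  | j + 1, g => ∑ h ∈ Ioo (-(Y : ℤ)) Y, listSum Y j (fun l => g (h :: l))

theorem listSum_mono {Y : ℕ} : ∀ {j : ℕ} {f g : List ℤ → ℝ},
    (∀ l : List ℤ, l.length = j → (∀ h ∈ l, h ∈ Ioo (-(Y : ℤ)) Y) → f l ≤ g l) →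
      listSum Y j f ≤ listSum Y j g
  | 0, f, g, h => h [] rfl (by simp)
  | j + 1, f, g, h => by
    refine sum_le_sum fun x hx => listSum_mono fun l hl hm => h _ (by simp [hl]) ?_
    intro y hy
    rcases List.mem_cons.1 hy with rfl | hy
    · exact hx
    · exact hm y hy

theorem listSum_add (Y : ℕ) : ∀ (j : ℕ) (f g : List ℤ → ℝ),
    listSum Y j (fun l => f l + g l) = listSum Y j f + listSum Y j g
  | 0, f, g => rfl
  | j + 1, f, g => by
    simp only [listSum, listSum_add Y j, sum_add_distrib]

theorem listSum_mul_left (Y : ℕ) (c : ℝ) : ∀ (j : ℕ) (f : List ℤ → ℝ),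
    listSum Y j (fun l => c * f l) = c * listSum Y j f
  | 0, f => rfl
  | j + 1, f => by
    simp only [listSum, listSum_mul_left Y c j, mul_sum]

theorem listSum_sum {ι : Type*} (Y : ℕ) (s : Finset ι) : ∀ (j : ℕ) (f : ι → List ℤ → ℝ),
    listSum Y j (fun l => ∑ i ∈ s, f i l) = ∑ i ∈ s, listSum Y j (f i)
  | 0, f => rfl
  | j + 1, f => by
    simp only [listSum, listSum_sum Y s j]
    exact sum_comm

theorem listSum_nonneg {Y j : ℕ} {f : List ℤ → ℝ} (h : ∀ l, 0 ≤ f l) : 0 ≤ listSum Y j f := by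
  have h1 := listSum_mul_left Y 0 j f
  have h2 : listSum Y j (fun l => 0 * f l) ≤ listSum Y j f :=
    listSum_mono fun l _ _ => by simpa using h l
  rw [h1, zero_mul] at h2
  exact h2

theorem listSum_const_le {Y : ℕ} {c : ℝ} (hc : 0 ≤ c) : ∀ j : ℕ,
    listSum Y j (fun _ => c) ≤ (2 * (Y : ℝ)) ^ j * c
  | 0 => by simp [listSum]
  | j + 1 => by
    simp only [listSum, sum_const, nsmul_eq_mul]
    calc _ ≤ (2 * (Y : ℝ)) * ((2 * (Y : ℝ)) ^ j * c) :=
          mul_le_mul (card_Ioo_neg_le Y) (listSum_const_le hc j)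
            (listSum_nonneg fun _ => hc) (by positivity)
      _ = _ := by ring

/-- Iterated multiplicative differences `F(y + h) \bar F(y)`. -/
noncomputable def mulDiff : List ℤ → (ℤ → ℂ) → ℤ → ℂ
  | [], F => F
  | h :: l, F => mulDiff l (fun y => F (y + h) * (starRingEnd ℂ) (F y))

theorem norm_sq_eq_sum_diff {Y : ℕ} {F : ℤ → ℂ} (hF : ∀ y, y ∉ Icc 1 (Y : ℤ) → F y = 0) :
    ((‖∑ y ∈ Icc 1 (Y : ℤ), F y‖ ^ 2 : ℝ) : ℂ) = ∑ h ∈ Ioo (-(Y : ℤ)) Y,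
      ∑ y ∈ Icc 1 (Y : ℤ), F (y + h) * (starRingEnd ℂ) (F y) := by
  have h1 := sum_mul_conj_eq (Subset.refl (Icc 1 (Y : ℤ))) F
  rw [Complex.mul_conj, Complex.normSq_eq_norm_sq] at h1
  rw [h1]
  refine sum_congr rfl fun h _ => ?_
  rw [sum_filter]
  refine sum_congr rfl fun y _ => ?_
  split_ifs with hy
  · rfl
  · rw [hF _ hy, zero_mul]

theorem norm_sum_pow_le_listSum {Y : ℕ} : ∀ (j : ℕ) {F : ℤ → ℂ},
    (∀ y, y ∉ Icc 1 (Y : ℤ) → F y = 0) →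
    (2 * (Y : ℝ)) ^ (j + 2) * ‖∑ y ∈ Icc 1 (Y : ℤ), F y‖ ^ 2 ^ (j + 1) ≤
      (2 * (Y : ℝ)) ^ 2 ^ (j + 1) *
        listSum Y (j + 1) (fun l => (∑ y ∈ Icc 1 (Y : ℤ), mulDiff l F y).re)
  | 0, F, hF => by
    have h1 := congrArg Complex.re (norm_sq_eq_sum_diff hF)
    rw [Complex.ofReal_re] at h1
    simp only [zero_add, pow_one, listSum, mulDiff]
    rw [h1, Complex.re_sum]
  | j + 1, F, hF => by
    have hY : (0 : ℝ) ≤ 2 * Y := by positivity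
    set G : ℤ → ℤ → ℂ := fun h y => F (y + h) * (starRingEnd ℂ) (F y) with hG
    have h1 : ‖∑ y ∈ Icc 1 (Y : ℤ), F y‖ ^ 2 ≤
        ∑ h ∈ Ioo (-(Y : ℤ)) Y, ‖∑ y ∈ Icc 1 (Y : ℤ), G h y‖ := by
      have h2 := norm_sq_eq_sum_diff hF
      have h3 := norm_sum_le (Ioo (-(Y : ℤ)) Y) fun h => ∑ y ∈ Icc 1 (Y : ℤ), G h y
      rw [← h2, Complex.norm_real, Real.norm_of_nonneg (by positivity)] at h3
      exact h3
    obtain ⟨m, hm⟩ : ∃ m, 2 ^ (j + 1) = m + 1 := ⟨2 ^ (j + 1) - 1, by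
      have := Nat.one_le_two_pow (n := j + 1); omega⟩
    have h4 : ‖∑ y ∈ Icc 1 (Y : ℤ), F y‖ ^ 2 ^ (j + 2) ≤ (2 * (Y : ℝ)) ^ m *
        ∑ h ∈ Ioo (-(Y : ℤ)) Y, ‖∑ y ∈ Icc 1 (Y : ℤ), G h y‖ ^ (2 ^ (j + 1)) := by
      rw [show 2 ^ (j + 2) = 2 * 2 ^ (j + 1) by ring, pow_mul, hm]
      calc _ ≤ (∑ h ∈ Ioo (-(Y : ℤ)) Y, ‖∑ y ∈ Icc 1 (Y : ℤ), G h y‖) ^ (m + 1) :=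
            pow_le_pow_left₀ (by positivity) h1 _
        _ ≤ (#(Ioo (-(Y : ℤ)) Y) : ℝ) ^ m * _ :=
            pow_sum_le_card_mul_sum_pow (fun _ _ => norm_nonneg _) m
        _ ≤ _ := by
          refine mul_le_mul_of_nonneg_right (pow_le_pow_left₀ (by positivity)
            (card_Ioo_neg_le Y) _) (sum_nonneg fun _ _ => by positivity)
    have h5 : ∀ h ∈ Ioo (-(Y : ℤ)) Y, (2 * (Y : ℝ)) ^ (j + 2) *
        ‖∑ y ∈ Icc 1 (Y : ℤ), G h y‖ ^ 2 ^ (j + 1) ≤ (2 * (Y : ℝ)) ^ 2 ^ (j + 1) *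
        listSum Y (j + 1) (fun l => (∑ y ∈ Icc 1 (Y : ℤ), mulDiff (h :: l) F y).re) := by
      intro h _
      refine norm_sum_pow_le_listSum j (F := G h) fun y hy => ?_
      simp [hG, hF y hy]
    calc (2 * (Y : ℝ)) ^ (j + 1 + 2) * ‖∑ y ∈ Icc 1 (Y : ℤ), F y‖ ^ 2 ^ (j + 1 + 1)
        ≤ (2 * (Y : ℝ)) ^ (j + 1 + 2) * ((2 * (Y : ℝ)) ^ m *
          ∑ h ∈ Ioo (-(Y : ℤ)) Y, ‖∑ y ∈ Icc 1 (Y : ℤ), G h y‖ ^ (2 ^ (j + 1))) :=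
          mul_le_mul_of_nonneg_left h4 (by positivity)
      _ = (2 * (Y : ℝ)) ^ (m + 1) * ∑ h ∈ Ioo (-(Y : ℤ)) Y, (2 * (Y : ℝ)) ^ (j + 2) *
          ‖∑ y ∈ Icc 1 (Y : ℤ), G h y‖ ^ (2 ^ (j + 1)) := by
        rw [← mul_sum]; ring
      _ ≤ (2 * (Y : ℝ)) ^ (m + 1) * ∑ h ∈ Ioo (-(Y : ℤ)) Y, (2 * (Y : ℝ)) ^ 2 ^ (j + 1) *
        listSum Y (j + 1) (fun l => (∑ y ∈ Icc 1 (Y : ℤ), mulDiff (h :: l) F y).re) :=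
          mul_le_mul_of_nonneg_left (sum_le_sum h5) (by positivity)
      _ = _ := by
        rw [← mul_sum, ← mul_assoc, ← hm, ← pow_add]
        congr 2
        ring

/-- Absolute values of the coefficients after iterated differencing. -/
noncomputable def coeffDiff : List ℤ → (ℤ → ℝ) → ℤ → ℝ
  | [], v => v
  | h :: l, v => coeffDiff l (fun y => v (y + h) * v y)

theorem coeffDiff_nonneg : ∀ (l : List ℤ) {v : ℤ → ℝ}, (∀ y, 0 ≤ v y) → ∀ y, 0 ≤ coeffDiff l v y
  | [], _, hv => hv
  | _ :: l, _, hv => coeffDiff_nonneg l fun y => mul_nonneg (hv _) (hv _)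

theorem coeffDiff_le : ∀ (l : List ℤ) {v : ℤ → ℝ} {B : ℝ}, (∀ y, 0 ≤ v y) → (∀ y, v y ≤ B) →
    ∀ y, coeffDiff l v y ≤ B ^ 2 ^ l.length
  | [], v, B, _, h => by simpa [coeffDiff] using h
  | h :: l, v, B, hv, hB => by
    intro y
    refine (coeffDiff_le l (B := B ^ 2) (fun y => mul_nonneg (hv _) (hv _)) (fun z => ?_) y).trans ?_
    · rw [sq]
      exact mul_le_mul (hB _) (hB _) (hv _) ((hv z).trans (hB z))
    · rw [← pow_mul, List.length_cons, pow_succ']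

theorem listSum_coeffDiff_sq_le {Y : ℕ} : ∀ (j : ℕ) {v : ℤ → ℝ}, (∀ y, 0 ≤ v y) →
    (∀ y, y ∉ Icc 1 (Y : ℤ) → v y = 0) →
    listSum Y j (fun l => ∑ y ∈ Icc 1 (Y : ℤ), coeffDiff l v y ^ 2) ≤
      (2 * (Y : ℝ)) ^ j * ∑ y ∈ Icc 1 (Y : ℤ), v y ^ 2 ^ (j + 1)
  | 0, v, _, _ => by simp [listSum, coeffDiff]
  | j + 1, v, hv, hs => by
    simp only [listSum, coeffDiff]
    have h0 : ∀ h : ℤ, ∑ y ∈ Icc 1 (Y : ℤ), v (y + h) ^ 2 ^ (j + 2) ≤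
        ∑ y ∈ Icc 1 (Y : ℤ), v y ^ 2 ^ (j + 2) := by
      intro h
      have e : ∑ y ∈ Icc 1 (Y : ℤ), v (y + h) ^ 2 ^ (j + 2) =
          ∑ y ∈ (Icc 1 (Y : ℤ)).image (· + h), v y ^ 2 ^ (j + 2) := by
        rw [sum_image (fun a _ b _ hab => by simpa using hab)]
      rw [e]
      rw [← sum_filter_of_ne (p := fun y => y ∈ Icc 1 (Y : ℤ)) fun y _ hy => by
        by_contra hc
        exact hy (by rw [hs y hc]; exact zero_pow (by positivity))]
      exact sum_le_sum_of_subset_of_nonneg (fun y hy => (mem_filter.1 hy).2)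
        fun y _ _ => pow_nonneg (hv y) _
    calc _ ≤ ∑ h ∈ Ioo (-(Y : ℤ)) Y, (2 * (Y : ℝ)) ^ j *
          ∑ y ∈ Icc 1 (Y : ℤ), v y ^ 2 ^ (j + 2) := by
          refine sum_le_sum fun h _ => ?_
          refine (listSum_coeffDiff_sq_le j (fun y => mul_nonneg (hv _) (hv _))
            (fun y hy => by simp [hs y hy])).trans ?_
          refine mul_le_mul_of_nonneg_left ?_ (by positivity)
          calc _ ≤ ∑ y ∈ Icc 1 (Y : ℤ), (v (y + h) ^ 2 ^ (j + 2) + v y ^ 2 ^ (j + 2)) / 2 := by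
                refine sum_le_sum fun y _ => ?_
                rw [mul_pow, show 2 ^ (j + 2) = 2 ^ (j + 1) * 2 by ring, pow_mul, pow_mul]
                nlinarith [sq_nonneg (v (y + h) ^ 2 ^ (j + 1) - v y ^ 2 ^ (j + 1))]
            _ ≤ _ := by
              rw [← sum_div, sum_add_distrib]
              linarith [h0 h]
      _ ≤ _ := by
        rw [sum_const, nsmul_eq_mul, pow_succ' (2 * (Y : ℝ)), mul_assoc]
        exact mul_le_mul_of_nonneg_right (card_Ioo_neg_le Y)
          (mul_nonneg (by positivity) (sum_nonneg fun y _ => pow_nonneg (hv y) _))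

/-- Iterated differences of an integer function. -/
def intDiff : List ℤ → (ℤ → ℤ) → ℤ → ℤ
  | [], P => P
  | h :: l, P => intDiff l (fun y => P (y + h) - P y)

theorem exists_mulDiff_eq {X : ℕ} (α : ℝ) (k : ℕ) : ∀ (l : List ℤ) (A : ℤ → Finset ℤ)
    (v : ℤ → ℂ) (P : ℤ → ℤ), (∀ y, A y ⊆ Icc 1 (X : ℤ)) → (∀ y, (A y : Set ℤ).OrdConnected) →
    ∃ B : ℤ → Finset ℤ, ∃ w : ℤ → ℂ, (∀ y, B y ⊆ Icc 1 (X : ℤ)) ∧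
      (∀ y, (B y : Set ℤ).OrdConnected) ∧ (∀ y, ‖w y‖ = coeffDiff l (fun y => ‖v y‖) y) ∧
      ∀ x y, mulDiff l (fun y => if x ∈ A y then v y * eAdd (α * (x : ℝ) ^ k * P y) else 0) y =
        if x ∈ B y then w y * eAdd (α * (x : ℝ) ^ k * intDiff l P y) else 0
  | [], A, v, P, h1, h2 => ⟨A, v, h1, h2, fun _ => rfl, fun _ _ => rfl⟩
  | h :: l, A, v, P, h1, h2 => by
    obtain ⟨B, w, b1, b2, b3, b4⟩ := exists_mulDiff_eq α k l (fun y => A (y + h) ∩ A y)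
      (fun y => v (y + h) * (starRingEnd ℂ) (v y)) (fun y => P (y + h) - P y)
      (fun y => inter_subset_right.trans (h1 y))
      (fun y => by rw [coe_inter]; exact (h2 _).inter (h2 _))
    refine ⟨B, w, b1, b2, fun y => ?_, fun x y => ?_⟩
    · rw [b3, coeffDiff]
      simp
    · rw [mulDiff, intDiff, ← b4]
      congr 1
      funext z
      simp only [mem_inter]
      by_cases hA : x ∈ A (z + h) <;> by_cases hB : x ∈ A z <;> simp [hA, hB]
      rw [mul_sub, eAdd_sub]
      ring

theorem intDiff_mul_left (c : ℤ) : ∀ (l : List ℤ) (P : ℤ → ℤ) (y : ℤ),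
    intDiff l (fun y => c * P y) y = c * intDiff l P y
  | [], _, _ => rfl
  | h :: l, P, y => by
    simp only [intDiff, ← intDiff_mul_left c l, mul_sub]

theorem exists_intDiff_eval (j : ℕ) : ∀ (l : List ℤ) (p : Polynomial ℤ), l.length = j →
    p.natDegree ≤ j + 1 → ∃ c : ℤ, ∀ y,
      intDiff l (fun y => p.eval y) y = l.prod * ((j + 1).factorial * p.coeff (j + 1) * y + c) := by
  induction j with
  | zero =>
    intro l p hl hp
    obtain rfl := List.length_eq_zero_iff.1 hl
    refine ⟨p.coeff 0, fun y => ?_⟩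
    have h1 := Polynomial.eval_eq_sum_range' (Nat.lt_succ_of_le hp) y
    simp only [intDiff, h1]
    simp [sum_range_succ]
    ring
  | succ j ih =>
    intro l p hl hp
    obtain ⟨h, l, rfl⟩ := List.exists_cons_of_length_eq_add_one hl
    obtain ⟨g, g1, g2, g3⟩ := exists_polynomial_diff (j + 1) p hp h
    obtain ⟨c, hc⟩ := ih l g (by simpa using hl) g1
    refine ⟨c, fun y => ?_⟩
    simp only [intDiff, g3, intDiff_mul_left, hc, g2, List.prod_cons, Nat.factorial_succ (j + 1)]
    push_cast
    ring

theorem abs_intDiff_le {Y B : ℤ} (hY : 0 ≤ Y) : ∀ (l : List ℤ) (P : ℤ → ℤ) (T : ℤ),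
    (∀ h ∈ l, |h| ≤ Y) → (∀ z, |z| ≤ T + l.length * Y → |P z| ≤ B) →
    ∀ y, |y| ≤ T → |intDiff l P y| ≤ 2 ^ l.length * B
  | [], P, T, _, hP, y, hy => by simpa [intDiff] using hP y (by simpa using hy)
  | h :: l, P, T, hl, hP, y, hy => by
    rw [intDiff]
    have := abs_intDiff_le (B := 2 * B) hY l (fun y => P (y + h) - P y) T
      (fun h hh => hl h (by simp [hh])) (fun z hz => ?_) y hy
    · rw [List.length_cons, pow_succ, mul_assoc]
      exact this
    · have hh := hl h (by simp)
      rw [List.length_cons] at hP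
      push_cast at hP
      have h1 := hP (z + h) ((abs_add_le z h).trans (by linarith))
      have h2 := hP z (by linarith)
      exact (abs_sub _ _).trans (by linarith)

theorem card_filter_dvd_le (Y : ℕ) {u : ℕ} (hu : u ≠ 0) :
    (#((Ioo (-(Y : ℤ)) Y).filter (fun h => h ∣ (u : ℤ))) : ℝ) ≤ 2 * tau u := by
  have h1 : (Ioo (-(Y : ℤ)) Y).filter (fun h => h ∣ (u : ℤ)) ⊆
      u.divisors.image (fun n : ℕ => (n : ℤ)) ∪ u.divisors.image (fun n : ℕ => -(n : ℤ)) := by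
    intro h hh
    have hd := (mem_filter.1 hh).2
    rw [mem_union, mem_image, mem_image]
    have hd' : h.natAbs ∣ u := Int.natCast_dvd_natCast.1 (by simpa using hd)
    rcases le_total 0 h with h0 | h0
    · exact Or.inl ⟨h.natAbs, Nat.mem_divisors.2 ⟨hd', hu⟩, by simpa using h0⟩
    · exact Or.inr ⟨h.natAbs, Nat.mem_divisors.2 ⟨hd', hu⟩, by
        rw [Int.natCast_natAbs, abs_of_nonpos h0, neg_neg]⟩
  have h2 := (card_le_card h1).trans (card_union_le _ _)
  have h3 := card_image_le (s := u.divisors) (f := fun n : ℕ => (n : ℤ))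
  have h4 := card_image_le (s := u.divisors) (f := fun n : ℕ => -(n : ℤ))
  have h5 : #((Ioo (-(Y : ℤ)) Y).filter (fun h => h ∣ (u : ℤ))) ≤ 2 * #u.divisors := by omega
  rw [tau]
  exact_mod_cast h5

theorem listSum_dvd_le (Y : ℕ) {u : ℕ} (hu : u ≠ 0) {c : ℝ} (hc : 0 ≤ c) : ∀ j : ℕ,
    listSum Y j (fun l => if ∀ h ∈ l, h ∣ (u : ℤ) then c else 0) ≤ (2 * tau u) ^ j * c
  | 0 => by simp [listSum]
  | j + 1 => by
    have h0 : (0:ℝ) ≤ tau u := tau_nonneg u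
    have h1 : ∀ h : ℤ, listSum Y j (fun l => if ∀ x ∈ h :: l, x ∣ (u : ℤ) then c else 0) ≤
        if h ∣ (u : ℤ) then (2 * tau u) ^ j * c else 0 := by
      intro h
      split_ifs with hd
      · simpa [hd] using listSum_dvd_le Y hu hc j
      · simpa [hd] using (listSum_const_le (Y := Y) (le_refl (0:ℝ)) j)
    simp only [listSum]
    refine (sum_le_sum fun h _ => h1 h).trans ?_
    rw [← sum_filter, sum_const, nsmul_eq_mul]
    calc _ ≤ (2 * tau u) * ((2 * tau u) ^ j * c) :=
          mul_le_mul_of_nonneg_right (card_filter_dvd_le Y hu) (by positivity)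
      _ = _ := by ring

theorem listSum_zero_mem_le (Y : ℕ) : ∀ j : ℕ,
    listSum Y j (fun l => if (0 : ℤ) ∈ l then (Y : ℝ) else 0) ≤ j * (2 * (Y : ℝ)) ^ j
  | 0 => by simp [listSum]
  | j + 1 => by
    have h1 : ∀ h : ℤ, listSum Y j (fun l => if (0 : ℤ) ∈ h :: l then (Y : ℝ) else 0) ≤
        (if h = 0 then (2 * (Y : ℝ)) ^ j * Y else 0) + j * (2 * (Y : ℝ)) ^ j := by
      intro h
      have h3 : (0:ℝ) ≤ j * (2 * (Y : ℝ)) ^ j := by positivity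
      split_ifs with hd
      · have h2 := listSum_const_le (Y := Y) (Nat.cast_nonneg (α := ℝ) Y) j
        refine le_trans ?_ (le_add_of_nonneg_right h3)
        simpa [hd] using h2
      · rw [zero_add]
        simpa [Ne.symm hd] using listSum_zero_mem_le Y j
    simp only [listSum]
    refine (sum_le_sum fun h _ => h1 h).trans ?_
    rw [sum_add_distrib, sum_ite_eq', sum_const, nsmul_eq_mul]
    have h4 : (if (0:ℤ) ∈ Ioo (-(Y : ℤ)) Y then (2 * (Y : ℝ)) ^ j * Y else 0) ≤
        (2 * (Y : ℝ)) ^ j * Y := by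
      split_ifs
      · exact le_rfl
      · positivity
    have h5 : (#(Ioo (-(Y : ℤ)) Y) : ℝ) * (j * (2 * (Y : ℝ)) ^ j) ≤
        2 * Y * (j * (2 * (Y : ℝ)) ^ j) :=
      mul_le_mul_of_nonneg_right (card_Ioo_neg_le Y) (by positivity)
    have h6 : (0:ℝ) ≤ (2 * (Y : ℝ)) ^ j * Y := by positivity
    push_cast
    rw [pow_succ]
    linarith

theorem exists_intDiff_pow {j : ℕ} {l : List ℤ} (hl : l.length = j) : ∃ c : ℤ, ∀ y,
    intDiff l (fun y => y ^ (j + 1)) y = l.prod * ((j + 1).factorial * y + c) := by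
  obtain ⟨c, hc⟩ := exists_intDiff_eval j l (Polynomial.X ^ (j + 1)) hl (by simp)
  exact ⟨c, fun y => by simpa using hc y⟩

theorem dvd_intDiff_pow {j : ℕ} {l : List ℤ} (hl : l.length = j) {h : ℤ} (hh : h ∈ l) (y : ℤ) :
    h ∣ intDiff l (fun y => y ^ (j + 1)) y := by
  obtain ⟨c, hc⟩ := exists_intDiff_pow hl
  rw [hc]
  exact (List.dvd_prod hh).mul_right _

theorem intDiff_pow_injective {j : ℕ} {l : List ℤ} (hl : l.length = j) (h0 : (0 : ℤ) ∉ l) :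
    Function.Injective (intDiff l (fun y => y ^ (j + 1))) := by
  obtain ⟨c, hc⟩ := exists_intDiff_pow hl
  intro a b hab
  rw [hc, hc] at hab
  have h1 : l.prod ≠ 0 := List.prod_ne_zero h0
  have h2 := mul_left_cancel₀ h1 hab
  have h3 : ((j + 1).factorial : ℤ) ≠ 0 := by exact_mod_cast (j + 1).factorial_ne_zero
  exact mul_left_cancel₀ h3 (by linarith)

theorem listSum_card_intDiff_eq_zero_le (Y j : ℕ) :
    listSum Y j (fun l => (#((Icc 1 (Y : ℤ)).filter
      fun y => intDiff l (fun y => y ^ (j + 1)) y = 0) : ℝ)) ≤ (j + 1) * (2 * (Y : ℝ)) ^ j := by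
  have h1 := listSum_const_le (Y := Y) (zero_le_one (α := ℝ)) j
  have h2 := listSum_zero_mem_le Y j
  refine le_trans (listSum_mono (g := fun l => 1 + if (0 : ℤ) ∈ l then (Y : ℝ) else 0)
    fun l hl _ => ?_) ?_
  · split_ifs with h0
    · have : #((Icc 1 (Y : ℤ)).filter fun y => intDiff l (fun y => y ^ (j + 1)) y = 0) ≤ Y :=
        (card_filter_le _ _).trans (by simp)
      have h3 : (#((Icc 1 (Y : ℤ)).filter
        fun y => intDiff l (fun y => y ^ (j + 1)) y = 0) : ℝ) ≤ Y := by exact_mod_cast this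
      linarith
    · have : #((Icc 1 (Y : ℤ)).filter fun y => intDiff l (fun y => y ^ (j + 1)) y = 0) ≤ 1 := by
        rw [card_le_one]
        intro a ha b hb
        exact intDiff_pow_injective hl h0 ((mem_filter.1 ha).2.trans (mem_filter.1 hb).2.symm)
      rw [add_zero]
      exact_mod_cast this
  · rw [listSum_add]
    linarith

theorem listSum_intDiff_ne_zero_le (Y j : ℕ) (w : ℕ → ℝ) (hw : ∀ u, 0 ≤ w u) :
    listSum Y j (fun l => ∑ y ∈ (Icc 1 (Y : ℤ)).filter
      (fun y => intDiff l (fun y => y ^ (j + 1)) y ≠ 0),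
        w (intDiff l (fun y => y ^ (j + 1)) y).natAbs) ≤
    2 ^ (j + 1) * ∑ u ∈ Icc 1 (2 ^ j * ((j + 1) * Y) ^ (j + 1)), tau u ^ j * w u := by
  set U := 2 ^ j * ((j + 1) * Y) ^ (j + 1) with hU
  refine le_trans (listSum_mono (g := fun l => ∑ u ∈ Icc 1 U, w u *
    if ∀ h ∈ l, h ∣ (u : ℤ) then (2 : ℝ) else 0) fun l hl hm => ?_) ?_
  · set D := intDiff l (fun y => y ^ (j + 1)) with hD
    have hmaps : ∀ y ∈ (Icc 1 (Y : ℤ)).filter (fun y => D y ≠ 0), (D y).natAbs ∈ Icc 1 U := by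
      intro y hy
      obtain ⟨hy1, hy2⟩ := mem_filter.1 hy
      rw [mem_Icc] at hy1
      rw [mem_Icc]
      refine ⟨Int.natAbs_pos.2 hy2, ?_⟩
      have h1 := abs_intDiff_le (Y := (Y : ℤ)) (B := ((j + 1) * Y) ^ (j + 1)) (by positivity) l
        (fun y => y ^ (j + 1)) Y (fun h hh => by
          have := mem_Ioo.1 (hm h hh)
          exact abs_le.2 ⟨by linarith, by linarith⟩) (fun z hz => by
          rw [abs_pow]
          refine pow_le_pow_left₀ (abs_nonneg z) (hz.trans ?_) _
          rw [hl]
          linarith) y (abs_le.2 ⟨by linarith, hy1.2⟩)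
      rw [hl] at h1
      zify
      exact h1
    rw [← sum_fiberwise_of_maps_to hmaps]
    refine sum_le_sum fun u hu => ?_
    have hu0 : u ≠ 0 := by have := (mem_Icc.1 hu).1; omega
    rw [sum_congr rfl (g := fun _ => w u) (fun y hy => by rw [(mem_filter.1 hy).2]), sum_const,
      nsmul_eq_mul, mul_comm]
    refine mul_le_mul_of_nonneg_left ?_ (hw u)
    split_ifs with hd
    · by_cases h0 : (0 : ℤ) ∈ l
      · have := hd 0 h0
        rw [zero_dvd_iff] at this
        exact absurd (by exact_mod_cast this) hu0
      · have hinj := intDiff_pow_injective hl h0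
        have h1 : #(((Icc 1 (Y : ℤ)).filter (fun y => D y ≠ 0)).filter
            fun y => (D y).natAbs = u) ≤ #({(u : ℤ), -(u : ℤ)} : Finset ℤ) := by
          refine card_le_card_of_injOn D (fun y hy => ?_) (fun a _ b _ hab => hinj hab)
          have h2 := (mem_filter.1 hy).2
          rw [mem_coe, mem_insert, mem_singleton]
          omega
        exact_mod_cast h1.trans card_le_two
    · push Not at hd
      obtain ⟨h, hh, hd⟩ := hd
      rw [filter_eq_empty_iff.2]
      · simp
      · intro y _ hy
        apply hd
        rw [← hy, Int.dvd_natAbs]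
        exact dvd_intDiff_pow hl hh y
  · rw [listSum_sum, mul_sum]
    refine sum_le_sum fun u hu => ?_
    have hu0 : u ≠ 0 := by have := (mem_Icc.1 hu).1; omega
    rw [listSum_mul_left]
    calc _ ≤ w u * ((2 * tau u) ^ j * 2) :=
          mul_le_mul_of_nonneg_left (listSum_dvd_le Y hu0 (by norm_num) j) (hw u)
      _ = _ := by rw [mul_pow]; ring

theorem exists_pl_affine (d c : ℝ) (C₀ : ℕ) : ∃ C : ℕ, ∀ L : ℝ, 1 ≤ L →
    d + c * pl C₀ L ≤ pl C L := by
  obtain ⟨C, hC⟩ := exists_pl_const (|d| + |c| * (C₀ + 1)) C₀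
  refine ⟨C, fun L hL => le_trans ?_ (hC L hL)⟩
  have h1 : (1:ℝ) ≤ L ^ C₀ := one_le_pow₀ hL
  have h2 : d ≤ |d| * L ^ C₀ := (le_abs_self d).trans (le_mul_of_one_le_right (abs_nonneg d) h1)
  have h3 : c * pl C₀ L ≤ |c| * ((C₀ + 1) * L ^ C₀) := by
    rw [pl]
    exact mul_le_mul_of_nonneg_right (le_abs_self c) (by positivity)
  linarith

theorem mul_le_sq_add_pow {a b σ : ℝ} (hb : 0 ≤ b) (hσ : 0 < σ) {K : ℕ} (hK : 2 ≤ K) :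
    a * b ≤ σ * (a ^ 2 + 1) + σ * (b / σ) ^ K := by
  obtain ⟨t, rfl⟩ : ∃ t, b = σ * t := ⟨b / σ, by field_simp⟩
  have ht : 0 ≤ t := nonneg_of_mul_nonneg_right hb hσ
  rw [mul_div_cancel_left₀ _ hσ.ne']
  have h1 : t ^ 2 ≤ 1 + t ^ K := by
    rcases le_total t 1 with h | h
    · have := pow_le_one₀ (n := 2) ht h
      have := pow_nonneg ht K
      linarith
    · have := pow_le_pow_right₀ h hK
      linarith
  have h2 : a * t ≤ a ^ 2 + t ^ 2 := by nlinarith [sq_nonneg (a - t), sq_nonneg a, sq_nonneg t]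
  calc a * (σ * t) = σ * (a * t) := by ring
    _ ≤ σ * (a ^ 2 + (1 + t ^ K)) := mul_le_mul_of_nonneg_left (by linarith) hσ.le
    _ = _ := by ring

theorem multiBd_natAbs (j X : ℕ) (θ : ℝ) (n : ℤ) :
    multiBd j X (θ * (n.natAbs : ℝ)) = multiBd j X (θ * n) := by
  rw [Nat.cast_natAbs]
  rcases le_total 0 n with h | h
  · rw [abs_of_nonneg h]
  · rw [abs_of_nonpos h, Int.cast_neg, mul_neg, multiBd_neg]

theorem sum_norm_pow_le_listSum (j : ℕ) (hj : 1 ≤ j) {X Y : ℕ} (hX : 1 ≤ X) (hY : 1 ≤ Y) (α : ℝ)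
    {A : ℤ → Finset ℤ} (hA : ∀ y, A y ⊆ Icc 1 (X : ℤ)) (hc : ∀ y, (A y : Set ℤ).OrdConnected)
    {v : ℤ → ℂ} (hv : ∀ y, y ∉ Icc 1 (Y : ℤ) → v y = 0) {Δ σ : ℝ} (hσ : 0 < σ)
    (hΔ : ∀ y, ‖v y‖ ≤ Δ) :
    (2 * (Y : ℝ)) ^ (j + 1) * ∑ x ∈ Icc 1 (X : ℤ), ‖∑ y ∈ Icc 1 (Y : ℤ),
      if x ∈ A y then v y * eAdd (α * (x : ℝ) ^ (j + 1) * ((y ^ (j + 1) : ℤ) : ℝ)) else 0‖ ^ 2 ^ j ≤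
    (2 * (Y : ℝ)) ^ 2 ^ j * (σ * ((2 * Y) ^ j * ∑ y ∈ Icc 1 (Y : ℤ), ‖v y‖ ^ 2 ^ (j + 1)) +
      σ * ((2 * Y) ^ j * Y) + σ * (1 / σ) ^ 2 ^ j * (3 / 2 * (2 * X) ^ 2 ^ j / (2 * X) ^ (j + 1)) *
        (2 ^ (j + 1) * ∑ u ∈ Icc 1 (2 ^ j * ((j + 1) * Y) ^ (j + 1)),
          tau u ^ j * multiBd j X (α * (j + 1).factorial * u)) +
      Δ ^ 2 ^ j * X * ((j + 1) * (2 * Y) ^ j)) := by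
  have hΔ0 : 0 ≤ Δ := (norm_nonneg _).trans (hΔ 0)
  have hXR : (0:ℝ) < 2 * X := by positivity
  set P : ℤ → ℤ := fun y => y ^ (j + 1) with hP
  set F : ℤ → ℤ → ℂ := fun x y =>
    if x ∈ A y then v y * eAdd (α * (x : ℝ) ^ (j + 1) * P y) else 0 with hF
  set Q : ℝ := 3 / 2 * (2 * X) ^ 2 ^ j / (2 * X) ^ (j + 1) with hQ
  have hQ0 : 0 ≤ Q := by positivity
  set w : ℕ → ℝ := fun u => multiBd j X (α * (j + 1).factorial * u) with hw
  have hw0 : ∀ u, 0 ≤ w u := fun u => multiBd_nonneg _ _ _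
  obtain ⟨i, rfl⟩ : ∃ i, j = i + 1 := ⟨j - 1, by omega⟩
  have h1 : ∀ x ∈ Icc 1 (X : ℤ), (2 * (Y : ℝ)) ^ (i + 1 + 1) *
      ‖∑ y ∈ Icc 1 (Y : ℤ), F x y‖ ^ 2 ^ (i + 1) ≤ (2 * (Y : ℝ)) ^ 2 ^ (i + 1) *
        listSum Y (i + 1) (fun l => (∑ y ∈ Icc 1 (Y : ℤ), mulDiff l (F x) y).re) := by
    intro x _
    exact norm_sum_pow_le_listSum i fun y hy => by simp [hF, hv y hy]
  rw [mul_sum]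
  refine (sum_le_sum h1).trans ?_
  rw [← mul_sum, ← listSum_sum]
  refine mul_le_mul_of_nonneg_left ?_ (by positivity)
  have h2 : ∀ l : List ℤ, l.length = i + 1 →
      ∑ x ∈ Icc 1 (X : ℤ), (∑ y ∈ Icc 1 (Y : ℤ), mulDiff l (F x) y).re ≤
      σ * ∑ y ∈ Icc 1 (Y : ℤ), coeffDiff l (fun y => ‖v y‖) y ^ 2 + σ * Y +
      σ * (1 / σ) ^ 2 ^ (i + 1) * Q * ∑ y ∈ (Icc 1 (Y : ℤ)).filter (fun y => intDiff l P y ≠ 0),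
        w (intDiff l P y).natAbs +
      Δ ^ 2 ^ (i + 1) * X * (#((Icc 1 (Y : ℤ)).filter fun y => intDiff l P y = 0) : ℝ) := by
    intro l hl
    obtain ⟨B, z, b1, b2, b3, b4⟩ := exists_mulDiff_eq (X := X) α (i + 1 + 1) l A v P hA hc
    have hV0 : ∀ y, 0 ≤ coeffDiff l (fun y => ‖v y‖) y :=
      coeffDiff_nonneg l fun _ => norm_nonneg _
    have e1 : ∑ x ∈ Icc 1 (X : ℤ), (∑ y ∈ Icc 1 (Y : ℤ), mulDiff l (F x) y).re =
        ∑ y ∈ Icc 1 (Y : ℤ), (∑ x ∈ Icc 1 (X : ℤ), mulDiff l (F x) y).re := by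
      simp only [Complex.re_sum]
      exact sum_comm
    rw [e1]
    have e2 : ∀ y, ∑ x ∈ Icc 1 (X : ℤ), mulDiff l (F x) y =
        z y * ∑ x ∈ B y, eAdd (α * intDiff l P y * (x : ℝ) ^ (i + 1 + 1)) := by
      intro y
      rw [sum_congr rfl fun x _ => b4 x y, ← sum_filter, filter_mem_eq_inter,
        inter_eq_right.2 (b1 y), mul_sum]
      refine sum_congr rfl fun x _ => ?_
      congr 2
      ring
    have h3 : ∀ y ∈ Icc 1 (Y : ℤ), (∑ x ∈ Icc 1 (X : ℤ), mulDiff l (F x) y).re ≤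
        σ * coeffDiff l (fun y => ‖v y‖) y ^ 2 + σ +
        σ * (1 / σ) ^ 2 ^ (i + 1) * Q *
          (if intDiff l P y ≠ 0 then w (intDiff l P y).natAbs else 0) +
        Δ ^ 2 ^ (i + 1) * X * (if intDiff l P y = 0 then 1 else 0) := by
      intro y _
      refine (Complex.re_le_norm _).trans ?_
      rw [e2, norm_mul, b3]
      set V := coeffDiff l (fun y => ‖v y‖) y with hV
      set W := ‖∑ x ∈ B y, eAdd (α * intDiff l P y * (x : ℝ) ^ (i + 1 + 1))‖ with hW
      have hW0 : 0 ≤ W := norm_nonneg _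
      by_cases hD : intDiff l P y = 0
      · simp only [hD, ne_eq, not_true_eq_false, if_false, if_true, mul_zero, mul_one]
        have h4 : V ≤ Δ ^ 2 ^ (i + 1) := by
          have := coeffDiff_le l (fun y => norm_nonneg (v y)) hΔ y
          rwa [hl] at this
        have h5 : W ≤ X := by
          refine (norm_sum_le _ _).trans ?_
          simp only [norm_eAdd, sum_const, nsmul_eq_mul, mul_one]
          have := card_le_card (b1 y)
          rw [Int.card_Icc] at this
          exact_mod_cast this.trans (by simp)
        have h6 : V * W ≤ Δ ^ 2 ^ (i + 1) * X := mul_le_mul h4 h5 hW0 (by positivity)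
        have h7 : 0 ≤ σ * V ^ 2 := by positivity
        linarith
      · simp only [hD, ne_eq, not_false_eq_true, if_false, if_true, mul_zero, add_zero]
        have h4 : W ^ 2 ^ (i + 1) ≤ Q * w (intDiff l P y).natAbs := by
          have := weyl_monomial (i + 1) (α * intDiff l P y) (b1 y) (b2 y)
          rw [hQ, div_mul_eq_mul_div, le_div_iff₀ (by positivity), mul_comm]
          refine this.trans (le_of_eq ?_)
          rw [hw]
          simp only
          rw [multiBd_natAbs]
          congr 2
          ring
        refine (mul_le_sq_add_pow hW0 hσ (K := 2 ^ (i + 1)) ?_).trans ?_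
        · rw [pow_succ]
          have := Nat.one_le_two_pow (n := i)
          omega
        · have h5 : σ * (W / σ) ^ 2 ^ (i + 1) ≤
              σ * (1 / σ) ^ 2 ^ (i + 1) * Q * w (intDiff l P y).natAbs := by
            rw [div_eq_mul_one_div W, mul_pow, mul_comm (W ^ _), ← mul_assoc, mul_assoc _ Q]
            exact mul_le_mul_of_nonneg_left h4 (by positivity)
          linarith
    refine (sum_le_sum h3).trans (le_of_eq ?_)
    rw [sum_add_distrib, sum_add_distrib, sum_add_distrib, ← mul_sum, ← mul_sum, ← mul_sum,
      sum_boole, sum_filter]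
    simp
    ring
  refine (listSum_mono fun l hl _ => h2 l hl).trans ?_
  rw [listSum_add, listSum_add, listSum_add, listSum_mul_left, listSum_mul_left, listSum_mul_left,
    listSum_mul_left]
  have g1 := mul_le_mul_of_nonneg_left (listSum_coeffDiff_sq_le (Y := Y) (i + 1)
    (v := fun y => ‖v y‖) (fun y => norm_nonneg (v y)) (fun y hy => by simp [hv y hy])) hσ.le
  have g2 := mul_le_mul_of_nonneg_left
    (listSum_const_le (Y := Y) (Nat.cast_nonneg (α := ℝ) Y) (i + 1)) hσ.le
  have g3 := mul_le_mul_of_nonneg_left (listSum_intDiff_ne_zero_le Y (i + 1) w hw0)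
    (show 0 ≤ σ * (1 / σ) ^ 2 ^ (i + 1) * Q by positivity)
  have g4 := mul_le_mul_of_nonneg_left (listSum_card_intDiff_eq_zero_le Y (i + 1))
    (show 0 ≤ Δ ^ 2 ^ (i + 1) * X by positivity)
  exact add_le_add (add_le_add (add_le_add g1 g2) g3) (by push_cast at g4 ⊢; exact g4)

theorem exists_typeII_weyl (j : ℕ) (hj : 1 ≤ j) (s : ℕ) : ∃ C : ℕ, ∀ (α : ℝ) (a : ℤ) (q : ℕ),
    IsApprox α a q → ∀ D X Y : ℕ, 1 ≤ D → 1 ≤ X → 1 ≤ Y → D ≤ Y →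
    (j + 1).factorial * (2 ^ j * ((j + 1) * Y) ^ (j + 1) * X ^ j) ≤ D ^ s → ∀ L : ℝ,
    lg D ≤ L → lg (2 * q) ≤ L → lg (2 ^ j * ((j + 1) * Y) ^ (j + 1) * X ^ j : ℕ) ≤ L →
    ∀ η : ℝ, 1 ≤ η → (η ^ 2 ^ j) ^ 2 ^ j ≤ X → (η ^ 2 ^ j) ^ 2 ^ j * D ≤ q →
    (η ^ 2 ^ j) ^ 2 ^ j * D * q ≤ ((X : ℝ) * Y) ^ (j + 1) →
    ∀ Δ : ℝ, η ^ 2 ^ j * Δ ^ 2 ^ j ≤ Y →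
    ∀ A : ℤ → Finset ℤ, (∀ y, A y ⊆ Icc 1 (X : ℤ)) → (∀ y, (A y : Set ℤ).OrdConnected) →
    ∀ u v : ℤ → ℂ, (∀ y, y ∉ Icc 1 (Y : ℤ) → v y = 0) → (∀ y, ‖v y‖ ≤ Δ) → ∀ M : ℝ, 1 ≤ M →
    ∑ x ∈ Icc 1 (X : ℤ), ‖u x‖ ^ 2 ≤ X * M →
    ∑ y ∈ Icc 1 (Y : ℤ), ‖v y‖ ^ 2 ^ (j + 1) ≤ Y * M →
    ‖∑ y ∈ Icc 1 (Y : ℤ), ∑ x ∈ A y, u x * v y * eAdd (α * ((x : ℝ) * y) ^ (j + 1))‖ ≤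
      pl C L * M * (X * Y / η) := by
  obtain ⟨C₀, hC₀⟩ := exists_mean_value j j s
  set cU : ℝ := 2 ^ j * (j + 1) ^ (j + 1) with hcU
  set cM : ℝ := 3 / 2 * 2 ^ 2 ^ j / 2 ^ (j + 1) * (2 ^ (j + 1) * (2 * cU + 2)) with hcM
  set cG : ℝ := 2 ^ 2 ^ j / 2 ^ (j + 1) with hcG
  obtain ⟨C, hC⟩ := exists_pl_affine (2 + cG * (2 * 2 ^ j + (j + 1) * 2 ^ j)) (cG * cM) C₀
  refine ⟨C, ?_⟩
  intro α a q hq D X Y hD hX hY hDY hDs L hL1 hL2 hL3 η hη e1 e2 e3 Δ e4 A hA hc u v hv hvΔ M hM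
    hu hvM
  have hL : 1 ≤ L := (one_le_lg D).trans hL1
  have hXR : (1 : ℝ) ≤ X := by exact_mod_cast hX
  have hYR : (1 : ℝ) ≤ Y := by exact_mod_cast hY
  have hDR : (1 : ℝ) ≤ D := by exact_mod_cast hD
  have hDYR : (D : ℝ) ≤ Y := by exact_mod_cast hDY
  have hX0 : (0 : ℝ) < X := by linarith
  have hY0 : (0 : ℝ) < Y := by linarith
  have hq1 : 1 ≤ q := hq.1
  have hqR : (0 : ℝ) < q := by exact_mod_cast hq1
  have hη0 : 0 < η := by linarith
  set K := 2 ^ j with hK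
  set H := η ^ K with hH
  have hH0 : 0 < H := by positivity
  have hcU0 : 0 < cU := by positivity
  have hcM0 : 0 < cM := by positivity
  have hcG0 : 0 < cG := by positivity
  have hp0 : 0 ≤ pl C₀ L := pl_nonneg _ hL
  have hK2 : 2 ≤ K := by
    rw [hK]; exact (pow_le_pow_right₀ (by norm_num) hj : 2 ^ 1 ≤ 2 ^ j)
  -- the mean value of the Weyl bounds
  set T := ∑ u ∈ Icc 1 (2 ^ j * ((j + 1) * Y) ^ (j + 1)),
          tau u ^ j * multiBd j X (α * (j + 1).factorial * u) with hT
  have hTle : H ^ K * T ≤ pl C₀ L * ((2 * cU + 2) * ((X : ℝ) * Y) ^ (j + 1)) := by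
    have h1 := hC₀ α a q hq D (2 ^ j * ((j + 1) * Y) ^ (j + 1)) X hD hX hDs L hL1 hL2 hL3
    rw [← hT] at h1
    have hUc : ((2 ^ j * ((j + 1) * Y) ^ (j + 1) : ℕ) : ℝ) = cU * (Y : ℝ) ^ (j + 1) := by
      push_cast; rw [hcU, mul_pow]; ring
    rw [hUc] at h1
    have h2 : H ^ K * (cU * (Y : ℝ) ^ (j + 1) * X ^ j +
        D * (cU * (Y : ℝ) ^ (j + 1) * X ^ (j + 1) / q + X + q)) ≤
        (2 * cU + 2) * ((X : ℝ) * Y) ^ (j + 1) := by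
      have f1 : H ^ K * (cU * (Y : ℝ) ^ (j + 1) * X ^ j) ≤ cU * ((X : ℝ) * Y) ^ (j + 1) := by
        calc _ = H ^ K * (cU * (Y : ℝ) ^ (j + 1) * X ^ j) := rfl
          _ ≤ X * (cU * (Y : ℝ) ^ (j + 1) * X ^ j) :=
            mul_le_mul_of_nonneg_right e1 (by positivity)
          _ = _ := by rw [mul_pow]; ring
      have f2 : H ^ K * (D * (cU * (Y : ℝ) ^ (j + 1) * X ^ (j + 1) / q)) ≤
          cU * ((X : ℝ) * Y) ^ (j + 1) := by
        calc _ = (H ^ K * D) * (cU * ((X : ℝ) * Y) ^ (j + 1) / q) := by rw [mul_pow]; ring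
          _ ≤ q * (cU * ((X : ℝ) * Y) ^ (j + 1) / q) :=
            mul_le_mul_of_nonneg_right e2 (by positivity)
          _ = _ := by field_simp
      have f3 : H ^ K * (D * X) ≤ ((X : ℝ) * Y) ^ (j + 1) := by
        calc H ^ K * (D * X) ≤ X * (Y * X) := by
              refine mul_le_mul e1 ?_ (by positivity) hX0.le
              exact mul_le_mul_of_nonneg_right hDYR hX0.le
          _ = X ^ 2 * Y ^ 1 := by ring
          _ ≤ X ^ (j + 1) * Y ^ (j + 1) :=
            mul_le_mul (pow_le_pow_right₀ hXR (by omega)) (pow_le_pow_right₀ hYR (by omega))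
              (by positivity) (by positivity)
          _ = _ := by rw [mul_pow]
      have f4 : H ^ K * (D * q) ≤ ((X : ℝ) * Y) ^ (j + 1) := by
        rw [← mul_assoc]; exact e3
      calc _ = H ^ K * (cU * (Y : ℝ) ^ (j + 1) * X ^ j) +
            H ^ K * (D * (cU * (Y : ℝ) ^ (j + 1) * X ^ (j + 1) / q)) + H ^ K * (D * X) +
            H ^ K * (D * q) := by ring
        _ ≤ _ := by linarith
    calc H ^ K * T ≤ H ^ K * (pl C₀ L * (cU * (Y : ℝ) ^ (j + 1) * X ^ j +
        D * (cU * (Y : ℝ) ^ (j + 1) * X ^ (j + 1) / q + X + q))) :=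
          mul_le_mul_of_nonneg_left h1 (by positivity)
      _ = pl C₀ L * (H ^ K * (cU * (Y : ℝ) ^ (j + 1) * X ^ j +
        D * (cU * (Y : ℝ) ^ (j + 1) * X ^ (j + 1) / q + X + q))) := by ring
      _ ≤ _ := mul_le_mul_of_nonneg_left h2 hp0
  -- the power moment of the inner sums
  set G : ℤ → ℂ := fun x => ∑ y ∈ Icc 1 (Y : ℤ),
      if x ∈ A y then v y * eAdd (α * (x : ℝ) ^ (j + 1) * ((y ^ (j + 1) : ℤ) : ℝ)) else 0 with hG
  have hGle : ∑ x ∈ Icc 1 (X : ℤ), ‖G x‖ ^ K ≤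
      cG * (2 * 2 ^ j + (j + 1) * 2 ^ j + cM * pl C₀ L) * M * (X * Y ^ K / H) := by
    have h1 := sum_norm_pow_le_listSum j hj hX hY α hA hc hv (σ := X / H) (by positivity) hvΔ
    rw [← hK, ← hT] at h1
    set B := X / H * ((2 * Y) ^ j * ∑ y ∈ Icc 1 (Y : ℤ), ‖v y‖ ^ 2 ^ (j + 1)) +
      X / H * ((2 * Y) ^ j * Y) + X / H * (1 / (X / H)) ^ K *
        (3 / 2 * (2 * X) ^ K / (2 * X) ^ (j + 1)) * (2 ^ (j + 1) * T) +
      Δ ^ K * X * ((j + 1) * (2 * Y) ^ j) with hB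
    have hB1 : B ≤ (2 * 2 ^ j + (j + 1) * 2 ^ j + cM * pl C₀ L) * M * (X * Y ^ (j + 1) / H) := by
      have f1 : X / H * ((2 * Y) ^ j * ∑ y ∈ Icc 1 (Y : ℤ), ‖v y‖ ^ 2 ^ (j + 1)) ≤
          2 ^ j * M * (X * Y ^ (j + 1) / H) := by
        calc _ ≤ X / H * ((2 * Y) ^ j * (Y * M)) :=
              mul_le_mul_of_nonneg_left (mul_le_mul_of_nonneg_left hvM (by positivity))
                (by positivity)
          _ = _ := by rw [mul_pow]; ring
      have f2 : X / H * ((2 * Y) ^ j * Y) ≤ 2 ^ j * M * (X * Y ^ (j + 1) / H) := by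
        calc _ = 2 ^ j * 1 * (X * Y ^ (j + 1) / H) := by rw [mul_pow]; ring
          _ ≤ _ := by
            refine mul_le_mul_of_nonneg_right (mul_le_mul_of_nonneg_left hM (by positivity))
              (by positivity)
      have f3 : X / H * (1 / (X / H)) ^ K * (3 / 2 * (2 * X) ^ K / (2 * X) ^ (j + 1)) *
          (2 ^ (j + 1) * T) ≤ cM * pl C₀ L * M * (X * Y ^ (j + 1) / H) := by
        calc _ = (3 / 2 * 2 ^ K / 2 ^ (j + 1)) * 2 ^ (j + 1) *
              (X / H / X ^ (j + 1)) * (H ^ K * T) := by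
              rw [one_div_div, div_pow, mul_pow, mul_pow]
              field_simp
          _ ≤ (3 / 2 * 2 ^ K / 2 ^ (j + 1)) * 2 ^ (j + 1) *
              (X / H / X ^ (j + 1)) * (pl C₀ L * ((2 * cU + 2) * ((X : ℝ) * Y) ^ (j + 1))) :=
              mul_le_mul_of_nonneg_left hTle (by positivity)
          _ = cM * pl C₀ L * 1 * (X * Y ^ (j + 1) / H) := by
            rw [hcM, mul_pow]
            field_simp
          _ ≤ _ := by
            refine mul_le_mul_of_nonneg_right (mul_le_mul_of_nonneg_left hM (by positivity))
              (by positivity)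
      have f4 : Δ ^ K * X * ((j + 1) * (2 * Y) ^ j) ≤
          (j + 1) * 2 ^ j * M * (X * Y ^ (j + 1) / H) := by
        have : Δ ^ K ≤ Y / H := by rw [le_div_iff₀ hH0]; linarith
        calc _ ≤ Y / H * X * ((j + 1) * (2 * Y) ^ j) := by
              refine mul_le_mul_of_nonneg_right (mul_le_mul_of_nonneg_right this hX0.le)
                (by positivity)
          _ = (j + 1) * 2 ^ j * 1 * (X * Y ^ (j + 1) / H) := by rw [mul_pow]; ring
          _ ≤ _ := by
            refine mul_le_mul_of_nonneg_right (mul_le_mul_of_nonneg_left hM (by positivity))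
              (by positivity)
      rw [hB]
      linarith
    have h2 : (2 * (Y : ℝ)) ^ (j + 1) * ∑ x ∈ Icc 1 (X : ℤ), ‖G x‖ ^ K ≤ (2 * (Y : ℝ)) ^ K *
        ((2 * 2 ^ j + (j + 1) * 2 ^ j + cM * pl C₀ L) * M * (X * Y ^ (j + 1) / H)) :=
      h1.trans (mul_le_mul_of_nonneg_left hB1 (by positivity))
    rw [← le_div_iff₀' (by positivity)] at h2
    refine h2.trans (le_of_eq ?_)
    rw [hcG, mul_pow, mul_pow]
    field_simp
  have e5 : ∑ y ∈ Icc 1 (Y : ℤ), ∑ x ∈ A y, u x * v y * eAdd (α * ((x : ℝ) * y) ^ (j + 1)) =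
      ∑ x ∈ Icc 1 (X : ℤ), u x * G x := by
    simp only [hG, mul_sum]
    rw [sum_comm]
    refine sum_congr rfl fun y _ => ?_
    simp only [mul_ite, mul_zero]
    rw [← sum_filter, filter_mem_eq_inter, inter_eq_right.2 (hA y)]
    refine sum_congr rfl fun x _ => ?_
    rw [mul_pow]
    push_cast
    rw [← mul_assoc, ← mul_assoc]
  rw [e5]
  have hσ : 0 < Y / η := by positivity
  calc ‖∑ x ∈ Icc 1 (X : ℤ), u x * G x‖ ≤ ∑ x ∈ Icc 1 (X : ℤ), ‖u x‖ * ‖G x‖ := by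
        refine (norm_sum_le _ _).trans (le_of_eq (sum_congr rfl fun x _ => norm_mul _ _))
    _ ≤ ∑ x ∈ Icc 1 (X : ℤ), (Y / η * (‖u x‖ ^ 2 + 1) + Y / η * (‖G x‖ / (Y / η)) ^ K) :=
      sum_le_sum fun x _ => mul_le_sq_add_pow (norm_nonneg _) hσ hK2
    _ = Y / η * (∑ x ∈ Icc 1 (X : ℤ), ‖u x‖ ^ 2) + Y / η * X +
        Y / η * (H / Y ^ K) * ∑ x ∈ Icc 1 (X : ℤ), ‖G x‖ ^ K := by
      rw [sum_add_distrib, ← mul_sum, sum_add_distrib, mul_sum]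
      simp only [sum_const, Int.card_Icc, nsmul_eq_mul]
      rw [mul_add, mul_sum, mul_sum]
      congr 1
      · simp
      · refine sum_congr rfl fun x _ => ?_
        rw [div_div_eq_mul_div, div_pow, mul_pow, ← hH]
        ring
    _ ≤ Y / η * (X * M) + Y / η * X * M + Y / η * (H / Y ^ K) *
        (cG * (2 * 2 ^ j + (j + 1) * 2 ^ j + cM * pl C₀ L) * M * (X * Y ^ K / H)) := by
      refine add_le_add (add_le_add (mul_le_mul_of_nonneg_left hu hσ.le) ?_)
        (mul_le_mul_of_nonneg_left hGle (by positivity))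
      exact le_mul_of_one_le_right (by positivity) hM
    _ = (2 + cG * (2 * 2 ^ j + (j + 1) * 2 ^ j) + cG * cM * pl C₀ L) * M * (X * Y / η) := by
      field_simp
      ring
    _ ≤ _ := by
      refine mul_le_mul_of_nonneg_right (mul_le_mul_of_nonneg_right (hC L hL) (by linarith))
        (by positivity)

theorem exists_typeI_weyl (j : ℕ) (hj : 1 ≤ j) (s : ℕ) : ∃ C : ℕ, ∀ (α : ℝ) (a : ℤ) (q : ℕ),
    IsApprox α a q → ∀ D M X : ℕ, 1 ≤ D → 1 ≤ M → 1 ≤ X →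
    (j + 1).factorial * ((2 * M) ^ (j + 1) * X ^ j) ≤ D ^ s → ∀ L : ℝ,
    lg D ≤ L → lg (2 * q) ≤ L → lg ((2 * M) ^ (j + 1) * X ^ j : ℕ) ≤ L →
    ∀ η : ℝ, 1 ≤ η → η ^ 2 ^ j * M ^ j ≤ X → η ^ 2 ^ j * D * M ^ j ≤ q → η ^ 2 ^ j * D ≤ X →
    η ^ 2 ^ j * D * q ≤ (M : ℝ) * X ^ (j + 1) →
    ∀ A : ℤ → Finset ℤ, (∀ m, A m ⊆ Icc 1 (X : ℤ)) → (∀ m, (A m : Set ℤ).OrdConnected) →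
    ∑ m ∈ Ico M (2 * M), ‖∑ n ∈ A m, eAdd (α * ((m : ℝ) * n) ^ (j + 1))‖ ≤
      pl C L * (M * X / η) := by
  obtain ⟨C₀, hC₀⟩ := exists_mean_value j 0 s
  set c : ℝ := 3 / 2 * 2 ^ 2 ^ j / 2 ^ (j + 1) * (2 * 2 ^ (j + 1) + 2) with hc
  obtain ⟨C, hC⟩ := exists_pl_affine 1 c C₀
  refine ⟨C, ?_⟩
  intro α a q hq D M X hD hM hX hDs L hL1 hL2 hL3 η hη e1 e2 e3 e4 A hA hAc
  have hL : 1 ≤ L := (one_le_lg D).trans hL1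
  have hXR : (1 : ℝ) ≤ X := by exact_mod_cast hX
  have hMR : (1 : ℝ) ≤ M := by exact_mod_cast hM
  have hDR : (1 : ℝ) ≤ D := by exact_mod_cast hD
  have hX0 : (0 : ℝ) < X := by linarith
  have hM0 : (0 : ℝ) < M := by linarith
  have hq1 : 1 ≤ q := hq.1
  have hqR : (0 : ℝ) < q := by exact_mod_cast hq1
  have hη0 : 0 < η := by linarith
  have hc0 : 0 < c := by positivity
  have hp0 : 0 ≤ pl C₀ L := pl_nonneg _ hL
  set K := 2 ^ j with hK
  set H := η ^ K with hH
  have hH0 : 0 < H := by positivity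
  have hK0 : K ≠ 0 := by positivity
  obtain ⟨K', hK'⟩ : ∃ K', K = K' + 1 := ⟨K - 1, (Nat.succ_pred_eq_of_ne_zero hK0).symm⟩
  set T := ∑ u ∈ Icc 1 ((2 * M) ^ (j + 1)), multiBd j X (α * (j + 1).factorial * u) with hT
  have hTle : T ≤ pl C₀ L * ((2 * 2 ^ (j + 1) + 2) * (M * X ^ (j + 1) / H)) := by
    have h1 := hC₀ α a q hq D ((2 * M) ^ (j + 1)) X hD hX hDs L hL1 hL2 hL3
    simp only [pow_zero, one_mul] at h1
    rw [← hT] at h1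
    refine h1.trans (mul_le_mul_of_nonneg_left ?_ hp0)
    push_cast
    have f1 : (2 * (M : ℝ)) ^ (j + 1) * X ^ j ≤ 2 ^ (j + 1) * (M * X ^ (j + 1) / H) := by
      rw [← mul_div_assoc, le_div_iff₀ hH0]
      calc (2 * (M : ℝ)) ^ (j + 1) * X ^ j * H = 2 ^ (j + 1) * (M * X ^ j) * (H * M ^ j) := by
            rw [mul_pow]; ring
        _ ≤ 2 ^ (j + 1) * (M * X ^ j) * X := mul_le_mul_of_nonneg_left e1 (by positivity)
        _ = _ := by ring
    have f2 : (D : ℝ) * ((2 * M) ^ (j + 1) * X ^ (j + 1) / q) ≤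
        2 ^ (j + 1) * (M * X ^ (j + 1) / H) := by
      rw [← mul_div_assoc, ← mul_div_assoc, div_le_div_iff₀ hqR hH0]
      calc (D : ℝ) * ((2 * M) ^ (j + 1) * X ^ (j + 1)) * H =
            2 ^ (j + 1) * (M * X ^ (j + 1)) * (H * D * M ^ j) := by
            rw [mul_pow]; ring
        _ ≤ 2 ^ (j + 1) * (M * X ^ (j + 1)) * q := mul_le_mul_of_nonneg_left e2 (by positivity)
    have f3 : (D : ℝ) * X ≤ M * X ^ (j + 1) / H := by
      rw [le_div_iff₀ hH0]
      calc (D : ℝ) * X * H = 1 * (H * D * X ^ 1) := by ring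
        _ ≤ M * (X * X ^ j) := by
          refine mul_le_mul hMR ?_ (by positivity) hM0.le
          exact mul_le_mul e3 (pow_le_pow_right₀ hXR hj) (by positivity) hX0.le
        _ = _ := by ring
    have f4 : (D : ℝ) * q ≤ M * X ^ (j + 1) / H := by
      rw [le_div_iff₀ hH0]
      linarith
    linarith
  set W : ℕ → ℝ := fun m => ‖∑ n ∈ A m, eAdd (α * ((m : ℝ) * n) ^ (j + 1))‖ with hW
  have hWle : ∑ m ∈ Ico M (2 * M), W m ^ K ≤ 3 / 2 * (2 * X) ^ K / (2 * X) ^ (j + 1) * T := by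
    have h1 : ∀ m ∈ Ico M (2 * M), W m ^ K ≤ 3 / 2 * (2 * X) ^ K / (2 * X) ^ (j + 1) *
        multiBd j X (α * (j + 1).factorial * ((m ^ (j + 1) : ℕ) : ℝ)) := by
      intro m _
      have := weyl_monomial j (α * (m : ℝ) ^ (j + 1)) (hA m) (hAc m)
      rw [div_mul_eq_mul_div, le_div_iff₀ (by positivity), mul_comm]
      have g1 : W m = ‖∑ n ∈ A m, eAdd (α * (m : ℝ) ^ (j + 1) * (n : ℝ) ^ (j + 1))‖ := by
        simp only [hW, mul_pow, mul_assoc]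
      have g2 : α * (j + 1).factorial * ((m ^ (j + 1) : ℕ) : ℝ) =
          α * (m : ℝ) ^ (j + 1) * (j + 1).factorial := by push_cast; ring
      rw [g1, g2]
      exact this
    refine (sum_le_sum h1).trans ?_
    rw [← mul_sum]
    refine mul_le_mul_of_nonneg_left ?_ (by positivity)
    rw [hT, ← sum_image (f := fun u : ℕ => multiBd j X (α * (j + 1).factorial * u))
      (g := fun m => m ^ (j + 1)) (fun a _ b _ hab => Nat.pow_left_injective (by omega) hab)]
    refine sum_le_sum_of_subset_of_nonneg (fun u hu => ?_) fun _ _ _ => multiBd_nonneg _ _ _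
    obtain ⟨m, hm, rfl⟩ := mem_image.1 hu
    rw [mem_Ico] at hm
    exact mem_Icc.2 ⟨Nat.one_le_pow _ _ (by omega), Nat.pow_le_pow_left (by omega) _⟩
  have h2 : (∑ m ∈ Ico M (2 * M), W m) ^ K ≤ (pl C L * (M * X / η)) ^ K := by
    calc (∑ m ∈ Ico M (2 * M), W m) ^ K ≤ M ^ K' * ∑ m ∈ Ico M (2 * M), W m ^ K := by
          rw [hK']
          have := pow_sum_le_card_mul_sum_pow (s := Ico M (2 * M)) (f := W)
            (fun _ _ => norm_nonneg _) K'
          rw [Nat.card_Ico, show 2 * M - M = M by omega] at this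
          exact this
      _ ≤ M ^ K' * (3 / 2 * (2 * X) ^ K / (2 * X) ^ (j + 1) *
          (pl C₀ L * ((2 * 2 ^ (j + 1) + 2) * (M * X ^ (j + 1) / H)))) := by
          refine mul_le_mul_of_nonneg_left (hWle.trans ?_) (by positivity)
          exact mul_le_mul_of_nonneg_left hTle (by positivity)
      _ = (c * pl C₀ L) * (M * X / η) ^ K := by
          rw [hc, hH, div_pow, mul_pow, mul_pow, mul_pow, hK', pow_succ (M : ℝ) K']
          field_simp
      _ ≤ pl C L ^ K * (M * X / η) ^ K := by
          refine mul_le_mul_of_nonneg_right ?_ (by positivity)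
          have := hC L hL
          have h3 : pl C L ≤ pl C L ^ K := le_self_pow₀ (one_le_pl C hL) hK0
          linarith
      _ = _ := by rw [← mul_pow]
  exact le_of_pow_le_pow_left₀ hK0 (mul_nonneg (pl_nonneg _ hL) (by positivity)) h2

open ArithmeticFunction in
/-- Vaughan's identity, as an identity between arithmetic functions. -/
theorem vonMangoldt_decomposition {Λ₁ Λ₂ μ₁ μ₂ : ArithmeticFunction ℝ}
    (h1 : Λ₁ + Λ₂ = vonMangoldt) (h2 : μ₁ + μ₂ = ((moebius : ArithmeticFunction ℤ) :
      ArithmeticFunction ℝ)) :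
    (vonMangoldt : ArithmeticFunction ℝ) = Λ₁ + μ₁ * ArithmeticFunction.log -
      (Λ₁ * μ₁) * (zeta : ArithmeticFunction ℝ) + (μ₂ * (zeta : ArithmeticFunction ℝ)) * Λ₂ := by
  have h3 : (vonMangoldt : ArithmeticFunction ℝ) * (zeta : ArithmeticFunction ℝ) =
    ArithmeticFunction.log := vonMangoldt_mul_zeta
  have h4 : ((moebius : ArithmeticFunction ℤ) : ArithmeticFunction ℝ) *
    (zeta : ArithmeticFunction ℝ) = 1 := coe_moebius_mul_coe_zeta
  rw [← h3, ← h1]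
  rw [← h2] at h4
  linear_combination (-Λ₂) * h4

/-- The part of an arithmetic function supported on `n ≤ U`. -/
noncomputable def truncLe (U : ℕ) (f : ArithmeticFunction ℝ) : ArithmeticFunction ℝ :=
  ⟨fun n => if n ≤ U then f n else 0, by simp⟩

/-- The part of an arithmetic function supported on `n > U`. -/
noncomputable def truncGt (U : ℕ) (f : ArithmeticFunction ℝ) : ArithmeticFunction ℝ :=
  ⟨fun n => if n ≤ U then 0 else f n, by simp⟩

theorem truncLe_apply (U : ℕ) (f : ArithmeticFunction ℝ) (n : ℕ) :
    truncLe U f n = if n ≤ U then f n else 0 := rfl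

theorem truncGt_apply (U : ℕ) (f : ArithmeticFunction ℝ) (n : ℕ) :
    truncGt U f n = if n ≤ U then 0 else f n := rfl

theorem truncLe_add_truncGt (U : ℕ) (f : ArithmeticFunction ℝ) :
    truncLe U f + truncGt U f = f := by
  ext n
  rw [ArithmeticFunction.add_apply, truncLe_apply, truncGt_apply]
  split_ifs <;> simp

theorem sum_mul_apply_Icc (N : ℕ) (f g : ArithmeticFunction ℝ) (F : ℕ → ℂ) :
    ∑ n ∈ Icc 1 N, ((f * g) n : ℂ) * F n =
      ∑ m ∈ Icc 1 N, ∑ l ∈ Icc 1 (N / m), (f m : ℂ) * (g l : ℂ) * F (m * l) := by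
  rw [← sum_divisorsAntidiagonal_Icc N fun p => (f p.1 : ℂ) * (g p.2 : ℂ) * F (p.1 * p.2)]
  refine sum_congr rfl fun n _ => ?_
  rw [ArithmeticFunction.mul_apply]
  push_cast
  rw [sum_mul]
  refine sum_congr rfl fun p hp => ?_
  rw [(Nat.mem_divisorsAntidiagonal.1 hp).1]

theorem norm_sum_dyadic_le (N : ℕ) (A : ℕ → ℂ) (hA : ∀ m, N < m → A m = 0) {B : ℝ}
    (hB : ∀ i, ‖∑ m ∈ Ico (2 ^ i) (2 * 2 ^ i), A m‖ ≤ B) :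
    ‖∑ m ∈ Icc 1 N, A m‖ ≤ 2 * lg N * B := by
  have hB0 : 0 ≤ B := (norm_nonneg _).trans (hB 0)
  have h1 : ∀ n : ℕ, ‖∑ m ∈ Ico 1 (2 ^ n), A m‖ ≤ n * B := by
    intro n
    induction n with
    | zero => simp
    | succ n ih =>
      rw [← sum_Ico_consecutive A (Nat.one_le_two_pow (n := n))
        (Nat.pow_le_pow_right (by norm_num) (Nat.le_succ n))]
      have := hB n
      rw [← pow_succ'] at this
      refine (norm_add_le _ _).trans ?_
      push_cast
      linarith
  have h2 : ∑ m ∈ Icc 1 N, A m = ∑ m ∈ Ico 1 (2 ^ (Nat.log 2 N + 1)), A m := by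
    refine sum_subset (fun m hm => ?_) fun m hm hm' => hA m ?_
    · rw [mem_Icc] at hm
      exact mem_Ico.2 ⟨hm.1, lt_of_le_of_lt hm.2 (Nat.lt_pow_succ_log_self (by norm_num) N)⟩
    · by_contra h
      exact hm' (mem_Icc.2 ⟨(mem_Ico.1 hm).1, by omega⟩)
  rw [h2]
  refine (h1 _).trans (mul_le_mul_of_nonneg_right ?_ hB0)
  have h3 : (Nat.log 2 N : ℝ) ≤ 2 * Real.log N := by
    rcases Nat.eq_zero_or_pos N with rfl | hN
    · simp
    have h4 : ((2 ^ Nat.log 2 N : ℕ) : ℝ) ≤ N := by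
      exact_mod_cast Nat.pow_log_le_self 2 hN.ne'
    have h5 := Real.log_le_log (by positivity) h4
    push_cast at h5
    rw [Real.log_pow] at h5
    have h6 := Real.log_two_gt_d9
    have h7 : (0:ℝ) ≤ Nat.log 2 N := by positivity
    nlinarith
  rw [lg]
  push_cast
  linarith

theorem norm_typeII_sum_le {N U : ℕ} {F : ℕ → ℂ} {B : ℝ} (hB0 : 0 ≤ B)
    (hII : ∀ M : ℕ, U < 2 * M → M * (U + 1) ≤ N → ∀ a b : ℕ → ℂ,
      (∀ m, 1 ≤ m → ‖a m‖ ≤ tau m) → (∀ n, 1 ≤ n → ‖b n‖ ≤ tau n) →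
      ‖∑ m ∈ Ico M (2 * M), ∑ n ∈ Icc 1 (N / m), a m * b n * F (m * n)‖ ≤ B)
    {a b : ℕ → ℂ} (ha : ∀ m, 1 ≤ m → ‖a m‖ ≤ tau m) (hb : ∀ n, 1 ≤ n → ‖b n‖ ≤ tau n)
    (ha0 : ∀ m, m ≤ U → a m = 0)
    (hab : ∀ m n, N < m * (U + 1) → n ≤ N / m → a m * b n = 0) :
    ‖∑ m ∈ Icc 1 N, ∑ n ∈ Icc 1 (N / m), a m * b n * F (m * n)‖ ≤ 2 * lg N * B := by
  refine norm_sum_dyadic_le N _ (fun m hm => ?_) fun i => ?_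
  · rw [Nat.div_eq_of_lt hm]; simp
  · by_cases h1 : U < 2 * 2 ^ i
    · by_cases h2 : 2 ^ i * (U + 1) ≤ N
      · exact hII _ h1 h2 a b ha hb
      · rw [sum_eq_zero, norm_zero]
        · exact hB0
        intro m hm
        refine sum_eq_zero fun n hn => ?_
        rw [hab m n ((not_le.1 h2).trans_le (Nat.mul_le_mul_right _ (mem_Ico.1 hm).1))
          (mem_Icc.1 hn).2, zero_mul]
    · rw [sum_eq_zero, norm_zero]
      · exact hB0
      intro m hm
      refine sum_eq_zero fun n _ => ?_
      rw [ha0 m (by have := (mem_Ico.1 hm).2; omega), zero_mul, zero_mul]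

theorem norm_typeI_log_sum_le {N U : ℕ} {F : ℕ → ℂ} {B : ℝ}
    (hI : ∀ t : ℕ → ℕ, ∑ m ∈ Icc 1 U, ‖∑ n ∈ Icc 1 (min (t m) (N / m)), F (m * n)‖ ≤ B)
    {a : ℕ → ℂ} (ha : ∀ m, ‖a m‖ ≤ 1) (ha0 : ∀ m, U < m → a m = 0) (hN : 1 ≤ N) :
    ‖∑ m ∈ Icc 1 N, ∑ n ∈ Icc 1 (N / m), a m * (Real.log n : ℂ) * F (m * n)‖ ≤
      2 * lg N * B := by
  have hB0 : 0 ≤ B := le_trans (sum_nonneg fun _ _ => norm_nonneg _) (hI id)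
  set δ : ℕ → ℝ := fun l => Real.log (l + 1 : ℕ) - Real.log l with hδ
  have hδ0 : ∀ l ∈ Ico 1 N, 0 ≤ δ l := by
    intro l hl
    have h1 := (mem_Ico.1 hl).1
    exact sub_nonneg.2 (Real.log_le_log (by exact_mod_cast h1) (by exact_mod_cast Nat.le_succ l))
  have hsum : ∀ n, 1 ≤ n → ∑ l ∈ Ico 1 n, δ l = Real.log n := by
    intro n hn
    rw [hδ, sum_Ico_sub (fun l : ℕ => Real.log l) hn]
    simp
  have h1 : ∀ m ∈ Icc 1 N, ∑ n ∈ Icc 1 (N / m), a m * (Real.log n : ℂ) * F (m * n) =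
      a m * ∑ l ∈ Ico 1 N, (δ l : ℂ) * (∑ n ∈ Icc 1 (N / m), F (m * n) -
        ∑ n ∈ Icc 1 (min l (N / m)), F (m * n)) := by
    intro m hm
    have h2 : ∀ l, ∑ n ∈ Icc 1 (N / m), F (m * n) - ∑ n ∈ Icc 1 (min l (N / m)), F (m * n) =
        ∑ n ∈ Icc 1 (N / m), if l < n then F (m * n) else 0 := by
      intro l
      rw [sub_eq_iff_eq_add, ← sum_filter, ← sum_filter_add_sum_filter_not (Icc 1 (N / m))
        (fun n => l < n)]
      congr 2
      ext n
      simp only [mem_filter, mem_Icc]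
      omega
    simp only [h2, mul_sum, mul_ite, mul_zero]
    rw [sum_comm]
    refine sum_congr rfl fun n hn => ?_
    rw [mem_Icc] at hn
    have hnN : n ≤ N := hn.2.trans (Nat.div_le_self _ _)
    rw [← hsum n hn.1, ← sum_filter]
    have e : (Ico 1 N).filter (fun l => l < n) = Ico 1 n := by
      ext l; simp only [mem_filter, mem_Ico]; omega
    rw [e]
    push_cast
    rw [mul_sum, sum_mul]
    exact sum_congr rfl fun l _ => by ring
  rw [sum_congr rfl h1]
  have h3 : ∑ m ∈ Icc 1 N, a m * ∑ l ∈ Ico 1 N, (δ l : ℂ) * (∑ n ∈ Icc 1 (N / m), F (m * n) -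
        ∑ n ∈ Icc 1 (min l (N / m)), F (m * n)) =
      ∑ l ∈ Ico 1 N, (δ l : ℂ) * ∑ m ∈ Icc 1 N, a m * (∑ n ∈ Icc 1 (N / m), F (m * n) -
        ∑ n ∈ Icc 1 (min l (N / m)), F (m * n)) := by
    simp only [mul_sum]
    rw [sum_comm]
    exact sum_congr rfl fun l _ => sum_congr rfl fun m _ => by ring
  rw [h3]
  have h4 : ∀ l ∈ Ico 1 N, ‖(δ l : ℂ) * ∑ m ∈ Icc 1 N, a m * (∑ n ∈ Icc 1 (N / m), F (m * n) -
        ∑ n ∈ Icc 1 (min l (N / m)), F (m * n))‖ ≤ δ l * (2 * B) := by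
    intro l hl
    rw [norm_mul, Complex.norm_real, Real.norm_of_nonneg (hδ0 l hl)]
    refine mul_le_mul_of_nonneg_left ?_ (hδ0 l hl)
    have e : ∑ m ∈ Icc 1 N, a m * (∑ n ∈ Icc 1 (N / m), F (m * n) -
        ∑ n ∈ Icc 1 (min l (N / m)), F (m * n)) = ∑ m ∈ (Icc 1 N).filter (fun m => m ≤ U),
        a m * (∑ n ∈ Icc 1 (N / m), F (m * n) - ∑ n ∈ Icc 1 (min l (N / m)), F (m * n)) := by
      refine (sum_filter_of_ne fun m _ hm => ?_).symm
      by_contra h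
      exact hm (by rw [ha0 m (not_le.1 h), zero_mul])
    rw [e]
    have hI1 := hI fun m => N / m
    have hI2 := hI fun _ => l
    simp only [min_self] at hI1
    calc _ ≤ ∑ m ∈ (Icc 1 N).filter (fun m => m ≤ U), (‖∑ n ∈ Icc 1 (N / m), F (m * n)‖ +
          ‖∑ n ∈ Icc 1 (min l (N / m)), F (m * n)‖) := by
          refine (norm_sum_le _ _).trans (sum_le_sum fun m _ => ?_)
          rw [norm_mul]
          calc _ ≤ 1 * (‖∑ n ∈ Icc 1 (N / m), F (m * n)‖ +
                ‖∑ n ∈ Icc 1 (min l (N / m)), F (m * n)‖) :=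
                mul_le_mul (ha m) (norm_sub_le _ _) (norm_nonneg _) zero_le_one
            _ = _ := one_mul _
      _ ≤ ∑ m ∈ Icc 1 U, (‖∑ n ∈ Icc 1 (N / m), F (m * n)‖ +
          ‖∑ n ∈ Icc 1 (min l (N / m)), F (m * n)‖) := by
          refine sum_le_sum_of_subset_of_nonneg (fun m hm => ?_) fun _ _ _ => by positivity
          simp only [mem_filter, mem_Icc] at hm ⊢
          omega
      _ ≤ _ := by rw [sum_add_distrib]; linarith
  refine (norm_sum_le _ _).trans ((sum_le_sum h4).trans ?_)
  rw [← sum_mul, hsum N hN, lg]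
  nlinarith

open ArithmeticFunction in
theorem norm_sum_vonMangoldt_le {N U : ℕ} {F : ℕ → ℂ} {B₁ B₂ : ℝ} (hF : ∀ n, ‖F n‖ ≤ 1)
    (hB₂ : 0 ≤ B₂) (hU : 1 ≤ U) (hUN : U ^ 2 * (U + 1) ≤ N)
    (hI : ∀ t : ℕ → ℕ, ∑ m ∈ Icc 1 U, ‖∑ n ∈ Icc 1 (min (t m) (N / m)), F (m * n)‖ ≤ B₁)
    (hII : ∀ M : ℕ, U < 2 * M → M * (U + 1) ≤ N → ∀ a b : ℕ → ℂ,
      (∀ m, 1 ≤ m → ‖a m‖ ≤ tau m) → (∀ n, 1 ≤ n → ‖b n‖ ≤ tau n) →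
      ‖∑ m ∈ Ico M (2 * M), ∑ n ∈ Icc 1 (N / m), a m * b n * F (m * n)‖ ≤ B₂) :
    ‖∑ n ∈ Icc 1 N, (vonMangoldt n : ℂ) * F n‖ ≤
      lg N * U + 3 * lg N * B₁ + 4 * lg N ^ 2 * B₂ := by
  have hN : 1 ≤ N := by nlinarith [Nat.one_le_pow 2 U hU]
  have hUN' : U ≤ N := by nlinarith [Nat.le_self_pow two_ne_zero U]
  have hL : 1 ≤ lg N := one_le_lg N
  have hL0 : lg N ≠ 0 := (lg_pos N).ne'
  have hlog : ∀ n, n ≤ N → Real.log n ≤ lg N := by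
    intro n hn
    have := lg_mono hn
    simp only [lg] at this ⊢
    linarith
  have hΛ : ∀ n, n ≤ N → vonMangoldt n ≤ lg N := fun n hn => vonMangoldt_le_log.trans (hlog n hn)
  have hμ : ∀ n, |((moebius : ArithmeticFunction ℤ) : ArithmeticFunction ℝ) n| ≤ 1 := by
    intro n
    rw [intCoe_apply]
    exact_mod_cast abs_moebius_le_one
  set Λ₁ := truncLe U vonMangoldt with hΛ₁
  set Λ₂ := truncGt U vonMangoldt with hΛ₂
  set μ₁ := truncLe U ((moebius : ArithmeticFunction ℤ) : ArithmeticFunction ℝ) with hμ₁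
  set μ₂ := truncGt U ((moebius : ArithmeticFunction ℤ) : ArithmeticFunction ℝ) with hμ₂
  have hμ₁le : ∀ n, |μ₁ n| ≤ 1 := by
    intro n
    rw [hμ₁, truncLe_apply]
    split_ifs
    · exact hμ n
    · simp
  have hμ₂le : ∀ n, |μ₂ n| ≤ 1 := by
    intro n
    rw [hμ₂, truncGt_apply]
    split_ifs
    · simp
    · exact hμ n
  have hΛ₁0 : ∀ n, 0 ≤ Λ₁ n := by
    intro n
    rw [hΛ₁, truncLe_apply]
    split_ifs
    · exact vonMangoldt_nonneg
    · exact le_rfl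
  have hΛ₁le : ∀ n, Λ₁ n ≤ vonMangoldt n := by
    intro n
    rw [hΛ₁, truncLe_apply]
    split_ifs
    · exact le_rfl
    · exact vonMangoldt_nonneg
  have key := vonMangoldt_decomposition (truncLe_add_truncGt U vonMangoldt)
    (truncLe_add_truncGt U ((moebius : ArithmeticFunction ℤ) : ArithmeticFunction ℝ))
  rw [← hΛ₁, ← hΛ₂, ← hμ₁, ← hμ₂] at key
  set c := Λ₁ * μ₁ with hc
  set d := μ₂ * (zeta : ArithmeticFunction ℝ) with hd
  have e1 : ∑ n ∈ Icc 1 N, (vonMangoldt n : ℂ) * F n = ∑ n ∈ Icc 1 N, (Λ₁ n : ℂ) * F n +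
      ∑ n ∈ Icc 1 N, ((μ₁ * ArithmeticFunction.log) n : ℂ) * F n -
      ∑ n ∈ Icc 1 N, ((c * (zeta : ArithmeticFunction ℝ)) n : ℂ) * F n +
      ∑ n ∈ Icc 1 N, ((d * Λ₂) n : ℂ) * F n := by
    rw [← sum_add_distrib, ← sum_sub_distrib, ← sum_add_distrib]
    refine sum_congr rfl fun n _ => ?_
    rw [key]
    have hsub : ∀ f g : ArithmeticFunction ℝ, (f - g) n = f n - g n := by
      intro f g
      have h := DFunLike.congr_fun (sub_add_cancel f g) n
      rw [ArithmeticFunction.add_apply] at h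
      linarith
    rw [ArithmeticFunction.add_apply, hsub, ArithmeticFunction.add_apply]
    push_cast
    ring
  -- the four pieces
  have p1 : ‖∑ n ∈ Icc 1 N, (Λ₁ n : ℂ) * F n‖ ≤ lg N * U := by
    rw [← sum_subset (Icc_subset_Icc_right hUN') fun n hn hn' => by
      have : ¬ n ≤ U := fun h => hn' (mem_Icc.2 ⟨(mem_Icc.1 hn).1, h⟩)
      rw [hΛ₁, truncLe_apply, if_neg this, Complex.ofReal_zero, zero_mul]]
    calc _ ≤ ∑ n ∈ Icc 1 U, lg N := by
          refine (norm_sum_le _ _).trans (sum_le_sum fun n hn => ?_)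
          rw [norm_mul, Complex.norm_real, Real.norm_of_nonneg (hΛ₁0 n)]
          calc _ ≤ lg N * 1 := mul_le_mul ((hΛ₁le n).trans (hΛ n ((mem_Icc.1 hn).2.trans hUN')))
                (hF n) (norm_nonneg _) (by linarith)
            _ = _ := mul_one _
      _ = _ := by simp [mul_comm]
  have p2 : ‖∑ n ∈ Icc 1 N, ((μ₁ * ArithmeticFunction.log) n : ℂ) * F n‖ ≤ 2 * lg N * B₁ := by
    rw [sum_mul_apply_Icc]
    refine norm_typeI_log_sum_le (a := fun m => (μ₁ m : ℂ)) hI (fun m => ?_) (fun m hm => ?_) hN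
    · rw [Complex.norm_real]; exact hμ₁le m
    · simp only [hμ₁, truncLe_apply, if_neg (not_le.2 hm), Complex.ofReal_zero]
  have hcle : ∀ m, m ≤ N → |c m| ≤ lg N := by
    intro m hm
    rw [hc, mul_apply]
    calc _ ≤ ∑ p ∈ m.divisorsAntidiagonal, vonMangoldt p.1 := by
          refine (abs_sum_le_sum_abs _ _).trans (sum_le_sum fun p _ => ?_)
          rw [abs_mul, abs_of_nonneg (hΛ₁0 _)]
          calc _ ≤ vonMangoldt p.1 * 1 := mul_le_mul (hΛ₁le _) (hμ₁le _) (abs_nonneg _)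
                vonMangoldt_nonneg
            _ = _ := mul_one _
      _ = Real.log m := by
          rw [Nat.sum_divisorsAntidiagonal (fun i _ => vonMangoldt i), vonMangoldt_sum]
      _ ≤ _ := hlog m hm
  have hc0 : ∀ m, U ^ 2 < m → c m = 0 := by
    intro m hm
    rw [hc, mul_apply]
    refine sum_eq_zero fun p hp => ?_
    have hp' := (Nat.mem_divisorsAntidiagonal.1 hp).1
    rw [hΛ₁, hμ₁, truncLe_apply, truncLe_apply]
    by_cases h1 : p.1 ≤ U
    · by_cases h2 : p.2 ≤ U
      · exfalso
        have := Nat.mul_le_mul h1 h2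
        rw [hp'] at this
        nlinarith
      · rw [if_neg h2, mul_zero]
    · rw [if_neg h1, zero_mul]
  have hcz : ∀ m ∈ Icc 1 N, ∑ l ∈ Icc 1 (N / m), (c m : ℂ) *
      (((zeta : ArithmeticFunction ℝ) l : ℝ) : ℂ) * F (m * l) =
      (c m : ℂ) * ∑ l ∈ Icc 1 (N / m), F (m * l) := by
    intro m _
    rw [mul_sum]
    refine sum_congr rfl fun l hl => ?_
    have : l ≠ 0 := by have := (mem_Icc.1 hl).1; omega
    rw [natCoe_apply, zeta_apply, if_neg this]
    simp
  have p3 : ‖∑ n ∈ Icc 1 N, ((c * (zeta : ArithmeticFunction ℝ)) n : ℂ) * F n‖ ≤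
      lg N * B₁ + 2 * lg N ^ 2 * B₂ := by
    rw [sum_mul_apply_Icc, sum_congr rfl hcz,
      ← sum_filter_add_sum_filter_not (Icc 1 N) (fun m => m ≤ U)]
    refine (norm_add_le _ _).trans (add_le_add ?_ ?_)
    · have e : (Icc 1 N).filter (fun m => m ≤ U) = Icc 1 U := by
        ext m; simp only [mem_filter, mem_Icc]; omega
      rw [e]
      have hI1 := hI fun m => N / m
      simp only [min_self] at hI1
      calc _ ≤ ∑ m ∈ Icc 1 U, lg N * ‖∑ l ∈ Icc 1 (N / m), F (m * l)‖ := by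
            refine (norm_sum_le _ _).trans (sum_le_sum fun m hm => ?_)
            rw [norm_mul, Complex.norm_real]
            exact mul_le_mul_of_nonneg_right (hcle m ((mem_Icc.1 hm).2.trans hUN'))
              (norm_nonneg _)
        _ ≤ _ := by
          rw [← mul_sum]
          exact mul_le_mul_of_nonneg_left hI1 (by linarith)
    · set a : ℕ → ℂ := fun m => if m ≤ U ∨ N < m then 0 else (c m / lg N : ℝ) with ha
      have e : ∑ m ∈ (Icc 1 N).filter (fun m => ¬ m ≤ U), (c m : ℂ) *
          ∑ l ∈ Icc 1 (N / m), F (m * l) = lg N * ∑ m ∈ Icc 1 N, ∑ n ∈ Icc 1 (N / m),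
            a m * (fun _ => (1 : ℂ)) n * F (m * n) := by
        rw [sum_filter, mul_sum]
        refine sum_congr rfl fun m hm => ?_
        have hmN := (mem_Icc.1 hm).2
        by_cases h : m ≤ U
        · simp [ha, h]
        · have h2 : ¬ (m ≤ U ∨ N < m) := by omega
          have h3 : a m = ((c m / lg N : ℝ) : ℂ) := if_neg h2
          rw [h3, if_pos h]
          simp only [mul_one]
          rw [← mul_sum, ← mul_assoc]
          congr 1
          rw [← Complex.ofReal_mul, mul_div_cancel₀ _ hL0]
      rw [e, norm_mul, Complex.norm_real, Real.norm_of_nonneg (by linarith)]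
      calc _ ≤ lg N * (2 * lg N * B₂) := by
            refine mul_le_mul_of_nonneg_left ?_ (by linarith)
            refine norm_typeII_sum_le hB₂ hII (fun m hm => ?_) (fun n hn => ?_) (fun m hm => ?_)
              (fun m n hm _ => ?_)
            · simp only [ha]
              split_ifs with h
              · simpa using tau_nonneg m
              · rw [Complex.norm_real, Real.norm_eq_abs, abs_div, abs_of_pos (lg_pos N)]
                push Not at h
                exact (div_le_one_of_le₀ (hcle m h.2) (by linarith)).trans
                  (one_le_tau (by omega))
            · simpa using one_le_tau (by omega : n ≠ 0)
            · simp [ha, hm]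
            · have : U ^ 2 < m := by
                by_contra h
                have := Nat.mul_le_mul_right (U + 1) (not_lt.1 h)
                omega
              simp [ha, hc0 m this]
        _ = _ := by ring
  have hdle : ∀ m, |d m| ≤ tau m := by
    intro m
    rw [hd, coe_mul_zeta_apply, tau]
    calc _ ≤ ∑ i ∈ m.divisors, (1:ℝ) :=
          (abs_sum_le_sum_abs _ _).trans (sum_le_sum fun i _ => hμ₂le i)
      _ = _ := by simp
  have hd0 : ∀ m, m ≤ U → d m = 0 := by
    intro m hm
    rw [hd, coe_mul_zeta_apply]
    refine sum_eq_zero fun i hi => ?_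
    have h1 : i ≤ m := Nat.divisor_le hi
    rw [hμ₂, truncGt_apply, if_pos (h1.trans hm)]
  have p4 : ‖∑ n ∈ Icc 1 N, ((d * Λ₂) n : ℂ) * F n‖ ≤ 2 * lg N ^ 2 * B₂ := by
    rw [sum_mul_apply_Icc]
    set b : ℕ → ℂ := fun n => if n ≤ N then (Λ₂ n / lg N : ℝ) else 0 with hb
    have e : ∑ m ∈ Icc 1 N, ∑ l ∈ Icc 1 (N / m), (d m : ℂ) * (Λ₂ l : ℂ) * F (m * l) =
        lg N * ∑ m ∈ Icc 1 N, ∑ n ∈ Icc 1 (N / m), (fun m => (d m : ℂ)) m * b n * F (m * n) := by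
      rw [mul_sum]
      refine sum_congr rfl fun m _ => ?_
      rw [mul_sum]
      refine sum_congr rfl fun n hn => ?_
      have : n ≤ N := (mem_Icc.1 hn).2.trans (Nat.div_le_self _ _)
      simp only [hb, this, if_true]
      have h2 : (lg N : ℂ) ≠ 0 := by exact_mod_cast hL0
      push_cast
      field_simp
    rw [e, norm_mul, Complex.norm_real, Real.norm_of_nonneg (by linarith)]
    calc _ ≤ lg N * (2 * lg N * B₂) := by
          refine mul_le_mul_of_nonneg_left ?_ (by linarith)
          refine norm_typeII_sum_le hB₂ hII (fun m _ => ?_) (fun n hn => ?_) (fun m hm => ?_)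
            (fun m n hm hn => ?_)
          · rw [Complex.norm_real]; exact hdle m
          · simp only [hb]
            split_ifs with h
            · rw [Complex.norm_real, Real.norm_eq_abs, abs_div, abs_of_pos (lg_pos N)]
              refine (div_le_one_of_le₀ ?_ (by linarith)).trans (one_le_tau (by omega))
              rw [hΛ₂, truncGt_apply]
              split_ifs
              · simp; linarith
              · rw [abs_of_nonneg vonMangoldt_nonneg]
                exact hΛ n h
            · simpa using tau_nonneg n
          · simp [hd0 m hm]
          · have hm0 : 0 < m := by
              rcases Nat.eq_zero_or_pos m with rfl | h
              · omega
              · exact h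
            have : n ≤ U := by
              have h1 := Nat.mul_le_of_le_div _ _ _ hn
              by_contra h
              have h2 : m * (U + 1) ≤ m * n := Nat.mul_le_mul_left m (by omega)
              nlinarith
            simp only [hb]
            rw [hΛ₂, truncGt_apply, if_pos this]
            simp
      _ = _ := by ring
  rw [e1]
  calc _ ≤ ‖∑ n ∈ Icc 1 N, (Λ₁ n : ℂ) * F n‖ +
        ‖∑ n ∈ Icc 1 N, ((μ₁ * ArithmeticFunction.log) n : ℂ) * F n‖ +
        ‖∑ n ∈ Icc 1 N, ((c * (zeta : ArithmeticFunction ℝ)) n : ℂ) * F n‖ +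
        ‖∑ n ∈ Icc 1 N, ((d * Λ₂) n : ℂ) * F n‖ :=
      (norm_add_le _ _).trans (add_le_add_left ((norm_sub_le _ _).trans
        (add_le_add_left (norm_add_le _ _) _)) _)
    _ ≤ _ := by linarith

open Filter in
theorem eventually_le_rpow {ε : ℝ} (hε : 0 < ε) (c : ℝ) : ∀ᶠ N : ℕ in atTop, c ≤ (N : ℝ) ^ ε :=
  ((tendsto_rpow_atTop hε).comp tendsto_natCast_atTop_atTop).eventually_ge_atTop c

open Filter in
theorem eventually_mul_lg_pow_le (c : ℝ) (n : ℕ) {ε : ℝ} (hε : 0 < ε) :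
    ∀ᶠ N : ℕ in atTop, c * lg N ^ n ≤ (N : ℝ) ^ ε := by
  have h1 := ((isLittleO_log_rpow_rpow_atTop (n : ℝ) hε).comp_tendsto
    tendsto_natCast_atTop_atTop).def (c := (1 / (2 ^ n * (|c| + 1)))) (by positivity)
  filter_upwards [h1, eventually_ge_atTop 3] with N hN h3
  have h3' : (3 : ℝ) ≤ N := by exact_mod_cast h3
  have hlog : 1 ≤ Real.log N := by
    rw [Real.le_log_iff_exp_le (by linarith)]
    linarith [Real.exp_one_lt_d9]
  simp only [Function.comp, Real.rpow_natCast, norm_pow] at hN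
  rw [Real.norm_of_nonneg (by linarith), Real.norm_of_nonneg (by positivity),
    div_mul_eq_mul_div, one_mul, le_div_iff₀ (by positivity)] at hN
  have h4 : lg N ≤ 2 * Real.log N := by rw [lg]; linarith
  have h5 : lg N ^ n ≤ 2 ^ n * Real.log N ^ n := by
    rw [← mul_pow]
    exact pow_le_pow_left₀ (lg_pos N).le h4 n
  have h6 : 0 ≤ lg N ^ n := pow_nonneg (lg_pos N).le n
  calc c * lg N ^ n ≤ (|c| + 1) * (2 ^ n * Real.log N ^ n) :=
        mul_le_mul (by linarith [le_abs_self c]) h5 h6 (by positivity)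
    _ = Real.log N ^ n * (2 ^ n * (|c| + 1)) := by ring
    _ ≤ _ := hN

open Filter in
theorem eventually_tau_pow_le (K : ℕ) {δ : ℝ} (hδ : 0 < δ) :
    ∀ᶠ N : ℕ in atTop, ∀ n, 1 ≤ n → n ≤ 2 * N → tau n ^ K ≤ (N : ℝ) ^ δ := by
  obtain ⟨B, hB⟩ := exists_nat_gt (2 / δ)
  have hB0 : (0 : ℝ) < B := lt_trans (by positivity) hB
  have hB1 : B ≠ 0 := by rintro rfl; simp at hB0
  filter_upwards [eventually_mul_lg_pow_le (2 * 2 ^ 2 ^ (K * B)) (2 ^ (K * B)) one_pos,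
    eventually_ge_atTop 1] with N hN h1 n hn hnN
  have h1' : (1 : ℝ) ≤ N := by exact_mod_cast h1
  refine le_of_pow_le_pow_left₀ hB1 (by positivity) ?_
  rw [← pow_mul]
  calc tau n ^ (K * B) ≤ n * lg n ^ 2 ^ (K * B) := tau_pow_le _ hn
    _ ≤ (2 * N : ℕ) * (2 * lg N) ^ 2 ^ (K * B) := by
        refine mul_le_mul (by exact_mod_cast hnN) (pow_le_pow_left₀ (lg_pos n).le ?_ _)
          (pow_nonneg (lg_pos n).le _) (by positivity)
        exact (lg_mono hnN).trans (lg_two_mul_le N)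
    _ = N * (2 * 2 ^ 2 ^ (K * B) * lg N ^ 2 ^ (K * B)) := by push_cast; rw [mul_pow]; ring
    _ ≤ N * (N : ℝ) ^ (1 : ℝ) := mul_le_mul_of_nonneg_left hN (by linarith)
    _ = (N : ℝ) ^ (2 : ℝ) := by rw [Real.rpow_one, Real.rpow_two]; ring
    _ ≤ (N : ℝ) ^ (δ * B) := by
        refine Real.rpow_le_rpow_of_exponent_le h1' ?_
        rw [div_lt_iff₀ hδ] at hB
        linarith
    _ = _ := by rw [Real.rpow_mul (by linarith), Real.rpow_natCast]

set_option maxHeartbeats 1000000 in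
open Filter in
theorem exists_minor_arc_parameters (j : ℕ) (hj : 1 ≤ j) {ω : ℝ} (hω : 0 < ω) (hω' : ω ≤ 1 / 8) :
    ∃ s : ℕ, ∀ᶠ N : ℕ in atTop, ∃ D U : ℕ, ∃ η Δ : ℝ,
      1 ≤ D ∧ D ≤ U ∧ (D : ℝ) ≤ (N : ℝ) ^ ω ∧ N ^ (2 * j + 2) ≤ D ^ s ∧ 1 ≤ η ∧
      (η ^ 2 ^ j) ^ 2 ^ j ≤ (N : ℝ) ^ (1 / 2 : ℝ) / 2 ∧
      1 / η ≤ 2 * (N : ℝ) ^ (-(1 : ℝ) / (2 * (2 ^ j) ^ 2)) ∧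
      U ^ 2 * (U + 1) ≤ N ∧ η ^ 2 ^ j * Δ ^ 2 ^ j ≤ U ∧ (∀ n, 1 ≤ n → n ≤ 2 * N → tau n ≤ Δ) ∧
      η ^ 2 ^ j * D * (U ^ j * 2 ^ (j + 1)) ≤ (N : ℝ) ^ (1 / 2 + ω) ∧
      η ^ 2 ^ j * D * (U ^ (j + 1) * 2) ≤ N ∧ (U : ℝ) * (N : ℝ) ^ (1 / 2 : ℝ) ≤ N := by
  set K : ℝ := 2 ^ j with hK
  have hK2 : 2 ≤ K := by
    rw [hK]
    calc (2 : ℝ) = 2 ^ 1 := by norm_num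
      _ ≤ _ := pow_le_pow_right₀ (by norm_num) hj
  have hjK : (j : ℝ) + 1 ≤ K := by
    have : j + 1 ≤ 2 ^ j := Nat.lt_two_pow_self
    rw [hK]; exact_mod_cast this
  have hj1 : (1 : ℝ) ≤ j := by exact_mod_cast hj
  set δ : ℝ := ω / (4 * (2 * j + 3)) with hδ
  have hδ0 : 0 < δ := by positivity
  have hδω : (2 * j + 3) * δ = ω / 4 := by rw [hδ]; field_simp
  obtain ⟨s, hs⟩ := exists_nat_gt ((2 * j + 2) / δ)
  rw [div_lt_iff₀ hδ0] at hs
  set u : ℝ := 1 / (2 * K) + 2 * δ with hu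
  have hKi : 1 / (2 * K) ≤ 1 / 4 := by
    rw [div_le_div_iff₀ (by positivity) (by norm_num)]; linarith
  have hKj : (j + 1) * (1 / (2 * K)) ≤ 1 / 2 := by
    rw [mul_one_div, div_le_div_iff₀ (by positivity) (by norm_num)]; linarith
  have hKi0 : 0 < 1 / (2 * K) := by positivity
  have h5 : 5 * δ ≤ ω / 4 := by
    rw [← hδω]
    exact mul_le_mul_of_nonneg_right (by linarith) hδ0.le
  have hjδ : 0 < j * δ := by positivity
  refine ⟨s, ?_⟩
  filter_upwards [eventually_tau_pow_le (2 ^ j) hδ0,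
    eventually_le_rpow (show 0 < ω / 2 by positivity) (2 ^ (2 * j + 2)),
    eventually_le_rpow (show (0 : ℝ) < 1 / 8 by positivity) (2 ^ (j + 4)),
    eventually_le_rpow (show 0 < δ by positivity) 1, eventually_ge_atTop 4] with N hN1 hN2 hN3 hN4 h4
  have h1 : (1 : ℝ) ≤ N := by exact_mod_cast (by omega : 1 ≤ N)
  have h0 : (0 : ℝ) < N := by linarith
  have hD1 : (1 : ℝ) ≤ ⌈(N : ℝ) ^ δ⌉₊ := hN4.trans (Nat.le_ceil _)
  have hD2 : (⌈(N : ℝ) ^ δ⌉₊ : ℝ) ≤ 2 * (N : ℝ) ^ δ := by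
    linarith [(Nat.ceil_lt_add_one (by positivity : (0 : ℝ) ≤ (N : ℝ) ^ δ)).le]
  have hNu : 1 ≤ (N : ℝ) ^ u := Real.one_le_rpow h1 (by positivity)
  have hU2 : (⌈(N : ℝ) ^ u⌉₊ : ℝ) ≤ 2 * (N : ℝ) ^ u := by
    linarith [(Nat.ceil_lt_add_one (by positivity : (0 : ℝ) ≤ (N : ℝ) ^ u)).le]
  have hU1 : (N : ℝ) ^ u ≤ ⌈(N : ℝ) ^ u⌉₊ := Nat.le_ceil _
  set D := ⌈(N : ℝ) ^ δ⌉₊ with hD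
  set U := ⌈(N : ℝ) ^ u⌉₊ with hU
  have hsq : (2 : ℝ) ≤ (N : ℝ) ^ (1 / 2 : ℝ) := by
    rw [← Real.sqrt_eq_rpow]
    exact Real.le_sqrt_of_sq_le (by norm_num; exact_mod_cast h4)
  set b : ℝ := (N : ℝ) ^ (1 / 2 : ℝ) / 2 with hb
  have hb1 : 1 ≤ b := by rw [hb]; linarith
  set η : ℝ := b ^ (1 / K ^ 2) with hη
  have hη1 : 1 ≤ η := Real.one_le_rpow hb1 (by positivity)
  have hηK : η ^ 2 ^ j ≤ (N : ℝ) ^ (1 / (2 * K)) := by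
    have : ((2 ^ j : ℕ) : ℝ) = K := by push_cast; rfl
    rw [hη, ← Real.rpow_natCast, ← Real.rpow_mul (by linarith), this]
    calc b ^ (1 / K ^ 2 * K) ≤ ((N : ℝ) ^ (1 / 2 : ℝ)) ^ (1 / K ^ 2 * K) :=
          Real.rpow_le_rpow (by linarith) (by rw [hb]; linarith) (by positivity)
      _ = _ := by
        rw [← Real.rpow_mul h0.le]
        congr 1
        field_simp
  have hηK0 : 0 ≤ η ^ 2 ^ j := by positivity
  have hDU : (N : ℝ) ^ δ ≤ (N : ℝ) ^ u :=
    Real.rpow_le_rpow_of_exponent_le h1 (by rw [hu]; linarith)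
  have hNp : ∀ x y : ℝ, x ≤ y → (N : ℝ) ^ x ≤ (N : ℝ) ^ y := fun x y h =>
    Real.rpow_le_rpow_of_exponent_le h1 h
  refine ⟨D, U, η, (N : ℝ) ^ (δ / K), ?_, Nat.ceil_le_ceil hDU, ?_, ?_, hη1, ?_, ?_, ?_, ?_, ?_,
    ?_, ?_, ?_⟩
  · exact_mod_cast hD1
  · calc (D : ℝ) ≤ 2 * (N : ℝ) ^ δ := hD2
      _ ≤ (N : ℝ) ^ (ω / 2) * (N : ℝ) ^ (ω / 2) := by
        refine mul_le_mul (le_trans ?_ hN2) (hNp _ _ ?_) (by positivity) (by positivity)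
        · calc (2 : ℝ) = 2 ^ 1 := by norm_num
            _ ≤ _ := pow_le_pow_right₀ (by norm_num) (by omega)
        · linarith
      _ = _ := by rw [← Real.rpow_add h0]; congr 1; ring
  · have : ((N ^ (2 * j + 2) : ℕ) : ℝ) ≤ ((D ^ s : ℕ) : ℝ) := by
      push_cast
      calc (N : ℝ) ^ (2 * j + 2) = (N : ℝ) ^ ((2 * j + 2 : ℕ) : ℝ) := by rw [Real.rpow_natCast]
        _ ≤ (N : ℝ) ^ (δ * s) := hNp _ _ (by push_cast; linarith)
        _ = ((N : ℝ) ^ δ) ^ s := by rw [Real.rpow_mul h0.le, Real.rpow_natCast]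
        _ ≤ _ := pow_le_pow_left₀ (by positivity) (Nat.le_ceil _) _
    exact_mod_cast this
  · rw [← pow_mul, hη, ← Real.rpow_natCast, ← Real.rpow_mul (by linarith)]
    have : 1 / K ^ 2 * ((2 ^ j * 2 ^ j : ℕ) : ℝ) = 1 := by
      push_cast
      rw [hK]
      field_simp
    rw [this, Real.rpow_one]
  · rw [hη, hb, Real.div_rpow (by positivity) (by norm_num), one_div_div, ← Real.rpow_mul h0.le,
      div_eq_mul_inv, ← Real.rpow_neg h0.le]
    have e : -(1 / 2 * (1 / K ^ 2)) = -1 / (2 * K ^ 2) := by field_simp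
    rw [e]
    refine mul_le_mul_of_nonneg_right ?_ (by positivity)
    calc (2 : ℝ) ^ (1 / K ^ 2) ≤ 2 ^ (1 : ℝ) := by
          refine Real.rpow_le_rpow_of_exponent_le (by norm_num) ?_
          rw [div_le_one (by positivity)]
          nlinarith
      _ = 2 := Real.rpow_one 2
  · have hU0 : (1 : ℝ) ≤ U := hNu.trans hU1
    have e3 : (N : ℝ) ^ (u * 3) = ((N : ℝ) ^ u) ^ 3 := by
      rw [Real.rpow_mul h0.le]; exact_mod_cast Real.rpow_natCast _ 3
    have : ((U ^ 2 * (U + 1) : ℕ) : ℝ) ≤ N := by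
      push_cast
      calc (U : ℝ) ^ 2 * (U + 1) ≤ U ^ 2 * (2 * U) :=
            mul_le_mul_of_nonneg_left (by linarith) (by positivity)
        _ = 2 * U ^ 3 := by ring
        _ ≤ 2 * (2 * (N : ℝ) ^ u) ^ 3 :=
            mul_le_mul_of_nonneg_left (pow_le_pow_left₀ (by positivity) hU2 _) (by norm_num)
        _ = 16 * (N : ℝ) ^ (u * 3) := by
            rw [mul_pow, e3]; ring
        _ ≤ (N : ℝ) ^ (1 / 8 : ℝ) * (N : ℝ) ^ (7 / 8 : ℝ) := by
            refine mul_le_mul (le_trans ?_ hN3) (hNp _ _ ?_) (by positivity) (by positivity)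
            · calc (16 : ℝ) = 2 ^ 4 := by norm_num
                _ ≤ _ := pow_le_pow_right₀ (by norm_num) (by omega)
            · rw [hu]; linarith
        _ = N := by rw [← Real.rpow_add h0]; norm_num
    exact_mod_cast this
  · calc η ^ 2 ^ j * ((N : ℝ) ^ (δ / K)) ^ 2 ^ j ≤ (N : ℝ) ^ (1 / (2 * K)) * (N : ℝ) ^ δ := by
          refine mul_le_mul hηK (le_of_eq ?_) (by positivity) (by positivity)
          rw [← Real.rpow_natCast, ← Real.rpow_mul h0.le]
          push_cast
          rw [div_mul_cancel₀ _ (by positivity)]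
      _ = (N : ℝ) ^ (1 / (2 * K) + δ) := by rw [← Real.rpow_add h0]
      _ ≤ (N : ℝ) ^ u := hNp _ _ (by rw [hu]; linarith)
      _ ≤ _ := hU1
  · intro n hn hn2
    refine le_of_pow_le_pow_left₀ (n := 2 ^ j) (by positivity) (by positivity) ?_
    refine (hN1 n hn hn2).trans (le_of_eq ?_)
    rw [← Real.rpow_natCast, ← Real.rpow_mul h0.le]
    push_cast
    rw [div_mul_cancel₀ _ (by positivity)]
  · calc η ^ 2 ^ j * D * (U ^ j * 2 ^ (j + 1)) ≤ (N : ℝ) ^ (1 / (2 * K)) * (2 * (N : ℝ) ^ δ) *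
          ((2 * (N : ℝ) ^ u) ^ j * 2 ^ (j + 1)) := by gcongr
      _ = 2 ^ (2 * j + 2) * ((N : ℝ) ^ (1 / (2 * K)) * (N : ℝ) ^ δ * (N : ℝ) ^ (u * j)) := by
          rw [Real.rpow_mul h0.le, Real.rpow_natCast, mul_pow]; ring
      _ = 2 ^ (2 * j + 2) * (N : ℝ) ^ (1 / (2 * K) + δ + u * j) := by
          rw [Real.rpow_add h0, Real.rpow_add h0]
      _ ≤ (N : ℝ) ^ (ω / 2) * (N : ℝ) ^ (1 / 2 + ω / 2) := by
          refine mul_le_mul hN2 (hNp _ _ ?_) (by positivity) (by positivity)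
          rw [hu]; linarith
      _ = _ := by rw [← Real.rpow_add h0]; congr 1; ring
  · calc η ^ 2 ^ j * D * (U ^ (j + 1) * 2) ≤ (N : ℝ) ^ (1 / (2 * K)) * (2 * (N : ℝ) ^ δ) *
          ((2 * (N : ℝ) ^ u) ^ (j + 1) * 2) := by gcongr
      _ = 2 ^ (j + 3) * ((N : ℝ) ^ (1 / (2 * K)) * (N : ℝ) ^ δ * (N : ℝ) ^ (u * (j + 1 : ℕ))) := by
          rw [Real.rpow_mul h0.le, Real.rpow_natCast, mul_pow]; ring
      _ = 2 ^ (j + 3) * (N : ℝ) ^ (1 / (2 * K) + δ + u * (j + 1 : ℕ)) := by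
          rw [Real.rpow_add h0, Real.rpow_add h0]
      _ ≤ (N : ℝ) ^ (1 / 8 : ℝ) * (N : ℝ) ^ (7 / 8 : ℝ) := by
          refine mul_le_mul (le_trans ?_ hN3) (hNp _ _ ?_) (by positivity) (by positivity)
          · exact pow_le_pow_right₀ (by norm_num) (by omega)
          · push_cast
            rw [hu]; linarith
      _ = N := by rw [← Real.rpow_add h0]; norm_num
  · calc (U : ℝ) * (N : ℝ) ^ (1 / 2 : ℝ) ≤ (2 * (N : ℝ) ^ u) * (N : ℝ) ^ (1 / 2 : ℝ) := by gcongr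
      _ ≤ ((N : ℝ) ^ (1 / 8 : ℝ) * (N : ℝ) ^ (3 / 8 : ℝ)) * (N : ℝ) ^ (1 / 2 : ℝ) := by
          refine mul_le_mul_of_nonneg_right (mul_le_mul (le_trans ?_ hN3) (hNp _ _ ?_)
            (by positivity) (by positivity)) (by positivity)
          · calc (2 : ℝ) = 2 ^ 1 := by norm_num
              _ ≤ _ := pow_le_pow_right₀ (by norm_num) (by omega)
          · rw [hu]; linarith
      _ = N := by rw [← Real.rpow_add h0, ← Real.rpow_add h0]; norm_num

theorem sum_Icc_one_natCast {β : Type*} [AddCommMonoid β] (X : ℕ) (g : ℤ → β) :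
    ∑ x ∈ Icc 1 (X : ℤ), g x = ∑ x ∈ (Icc 1 X : Finset ℕ), g x := by
  have : Icc 1 (X : ℤ) = (Icc 1 X).map Nat.castEmbedding := by
    ext x
    simp only [mem_Icc, mem_map, Nat.castEmbedding_apply]
    constructor
    · rintro ⟨h1, h2⟩
      exact ⟨x.toNat, by omega, by omega⟩
    · rintro ⟨y, hy, rfl⟩
      omega
  rw [this, sum_map]
  rfl

theorem sum_Icc_one_filter_natCast {β : Type*} [AddCommMonoid β] (X : ℕ) (p : ℤ → Prop)
    [DecidablePred p] (g : ℤ → β) :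
    ∑ x ∈ (Icc 1 (X : ℤ)).filter p, g x = ∑ x ∈ (Icc 1 X).filter (fun x : ℕ => p x), g x := by
  rw [sum_filter, sum_filter, sum_Icc_one_natCast X]

theorem exists_typeII_weyl_nat (j : ℕ) (hj : 1 ≤ j) (s : ℕ) : ∃ C : ℕ, ∀ (α : ℝ) (a : ℤ) (q : ℕ),
    IsApprox α a q → ∀ D X Y : ℕ, 1 ≤ D → 1 ≤ X → 1 ≤ Y → D ≤ Y →
    (j + 1).factorial * (2 ^ j * ((j + 1) * Y) ^ (j + 1) * X ^ j) ≤ D ^ s → ∀ L : ℝ,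
    lg D ≤ L → lg (2 * q) ≤ L → lg (2 ^ j * ((j + 1) * Y) ^ (j + 1) * X ^ j : ℕ) ≤ L →
    ∀ η : ℝ, 1 ≤ η → (η ^ 2 ^ j) ^ 2 ^ j ≤ X → (η ^ 2 ^ j) ^ 2 ^ j * D ≤ q →
    (η ^ 2 ^ j) ^ 2 ^ j * D * q ≤ ((X : ℝ) * Y) ^ (j + 1) →
    ∀ Δ : ℝ, η ^ 2 ^ j * Δ ^ 2 ^ j ≤ Y → ∀ N' : ℕ,
    ∀ u v : ℕ → ℂ, (∀ x ∈ Icc 1 X, ‖u x‖ ≤ tau x) → (∀ y ∈ Icc 1 Y, ‖v y‖ ≤ tau y) →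
    (∀ y ∈ Icc 1 Y, tau y ≤ Δ) → lg X ≤ L → lg Y ≤ L →
    ‖∑ y ∈ Icc 1 Y, ∑ x ∈ (Icc 1 X).filter (fun x => x * y ≤ N'),
      u x * v y * eAdd (α * ((x : ℝ) * y) ^ (j + 1))‖ ≤
      pl C L * L ^ 2 ^ 2 ^ (j + 1) * (X * Y / η) := by
  obtain ⟨C, hC⟩ := exists_typeII_weyl j hj s
  refine ⟨C, ?_⟩
  intro α a q hq D X Y hD hX hY hDY hDs L hL1 hL2 hL3 η hη e1 e2 e3 Δ e4 N' u v hu hv hΔ hLX hLY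
  have hL : 1 ≤ L := (one_le_lg D).trans hL1
  have hmom : ∀ (Z : ℕ) (w : ℕ → ℂ), (∀ x ∈ Icc 1 Z, ‖w x‖ ≤ tau x) → lg Z ≤ L → ∀ B : ℕ,
      B ≤ 2 ^ (j + 1) → ∑ x ∈ Icc 1 Z, ‖w x‖ ^ B ≤ Z * L ^ 2 ^ 2 ^ (j + 1) := by
    intro Z w hw hZ B hB
    calc _ ≤ ∑ x ∈ Icc 1 Z, tau x ^ B :=
          sum_le_sum fun x hx => pow_le_pow_left₀ (norm_nonneg _) (hw x hx) _
      _ ≤ Z * lg Z ^ 2 ^ B := sum_tau_pow_le B Z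
      _ ≤ _ := by
        refine mul_le_mul_of_nonneg_left ?_ (by positivity)
        refine (pow_le_pow_left₀ (lg_pos Z).le hZ _).trans ?_
        exact pow_le_pow_right₀ hL (Nat.pow_le_pow_right (by norm_num) hB)
  have hΔ0 : 0 ≤ Δ := (tau_nonneg 1).trans (hΔ 1 (mem_Icc.2 ⟨le_rfl, hY⟩))
  have key := hC α a q hq D X Y hD hX hY hDY hDs L hL1 hL2 hL3 η hη e1 e2 e3 Δ e4
    (fun y => (Icc 1 (X : ℤ)).filter (fun x => x * y ≤ N')) (fun y => filter_subset _ _) ?_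
    (fun x => u x.natAbs) (fun y => if y ∈ Icc 1 (Y : ℤ) then v y.natAbs else 0)
    (fun y hy => if_neg hy) ?_ (L ^ 2 ^ 2 ^ (j + 1)) (one_le_pow₀ hL) ?_ ?_
  · refine le_trans (le_of_eq ?_) key
    congr 1
    rw [sum_Icc_one_natCast]
    refine sum_congr rfl fun y hy => ?_
    have hy' : (y : ℤ) ∈ Icc 1 (Y : ℤ) := by
      rw [mem_Icc] at hy ⊢; omega
    rw [sum_Icc_one_filter_natCast, if_pos hy']
    have e : (Icc 1 X).filter (fun x => x * y ≤ N') =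
        (Icc 1 X).filter (fun x : ℕ => (x : ℤ) * (y : ℤ) ≤ N') :=
      filter_congr fun x _ => by norm_cast
    rw [e]
    simp
  · intro y
    constructor
    intro x hx x' hx' z hz
    rw [mem_coe, mem_filter, mem_Icc] at hx hx' ⊢
    obtain ⟨hz1, hz2⟩ := hz
    refine ⟨by omega, ?_⟩
    rcases le_total 0 y with hy | hy
    · exact (mul_le_mul_of_nonneg_right hz2 hy).trans hx'.2
    · exact (mul_le_mul_of_nonpos_right hz1 hy).trans hx.2
  · intro y
    split_ifs with h
    · rw [mem_Icc] at h
      have : y.natAbs ∈ Icc 1 Y := by rw [mem_Icc]; omega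
      exact (hv _ this).trans (hΔ _ this)
    · simpa using hΔ0
  · rw [sum_Icc_one_natCast]
    simp only [Int.natAbs_natCast]
    refine hmom X u hu hLX 2 ?_
    rw [pow_succ]
    exact Nat.le_mul_of_pos_left 2 (by positivity)
  · rw [sum_Icc_one_natCast]
    have : ∀ y ∈ Icc 1 Y, ‖(if (y : ℤ) ∈ Icc 1 (Y : ℤ) then v (y : ℤ).natAbs else 0)‖ ^
        2 ^ (j + 1) = ‖v y‖ ^ 2 ^ (j + 1) := by
      intro y hy
      have hy' : (y : ℤ) ∈ Icc 1 (Y : ℤ) := by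
        rw [mem_Icc] at hy ⊢; omega
      rw [if_pos hy', Int.natAbs_natCast]
    rw [sum_congr rfl this]
    exact hmom Y v hv hLY _ le_rfl

/-- Removing a dyadic decomposition of a sum of nonnegative terms. -/
theorem sum_Icc_le_of_dyadic (U : ℕ) (f : ℕ → ℝ) (hf : ∀ m, 0 ≤ f m) {B : ℝ} (hB0 : 0 ≤ B)
    (hB : ∀ M, 1 ≤ M → M ≤ U → ∑ m ∈ Ico M (2 * M), f m ≤ B) :
    ∑ m ∈ Icc 1 U, f m ≤ 2 * lg U * B := by
  have key := norm_sum_dyadic_le U (fun m => if m ≤ U then (f m : ℂ) else 0)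
    (fun m hm => if_neg (not_le.2 hm)) (B := B) ?_
  · have e : ∑ m ∈ Icc 1 U, (if m ≤ U then (f m : ℂ) else 0) = ((∑ m ∈ Icc 1 U, f m : ℝ) : ℂ) := by
      push_cast
      exact sum_congr rfl fun m hm => if_pos (mem_Icc.1 hm).2
    rw [e, Complex.norm_real, Real.norm_of_nonneg (sum_nonneg fun m _ => hf m)] at key
    exact key
  · intro i
    rcases le_or_gt (2 ^ i) U with h | h
    · refine (norm_sum_le _ _).trans (le_trans (sum_le_sum fun m _ => ?_)
        (hB _ Nat.one_le_two_pow h))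
      split_ifs
      · rw [Complex.norm_real, Real.norm_of_nonneg (hf m)]
      · simpa using hf m
    · rw [sum_eq_zero, norm_zero]
      · exact hB0
      · intro m hm
        rw [if_neg (by have := (mem_Ico.1 hm).1; omega)]

theorem exists_pl_scale (d : ℝ) (C c e n : ℕ) : ∃ C' : ℕ, ∀ L : ℝ, 1 ≤ L →
    d * L ^ n * (pl C (c * L) * (c * L) ^ e) ≤ pl C' L := by
  obtain ⟨C', hC'⟩ := exists_pl_const (d * (C + 1) * c ^ C * c ^ e) (n + C + e)
  refine ⟨C', fun L hL => le_trans (le_of_eq ?_) (hC' L hL)⟩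
  rw [pl, mul_pow, mul_pow]
  ring

set_option maxHeartbeats 2000000 in
theorem exists_minor_arc_bound (j : ℕ) (hj : 1 ≤ j) {ω : ℝ} (hω : 0 < ω) (hω' : ω ≤ 1 / 8) :
    ∃ C : ℕ, ∀ᶠ N : ℕ in Filter.atTop, ∀ (α : ℝ) (a : ℤ) (q : ℕ), IsApprox α a q →
      (N : ℝ) ^ (1 / 2 + ω) ≤ q → q * (N : ℝ) ^ (1 / 2 + ω) ≤ (N : ℝ) ^ (j + 1) → ∀ N' ≤ N,
      ‖∑ n ∈ Icc 1 N', (ArithmeticFunction.vonMangoldt n : ℂ) * eAdd (α * (n : ℝ) ^ (j + 1))‖ ≤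
        pl C (lg N) * (N * (N : ℝ) ^ (-(1 : ℝ) / (2 * (2 ^ j) ^ 2))) := by
  obtain ⟨s, hs⟩ := exists_minor_arc_parameters j hj hω hω'
  obtain ⟨C₁, hC₁⟩ := exists_typeI_weyl j hj s
  obtain ⟨C₂, hC₂⟩ := exists_typeII_weyl_nat j hj s
  obtain ⟨C₃, hC₃⟩ := exists_pl_scale 12 C₁ (2 * j + 4) 0 2
  obtain ⟨C₄, hC₄⟩ := exists_pl_scale 16 C₂ (2 * j + 4) (2 ^ 2 ^ (j + 1)) 2
  obtain ⟨C₅, hC₅⟩ := exists_pl_const 1 1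
  refine ⟨C₅ + C₃ + 1 + C₄ + 1, ?_⟩
  filter_upwards [hs, Filter.eventually_ge_atTop
    ((j + 1).factorial * 2 ^ j * (j + 1) ^ (j + 1) * 2 ^ (j + 1) + 4)] with N hN hNc
  obtain ⟨D, U, η, Δ, hD1, hDU, hDω, hDs, hη1, hη2, hη3, hU3, hηΔ, hΔ, hI1, hI2, hU2⟩ := hN
  intro α a q hq hq1 hq2 N' hN'
  have hN4 : 4 ≤ N := by omega
  have hNR1 : (1 : ℝ) ≤ N := by exact_mod_cast (by omega : 1 ≤ N)
  have hN0 : (0 : ℝ) < N := by linarith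
  set ℓ := lg N with hℓ
  have hℓ1 : 1 ≤ ℓ := one_le_lg N
  set E : ℝ := (N : ℝ) ^ (-(1 : ℝ) / (2 * (2 ^ j) ^ 2)) with hE
  have hE0 : 0 < E := by positivity
  set L : ℝ := (2 * j + 4 : ℕ) * ℓ with hL
  have hL1 : 1 ≤ L := by
    have : (1 : ℝ) ≤ (2 * j + 4 : ℕ) := by exact_mod_cast (by omega : 1 ≤ 2 * j + 4)
    nlinarith
  have hlgL : ∀ X, X ≤ N ^ (2 * j + 4) → lg X ≤ L := by
    intro X hX
    refine (lg_mono hX).trans ((lg_pow_le N (2 * j + 3)).trans (le_of_eq ?_))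
    rw [hL]; push_cast; ring
  have hU1 : 1 ≤ U := hD1.trans hDU
  have hη0 : 0 < η := by linarith
  have hUR : (1 : ℝ) ≤ U := by exact_mod_cast hU1
  have hDR : (1 : ℝ) ≤ D := by exact_mod_cast hD1
  have hUN : U ≤ N := by nlinarith [Nat.le_self_pow two_ne_zero U]
  have hDN : D ≤ N := hDU.trans hUN
  have hsq2 : (N : ℝ) ^ (1 / 2 : ℝ) * (N : ℝ) ^ (1 / 2 : ℝ) = N := by
    rw [← Real.rpow_add hN0]; norm_num
  have hsqω : (N : ℝ) ^ (1 / 2 + ω) = (N : ℝ) ^ (1 / 2 : ℝ) * (N : ℝ) ^ ω := Real.rpow_add hN0 _ _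
  have hN12 : (1 : ℝ) ≤ (N : ℝ) ^ (1 / 2 + ω) := Real.one_le_rpow hNR1 (by positivity)
  have hqN : (q : ℝ) ≤ (N : ℝ) ^ (j + 1) := by nlinarith [(Nat.cast_nonneg q : (0 : ℝ) ≤ q)]
  have hqN' : q ≤ N ^ (j + 1) := by exact_mod_cast hqN
  have h2q : 2 * q ≤ N ^ (2 * j + 4) := by
    calc 2 * q ≤ N * N ^ (j + 1) := Nat.mul_le_mul (by omega) hqN'
      _ = N ^ (j + 2) := by ring
      _ ≤ _ := Nat.pow_le_pow_right (by omega) (by omega)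
  have hηD : (η ^ 2 ^ j) ^ 2 ^ j * D ≤ (N : ℝ) ^ (1 / 2 + ω) := by
    rw [hsqω]
    exact mul_le_mul (hη2.trans (by linarith [Real.rpow_pos_of_pos hN0 (1 / 2)])) hDω
      (by positivity) (by positivity)
  have hηDq : (η ^ 2 ^ j) ^ 2 ^ j * D * q ≤ (N : ℝ) ^ (j + 1) := by
    calc _ ≤ (N : ℝ) ^ (1 / 2 + ω) * q := mul_le_mul_of_nonneg_right hηD (by positivity)
      _ ≤ _ := by linarith
  have hηK1 : 1 ≤ η ^ 2 ^ j := one_le_pow₀ hη1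
  set F : ℕ → ℂ := fun n => if n ≤ N' then eAdd (α * (n : ℝ) ^ (j + 1)) else 0 with hF
  set B₁ : ℝ := 2 * lg U * (pl C₁ L * (2 * (N * E))) with hB₁
  set B₂ : ℝ := pl C₂ L * L ^ 2 ^ 2 ^ (j + 1) * (4 * (N * E)) with hB₂
  have hp1 : 0 ≤ pl C₁ L := pl_nonneg _ hL1
  have hp2 : 0 ≤ pl C₂ L := pl_nonneg _ hL1
  have hB₂0 : 0 ≤ B₂ := by positivity
  have hFn : ∀ n, ‖F n‖ ≤ 1 := by
    intro n
    simp only [hF]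
    split_ifs
    · exact (norm_eAdd _).le
    · simp
  have hxy : ∀ {XY : ℝ}, XY ≤ 2 * N → XY / η ≤ 4 * (N * E) := by
    intro XY h
    calc XY / η = XY * (1 / η) := by ring
      _ ≤ (2 * N) * (2 * E) := mul_le_mul h hη3 (by positivity) (by linarith)
      _ = _ := by ring
  have htypeII : ∀ X Y : ℕ, (N : ℝ) ^ (1 / 2 : ℝ) / 2 ≤ X → U ≤ Y → X * Y ≤ 2 * N → N ≤ X * Y →
      ∀ u v : ℕ → ℂ, (∀ x ∈ Icc 1 X, ‖u x‖ ≤ tau x) → (∀ y ∈ Icc 1 Y, ‖v y‖ ≤ tau y) →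
      ‖∑ y ∈ Icc 1 Y, ∑ x ∈ (Icc 1 X).filter (fun x => x * y ≤ N'),
        u x * v y * eAdd (α * ((x : ℝ) * y) ^ (j + 1))‖ ≤ B₂ := by
    intro X Y hX hY hXY hXY' u v hu hv
    have hX1 : 1 ≤ X := by
      rcases Nat.eq_zero_or_pos X with rfl | h
      · simp at hXY'; omega
      · exact h
    have hY1 : 1 ≤ Y := hU1.trans hY
    have hXN : X ≤ 2 * N := (Nat.le_mul_of_pos_right X hY1).trans hXY
    have hYN : Y ≤ 2 * N := (Nat.le_mul_of_pos_left Y hX1).trans hXY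
    have hsmall : Y ^ (j + 1) * X ^ j ≤ (2 * N) ^ (j + 1) := by
      calc Y ^ (j + 1) * X ^ j = Y * (X * Y) ^ j := by ring
        _ ≤ (2 * N) * (2 * N) ^ j := Nat.mul_le_mul hYN (Nat.pow_le_pow_left hXY j)
        _ = _ := by ring
    have hbig : (j + 1).factorial * (2 ^ j * ((j + 1) * Y) ^ (j + 1) * X ^ j) ≤
        N ^ (2 * j + 2) := by
      calc _ = (j + 1).factorial * 2 ^ j * (j + 1) ^ (j + 1) * (Y ^ (j + 1) * X ^ j) := by
            rw [mul_pow]; ring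
        _ ≤ (j + 1).factorial * 2 ^ j * (j + 1) ^ (j + 1) * (2 * N) ^ (j + 1) :=
            Nat.mul_le_mul_left _ hsmall
        _ = (j + 1).factorial * 2 ^ j * (j + 1) ^ (j + 1) * 2 ^ (j + 1) * N ^ (j + 1) := by
            rw [mul_pow]; ring
        _ ≤ N * N ^ (j + 1) := Nat.mul_le_mul_right _ (by omega)
        _ = N ^ (j + 2) := by ring
        _ ≤ _ := Nat.pow_le_pow_right (by omega) (by omega)
    have hN24 : N ^ (2 * j + 2) ≤ N ^ (2 * j + 4) := Nat.pow_le_pow_right (by omega) (by omega)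
    have h2N : 2 * N ≤ N ^ (2 * j + 4) := by
      calc 2 * N ≤ N * N := Nat.mul_le_mul_right _ (by omega)
        _ = N ^ 2 := by ring
        _ ≤ _ := Nat.pow_le_pow_right (by omega) (by omega)
    refine (hC₂ α a q hq D X Y hD1 hX1 hY1 (hDU.trans hY) (hbig.trans hDs) L
      (hlgL D (by omega)) (hlgL _ h2q) (hlgL _ ?_) η hη1 (hη2.trans hX) (hηD.trans hq1)
      (hηDq.trans ?_) Δ (hηΔ.trans (by exact_mod_cast hY)) N' u v hu hv
      (fun y hy => hΔ y (mem_Icc.1 hy).1 ((mem_Icc.1 hy).2.trans hYN)) (hlgL _ (by omega))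
      (hlgL _ (by omega))).trans ?_
    · exact (Nat.le_mul_of_pos_left _ (Nat.factorial_pos _)).trans (hbig.trans hN24)
    · exact pow_le_pow_left₀ hN0.le (by exact_mod_cast hXY') _
    · exact mul_le_mul_of_nonneg_left (hxy (by exact_mod_cast hXY)) (by positivity)
  have hmain := norm_sum_vonMangoldt_le (N := N) (U := U) (F := F) (B₁ := B₁) (B₂ := B₂)
    hFn hB₂0 hU1 hU3 ?_ ?_
  · have e : ∑ n ∈ Icc 1 N, (ArithmeticFunction.vonMangoldt n : ℂ) * F n =
        ∑ n ∈ Icc 1 N', (ArithmeticFunction.vonMangoldt n : ℂ) * eAdd (α * (n : ℝ) ^ (j + 1)) := by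
      symm
      refine sum_subset_zero_on_sdiff (Icc_subset_Icc_right hN') ?_ ?_
      · intro n hn
        rw [mem_sdiff, mem_Icc, mem_Icc] at hn
        simp only [hF]
        rw [if_neg (by omega), mul_zero]
      · intro n hn
        simp only [hF]
        rw [if_pos (mem_Icc.1 hn).2]
    rw [← e]
    refine hmain.trans ?_
    have hUE : (U : ℝ) ≤ N * E := by
      have h1 : (N : ℝ) ^ (-(1 / 2) : ℝ) ≤ E := by
        refine Real.rpow_le_rpow_of_exponent_le hNR1 ?_
        rw [neg_div, neg_le_neg_iff]
        refine div_le_div_of_nonneg_left (by norm_num) (by norm_num) ?_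
        have : (1 : ℝ) ≤ (2 ^ j) ^ 2 := one_le_pow₀ (one_le_pow₀ (by norm_num))
        linarith
      calc (U : ℝ) = U * (N : ℝ) ^ (1 / 2 : ℝ) * (N : ℝ) ^ (-(1 / 2) : ℝ) := by
            rw [mul_assoc, ← Real.rpow_add hN0]; norm_num
        _ ≤ _ := mul_le_mul hU2 h1 (by positivity) hN0.le
    have hlgU : lg U ≤ ℓ := lg_mono hUN
    have hP : 0 ≤ N * E := by positivity
    have hB1' : B₁ ≤ 4 * ℓ * pl C₁ L * (N * E) := by
      rw [hB₁]
      calc _ ≤ 2 * ℓ * (pl C₁ L * (2 * (N * E))) := by gcongr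
        _ = _ := by ring
    have h3 := hC₃ ℓ hℓ1
    have h4 := hC₄ ℓ hℓ1
    have h5 := hC₅ ℓ hℓ1
    rw [← hL] at h3 h4
    rw [pow_zero, mul_one] at h3
    rw [one_mul, pow_one] at h5
    have h6 : pl C₅ ℓ + pl C₃ ℓ + pl C₄ ℓ ≤ pl (C₅ + C₃ + 1 + C₄ + 1) ℓ := by
      linarith [pl_add_le C₅ C₃ hℓ1, pl_add_le (C₅ + C₃ + 1) C₄ hℓ1]
    calc ℓ * U + 3 * ℓ * B₁ + 4 * ℓ ^ 2 * B₂ ≤ ℓ * (N * E) +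
          3 * ℓ * (4 * ℓ * pl C₁ L * (N * E)) + 4 * ℓ ^ 2 * B₂ := by
          gcongr
      _ = (ℓ + 12 * ℓ ^ 2 * pl C₁ L + 16 * ℓ ^ 2 * (pl C₂ L * L ^ 2 ^ 2 ^ (j + 1))) * (N * E) := by
          rw [hB₂]; ring
      _ ≤ _ := by
          refine mul_le_mul_of_nonneg_right (le_trans ?_ h6) hP
          linarith
  · intro t
    refine sum_Icc_le_of_dyadic U (fun m => ‖∑ n ∈ Icc 1 (min (t m) (N / m)), F (m * n)‖)
      (fun m => norm_nonneg _) (by positivity) fun M hM1 hMU => ?_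
    have hMR : (1 : ℝ) ≤ M := by exact_mod_cast hM1
    have hMUR : (M : ℝ) ≤ U := by exact_mod_cast hMU
    have hMN : M ≤ N := hMU.trans hUN
    have hX1 : 1 ≤ N / M := Nat.div_pos hMN hM1
    have hMX : M * (N / M) ≤ N := Nat.mul_div_le N M
    have hNX : N ≤ 2 * (M * (N / M)) := by
      have h1 := Nat.lt_mul_div_succ N hM1
      nlinarith
    set X := N / M with hX
    have hNXR : (N : ℝ) ≤ 2 * (M * X) := by exact_mod_cast hNX
    have hMXR : (M : ℝ) * X ≤ N := by exact_mod_cast hMX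
    have hsmall : M ^ (j + 1) * X ^ j ≤ N ^ (j + 1) := by
      calc M ^ (j + 1) * X ^ j = M * (M * X) ^ j := by ring
        _ ≤ N * N ^ j := Nat.mul_le_mul hMN (Nat.pow_le_pow_left hMX j)
        _ = _ := by ring
    have hbig : (j + 1).factorial * ((2 * M) ^ (j + 1) * X ^ j) ≤ N ^ (2 * j + 2) := by
      calc _ = (j + 1).factorial * 2 ^ (j + 1) * (M ^ (j + 1) * X ^ j) := by
            rw [mul_pow]; ring
        _ ≤ (j + 1).factorial * 2 ^ (j + 1) * N ^ (j + 1) := Nat.mul_le_mul_left _ hsmall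
        _ ≤ N * N ^ (j + 1) := by
            refine Nat.mul_le_mul_right _ (le_trans ?_ hNc)
            calc (j + 1).factorial * 2 ^ (j + 1) ≤
                ((j + 1).factorial * 2 ^ (j + 1)) * (2 ^ j * (j + 1) ^ (j + 1)) :=
                  Nat.le_mul_of_pos_right _ (by positivity)
              _ = (j + 1).factorial * 2 ^ j * (j + 1) ^ (j + 1) * 2 ^ (j + 1) := by ring
              _ ≤ _ := Nat.le_add_right _ _
        _ = N ^ (j + 2) := by ring
        _ ≤ _ := Nat.pow_le_pow_right (by omega) (by omega)
    have hN24 : N ^ (2 * j + 2) ≤ N ^ (2 * j + 4) := Nat.pow_le_pow_right (by omega) (by omega)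
    have hDN' : D ≤ N ^ (2 * j + 4) := hDN.trans (Nat.le_self_pow (by omega) N)
    have c1 : η ^ 2 ^ j * D * M ^ (j + 1) ≤ X * M := by
      have : η ^ 2 ^ j * D * (M ^ (j + 1) * 2) ≤ N := by
        refine le_trans ?_ hI2
        gcongr
      linarith
    have c2 : η ^ 2 ^ j * D * M ^ j ≤ X := by
      refine le_of_mul_le_mul_right (le_trans (le_of_eq ?_) c1) (by linarith : (0 : ℝ) < M)
      ring
    have c3 : η ^ 2 ^ j * D * (M ^ j * 2 ^ (j + 1)) ≤ (N : ℝ) ^ (1 / 2 + ω) := by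
      refine le_trans ?_ hI1
      gcongr
    have hMj : (1 : ℝ) ≤ (M : ℝ) ^ j := one_le_pow₀ hMR
    have hηD0 : 0 ≤ η ^ 2 ^ j * D := by positivity
    have key := hC₁ α a q hq D M X hD1 hM1 hX1 (hbig.trans hDs) L (hlgL D hDN')
      (hlgL _ h2q) (hlgL _ ?_) η hη1 ?_ ?_ ?_ ?_
      (fun m => (Icc 1 (X : ℤ)).filter (fun n => n ≤ min (t m.natAbs : ℤ) (N / m.natAbs : ℕ) ∧
        m.natAbs * n ≤ N'))
      (fun m => filter_subset _ _) ?_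
    · calc _ = ∑ m ∈ Ico M (2 * M), ‖∑ n ∈ (Icc 1 (X : ℤ)).filter (fun n =>
            n ≤ min (t (m : ℤ).natAbs : ℤ) (N / (m : ℤ).natAbs : ℕ) ∧ ((m : ℤ).natAbs : ℤ) * n ≤ N'),
              eAdd (α * ((m : ℝ) * n) ^ (j + 1))‖ := by
            refine sum_congr rfl fun m hm => ?_
            congr 1
            rw [sum_Icc_one_filter_natCast]
            rw [mem_Ico] at hm
            have hle : N / m ≤ X := Nat.div_le_div_left hm.1 hM1
            have e2 : (Icc 1 X).filter (fun n : ℕ => (n : ℤ) ≤ min (t (m : ℤ).natAbs : ℤ)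
                (N / (m : ℤ).natAbs : ℕ) ∧ ((m : ℤ).natAbs : ℤ) * n ≤ N') =
                (Icc 1 (min (t m) (N / m))).filter (fun n => m * n ≤ N') := by
              ext n
              simp only [mem_filter, mem_Icc, Int.natAbs_natCast]
              rw [← Nat.cast_min, Nat.cast_le]
              have : (m : ℤ) * n ≤ N' ↔ m * n ≤ N' := by norm_cast
              rw [this]
              have h2 := min_le_right (t m) (N / m)
              omega
            rw [e2, sum_filter]
            refine sum_congr rfl fun n _ => ?_
            simp only [hF]
            push_cast
            rfl
        _ ≤ _ := key
        _ ≤ _ := by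
            refine mul_le_mul_of_nonneg_left ?_ hp1
            calc (M : ℝ) * X / η = M * X * (1 / η) := by ring
              _ ≤ N * (2 * E) := mul_le_mul hMXR hη3 (by positivity) hN0.le
              _ = _ := by ring
    · exact (Nat.le_mul_of_pos_left _ (Nat.factorial_pos _)).trans (hbig.trans hN24)
    · refine le_trans ?_ c2
      refine mul_le_mul_of_nonneg_right ?_ (by positivity)
      nlinarith
    · refine le_trans ?_ (c3.trans hq1)
      refine mul_le_mul_of_nonneg_left ?_ hηD0
      refine le_mul_of_one_le_right (by positivity) (one_le_pow₀ (by norm_num))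
    · refine le_trans ?_ c2
      exact le_mul_of_one_le_right hηD0 hMj
    · have h1 : (N : ℝ) ^ (j + 1) ≤ 2 ^ (j + 1) * (M ^ (j + 1) * X ^ (j + 1)) := by
        rw [← mul_pow, ← mul_pow]
        exact pow_le_pow_left₀ hN0.le hNXR _
      have h2 : η ^ 2 ^ j * D * (M ^ j * 2 ^ (j + 1)) * q ≤ 2 ^ (j + 1) *
          (M ^ (j + 1) * X ^ (j + 1)) := by
        refine le_trans ?_ h1
        refine le_trans (mul_le_mul_of_nonneg_right c3 (by positivity)) ?_
        linarith
      refine le_of_mul_le_mul_right (?_ : _ * (M ^ j * 2 ^ (j + 1) : ℝ) ≤ _ * _) (by positivity)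
      calc _ = η ^ 2 ^ j * D * (M ^ j * 2 ^ (j + 1)) * q := by ring
        _ ≤ _ := h2
        _ = _ := by ring
    · intro m
      constructor
      intro x hx x' hx' z hz
      rw [mem_coe, mem_filter, mem_Icc] at hx hx' ⊢
      obtain ⟨hz1, hz2⟩ := hz
      refine ⟨by omega, hz2.trans hx'.2.1, ?_⟩
      exact (mul_le_mul_of_nonneg_left hz2 (by positivity)).trans hx'.2.2
  · intro M hM1 hM2 u v hu hv
    have hM0 : 1 ≤ M := by omega
    have hMN : 2 * M ≤ N := by nlinarith
    have hUX : U + 1 ≤ N / M := by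
      rw [Nat.le_div_iff_mul_le hM0]
      linarith
    have hMX : M * (N / M) ≤ N := Nat.mul_div_le N M
    have hNX : N ≤ 2 * (M * (N / M)) := by
      have h1 := Nat.lt_mul_div_succ N hM0
      nlinarith
    -- rewrite the sum over the hyperbolic region
    have hre : ∑ m ∈ Ico M (2 * M), ∑ n ∈ Icc 1 (N / m), u m * v n * F (m * n) =
        ∑ m ∈ Ico M (2 * M), ∑ n ∈ (Icc 1 (N / M)).filter (fun n => m * n ≤ N'),
          u m * v n * eAdd (α * ((m : ℝ) * n) ^ (j + 1)) := by
      refine sum_congr rfl fun m hm => ?_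
      rw [mem_Ico] at hm
      have hm0 : 1 ≤ m := by omega
      rw [sum_filter]
      refine sum_subset_zero_on_sdiff (Icc_subset_Icc_right (Nat.div_le_div_left hm.1 hM0)) ?_ ?_
      · intro n hn
        rw [mem_sdiff, mem_Icc, mem_Icc] at hn
        rw [if_neg]
        intro h
        exact hn.2 ⟨hn.1.1, (Nat.le_div_iff_mul_le (by omega)).2 (by rw [mul_comm]; omega)⟩
      · intro n hn
        simp only [hF]
        push_cast
        split_ifs <;> simp
    rw [hre]
    set X := N / M with hX
    rcases le_total (N : ℝ) ((M : ℝ) * M) with h | h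
    · have hsqM : (N : ℝ) ^ (1 / 2 : ℝ) ≤ M := by
        rw [← Real.sqrt_eq_rpow]
        exact Real.sqrt_le_iff.2 ⟨by positivity, by rw [sq]; exact h⟩
      have hM0 : (0 : ℝ) ≤ M := Nat.cast_nonneg M
      have hsqrt0 := Real.rpow_nonneg hN0.le (1 / 2)
      have key := htypeII (2 * M) X (by push_cast; linarith)
        (by omega) (by nlinarith) (by linarith)
        (fun x => if x ∈ Ico M (2 * M) then u x else 0) v ?_ ?_
      · refine le_trans (le_of_eq ?_) key
        congr 1
        have e1 : ∀ y ∈ Icc 1 X, ∑ x ∈ (Icc 1 (2 * M)).filter (fun x => x * y ≤ N'),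
            (if x ∈ Ico M (2 * M) then u x else 0) * v y * eAdd (α * ((x : ℝ) * y) ^ (j + 1)) =
            ∑ x ∈ Ico M (2 * M), if x * y ≤ N' then
              u x * v y * eAdd (α * ((x : ℝ) * y) ^ (j + 1)) else 0 := by
          intro y _
          rw [sum_filter]
          symm
          refine sum_subset_zero_on_sdiff (fun x hx => ?_) (fun x hx => ?_) (fun x hx => ?_)
          · rw [mem_Ico] at hx; rw [mem_Icc]; omega
          · rw [if_neg (mem_sdiff.1 hx).2]; simp
          · rw [if_pos hx]
        rw [sum_congr rfl e1, sum_comm]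
        exact sum_congr rfl fun x _ => by rw [sum_filter]
      · intro x hx
        split_ifs
        · exact hu x (mem_Icc.1 hx).1
        · simpa using tau_nonneg x
      · exact fun y hy => hv y (mem_Icc.1 hy).1
    · have hsqM : (N : ℝ) ^ (1 / 2 : ℝ) / 2 ≤ X := by
        have h1 : (M : ℝ) ≤ (N : ℝ) ^ (1 / 2 : ℝ) := by
          rw [← Real.sqrt_eq_rpow]
          exact Real.le_sqrt_of_sq_le (by rw [sq]; exact h)
        have h2 : (N : ℝ) ≤ 2 * (M * X) := by exact_mod_cast hNX
        have h3 : (0 : ℝ) < (N : ℝ) ^ (1 / 2 : ℝ) := by positivity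
        have h4 : (M : ℝ) * X ≤ (N : ℝ) ^ (1 / 2 : ℝ) * X :=
          mul_le_mul_of_nonneg_right h1 (by positivity)
        rw [div_le_iff₀ (by norm_num)]
        refine le_of_mul_le_mul_left ?_ h3
        linarith
      have key := htypeII X (2 * M) hsqM (by omega) (by nlinarith) (by linarith)
        v (fun x => if x ∈ Ico M (2 * M) then u x else 0) ?_ ?_
      · refine le_trans (le_of_eq ?_) key
        congr 1
        refine sum_subset_zero_on_sdiff (fun x hx => ?_) (fun x hx => ?_) (fun x hx => ?_)
        · rw [mem_Ico] at hx; rw [mem_Icc]; omega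
        · refine sum_eq_zero fun y _ => ?_
          rw [if_neg (mem_sdiff.1 hx).2]; simp
        · rw [if_pos hx]
          refine sum_congr (filter_congr fun y _ => by rw [mul_comm]) fun y _ => ?_
          rw [mul_comm (u x), mul_comm (x : ℝ)]
      · exact fun y hy => hv y (mem_Icc.1 hy).1
      · intro x hx
        split_ifs
        · exact hu x (mem_Icc.1 hx).1
        · simpa using tau_nonneg x

theorem sum_one_div_one_add_mul_le {c : ℝ} (hc : 0 ≤ c) (P : ℕ) :
    ∑ l ∈ Icc 1 P, 1 / (1 + c * l) ≤ 2 * lg P * (P / (1 + c * P)) := by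
  have hL := one_le_lg P
  rcases le_or_gt (c * P) 1 with h | h
  · calc ∑ l ∈ Icc 1 P, 1 / (1 + c * l) ≤ ∑ l ∈ Icc 1 P, (1 : ℝ) := by
          refine sum_le_sum fun l _ => ?_
          have : 0 ≤ c * l := by positivity
          rw [div_le_one (by linarith)]
          linarith
      _ = P := by simp
      _ ≤ 2 * 1 * (P / (1 + c * P)) := by
          rw [← mul_div_assoc, le_div_iff₀ (by positivity)]
          nlinarith [(Nat.cast_nonneg P : (0 : ℝ) ≤ P)]
      _ ≤ _ := by gcongr
  · have hc0 : 0 < c := by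
      rcases hc.eq_or_lt with rfl | h0
      · simp at h; linarith
      · exact h0
    calc ∑ l ∈ Icc 1 P, 1 / (1 + c * l) ≤ ∑ l ∈ Icc 1 P, 1 / c * (1 / l) := by
          refine sum_le_sum fun l hl => ?_
          have h1 : (1 : ℝ) ≤ l := by exact_mod_cast (mem_Icc.1 hl).1
          rw [one_div_mul_one_div]
          exact one_div_le_one_div_of_le (by positivity) (by linarith)
      _ = 1 / c * ∑ l ∈ Icc 1 P, (1 / l : ℝ) := by rw [mul_sum]
      _ ≤ 1 / c * lg P := mul_le_mul_of_nonneg_left (sum_one_div_le_lg P) (by positivity)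
      _ ≤ _ := by
          have : 1 / c ≤ 2 * (P / (1 + c * P)) := by
            rw [← mul_div_assoc, div_le_div_iff₀ hc0 (by positivity)]
            nlinarith
          calc 1 / c * lg P ≤ 2 * (P / (1 + c * P)) * lg P :=
                mul_le_mul_of_nonneg_right this (by linarith)
            _ = _ := by ring

theorem sum_bd_mul_le_of_close {θ β : ℝ} {b : ℤ} {r H : ℕ} {X : ℝ} (hr : 1 ≤ r)
    (hrH : r ≤ H) (hc : IsCoprime b (r : ℤ)) (hθ : θ = b / r + β)
    (h : |β| * H ≤ 1 / (2 * r)) (hX : 0 ≤ X) :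
    ∑ n ∈ Icc 1 H, bd X (θ * n) ≤
      256 * lg H * H + 2 * lg H * (X * H / r / (1 + X * |β| * H / 2)) := by
  have hr0 : (0 : ℝ) < r := by exact_mod_cast hr
  have hr1 : (1 : ℝ) ≤ r := by exact_mod_cast hr
  have hβn : ∀ n ∈ Icc 1 H, |β * n| ≤ 1 / (2 * r) := by
    intro n hn
    rw [abs_mul, Nat.abs_cast]
    refine le_trans (mul_le_mul_of_nonneg_left ?_ (abs_nonneg _)) h
    exact_mod_cast (mem_Icc.1 hn).2
  rw [← sum_filter_add_sum_filter_not (Icc 1 H) (fun n => ¬ r ∣ n)]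
  refine add_le_add ?_ ?_
  · calc ∑ n ∈ (Icc 1 H).filter (fun n => ¬ r ∣ n), bd X (θ * n)
        ≤ ∑ n ∈ (Icc 1 H).filter (fun n => ¬ r ∣ n), 4 * bd r (((b : ℝ) / r) * n) := by
          refine sum_le_sum fun n hn => ?_
          rw [mem_filter] at hn
          have hnd : ¬ (r : ℤ) ∣ b * n := by
            intro hd
            exact hn.2 (Int.natCast_dvd_natCast.1 (hc.symm.dvd_of_dvd_mul_left hd))
          have h1 : (1 : ℝ) / r ≤ distInt ((b : ℝ) / r * n) := by
            have := one_div_le_distInt_div hr hnd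
            rw [show ((b : ℝ) / r * n) = ((b * n : ℤ) : ℝ) / r by push_cast; ring]
            exact this
          set φ := distInt ((b : ℝ) / r * n) with hφ
          have hφ0 : 0 < φ := lt_of_lt_of_le (by positivity) h1
          have h2 : φ / 2 ≤ distInt (θ * n) := by
            have e : (b : ℝ) / r * n = θ * n + -(β * n) := by rw [hθ]; ring
            have h3 : φ ≤ distInt (θ * n) + |β * n| := by
              rw [hφ, e]
              refine (distInt_add_le _ _).trans (add_le_add le_rfl ?_)
              rw [distInt_neg]
              exact distInt_le_abs _
            have h4 := hβn n hn.1
            have h5 : (1 : ℝ) / (2 * r) = 1 / r / 2 := by field_simp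
            linarith
          refine (bd_le_one_div hX (by positivity) h2).trans ?_
          have h6 : 1 ≤ r * φ := by
            rw [div_le_iff₀ hr0] at h1; linarith
          rw [bd, ← hφ, ← mul_div_assoc, div_le_div_iff₀ (by positivity) (by positivity)]
          nlinarith
      _ ≤ ∑ n ∈ Icc 1 H, 4 * bd r (((b : ℝ) / r) * n) :=
          sum_le_sum_of_subset_of_nonneg (filter_subset _ _) fun n _ _ =>
            mul_nonneg (by norm_num) (bd_nonneg hr0.le _)
      _ = 4 * ∑ n ∈ Icc 1 H, bd r (((b : ℝ) / r) * n) := by rw [mul_sum]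
      _ ≤ 4 * (16 * (H / r + 1) * (r + r * lg r)) := by
          refine mul_le_mul_of_nonneg_left (IsApprox.sum_bd_le (b := b) ⟨hr, hc, ?_⟩ H hr0.le)
            (by norm_num)
          simp
      _ ≤ 4 * (16 * (H / r + H / r) * (r * lg H + r * lg H)) := by
          have h1 : (1 : ℝ) ≤ H / r := by
            rw [one_le_div hr0]; exact_mod_cast hrH
          have h2 := lg_mono hrH
          have h3 := one_le_lg H
          have h4 : (r : ℝ) ≤ r * lg H := le_mul_of_one_le_right hr0.le h3
          have h5 := lg_pos r
          gcongr
      _ = _ := by field_simp; ring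
  · simp only [not_not]
    have hP : ((H / r : ℕ) : ℝ) ≤ H / r := Nat.cast_div_le
    calc ∑ n ∈ (Icc 1 H).filter (fun n => r ∣ n), bd X (θ * n)
        ≤ ∑ l ∈ Icc 1 (H / r), X * (1 / (1 + (X * |β| * r) * l)) := by
          refine le_of_eq ?_
          symm
          refine sum_bij (fun l _ => r * l) ?_ ?_ ?_ ?_
          · intro l hl
            rw [mem_Icc] at hl
            rw [mem_filter, mem_Icc]
            refine ⟨⟨Nat.mul_pos hr hl.1, ?_⟩, dvd_mul_right _ _⟩
            exact (Nat.mul_le_mul_left r hl.2).trans (Nat.mul_div_le _ _)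
          · intro l _ l' _ h
            exact Nat.eq_of_mul_eq_mul_left hr h
          · intro n hn
            rw [mem_filter, mem_Icc] at hn
            obtain ⟨l, rfl⟩ := hn.2
            refine ⟨l, mem_Icc.2 ⟨?_, ?_⟩, rfl⟩
            · exact Nat.pos_of_mul_pos_left hn.1.1
            · rw [Nat.le_div_iff_mul_le hr, mul_comm]; exact hn.1.2
          · intro l hl
            rw [mem_Icc] at hl
            have hm : r * l ∈ Icc 1 H := mem_Icc.2 ⟨Nat.mul_pos hr hl.1,
              (Nat.mul_le_mul_left r hl.2).trans (Nat.mul_div_le _ _)⟩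
            have h1 := hβn _ hm
            have e : θ * ((r * l : ℕ) : ℝ) = β * (r * l : ℕ) + ((b * l : ℤ) : ℝ) := by
              rw [hθ]; push_cast; field_simp; ring
            have h2 : |β * ((r * l : ℕ) : ℝ)| ≤ 1 / 2 :=
              h1.trans (one_div_le_one_div_of_le (by norm_num) (by linarith))
            rw [bd, e, distInt_add_int, distInt_eq_abs h2, abs_mul, Nat.abs_cast]
            push_cast
            rw [mul_one_div]
            congr 2
            ring
      _ = X * ∑ l ∈ Icc 1 (H / r), 1 / (1 + (X * |β| * r) * l) := by rw [mul_sum]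
      _ ≤ X * (2 * lg (H / r) * ((H / r : ℕ) / (1 + (X * |β| * r) * (H / r : ℕ)))) :=
          mul_le_mul_of_nonneg_left (sum_one_div_one_add_mul_le (by positivity) _) hX
      _ ≤ X * (2 * lg H * (H / r / (1 + X * |β| * H / 2))) := by
          have hlg : lg (H / r) ≤ lg H := lg_mono (Nat.div_le_self _ _)
          have hlg0 := lg_pos H
          have hH2 : (H : ℝ) ≤ 2 * (r * (H / r : ℕ)) := by
            have h1 := Nat.lt_mul_div_succ H hr
            have h2 : 1 ≤ H / r := Nat.div_pos hrH hr
            have : H ≤ 2 * (r * (H / r)) := by nlinarith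
            exact_mod_cast this
          have hden : 1 + X * |β| * H / 2 ≤ 1 + (X * |β| * r) * (H / r : ℕ) := by
            have : X * |β| * H ≤ X * |β| * (2 * (r * (H / r : ℕ))) :=
              mul_le_mul_of_nonneg_left hH2 (by positivity)
            linarith
          refine mul_le_mul_of_nonneg_left ?_ hX
          refine mul_le_mul (by linarith) ?_ ?_ (by linarith)
          · exact div_le_div₀ (by positivity) hP (by positivity) hden
          · positivity
      _ = _ := by ring

theorem sum_mul_pow_four_le (H : ℕ) {X : ℝ} (t b : ℕ → ℝ) (hb : ∀ n, 0 ≤ b n)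
    (hbX : ∀ n, b n ≤ X) :
    (∑ n ∈ Icc 1 H, t n * b n) ^ 4 ≤
      (∑ n ∈ Icc 1 H, t n ^ 4) * X * (∑ n ∈ Icc 1 H, b n) ^ 3 := by
  have h1 : (∑ n ∈ Icc 1 H, t n * b n) ^ 2 ≤
      (∑ n ∈ Icc 1 H, t n ^ 2 * b n) * ∑ n ∈ Icc 1 H, b n := by
    have := sum_mul_sq_le_sq_mul_sq (Icc 1 H) (fun n => t n * √(b n)) (fun n => √(b n))
    simp only [mul_pow, Real.sq_sqrt (hb _), mul_assoc, Real.mul_self_sqrt (hb _)] at this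
    exact this
  have h2 : (∑ n ∈ Icc 1 H, t n ^ 2 * b n) ^ 2 ≤
      (∑ n ∈ Icc 1 H, t n ^ 4) * (X * ∑ n ∈ Icc 1 H, b n) := by
    refine (sum_mul_sq_le_sq_mul_sq (Icc 1 H) (fun n => t n ^ 2) b).trans ?_
    simp only [← pow_mul, Nat.reduceMul]
    refine mul_le_mul_of_nonneg_left ?_ (sum_nonneg fun n _ => by positivity)
    rw [mul_sum]
    refine sum_le_sum fun n _ => ?_
    rw [sq]
    exact mul_le_mul_of_nonneg_right (hbX n) (hb n)
  calc _ = ((∑ n ∈ Icc 1 H, t n * b n) ^ 2) ^ 2 := by ring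
    _ ≤ ((∑ n ∈ Icc 1 H, t n ^ 2 * b n) * ∑ n ∈ Icc 1 H, b n) ^ 2 :=
        pow_le_pow_left₀ (sq_nonneg _) h1 2
    _ = (∑ n ∈ Icc 1 H, t n ^ 2 * b n) ^ 2 * (∑ n ∈ Icc 1 H, b n) ^ 2 := mul_pow _ _ _
    _ ≤ (∑ n ∈ Icc 1 H, t n ^ 4) * (X * ∑ n ∈ Icc 1 H, b n) * (∑ n ∈ Icc 1 H, b n) ^ 2 :=
        mul_le_mul_of_nonneg_right h2 (sq_nonneg _)
    _ = _ := by ring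

theorem exists_major_weyl (j : ℕ) (hj : 1 ≤ j) : ∃ C : ℕ, ∀ (X r : ℕ) (b : ℤ) (θ β : ℝ),
    1 ≤ X → 1 ≤ r → IsCoprime b (r : ℤ) → θ = b / r + β →
    2 * (j + 1).factorial * (r * (1 + |β| * X ^ (j + 1))) ≤ X →
    ∀ A : Finset ℤ, A ⊆ Icc 1 (X : ℤ) → (A : Set ℤ).OrdConnected →
      ‖∑ x ∈ A, eAdd (θ * (x : ℝ) ^ (j + 1))‖ ^ (4 * 2 ^ j) ≤
        pl C (lg X) * ((X : ℝ) ^ (4 * 2 ^ j) / (r * (1 + |β| * X ^ (j + 1))) ^ 3) := by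
  set e : ℕ := 4 * 2 ^ j + 2 ^ (4 * j) + 3 with he
  set c : ℝ := lg (j + 1).factorial + j with hc
  set d : ℝ := 2 ^ (4 * 2 ^ j) * (81 / 16 * 8) *
      ((j * 2 ^ j) ^ 4 + (2 ^ j) ^ 4 * 258 ^ 3 * ((j + 1).factorial : ℝ) ^ 4)
    with hd
  obtain ⟨C, hC⟩ := exists_pl_const (d * c ^ e) e
  refine ⟨C, fun X r b θ β hX hr hb hθ hD A hA hA' => ?_⟩
  have hX1 : (1 : ℝ) ≤ X := by exact_mod_cast hX
  have hX0 : (0 : ℝ) < X := by linarith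
  have hr1 : (1 : ℝ) ≤ r := by exact_mod_cast hr
  set D : ℝ := r * (1 + |β| * X ^ (j + 1)) with hDdef
  have hβX : 0 ≤ |β| * X ^ (j + 1) := by positivity
  have hDr : (r : ℝ) ≤ D := le_mul_of_one_le_right (by linarith) (by linarith)
  have hD0 : 0 < D := by linarith
  have hf1 : (2 : ℝ) ≤ (j + 1).factorial := by
    have h1 : (2 : ℕ).factorial ≤ (j + 1).factorial := Nat.factorial_le (by omega)
    exact_mod_cast h1
  have hDX : D ≤ X := le_trans (by nlinarith) hD
  set H : ℕ := (j + 1).factorial * X ^ j with hH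
  have hXjX : X ≤ X ^ j := Nat.le_self_pow (by omega) X
  have hXH : X ≤ H := hXjX.trans (Nat.le_mul_of_pos_left _ (Nat.factorial_pos _))
  have hrH : r ≤ H := le_trans (by exact_mod_cast hDr.trans hDX) hXH
  have hHc : (H : ℝ) = (j + 1).factorial * X ^ j := by rw [hH]; push_cast; ring
  have hlH := one_le_lg H
  have hlHc : lg H ≤ c * lg X := by
    obtain ⟨i, rfl⟩ : ∃ i, j = i + 1 := ⟨j - 1, by omega⟩
    have h1 := lg_mul_le (i + 1 + 1).factorial (X ^ (i + 1))
    have h2 := lg_pow_le X i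
    have h3 := one_le_lg X
    have h4 := one_le_lg (i + 1 + 1).factorial
    rw [hc]
    push_cast at h2 ⊢
    rw [hH]
    nlinarith
  have hsum : ∑ n ∈ Icc 1 H, bd X (θ * n) ≤ 258 * lg H * (H * X / D) := by
    have hclose : |β| * H ≤ 1 / (2 * r) := by
      rw [le_div_iff₀ (by positivity), hHc]
      have h1 : 2 * ((j + 1).factorial : ℝ) * (r * (|β| * X ^ (j + 1))) ≤ X := by
        refine le_trans ?_ hD
        rw [hDdef]
        gcongr
        linarith
      rw [pow_succ] at h1
      have h2 : (|β| * ((j + 1).factorial * X ^ j) * (2 * r)) * X ≤ 1 * X := by linarith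
      exact le_of_mul_le_mul_right h2 hX0
    refine (sum_bd_mul_le_of_close hr hrH hb hθ hclose hX0.le).trans ?_
    have h1 : (H : ℝ) ≤ H * X / D := by
      rw [le_div_iff₀ hD0]
      gcongr
    have h2 : (X * H / r / (1 + X * |β| * H / 2) : ℝ) ≤ H * X / D := by
      rw [div_div, hDdef, mul_comm (X : ℝ) H]
      gcongr
      rw [hHc, pow_succ]
      have : (X * |β| * X ^ j) * 2 ≤ (X * |β| * X ^ j) * (j + 1).factorial := by gcongr
      linarith
    have h3 : 256 * lg H * (H : ℝ) ≤ 256 * lg H * (H * X / D) := by gcongr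
    have h4 : 2 * lg H * (X * H / r / (1 + X * |β| * H / 2) : ℝ) ≤ 2 * lg H * (H * X / D) := by
      gcongr
    linarith
  have hmom : (∑ n ∈ Icc 1 H, tau n ^ j * bd X (θ * n)) ^ 4 ≤
      258 ^ 3 * lg H ^ (2 ^ (4 * j) + 3) * (H ^ 4 * X ^ 4 / D ^ 3) := by
    refine (sum_mul_pow_four_le H (fun n => tau n ^ j) (fun n => bd X (θ * n))
      (fun n => bd_nonneg hX0.le _) (fun n => bd_le_self hX0.le _)).trans ?_
    have h1 : ∑ n ∈ Icc 1 H, (tau n ^ j) ^ 4 ≤ H * lg H ^ 2 ^ (4 * j) := by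
      simp only [← pow_mul, mul_comm j 4]
      exact sum_tau_pow_le (4 * j) H
    calc _ ≤ (H * lg H ^ 2 ^ (4 * j)) * X * (258 * lg H * (H * X / D)) ^ 3 := by
          refine mul_le_mul (mul_le_mul_of_nonneg_right h1 hX0.le)
            (pow_le_pow_left₀ (sum_nonneg fun n _ => bd_nonneg hX0.le _) hsum 3)
            (pow_nonneg (sum_nonneg fun n _ => bd_nonneg hX0.le _) _) (by positivity)
      _ = _ := by
          rw [mul_pow, mul_pow, div_pow]; ring
  have hmulti : multiBd j X (θ * (j + 1).factorial) ≤ j * 2 ^ j * X ^ j * lg H ^ 2 ^ j +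
      2 ^ j * ∑ n ∈ Icc 1 H, tau n ^ j * bd X (θ * n) := by
    have h1 := sum_tau_multiBd_le j 0 1 X hX (θ * (j + 1).factorial)
    simp only [Icc_self, sum_singleton, pow_zero, one_mul, Nat.cast_one, mul_one, zero_add] at h1
    refine h1.trans (add_le_add ?_ ?_)
    · have : lg (X ^ j) ≤ lg H := lg_mono (Nat.le_mul_of_pos_left _ (Nat.factorial_pos _))
      have := lg_pos (X ^ j)
      have h2 := pow_le_pow_left₀ this.le ‹lg (X ^ j) ≤ lg H› (2 ^ j)
      exact mul_le_mul_of_nonneg_left h2 (by positivity)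
    · refine mul_le_mul_of_nonneg_left ?_ (by positivity)
      exact sum_tau_pow_bd_mul_le j _ _ (Nat.factorial_pos _) θ hX0.le
  have hmulti4 : multiBd j X (θ * (j + 1).factorial) ^ 4 ≤
      16 / 81 * (d / 2 ^ (4 * 2 ^ j)) * lg H ^ e * (X ^ (4 * (j + 1)) / D ^ 3) := by
    set T := ∑ n ∈ Icc 1 H, tau n ^ j * bd X (θ * n) with hT
    have hT0 : 0 ≤ T := sum_nonneg fun n _ =>
      mul_nonneg (pow_nonneg (tau_nonneg n) _) (bd_nonneg hX0.le _)
    have hpow : ∀ x y : ℝ, (x + y) ^ 4 ≤ 8 * (x ^ 4 + y ^ 4) := by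
      intro x y
      nlinarith [sq_nonneg (x - y), sq_nonneg (x ^ 2 - y ^ 2), sq_nonneg (x + y),
        sq_nonneg (x * y), sq_nonneg ((x - y) * (x + y)), sq_nonneg ((x - y) ^ 2),
        mul_nonneg (sq_nonneg (x - y)) (sq_nonneg (x + y))]
    have hX3 : (1 : ℝ) ≤ X ^ 4 / D ^ 3 := by
      rw [one_le_div (by positivity)]
      calc D ^ 3 ≤ (X : ℝ) ^ 3 := by gcongr
        _ ≤ (X : ℝ) ^ 4 := pow_le_pow_right₀ hX1 (by norm_num)
    have hE : (X : ℝ) ^ (4 * (j + 1)) / D ^ 3 = X ^ (4 * j) * (X ^ 4 / D ^ 3) := by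
      rw [mul_add, pow_add, mul_one]; ring
    calc _ ≤ (j * 2 ^ j * X ^ j * lg H ^ 2 ^ j + 2 ^ j * T) ^ 4 :=
          pow_le_pow_left₀ (multiBd_nonneg _ _ _) hmulti 4
      _ ≤ 8 * ((j * 2 ^ j * X ^ j * lg H ^ 2 ^ j) ^ 4 + (2 ^ j * T) ^ 4) := hpow _ _
      _ ≤ 8 * ((j * 2 ^ j) ^ 4 * (X ^ (4 * j) * (X ^ 4 / D ^ 3)) * lg H ^ e +
            (2 ^ j) ^ 4 * (258 ^ 3 * lg H ^ e * ((j + 1).factorial ^ 4 * (X ^ (4 * j) *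
              (X ^ 4 / D ^ 3))))) := by
          refine mul_le_mul_of_nonneg_left (add_le_add ?_ ?_) (by norm_num)
          · rw [mul_pow, mul_pow, ← pow_mul, ← pow_mul, mul_comm j 4]
            refine mul_le_mul ?_ (pow_le_pow_right₀ hlH ?_) (by positivity) (by positivity)
            · refine mul_le_mul_of_nonneg_left ?_ (by positivity)
              exact le_mul_of_one_le_right (by positivity) hX3
            · rw [he]; linarith [Nat.zero_le (2 ^ (4 * j))]
          · rw [mul_pow]
            refine mul_le_mul_of_nonneg_left (hmom.trans ?_) (by positivity)
            refine mul_le_mul ?_ (le_of_eq ?_) (by positivity) (by positivity)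
            · refine mul_le_mul_of_nonneg_left (pow_le_pow_right₀ hlH ?_) (by positivity)
              omega
            · rw [hHc, mul_pow, ← pow_mul, mul_comm j 4]; ring
      _ = _ := by rw [hE, hd]; field_simp
  have hW := weyl_monomial j θ hA hA'
  set W := ‖∑ x ∈ A, eAdd (θ * (x : ℝ) ^ (j + 1))‖ with hWdef
  have hW0 : 0 ≤ W := norm_nonneg _
  have h4 := pow_le_pow_left₀ (by positivity) hW 4
  rw [mul_pow (_ ^ _ : ℝ) _ 4, mul_pow _ (multiBd _ _ _) 4, mul_pow _ (_ ^ _ : ℝ) 4, ← pow_mul,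
    ← pow_mul, ← pow_mul, mul_comm (2 ^ j) 4, mul_comm (j + 1) 4] at h4
  have hkey : (2 * (X : ℝ)) ^ (4 * (j + 1)) * W ^ (4 * 2 ^ j) ≤
      (2 * (X : ℝ)) ^ (4 * (j + 1)) * (d * lg H ^ e * (X ^ (4 * 2 ^ j) / D ^ 3)) := by
    refine h4.trans ?_
    have h5 : (1 : ℝ) ≤ 2 ^ (4 * (j + 1)) := one_le_pow₀ (by norm_num)
    calc (3 / 2 : ℝ) ^ 4 * (2 * (X : ℝ)) ^ (4 * 2 ^ j) * multiBd j X (θ * (j + 1).factorial) ^ 4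
        ≤ (3 / 2 : ℝ) ^ 4 * (2 * (X : ℝ)) ^ (4 * 2 ^ j) *
          (16 / 81 * (d / 2 ^ (4 * 2 ^ j)) * lg H ^ e * (X ^ (4 * (j + 1)) / D ^ 3)) := by
          gcongr
      _ = X ^ (4 * (j + 1)) * (d * lg H ^ e * (X ^ (4 * 2 ^ j) / D ^ 3)) := by
          rw [mul_pow]; field_simp; norm_num
      _ ≤ _ := by
          rw [mul_pow 2 (X : ℝ) (4 * (j + 1))]
          refine mul_le_mul_of_nonneg_right ?_ (by positivity)
          exact le_mul_of_one_le_left (by positivity) h5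
  have := le_of_mul_le_mul_left hkey (by positivity)
  refine this.trans (mul_le_mul_of_nonneg_right ?_ (by positivity))
  calc d * lg H ^ e ≤ d * (c * lg X) ^ e := by gcongr
    _ = d * c ^ e * lg X ^ e := by rw [mul_pow]; ring
    _ ≤ _ := hC _ (one_le_lg X)

theorem norm_sum_coprime_le {q : ℕ} (hq : 1 ≤ q) (s : ℕ) (G : ℕ → ℂ) :
    ‖∑ n ∈ Icc 1 s, if n.Coprime q then G n else 0‖ ≤
      ∑ d ∈ q.divisors, ‖∑ n ∈ Icc 1 (s / d), G (d * n)‖ := by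
  have hind : ∀ n : ℕ, (if n.Coprime q then G n else 0) =
      ∑ d ∈ q.divisors, if d ∣ n then (ArithmeticFunction.moebius d : ℂ) * G n else 0 := by
    intro n
    have h1 := ArithmeticFunction.coe_zeta_mul_apply
      (f := ArithmeticFunction.moebius) (x := n.gcd q)
    have h3 : (n.gcd q).divisors = q.divisors.filter (fun d => d ∣ n) := by
      ext d
      simp only [Nat.mem_divisors, mem_filter, Nat.dvd_gcd_iff]
      have : n.gcd q ≠ 0 := (Nat.gcd_pos_of_pos_right n hq).ne'
      constructor
      · rintro ⟨⟨h1, h2⟩, -⟩; exact ⟨⟨h2, by omega⟩, h1⟩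
      · rintro ⟨⟨h1, -⟩, h2⟩; exact ⟨⟨h2, h1⟩, this⟩
    rw [ArithmeticFunction.coe_zeta_mul_moebius, ArithmeticFunction.one_apply, h3] at h1
    rw [← sum_filter, ← sum_mul, ← Int.cast_sum, ← h1]
    by_cases h4 : n.Coprime q
    · rw [if_pos h4, if_pos h4]; simp
    · rw [if_neg h4, if_neg h4]; simp
  simp_rw [hind]
  rw [sum_comm]
  refine (norm_sum_le _ _).trans (sum_le_sum fun d hd => ?_)
  have hd0 : 0 < d := Nat.pos_of_mem_divisors hd
  have : ∑ n ∈ Icc 1 s, (if d ∣ n then (ArithmeticFunction.moebius d : ℂ) * G n else 0) =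
      (ArithmeticFunction.moebius d : ℂ) * ∑ n ∈ Icc 1 (s / d), G (d * n) := by
    rw [← sum_filter, mul_sum]
    symm
    refine sum_bij (fun l _ => d * l) ?_ ?_ ?_ ?_
    · intro l hl
      rw [mem_Icc] at hl
      rw [mem_filter, mem_Icc]
      exact ⟨⟨Nat.mul_pos hd0 hl.1, (Nat.mul_le_mul_left d hl.2).trans (Nat.mul_div_le _ _)⟩,
        dvd_mul_right _ _⟩
    · intro l _ l' _ h
      exact Nat.eq_of_mul_eq_mul_left hd0 h
    · intro n hn
      rw [mem_filter, mem_Icc] at hn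
      obtain ⟨l, rfl⟩ := hn.2
      refine ⟨l, mem_Icc.2 ⟨Nat.pos_of_mul_pos_left hn.1.1, ?_⟩, rfl⟩
      rw [Nat.le_div_iff_mul_le hd0, mul_comm]; exact hn.1.2
    · intro l _; rfl
  rw [this, norm_mul]
  refine mul_le_of_le_one_left (norm_nonneg _) ?_
  have h := ArithmeticFunction.abs_moebius_le_one (n := d)
  rw [Complex.norm_intCast]
  exact_mod_cast h

theorem exists_major_weyl_dilate (j : ℕ) (hj : 1 ≤ j) : ∃ C : ℕ, ∀ (N q w d s : ℕ) (a : ℤ)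
    (α β : ℝ), 1 ≤ q → IsCoprime a (q : ℤ) → α = a / q + β → 1 ≤ w →
    4 * (j + 1).factorial * (q * (1 + |β| * N ^ (j + 1))) * w ≤ N →
    q.gcd (w ^ (j + 1)) ≤ d ^ (j + 1) → s ≤ N / w →
      ‖∑ n ∈ Icc 1 s, eAdd (α * ((w * n : ℕ) : ℝ) ^ (j + 1))‖ ^ (4 * 2 ^ j) ≤
        pl C (lg N) * ((N / w : ℝ) ^ (4 * 2 ^ j) * (d : ℝ) ^ (3 * (j + 1)) /
          (q * (1 + |β| * N ^ (j + 1))) ^ 3) := by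
  obtain ⟨C₀, hC₀⟩ := exists_major_weyl j hj
  obtain ⟨C, hC⟩ := exists_pl_affine 0 ((2 : ℝ) ^ (3 * (j + 1))) C₀
  refine ⟨C, fun N q w d s a α β hq ha hα hw hN hd hs => ?_⟩
  have hq1 : (1 : ℝ) ≤ q := by exact_mod_cast hq
  have hw1 : (1 : ℝ) ≤ w := by exact_mod_cast hw
  have hw0 : (0 : ℝ) < w := by linarith
  set k := j + 1 with hk
  set R : ℝ := q * (1 + |β| * N ^ k) with hR
  have hβN : 0 ≤ |β| * (N : ℝ) ^ k := by positivity
  have hR1 : 1 ≤ R := by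
    rw [hR]; nlinarith
  have hf1 : (1 : ℝ) ≤ k.factorial := by exact_mod_cast Nat.factorial_pos k
  have hwN : w ≤ N := by
    have : (w : ℝ) ≤ N := by
      refine le_trans ?_ hN
      have : 1 ≤ 4 * (k.factorial : ℝ) * R := by nlinarith
      nlinarith
    exact_mod_cast this
  set X := N / w with hX
  have hX1 : 1 ≤ X := Nat.div_pos hwN hw
  have hXle : (X : ℝ) ≤ N / w := Nat.cast_div_le
  have hwX : (w : ℝ) * X ≤ N := by exact_mod_cast Nat.mul_div_le N w
  have hwX2 : (N : ℝ) ≤ 2 * (w * X) := by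
    have h1 := Nat.lt_mul_div_succ N hw
    have : N ≤ 2 * (w * X) := by nlinarith
    exact_mod_cast this
  set g := q.gcd (w ^ k) with hg
  have hg0 : 0 < g := Nat.gcd_pos_of_pos_left _ hq
  obtain ⟨r, hr⟩ : g ∣ q := Nat.gcd_dvd_left _ _
  obtain ⟨v, hv⟩ : g ∣ w ^ k := Nat.gcd_dvd_right _ _
  have hr0 : 1 ≤ r := Nat.pos_of_ne_zero (by rintro rfl; omega)
  have hrv : Nat.Coprime v r := by
    have h1 := Nat.coprime_div_gcd_div_gcd (m := q) (n := w ^ k) hg0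
    rw [← hg, hr, hv, Nat.mul_div_cancel_left _ hg0, Nat.mul_div_cancel_left _ hg0] at h1
    exact h1.symm
  have hcop : IsCoprime (a * v) (r : ℤ) := by
    refine IsCoprime.mul_left ?_ (Nat.isCoprime_iff_coprime.2 hrv)
    refine ha.of_isCoprime_of_dvd_right ?_
    rw [hr]; push_cast; exact dvd_mul_left _ _
  have hgR : (0 : ℝ) < g := by exact_mod_cast hg0
  have hrR : (1 : ℝ) ≤ r := by exact_mod_cast hr0
  have hqR : (q : ℝ) = g * r := by exact_mod_cast hr
  have hvR : (w : ℝ) ^ k = g * v := by exact_mod_cast hv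
  have hθ : α * w ^ k = ((a * v : ℤ) : ℝ) / r + β * w ^ k := by
    rw [hα, add_mul]; congr 1
    rw [hqR, hvR]; push_cast; field_simp
  set D : ℝ := r * (1 + |β * w ^ k| * X ^ k) with hD
  have hβw : |β * (w : ℝ) ^ k| * X ^ k = |β| * (w * X) ^ k := by
    rw [abs_mul, abs_of_nonneg (by positivity : (0 : ℝ) ≤ w ^ k), mul_pow]; ring
  have hDR : D ≤ R := by
    rw [hD, hR, hβw]
    have : (r : ℝ) ≤ q := by exact_mod_cast Nat.le_of_dvd hq ⟨g, by rw [hr, mul_comm]⟩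
    gcongr
  have hD0 : 0 < D := by rw [hD]; positivity
  have hDR' : R ≤ (2 * d) ^ k * D := by
    have h1 : |β| * (N : ℝ) ^ k ≤ 2 ^ k * (|β| * (w * X) ^ k) := by
      calc |β| * (N : ℝ) ^ k ≤ |β| * (2 * (w * X)) ^ k := by gcongr
        _ = _ := by rw [mul_pow]; ring
    have h2 : (1 : ℝ) ≤ 2 ^ k := one_le_pow₀ (by norm_num)
    have h3 : (g : ℝ) ≤ d ^ k := by exact_mod_cast hd
    calc R = g * (r * (1 + |β| * N ^ k)) := by rw [hR, hqR]; ring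
      _ ≤ d ^ k * (r * (2 ^ k * (1 + |β| * (w * X) ^ k))) := by
          gcongr
          linarith
      _ = _ := by rw [hD, hβw, mul_pow]; ring
  have hDX : 2 * k.factorial * D ≤ X := by
    have h1 : 2 * k.factorial * D ≤ 2 * k.factorial * R := by gcongr
    have h2 : (4 * k.factorial * R) * w ≤ (2 * X) * w := by linarith
    have := le_of_mul_le_mul_right h2 hw0
    linarith
  have hmain := hC₀ X r (a * v) (α * w ^ k) (β * w ^ k) hX1 hr0 hcop hθ hDX
    (Icc 1 (s : ℤ)) (Icc_subset_Icc le_rfl (by exact_mod_cast hs))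
    (by rw [coe_Icc]; exact Set.ordConnected_Icc)
  rw [sum_Icc_one_natCast] at hmain
  have hsum : ∑ n ∈ Icc 1 s, eAdd (α * ((w * n : ℕ) : ℝ) ^ k) =
      ∑ n ∈ Icc 1 s, eAdd (α * w ^ k * (((n : ℕ) : ℤ) : ℝ) ^ k) := by
    refine sum_congr rfl fun n _ => ?_
    congr 1; push_cast; rw [mul_pow]; ring
  rw [hsum]
  refine hmain.trans ?_
  have hL := one_le_lg N
  have h1 : pl C₀ (lg X) ≤ pl C₀ (lg N) :=
    mul_le_mul_of_nonneg_left
      (pow_le_pow_left₀ (lg_pos X).le (lg_mono (Nat.div_le_self _ _)) _) (by positivity)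
  have h2 : (X : ℝ) ^ (4 * 2 ^ j) / D ^ 3 ≤
      2 ^ (3 * k) * ((N / w : ℝ) ^ (4 * 2 ^ j) * (d : ℝ) ^ (3 * k) / R ^ 3) := by
    rw [← mul_div_assoc, div_le_div_iff₀ (by positivity) (by positivity)]
    calc (X : ℝ) ^ (4 * 2 ^ j) * R ^ 3 ≤ (N / w : ℝ) ^ (4 * 2 ^ j) * ((2 * d) ^ k * D) ^ 3 := by
          gcongr
      _ = _ := by ring
  have h0 := pl_nonneg C₀ hL
  calc _ ≤ pl C₀ (lg N) *
        (2 ^ (3 * k) * ((N / w : ℝ) ^ (4 * 2 ^ j) * (d : ℝ) ^ (3 * k) / R ^ 3)) := by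
        gcongr
    _ = (0 + 2 ^ (3 * k) * pl C₀ (lg N)) *
        ((N / w : ℝ) ^ (4 * 2 ^ j) * (d : ℝ) ^ (3 * k) / R ^ 3) := by ring
    _ ≤ _ := by
        refine mul_le_mul_of_nonneg_right (hC _ hL) (by positivity)

theorem tau_le_rpow {B : ℕ} (hB : 1 ≤ B) {n : ℕ} (hn : 1 ≤ n) :
    tau n ≤ (n : ℝ) ^ (1 / B : ℝ) * lg n ^ 2 ^ B := by
  have hL := one_le_lg n
  have hn0 : (0 : ℝ) ≤ n := Nat.cast_nonneg n
  refine le_of_pow_le_pow_left₀ (n := B) (by omega) (by positivity) ((tau_pow_le B hn).trans ?_)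
  rw [mul_pow, ← Real.rpow_natCast _ B, ← Real.rpow_mul hn0,
    one_div_mul_cancel (by positivity), Real.rpow_one]
  gcongr
  exact le_self_pow₀ (one_le_pow₀ hL) (by omega)

theorem le_mul_rpow_of_pow_le {V P Z R : ℝ} {n : ℕ} (hn : n ≠ 0) (hP : 1 ≤ P) (hZ : 0 ≤ Z)
    (hR : 1 ≤ R) (h : V ^ n ≤ P * (Z ^ n / R ^ 3)) : V ≤ P * (Z * R ^ (-(3 / n) : ℝ)) := by
  have hR0 : 0 < R := by linarith
  refine le_of_pow_le_pow_left₀ hn (by positivity) (h.trans ?_)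
  have hn' : (n : ℝ) ≠ 0 := by exact_mod_cast hn
  have e : (R ^ (-(3 / n) : ℝ)) ^ n = (R ^ 3)⁻¹ := by
    rw [← Real.rpow_natCast, ← Real.rpow_mul hR0.le, neg_mul, div_mul_cancel₀ _ hn',
      Real.rpow_neg hR0.le]
    norm_cast
  rw [mul_pow, mul_pow, e, div_eq_mul_inv]
  gcongr
  exact le_self_pow₀ hP hn

theorem exists_major_typeI (j : ℕ) (hj : 1 ≤ j) : ∃ C : ℕ, ∀ (N N' U q : ℕ) (a : ℤ) (α β R : ℝ),
    1 ≤ q → IsCoprime a (q : ℤ) → α = a / q + β → R = q * (1 + |β| * N ^ (j + 1)) →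
    8 * (j + 1).factorial * R ^ (11 / 6 : ℝ) ≤ N → (U : ℝ) ≤ 2 * R ^ (5 / 9 : ℝ) →
    ∀ t : ℕ → ℕ, ∑ m ∈ Icc 1 U, ‖∑ n ∈ Icc 1 (min (t m) (N / m)),
      (if m * n ≤ N' ∧ (m * n).Coprime q then eAdd (α * ((m * n : ℕ) : ℝ) ^ (j + 1)) else 0)‖ ≤
        pl C (lg N) * (N * R ^ (-(1 : ℝ) / (2 ^ j) ^ 2)) := by
  obtain ⟨C₀, hC₀⟩ := exists_major_weyl_dilate j hj
  set K : ℕ := 2 ^ j with hK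
  have hK2 : 2 ≤ K := by
    calc 2 = 2 ^ 1 := rfl
      _ ≤ 2 ^ j := Nat.pow_le_pow_right (by norm_num) hj
  set B : ℕ := 36 * K ^ 2 with hB
  have hB1 : 1 ≤ B := Nat.pos_of_ne_zero (by positivity)
  obtain ⟨C₁, hC₁⟩ := exists_pl_const 1 (2 ^ B + 1)
  refine ⟨C₁ * C₀ + C₁ + C₀, fun N N' U q a α β R hq ha hα hR hN hU t => ?_⟩
  have hq1 : (1 : ℝ) ≤ q := by exact_mod_cast hq
  have hβN : 0 ≤ |β| * (N : ℝ) ^ (j + 1) := by positivity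
  have hqR : (q : ℝ) ≤ R := by
    rw [hR]; exact le_mul_of_one_le_right (by linarith) (by linarith)
  have hR1 : 1 ≤ R := hq1.trans hqR
  have hR0 : 0 < R := by linarith
  have hK2R : (2 : ℝ) ≤ K := by exact_mod_cast hK2
  have hL := one_le_lg N
  have hP1 := one_le_pl C₀ hL
  have hf1 : (1 : ℝ) ≤ (j + 1).factorial := by exact_mod_cast Nat.factorial_pos (j + 1)
  have hRN : R ≤ N := by
    refine le_trans ?_ hN
    have h1 : R ≤ R ^ (11 / 6 : ℝ) := by
      conv_lhs => rw [← Real.rpow_one R]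
      exact Real.rpow_le_rpow_of_exponent_le hR1 (by norm_num)
    nlinarith
  have hqN : q ≤ N := by exact_mod_cast hqR.trans hRN
  set E : ℝ := R ^ (-(37 / B) : ℝ) with hE
  have hBR : (B : ℝ) = 36 * K ^ 2 := by rw [hB]; push_cast; ring
  have hE1 : R ^ (-(3 / (4 * K : ℕ)) : ℝ) ≤ E := by
    refine Real.rpow_le_rpow_of_exponent_le hR1 (neg_le_neg ?_)
    rw [hBR, div_le_div_iff₀ (by positivity) (by positivity)]
    push_cast
    nlinarith
  have hE2 : R ^ (-(5 / 18) : ℝ) ≤ E := by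
    refine Real.rpow_le_rpow_of_exponent_le hR1 (neg_le_neg ?_)
    rw [hBR, div_le_div_iff₀ (by positivity) (by positivity)]
    nlinarith
  have hE0 : 0 < E := by positivity
  have h3k : 3 * (j + 1) ≤ 4 * K := by
    have : ∀ i : ℕ, 3 * (i + 2) ≤ 4 * 2 ^ (i + 1) := by
      intro i
      induction i with
      | zero => norm_num
      | succ i ih => rw [pow_succ]; omega
    obtain ⟨i, rfl⟩ : ∃ i, j = i + 1 := ⟨j - 1, by omega⟩
    exact this i
  have hm : ∀ m ∈ Icc 1 U, ‖∑ n ∈ Icc 1 (min (t m) (N / m)),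
      (if m * n ≤ N' ∧ (m * n).Coprime q then eAdd (α * ((m * n : ℕ) : ℝ) ^ (j + 1)) else 0)‖ ≤
      tau q * (pl C₀ (lg N) * (N * E)) * (1 / m) := by
    intro m hm
    rw [mem_Icc] at hm
    have hm1 : (1 : ℝ) ≤ m := by exact_mod_cast hm.1
    by_cases hmq : m.Coprime q
    swap
    · rw [sum_eq_zero, norm_zero]
      · have := tau_nonneg q
        positivity
      · intro n _
        rw [if_neg]
        exact fun h => hmq (Nat.Coprime.coprime_mul_right h.2)
    set s := min (min (t m) (N / m)) (N' / m) with hs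
    have hsN : s ≤ N / m := (min_le_left _ _).trans (min_le_right _ _)
    have hsum : ∑ n ∈ Icc 1 (min (t m) (N / m)),
        (if m * n ≤ N' ∧ (m * n).Coprime q then eAdd (α * ((m * n : ℕ) : ℝ) ^ (j + 1)) else 0) =
        ∑ n ∈ Icc 1 s, if n.Coprime q then eAdd (α * ((m * n : ℕ) : ℝ) ^ (j + 1)) else 0 := by
      symm
      rw [← sum_subset (Icc_subset_Icc le_rfl (min_le_left _ _) : Icc 1 s ⊆ _)]
      · refine sum_congr rfl fun n hn => ?_
        have h1 : n ≤ N' / m := (mem_Icc.1 hn).2.trans (min_le_right _ _)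
        have h2 : m * n ≤ N' := by
          rw [mul_comm]; exact (Nat.le_div_iff_mul_le hm.1).1 h1
        have h3 : (m * n).Coprime q ↔ n.Coprime q := by
          rw [Nat.coprime_mul_iff_left]; exact ⟨fun h => h.2, fun h => ⟨hmq, h⟩⟩
        simp only [h2, h3, true_and]
      · intro n hn hn'
        rw [if_neg]
        rintro ⟨h, -⟩
        apply hn'
        rw [mem_Icc] at hn ⊢
        refine ⟨hn.1, le_min hn.2 ?_⟩
        rw [Nat.le_div_iff_mul_le hm.1, mul_comm]; exact h
    rw [hsum]
    refine (norm_sum_coprime_le hq s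
      (fun n => eAdd (α * ((m * n : ℕ) : ℝ) ^ (j + 1)))).trans ?_
    have hd : ∀ d ∈ q.divisors, ‖∑ n ∈ Icc 1 (s / d),
        eAdd (α * ((m * (d * n) : ℕ) : ℝ) ^ (j + 1))‖ ≤ pl C₀ (lg N) * (N / m * E) := by
      intro d hd
      have hd0 : 1 ≤ d := Nat.pos_of_mem_divisors hd
      have hd1 : (1 : ℝ) ≤ d := by exact_mod_cast hd0
      rcases le_or_gt (d : ℝ) (R ^ (5 / 18 : ℝ)) with hdR | hdR
      · have hw : 4 * (j + 1).factorial * (q * (1 + |β| * N ^ (j + 1))) * ((m * d : ℕ) : ℝ)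
            ≤ N := by
          refine le_trans ?_ hN
          rw [← hR]
          have hmU : (m : ℝ) ≤ 2 * R ^ (5 / 9 : ℝ) := le_trans (by exact_mod_cast hm.2) hU
          have e : R ^ (11 / 6 : ℝ) = R * (R ^ (5 / 9 : ℝ) * R ^ (5 / 18 : ℝ)) := by
            rw [← Real.rpow_add hR0]
            conv_rhs => rw [← Real.rpow_one_add' hR0.le (by norm_num)]
            norm_num
          rw [e]
          push_cast
          calc 4 * ((j + 1).factorial : ℝ) * R * (m * d)
              ≤ 4 * (j + 1).factorial * R * ((2 * R ^ (5 / 9 : ℝ)) * R ^ (5 / 18 : ℝ)) := by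
                gcongr
            _ = _ := by ring
        have hg : q.gcd ((m * d) ^ (j + 1)) ≤ d ^ (j + 1) := by
          rw [mul_pow, Nat.gcd_comm, Nat.Coprime.gcd_mul_left_cancel _ (Nat.Coprime.pow_left _ hmq)]
          exact Nat.gcd_le_left _ (Nat.pow_pos hd0)
        have hsd : s / d ≤ N / (m * d) := by
          rw [← Nat.div_div_eq_div_mul]; exact Nat.div_le_div_right hsN
        have h1 := hC₀ N q (m * d) d (s / d) a α β hq ha hα (Nat.mul_pos hm.1 hd0) hw hg hsd
        simp only [← mul_assoc]
        have h2 : (N / ((m * d : ℕ) : ℝ)) ^ (4 * K) * (d : ℝ) ^ (3 * (j + 1)) /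
            (q * (1 + |β| * N ^ (j + 1))) ^ 3 ≤ (N / m : ℝ) ^ (4 * K) / R ^ 3 := by
          rw [← hR]
          gcongr
          calc (N / ((m * d : ℕ) : ℝ)) ^ (4 * K) * (d : ℝ) ^ (3 * (j + 1))
              ≤ (N / ((m * d : ℕ) : ℝ)) ^ (4 * K) * (d : ℝ) ^ (4 * K) := by
                gcongr
            _ = _ := by
                rw [← mul_pow]; congr 1; push_cast; field_simp
        have h3 := le_mul_rpow_of_pow_le (by positivity) hP1 (by positivity) hR1
          (h1.trans (mul_le_mul_of_nonneg_left h2 (by linarith)))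
        simp only [← mul_assoc] at h3 ⊢
        refine h3.trans ?_
        gcongr
      · refine (norm_sum_le _ _).trans ?_
        simp only [norm_eAdd, sum_const, Nat.card_Icc, add_tsub_cancel_right, nsmul_eq_mul, mul_one]
        have h1 : ((s / d : ℕ) : ℝ) ≤ N / m * R ^ (-(5 / 18) : ℝ) := by
          have h2 : ((s / d : ℕ) : ℝ) ≤ s / d := Nat.cast_div_le
          have h3 : (s : ℝ) ≤ N / m := le_trans (by exact_mod_cast hsN) Nat.cast_div_le
          rw [Real.rpow_neg hR0.le, ← div_eq_mul_inv]
          refine h2.trans ?_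
          gcongr
        calc ((s / d : ℕ) : ℝ) ≤ 1 * (N / m * E) := by
              rw [one_mul]
              refine h1.trans ?_
              gcongr
          _ ≤ _ := by gcongr
    calc _ ≤ ∑ d ∈ q.divisors, pl C₀ (lg N) * (N / m * E) := sum_le_sum hd
      _ = _ := by rw [sum_const, nsmul_eq_mul, tau]; ring
  refine (sum_le_sum hm).trans ?_
  rw [← mul_sum]
  have hUN : lg U ≤ lg N := by
    apply lg_mono
    have : (U : ℝ) ≤ N := by
      refine hU.trans (le_trans ?_ hN)
      have h1 : R ^ (5 / 9 : ℝ) ≤ R ^ (11 / 6 : ℝ) :=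
        Real.rpow_le_rpow_of_exponent_le hR1 (by norm_num)
      have h2 : 0 < R ^ (11 / 6 : ℝ) := by positivity
      nlinarith
    exact_mod_cast this
  have hτ : tau q ≤ R ^ (1 / B : ℝ) * lg N ^ 2 ^ B := by
    refine (tau_le_rpow hB1 hq).trans ?_
    have := lg_mono hqN
    have := lg_pos q
    gcongr
  have hP0 := pl_nonneg C₀ hL
  have hexp : R ^ (1 / B : ℝ) * E = R ^ (-(1 : ℝ) / (2 ^ j) ^ 2) := by
    rw [hE, ← Real.rpow_add hR0]
    congr 1
    rw [hBR, hK]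
    push_cast
    field_simp
    norm_num
  calc tau q * (pl C₀ (lg N) * (N * E)) * ∑ m ∈ Icc 1 U, (1 / m : ℝ)
      ≤ (R ^ (1 / B : ℝ) * lg N ^ 2 ^ B) * (pl C₀ (lg N) * (N * E)) * lg N := by
        refine mul_le_mul ?_ ((sum_one_div_le_lg U).trans hUN)
          (sum_nonneg fun _ _ => by positivity) (by positivity)
        gcongr
    _ = (1 * lg N ^ (2 ^ B + 1)) * pl C₀ (lg N) * (N * (R ^ (1 / B : ℝ) * E)) := by
        rw [pow_succ]; ring
    _ ≤ pl C₁ (lg N) * pl C₀ (lg N) * (N * (R ^ (1 / B : ℝ) * E)) := by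
        have := hC₁ _ hL
        gcongr
    _ ≤ _ := by
        rw [hexp]
        exact mul_le_mul_of_nonneg_right (pl_mul_le C₁ C₀ hL) (by positivity)

open Classical in
theorem card_pow_eq_one_le_index_mul {G : Type*} [CommGroup G] [Fintype G] (H : Subgroup G)
    [IsCyclic H] {k : ℕ} (hk : 0 < k) : #{x : G | x ^ k = 1} ≤ k * H.index := by
  have h1 : #{x : G | x ^ k = 1} ≤ k * #(({x : G | x ^ k = 1} : Finset G).image
      (QuotientGroup.mk : G → G ⧸ H)) := by
    refine card_le_mul_card_image _ _ fun c hc => ?_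
    obtain ⟨x₀, hx₀, rfl⟩ := mem_image.1 hc
    rw [mem_filter] at hx₀
    refine le_trans ?_ (IsCyclic.card_pow_eq_one_le (α := H) hk)
    have hmem : ∀ x, x ∈ ({x ∈ ({x : G | x ^ k = 1} : Finset G) |
        (QuotientGroup.mk x : G ⧸ H) = QuotientGroup.mk x₀} : Finset G) → x₀⁻¹ * x ∈ H := by
      intro x hx
      rw [mem_filter] at hx
      exact QuotientGroup.eq.1 hx.2.symm
    refine card_le_card_of_injOn
      (fun x => if h : x₀⁻¹ * x ∈ H then (⟨x₀⁻¹ * x, h⟩ : H) else 1) ?_ ?_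
    · intro x hx
      have hx' := hmem x hx
      simp only [coe_filter, mem_univ, true_and, Set.mem_ofPred_eq, hx', dif_pos] at hx ⊢
      rw [Subtype.ext_iff]
      push_cast
      rw [mul_pow, inv_pow, hx₀.2, (mem_filter.1 hx.1).2]
      simp
    · intro x hx y hy hxy
      simp only [hmem x hx, hmem y hy, dif_pos, Subtype.mk.injEq] at hxy
      exact mul_left_cancel hxy
  refine h1.trans (Nat.mul_le_mul_left k ?_)
  rw [Subgroup.index_eq_card, Nat.card_eq_fintype_card]
  exact card_le_univ _

/-- The number of `k`-th roots of unity modulo `q`. -/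
noncomputable def rootCount (k q : ℕ) : ℕ := Nat.card {x : (ZMod q)ˣ // x ^ k = 1}

open Classical in
theorem rootCount_le_of_cyclic {k q : ℕ} [NeZero q] (hk : 0 < k) (H : Subgroup (ZMod q)ˣ)
    [IsCyclic H] : rootCount k q ≤ k * H.index := by
  rw [rootCount, Nat.card_eq_fintype_card, Fintype.card_subtype]
  convert card_pow_eq_one_le_index_mul H hk

theorem rootCount_prime_pow_le {k p : ℕ} (hk : 0 < k) (hp : p.Prime) (n : ℕ) :
    rootCount k (p ^ n) ≤ k * 2 := by
  have : NeZero (p ^ n) := ⟨pow_ne_zero _ hp.ne_zero⟩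
  by_cases hp2 : p = 2
  · subst hp2
    rcases Nat.lt_or_ge n 3 with hn | hn
    · have : IsCyclic (ZMod (2 ^ n))ˣ := by
        rw [ZMod.isCyclic_units_two_pow_iff]; omega
      refine (rootCount_le_of_cyclic hk ⊤).trans ?_
      rw [Subgroup.index_top]; omega
    · obtain ⟨m, rfl⟩ : ∃ m, n = m + 2 := ⟨n - 2, by omega⟩
      have h5 : IsUnit (5 : ZMod (2 ^ (m + 2))) := by
        have : ((5 : ℕ) : ZMod (2 ^ (m + 2))) = 5 := by norm_cast
        rw [← this, ZMod.isUnit_iff_coprime]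
        exact Nat.Coprime.pow_right _ (by norm_num)
      obtain ⟨u, hu⟩ := h5
      refine (rootCount_le_of_cyclic hk (Subgroup.zpowers u)).trans (Nat.mul_le_mul_left k ?_)
      have h1 : Nat.card (Subgroup.zpowers u) = 2 ^ m := by
        rw [Nat.card_zpowers, ← orderOf_units, hu, ZMod.orderOf_five]
      have h2 := (Subgroup.zpowers u).card_mul_index
      rw [h1, Nat.card_eq_fintype_card, ZMod.card_units_eq_totient,
        Nat.totient_prime_pow Nat.prime_two (by omega)] at h2
      have h3 : 2 ^ m * (Subgroup.zpowers u).index = 2 ^ m * 2 := by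
        rw [h2, show m + 2 - 1 = m + 1 by omega, pow_succ]; norm_num
      exact (Nat.eq_of_mul_eq_mul_left (by positivity) h3).le
  · have := ZMod.isCyclic_units_of_prime_pow p hp hp2 n
    refine (rootCount_le_of_cyclic hk ⊤).trans ?_
    rw [Subgroup.index_top]; omega

theorem rootCount_mul_le {k m n : ℕ} [NeZero m] [NeZero n] (h : m.Coprime n) :
    rootCount k (m * n) ≤ rootCount k m * rootCount k n := by
  have : NeZero (m * n) := ⟨mul_ne_zero (NeZero.ne m) (NeZero.ne n)⟩
  let e : (ZMod (m * n))ˣ ≃* (ZMod m)ˣ × (ZMod n)ˣ :=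
    (Units.mapEquiv (ZMod.chineseRemainder h).toMulEquiv).trans MulEquiv.prodUnits
  rw [rootCount, rootCount, rootCount, ← Nat.card_prod]
  refine Nat.card_le_card_of_injective
    (fun x => (⟨(e x.1).1, ?_⟩, ⟨(e x.1).2, ?_⟩)) ?_
  · rw [← Prod.pow_fst, ← map_pow, x.2, map_one]; rfl
  · rw [← Prod.pow_snd, ← map_pow, x.2, map_one]; rfl
  · intro x y hxy
    simp only [Prod.mk.injEq, Subtype.mk.injEq] at hxy
    exact Subtype.ext (e.injective (Prod.ext hxy.1 hxy.2))

theorem rootCount_le_tau_pow {k q : ℕ} (hk : 0 < k) (hq : 1 ≤ q) :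
    (rootCount k q : ℝ) ≤ tau q ^ (2 * k) := by
  induction q using Nat.recOnPosPrimePosCoprime with
  | zero => omega
  | one =>
    have h := rootCount_prime_pow_le hk Nat.prime_two 0
    have : Subsingleton (ZMod 1)ˣ := inferInstance
    have h1 : rootCount k 1 ≤ 1 := by
      rw [rootCount]; exact Finite.card_le_one_iff_subsingleton.2 inferInstance
    have h2 : (rootCount k 1 : ℝ) ≤ 1 := by exact_mod_cast h1
    simpa [tau] using h2
  | prime_pow p n hp hn =>
    have h := rootCount_prime_pow_le hk hp n
    have h1 : (2 : ℝ) ≤ tau (p ^ n) := by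
      rw [tau, Nat.divisors_prime_pow hp, card_map, card_range]
      exact_mod_cast (by omega : 2 ≤ n + 1)
    have h2 : k * 2 ≤ 2 ^ (2 * k) := by
      have : 2 * k < 2 ^ (2 * k) := Nat.lt_two_pow_self
      omega
    calc (rootCount k (p ^ n) : ℝ) ≤ ((2 ^ (2 * k) : ℕ) : ℝ) := by exact_mod_cast h.trans h2
      _ = (2 : ℝ) ^ (2 * k) := by push_cast; rfl
      _ ≤ _ := by gcongr
  | coprime a b ha hb hab iha ihb =>
    have : NeZero a := ⟨by omega⟩
    have : NeZero b := ⟨by omega⟩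
    have h1 : tau (a * b) = tau a * tau b := by
      rw [tau, tau, tau, hab.card_divisors_mul]; push_cast; rfl
    calc (rootCount k (a * b) : ℝ) ≤ rootCount k a * rootCount k b := by
          exact_mod_cast rootCount_mul_le hab
      _ ≤ tau a ^ (2 * k) * tau b ^ (2 * k) := by
          have := iha (by omega)
          have := ihb (by omega)
          have := tau_nonneg a
          gcongr
      _ = _ := by rw [h1, mul_pow]

theorem one_le_rootCount {k q : ℕ} [NeZero q] : 1 ≤ rootCount k q := by
  have : Nonempty {x : (ZMod q)ˣ // x ^ k = 1} := ⟨⟨1, one_pow k⟩⟩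
  exact Nat.card_pos

theorem card_le_rootCount {k q A : ℕ} [NeZero q] {S : Finset ℕ} {c : ZMod q}
    (hS : S ⊆ Ico A (A + q)) (hco : ∀ x ∈ S, x.Coprime q)
    (hc : ∀ x ∈ S, (x : ZMod q) ^ k = c) : #S ≤ rootCount k q := by
  rcases S.eq_empty_or_nonempty with rfl | ⟨x₀, hx₀⟩
  · simp
  have hu : ∀ x : S, ((ZMod.unitOfCoprime x.1 (hco x.1 x.2)) *
      (ZMod.unitOfCoprime x₀ (hco x₀ hx₀))⁻¹) ^ k = 1 := by
    intro x
    rw [mul_pow, inv_pow, mul_inv_eq_one]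
    ext
    simp [hc x.1 x.2, hc x₀ hx₀]
  rw [rootCount, ← Nat.card_eq_finsetCard]
  refine Nat.card_le_card_of_injective (fun x : S => ⟨_, hu x⟩) ?_
  intro x y hxy
  simp only [Subtype.mk.injEq, mul_left_inj] at hxy
  have h1 : ((x.1 : ℕ) : ZMod q) = (y.1 : ℕ) := by
    simpa using congrArg Units.val hxy
  have hx := mem_Ico.1 (hS x.2)
  have hy := mem_Ico.1 (hS y.2)
  rw [ZMod.natCast_eq_natCast_iff] at h1
  refine Subtype.ext ?_
  have h2 : ((x.1 - A : ℕ)) ≡ (y.1 - A : ℕ) [MOD q] := by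
    refine Nat.ModEq.add_right_cancel' A ?_
    rwa [Nat.sub_add_cancel hx.1, Nat.sub_add_cancel hy.1]
  have h3 := h2.eq_of_lt_of_lt (by omega) (by omega)
  omega

theorem card_le_mul_rootCount {k q A n : ℕ} [NeZero q] {S : Finset ℕ} {c : ZMod q}
    (hS : S ⊆ Ico A (A + q * n)) (hco : ∀ x ∈ S, x.Coprime q)
    (hc : ∀ x ∈ S, (x : ZMod q) ^ k = c) : #S ≤ rootCount k q * n := by
  have hq : 0 < q := Nat.pos_of_ne_zero (NeZero.ne q)
  have h1 : #S ≤ rootCount k q * #(S.image fun x => (x - A) / q) := by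
    refine card_le_mul_card_image _ _ fun i hi => ?_
    refine card_le_rootCount (A := A + q * i) (c := c) ?_ ?_ ?_
    · intro x hx
      rw [mem_filter] at hx
      have h := mem_Ico.1 (hS hx.1)
      rw [Nat.div_eq_iff hq] at hx
      rw [mem_Ico]
      obtain ⟨_, h2, h3⟩ := hx
      rw [mul_comm] at h2 h3
      omega
    · exact fun x hx => hco x (mem_filter.1 hx).1
    · exact fun x hx => hc x (mem_filter.1 hx).1
  refine h1.trans (Nat.mul_le_mul_left _ ?_)
  calc #(S.image fun x => (x - A) / q) ≤ #(range n) := by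
        refine card_le_card fun i hi => ?_
        obtain ⟨x, hx, rfl⟩ := mem_image.1 hi
        have h := mem_Ico.1 (hS hx)
        rw [mem_range, Nat.div_lt_iff_lt_mul hq, mul_comm]
        omega
    _ = n := card_range n

theorem sum_dist_div_le {k q Y y₁ : ℕ} [NeZero q] {S : Finset ℕ} {c : ZMod q}
    (hS : S ⊆ Ico Y (2 * Y)) (hy₁ : y₁ ∈ Ico Y (2 * Y)) (hco : ∀ x ∈ S, x.Coprime q)
    (hc : ∀ x ∈ S, (x : ZMod q) ^ k = c) {h : ℕ → ℝ} (hh : ∀ i, 0 ≤ h i) :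
    ∑ y ∈ S, h (((y - y₁) + (y₁ - y)) / q) ≤
      2 * rootCount k q * ∑ i ∈ range (Y / q + 1), h i := by
  have hq : 0 < q := Nat.pos_of_ne_zero (NeZero.ne q)
  have hmaps : ∀ y ∈ S, ((y - y₁) + (y₁ - y)) / q ∈ range (Y / q + 1) := by
    intro y hy
    have h1 := mem_Ico.1 (hS hy)
    have h2 := mem_Ico.1 hy₁
    rw [mem_range, Nat.lt_succ_iff]
    exact Nat.div_le_div_right (by omega)
  rw [← sum_fiberwise_of_maps_to hmaps, mul_sum]
  refine sum_le_sum fun i _ => ?_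
  rw [sum_congr rfl (fun y hy => by rw [(mem_filter.1 hy).2]) (g := fun _ => h i), sum_const,
    nsmul_eq_mul]
  refine mul_le_mul_of_nonneg_right ?_ (hh i)
  set T := {y ∈ S | ((y - y₁) + (y₁ - y)) / q = i}
  have hT : ∀ y ∈ T, y ∈ S ∧ i * q ≤ (y - y₁) + (y₁ - y) ∧
      (y - y₁) + (y₁ - y) < (i + 1) * q := by
    intro y hy
    rw [mem_filter, Nat.div_eq_iff hq] at hy
    refine ⟨hy.1, hy.2.1, ?_⟩
    rw [add_mul]; omega
  have h1 : #{y ∈ T | y₁ ≤ y} ≤ rootCount k q := by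
    refine card_le_rootCount (A := y₁ + i * q) (c := c) ?_ ?_ ?_
    · intro y hy
      rw [mem_filter] at hy
      have := hT y hy.1
      rw [add_mul] at this
      rw [mem_Ico]; omega
    · exact fun y hy => hco y (hT y (mem_filter.1 hy).1).1
    · exact fun y hy => hc y (hT y (mem_filter.1 hy).1).1
  have h2 : #{y ∈ T | ¬ y₁ ≤ y} ≤ rootCount k q := by
    refine card_le_rootCount (A := y₁ + 1 - (i + 1) * q) (c := c) ?_ ?_ ?_
    · intro y hy
      rw [mem_filter] at hy
      have := hT y hy.1
      rw [add_mul] at *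
      rw [mem_Ico]; omega
    · exact fun y hy => hco y (hT y (mem_filter.1 hy).1).1
    · exact fun y hy => hc y (hT y (mem_filter.1 hy).1).1
  have h3 := card_filter_add_card_filter_not (s := T) (fun y => y₁ ≤ y)
  have h4 : #T ≤ 2 * rootCount k q := by omega
  exact_mod_cast h4

theorem sub_mul_pow_le (Y k : ℕ) {x y : ℕ} (hY : Y ≤ y) (h : y ≤ x) :
    (x - y) * Y ^ k ≤ x ^ (k + 1) - y ^ (k + 1) := by
  obtain ⟨d, rfl⟩ := Nat.exists_eq_add_of_le h
  rw [Nat.add_sub_cancel_left]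
  refine Nat.le_sub_of_add_le ?_
  calc d * Y ^ k + y ^ (k + 1) ≤ d * (y + d) ^ k + y * (y + d) ^ k := by
        rw [pow_succ y k, mul_comm (y ^ k)]
        gcongr <;> omega
    _ = _ := by ring

theorem sum_bd_pow_sub_le {k q Y : ℕ} {a : ℤ} {α β Z : ℝ} (hq : 1 ≤ q)
    (hY : 1 ≤ Y)
    (hc : IsCoprime a (q : ℤ)) (hα : α = a / q + β)
    (hβ : q * |β| * (2 * Y) ^ (k + 1) ≤ 1 / 2) (hZ : 0 ≤ Z) {S : Finset ℕ}
    (hS : S ⊆ Ico Y (2 * Y)) (hco : ∀ x ∈ S, x.Coprime q) {y₁ : ℕ} (hy₁ : y₁ ∈ S) :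
    ∑ y ∈ S, bd Z (α * (((y : ℤ) ^ (k + 1) - (y₁ : ℤ) ^ (k + 1) : ℤ) : ℝ)) ≤
      2 * q * Y + 2 * rootCount (k + 1) q *
        (Z + 2 * lg Y * (Z * Y / (q * (1 + Z * |β| * Y ^ (k + 1))))) := by
  have : NeZero q := ⟨by omega⟩
  have hq0 : (0 : ℝ) < q := by exact_mod_cast hq
  have hq1 : (1 : ℝ) ≤ q := by exact_mod_cast hq
  have hY0 : (0 : ℝ) < Y := by exact_mod_cast hY
  have hsmall : ∀ y ∈ S, |β| * |(((y : ℤ) ^ (k + 1) - (y₁ : ℤ) ^ (k + 1) : ℤ) : ℝ)|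
      ≤ 1 / (2 * q) := by
    intro y hy
    have h1 := mem_Ico.1 (hS hy)
    have h2 := mem_Ico.1 (hS hy₁)
    have h3 : |(((y : ℤ) ^ (k + 1) - (y₁ : ℤ) ^ (k + 1) : ℤ) : ℝ)| ≤ (2 * Y) ^ (k + 1) := by
      push_cast
      have e1 : (y : ℝ) ^ (k + 1) ≤ (2 * Y) ^ (k + 1) := by
        refine pow_le_pow_left₀ (by positivity) ?_ _
        exact_mod_cast h1.2.le
      have e2 : (y₁ : ℝ) ^ (k + 1) ≤ (2 * Y) ^ (k + 1) := by
        refine pow_le_pow_left₀ (by positivity) ?_ _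
        exact_mod_cast h2.2.le
      rw [abs_le]
      constructor <;> nlinarith [pow_nonneg (Nat.cast_nonneg y : (0:ℝ) ≤ y) (k + 1),
        pow_nonneg (Nat.cast_nonneg y₁ : (0:ℝ) ≤ y₁) (k + 1)]
    have h4 := mul_le_mul_of_nonneg_left h3 (by positivity : 0 ≤ q * |β|)
    rw [le_div_iff₀ (by positivity)]
    nlinarith
  rw [← sum_filter_add_sum_filter_not S
    (fun y : ℕ => ¬ (q : ℤ) ∣ ((y : ℤ) ^ (k + 1) - (y₁ : ℤ) ^ (k + 1)))]
  refine add_le_add ?_ ?_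
  · calc _ ≤ ∑ y ∈ S.filter
            (fun y : ℕ => ¬ (q : ℤ) ∣ ((y : ℤ) ^ (k + 1) - (y₁ : ℤ) ^ (k + 1))), (2 * q : ℝ) := by
          refine sum_le_sum fun y hy => ?_
          rw [mem_filter] at hy
          set u : ℤ := (y : ℤ) ^ (k + 1) - (y₁ : ℤ) ^ (k + 1) with hu
          have hnd : ¬ (q : ℤ) ∣ a * u := fun hd => hy.2 (hc.symm.dvd_of_dvd_mul_left hd)
          have h1 := one_div_le_distInt_div hq hnd
          have e : ((a * u : ℤ) : ℝ) / q = α * u + -(β * u) := by rw [hα]; push_cast; ring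
          have h3 := distInt_add_le (α * u) (-(β * u))
          rw [← e, distInt_neg] at h3
          have h4 := distInt_le_abs (β * u)
          have h5 := hsmall y hy.1
          rw [← abs_mul] at h5
          have h6 : (1 : ℝ) / (2 * q) ≤ distInt (α * u) := by
            have : (1 : ℝ) / q = 1 / (2 * q) + 1 / (2 * q) := by field_simp; norm_num
            linarith
          refine (bd_le_one_div hZ (by positivity) h6).trans ?_
          rw [one_div_one_div]
      _ ≤ ∑ y ∈ Ico Y (2 * Y), (2 * q : ℝ) :=
          sum_le_sum_of_subset_of_nonneg ((filter_subset _ _).trans hS) fun _ _ _ => by positivity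
      _ = 2 * q * Y := by
          rw [sum_const, Nat.card_Ico, nsmul_eq_mul, show 2 * Y - Y = Y by omega]; ring
  · simp only [not_not]
    set T := S.filter (fun y : ℕ => (q : ℤ) ∣ ((y : ℤ) ^ (k + 1) - (y₁ : ℤ) ^ (k + 1))) with hT
    set c : ℝ := Z * |β| * Y ^ k * q with hcdef
    have hc0 : 0 ≤ c := by positivity
    set P := Y / q with hP
    have hPle : (P : ℝ) ≤ Y / q := Nat.cast_div_le
    calc _ ≤ ∑ y ∈ T, Z * (1 / (1 + c * ((((y - y₁) + (y₁ - y)) / q : ℕ) : ℝ))) := by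
          refine sum_le_sum fun y hy => ?_
          rw [mem_filter] at hy
          obtain ⟨hyS, v, hv⟩ := hy
          have h5 := hsmall y hyS
          have h1 := mem_Ico.1 (hS hyS)
          have h2 := mem_Ico.1 (hS hy₁)
          have h6 : ((((y - y₁) + (y₁ - y)) / q : ℕ) : ℝ) * q * Y ^ k ≤
              |(((y : ℤ) ^ (k + 1) - (y₁ : ℤ) ^ (k + 1) : ℤ) : ℝ)| := by
            have e1 : (((y - y₁) + (y₁ - y)) / q) * q * Y ^ k ≤
                ((y - y₁) + (y₁ - y)) * Y ^ k := by
              gcongr; exact Nat.div_mul_le_self _ _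
            have e2 : (((y - y₁) + (y₁ - y)) * Y ^ k : ℕ) ≤
                (y ^ (k + 1) - y₁ ^ (k + 1)) + (y₁ ^ (k + 1) - y ^ (k + 1)) := by
              rcases le_total y₁ y with h | h
              · rw [Nat.sub_eq_zero_of_le h, add_zero]
                exact (sub_mul_pow_le Y k h2.1 h).trans (Nat.le_add_right _ _)
              · rw [Nat.sub_eq_zero_of_le h, zero_add]
                exact (sub_mul_pow_le Y k h1.1 h).trans (Nat.le_add_left _ _)
            have e3 : ((((y ^ (k + 1) - y₁ ^ (k + 1)) + (y₁ ^ (k + 1) - y ^ (k + 1)) : ℕ) : ℤ))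
                = |(y : ℤ) ^ (k + 1) - (y₁ : ℤ) ^ (k + 1)| := by
              rcases le_total (y₁ ^ (k + 1)) (y ^ (k + 1)) with h | h
              · rw [Nat.sub_eq_zero_of_le h, add_zero, Nat.cast_sub h, abs_of_nonneg]
                · push_cast; rfl
                · rw [sub_nonneg]; exact_mod_cast h
              · rw [Nat.sub_eq_zero_of_le h, zero_add, Nat.cast_sub h, abs_of_nonpos]
                · push_cast; ring
                · rw [sub_nonpos]; exact_mod_cast h
            rw [← Int.cast_abs, ← e3, Int.cast_natCast]
            exact_mod_cast e1.trans e2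
          have h7 : distInt (α * (((y : ℤ) ^ (k + 1) - (y₁ : ℤ) ^ (k + 1) : ℤ) : ℝ)) =
              |β| * |(((y : ℤ) ^ (k + 1) - (y₁ : ℤ) ^ (k + 1) : ℤ) : ℝ)| := by
            rw [hα, add_mul, ← abs_mul, add_comm]
            rw [show (a : ℝ) / q * (((y : ℤ) ^ (k + 1) - (y₁ : ℤ) ^ (k + 1) : ℤ) : ℝ) =
              ((a * v : ℤ) : ℝ) by rw [hv]; push_cast; field_simp]
            rw [distInt_add_int, distInt_eq_abs]
            rw [abs_mul]
            refine h5.trans ?_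
            rw [div_le_div_iff₀ (by positivity) (by norm_num)]
            linarith
          rw [bd, h7, ← mul_one_div]
          refine mul_le_mul_of_nonneg_left ?_ hZ
          refine one_div_le_one_div_of_le (by positivity) ?_
          have := mul_le_mul_of_nonneg_left h6 (by positivity : 0 ≤ Z * |β|)
          rw [hcdef]
          linarith
      _ ≤ 2 * rootCount (k + 1) q * ∑ i ∈ range (P + 1), Z * (1 / (1 + c * (i : ℝ))) := by
          refine sum_dist_div_le (h := fun i : ℕ => Z * (1 / (1 + c * (i : ℝ))))
            (c := (y₁ : ZMod q) ^ (k + 1)) ((filter_subset _ _).trans hS) (hS hy₁)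
            (fun x hx => hco x (mem_filter.1 hx).1) ?_ (fun i => by positivity)
          intro x hx
          have := (mem_filter.1 hx).2
          rw [← ZMod.intCast_zmod_eq_zero_iff_dvd] at this
          push_cast at this
          exact sub_eq_zero.1 this
      _ ≤ _ := by
          refine mul_le_mul_of_nonneg_left ?_ (by positivity)
          rw [range_eq_Ico, sum_eq_sum_Ico_succ_bot (Nat.succ_pos P)]
          refine add_le_add (by simp) ?_
          rw [← mul_sum]
          have h1 : ∑ l ∈ Ico (0 + 1) (P + 1), 1 / (1 + c * (l : ℝ)) ≤
              2 * lg P * (P / (1 + c * P)) := sum_one_div_one_add_mul_le hc0 P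
          have h2 : (P : ℝ) / (1 + c * P) ≤ (Y / q) / (1 + c * (Y / q)) := by
            rw [div_le_div_iff₀ (by positivity) (by positivity)]
            nlinarith
          have h3 : lg P ≤ lg Y := lg_mono (Nat.div_le_self _ _)
          have h4 := lg_pos P
          have h5 := lg_pos Y
          calc _ ≤ Z * (2 * lg Y * ((Y / q) / (1 + c * (Y / q)))) := by
                refine mul_le_mul_of_nonneg_left (h1.trans ?_) hZ
                gcongr
            _ = _ := by
                rw [hcdef]
                field_simp
                ring

theorem norm_sum_range_eAdd_le (θ : ℝ) (n : ℕ) :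
    ‖∑ i ∈ range n, eAdd (θ * i)‖ ≤ 3 / 2 * bd n θ := by
  have h1 : ‖∑ i ∈ range n, eAdd (θ * i)‖ ≤ n := by
    refine (norm_sum_le _ _).trans ?_
    simp [norm_eAdd]
  have := le_bd_of_le (Nat.cast_nonneg n) h1 (norm_geom_eAdd_mul_le θ n)
  linarith

/-- A dual form of the large sieve inequality. -/
theorem sum_range_norm_sq_le {ι : Type*} (S : Finset ι) (φ : ι → ℝ) (w : ι → ℂ) (Z : ℕ) {B : ℝ}
    (hB : ∀ y₁ ∈ S, ∑ y ∈ S, bd Z (φ y - φ y₁) ≤ B) :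
    ∑ z ∈ range Z, ‖∑ y ∈ S, w y * eAdd (φ y * z)‖ ^ 2 ≤ 3 / 2 * B * ∑ y ∈ S, ‖w y‖ ^ 2 := by
  have e : ((∑ z ∈ range Z, ‖∑ y ∈ S, w y * eAdd (φ y * z)‖ ^ 2 : ℝ) : ℂ) =
      ∑ y ∈ S, ∑ x ∈ S, w y * (starRingEnd ℂ) (w x) *
        ∑ z ∈ range Z, eAdd ((φ y - φ x) * z) := by
    push_cast
    calc _ = ∑ z ∈ range Z, ∑ y ∈ S, ∑ x ∈ S, w y * (starRingEnd ℂ) (w x) *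
          eAdd ((φ y - φ x) * z) := by
          refine sum_congr rfl fun z _ => ?_
          rw [← Complex.mul_conj', map_sum, sum_mul_sum]
          refine sum_congr rfl fun y _ => sum_congr rfl fun x _ => ?_
          rw [map_mul, sub_mul, eAdd_sub]
          ring
      _ = _ := by
          rw [sum_comm]
          refine sum_congr rfl fun y _ => ?_
          rw [sum_comm]
          refine sum_congr rfl fun x _ => ?_
          rw [mul_sum]
  have h0 : 0 ≤ ∑ z ∈ range Z, ‖∑ y ∈ S, w y * eAdd (φ y * z)‖ ^ 2 :=
    sum_nonneg fun _ _ => by positivity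
  have h1 : ∑ z ∈ range Z, ‖∑ y ∈ S, w y * eAdd (φ y * z)‖ ^ 2 ≤
      ∑ y ∈ S, ∑ x ∈ S, ‖w y‖ * ‖w x‖ * (3 / 2 * bd Z (φ y - φ x)) := by
    rw [← abs_of_nonneg h0, ← Real.norm_eq_abs, ← Complex.norm_real, e]
    refine (norm_sum_le _ _).trans (sum_le_sum fun y _ => ?_)
    refine (norm_sum_le _ _).trans (sum_le_sum fun x _ => ?_)
    rw [norm_mul, norm_mul, RCLike.norm_conj]
    exact mul_le_mul_of_nonneg_left (norm_sum_range_eAdd_le _ _) (by positivity)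
  have hbd : ∀ θ, 0 ≤ bd Z θ := bd_nonneg (Nat.cast_nonneg Z)
  have h2 : ∑ y ∈ S, ∑ x ∈ S, ‖w y‖ * ‖w x‖ * (3 / 2 * bd Z (φ y - φ x)) ≤
      ∑ y ∈ S, ∑ x ∈ S, (3 / 4 * (‖w y‖ ^ 2 * bd Z (φ x - φ y)) +
        3 / 4 * (‖w x‖ ^ 2 * bd Z (φ y - φ x))) := by
    refine sum_le_sum fun y _ => sum_le_sum fun x _ => ?_
    have h3 : bd Z (φ x - φ y) = bd Z (φ y - φ x) := by rw [← bd_neg, neg_sub]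
    rw [h3]
    nlinarith [mul_nonneg (hbd (φ y - φ x)) (sq_nonneg (‖w y‖ - ‖w x‖))]
  have h4 : ∑ y ∈ S, ∑ x ∈ S, 3 / 4 * (‖w y‖ ^ 2 * bd Z (φ x - φ y)) ≤
      3 / 4 * (B * ∑ y ∈ S, ‖w y‖ ^ 2) := by
    rw [mul_sum, mul_sum]
    refine sum_le_sum fun y hy => ?_
    rw [← mul_sum, ← mul_sum]
    have := mul_le_mul_of_nonneg_left (hB y hy) (by positivity : 0 ≤ ‖w y‖ ^ 2)
    linarith
  have h5 : ∑ y ∈ S, ∑ x ∈ S, 3 / 4 * (‖w x‖ ^ 2 * bd Z (φ y - φ x)) ≤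
      3 / 4 * (B * ∑ y ∈ S, ‖w y‖ ^ 2) := by
    rw [sum_comm]; exact h4
  simp only [sum_add_distrib] at h2
  linarith

theorem sum_sum_range_pow_add_mul_le {k q X J : ℕ} (hq : 1 ≤ q) (hX : 1 ≤ X)
    {S : Finset ℕ} (hS : S ⊆ Ico X (2 * X)) (hco : ∀ x ∈ S, x.Coprime q) {g : ℕ → ℝ}
    (hg : ∀ z, 0 ≤ g z) :
    ∑ x ∈ S, ∑ i ∈ range J, g (x ^ (k + 1) + q * i) ≤
      (rootCount (k + 1) q * (J / X ^ k + 1) : ℕ) *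
        ∑ z ∈ range ((2 * X) ^ (k + 1) + q * J), g z := by
  have : NeZero q := ⟨by omega⟩
  rw [← sum_product']
  have hmaps : ∀ p ∈ S ×ˢ range J, p.1 ^ (k + 1) + q * p.2 ∈
      range ((2 * X) ^ (k + 1) + q * J) := by
    intro p hp
    rw [mem_product, mem_range] at hp
    have h1 := (mem_Ico.1 (hS hp.1)).2
    have h2 : p.1 ^ (k + 1) ≤ (2 * X) ^ (k + 1) := Nat.pow_le_pow_left h1.le _
    have h3 : q * p.2 < q * J := Nat.mul_lt_mul_of_pos_left hp.2 (by omega)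
    rw [mem_range]; omega
  rw [← sum_fiberwise_of_maps_to hmaps, mul_sum]
  refine sum_le_sum fun z _ => ?_
  rw [sum_congr rfl (fun p hp => by rw [(mem_filter.1 hp).2]) (g := fun _ => g z), sum_const,
    nsmul_eq_mul]
  refine mul_le_mul_of_nonneg_right ?_ (hg z)
  rw [Nat.cast_le]
  set T := {p ∈ S ×ˢ range J | p.1 ^ (k + 1) + q * p.2 = z} with hT
  have hTm : ∀ p ∈ T, p.1 ∈ S ∧ p.2 < J ∧ p.1 ^ (k + 1) + q * p.2 = z := by
    intro p hp
    rw [hT, mem_filter, mem_product, mem_range] at hp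
    exact ⟨hp.1.1, hp.1.2, hp.2⟩
  have hinj : Set.InjOn Prod.fst (T : Set (ℕ × ℕ)) := by
    intro p hp p' hp' h
    have h1 := hTm p hp
    have h2 := hTm p' hp'
    refine Prod.ext h ?_
    rw [h] at h1
    exact Nat.eq_of_mul_eq_mul_left (show 0 < q by omega) (by omega)
  rw [← card_image_of_injOn hinj]
  set T' := T.image Prod.fst with hT'
  rcases T'.eq_empty_or_nonempty with h | hne
  · rw [h]; simp
  have hT'm : ∀ x ∈ T', x ∈ S ∧ ∃ i < J, x ^ (k + 1) + q * i = z := by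
    intro x hx
    obtain ⟨p, hp, rfl⟩ := mem_image.1 hx
    have := hTm p hp
    exact ⟨this.1, p.2, this.2⟩
  refine card_le_mul_rootCount (A := T'.min' hne) (c := (z : ZMod q)) ?_ ?_ ?_
  · intro x hx
    have h0 := T'.min'_le x hx
    obtain ⟨hxS, i, hi, hxi⟩ := hT'm x hx
    obtain ⟨hyS, i', hi', hyi⟩ := hT'm _ (T'.min'_mem hne)
    set y := T'.min' hne
    have h1 := sub_mul_pow_le X k (mem_Ico.1 (hS hyS)).1 h0
    have h2 : q * i' < q * J := Nat.mul_lt_mul_of_pos_left hi' (by omega)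
    have h3 : (x - y) * X ^ k < q * J := by omega
    have h4 : J < (J / X ^ k + 1) * X ^ k := by
      rw [mul_comm]; exact Nat.lt_mul_div_succ J (by positivity)
    have h5 : x - y < q * (J / X ^ k + 1) := by
      by_contra hcon
      push Not at hcon
      have := Nat.mul_le_mul_right (X ^ k) hcon
      have := Nat.mul_le_mul_left q h4.le
      nlinarith
    rw [mem_Ico]; omega
  · exact fun x hx => hco x (hT'm x hx).1
  · intro x hx
    obtain ⟨_, i, _, hxi⟩ := hT'm x hx
    rw [← hxi]
    simp

theorem norm_eAdd_sub_one_le (x : ℝ) : ‖eAdd x - 1‖ ≤ 8 * |x| := by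
  rw [eAdd_eq]
  refine (Real.norm_exp_I_mul_ofReal_sub_one_le).trans ?_
  rw [Real.norm_eq_abs, abs_mul, abs_of_pos (by positivity)]
  nlinarith [Real.pi_lt_four, abs_nonneg x]

theorem sum_norm_sq_pow_le {k q X J : ℕ} {a : ℤ} {α β B : ℝ} (hq : 1 ≤ q) (hX : 1 ≤ X)
    (hJ : 1 ≤ J) (hα : α = a / q + β) {S T : Finset ℕ}
    (hS : S ⊆ Ico X (2 * X)) (hco : ∀ x ∈ S, x.Coprime q)
    (hT : ∀ y ∈ T, q * J * |β| * (y : ℝ) ^ (k + 1) ≤ 1 / 16)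
    (hB : ∀ y₁ ∈ T, ∑ y ∈ T, bd (((2 * X) ^ (k + 1) + q * J : ℕ) : ℝ)
      (α * (((y : ℤ) ^ (k + 1) - (y₁ : ℤ) ^ (k + 1) : ℤ) : ℝ)) ≤ B) (hB0 : 0 ≤ B) (v : ℕ → ℂ) :
    ∑ x ∈ S, ‖∑ y ∈ T, v y * eAdd (α * ((x : ℝ) ^ (k + 1) * (y : ℝ) ^ (k + 1)))‖ ^ 2 ≤
      6 * rootCount (k + 1) q * (1 / X ^ k + 1 / J) * B * ∑ y ∈ T, ‖v y‖ ^ 2 := by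
  have hJ0 : (0 : ℝ) < J := by exact_mod_cast hJ
  have hJc : (J : ℂ) ≠ 0 := by exact_mod_cast hJ0.ne'
  have hq0 : (0 : ℝ) < q := by exact_mod_cast hq
  set m : ℕ → ℂ := fun y => (1 / J : ℂ) * ∑ i ∈ range J, eAdd (q * β * i * (y : ℝ) ^ (k + 1))
    with hm
  have hm1 : ∀ y ∈ T, 1 / 2 ≤ ‖m y‖ := by
    intro y hy
    have h1 : ‖m y - 1‖ ≤ 1 / 2 := by
      have e : m y - 1 = (1 / J : ℂ) * ∑ i ∈ range J, (eAdd (q * β * i * (y : ℝ) ^ (k + 1)) - 1) := by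
        rw [sum_sub_distrib, sum_const, card_range, nsmul_eq_mul, mul_one, mul_sub,
          one_div_mul_cancel hJc]
      rw [e, norm_mul]
      have h2 : ‖∑ i ∈ range J, (eAdd (q * β * i * (y : ℝ) ^ (k + 1)) - 1)‖ ≤ J * (1 / 2) := by
        refine (norm_sum_le _ _).trans ?_
        calc _ ≤ ∑ i ∈ range J, (1 / 2 : ℝ) := by
              refine sum_le_sum fun i hi => (norm_eAdd_sub_one_le _).trans ?_
              have h3 : (i : ℝ) ≤ J := by exact_mod_cast (mem_range.1 hi).le
              have h4 := hT y hy
              rw [abs_mul, abs_mul, abs_mul, abs_of_pos hq0, Nat.abs_cast,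
                abs_of_nonneg (by positivity : 0 ≤ (y : ℝ) ^ (k + 1))]
              have h5 : (q : ℝ) * |β| * i * (y : ℝ) ^ (k + 1) ≤ q * |β| * J * (y : ℝ) ^ (k + 1) := by
                gcongr
              linarith
          _ = _ := by simp
      have h3 : ‖(1 / J : ℂ)‖ = 1 / J := by simp
      rw [h3]
      calc _ ≤ 1 / (J : ℝ) * (J * (1 / 2)) := by gcongr
        _ = _ := by field_simp
    have h2 : ‖(1 : ℂ)‖ ≤ ‖m y‖ + ‖m y - 1‖ := by
      have := norm_sub_le (m y) (m y - 1)
      simpa using this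
    rw [norm_one] at h2
    linarith
  set w : ℕ → ℂ := fun y => v y / m y with hw
  have hwv : ∀ y ∈ T, ‖w y‖ ^ 2 ≤ 4 * ‖v y‖ ^ 2 := by
    intro y hy
    have h1 := hm1 y hy
    have h2 : ‖w y‖ ≤ 2 * ‖v y‖ := by
      rw [hw, norm_div, div_le_iff₀ (by linarith)]
      nlinarith [norm_nonneg (v y)]
    nlinarith [norm_nonneg (w y)]
  set G : ℕ → ℂ := fun z => ∑ y ∈ T, w y * eAdd (α * (y : ℝ) ^ (k + 1) * z) with hG
  have key : ∀ x : ℕ, ∑ y ∈ T, v y * eAdd (α * ((x : ℝ) ^ (k + 1) * (y : ℝ) ^ (k + 1))) =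
      (1 / J : ℂ) * ∑ i ∈ range J, G (x ^ (k + 1) + q * i) := by
    intro x
    rw [hG, sum_comm, mul_sum]
    refine sum_congr rfl fun y hy => ?_
    have hmy : m y ≠ 0 := by
      have := hm1 y hy
      rw [← norm_pos_iff]; linarith
    have e : v y = w y * m y := by rw [hw, div_mul_cancel₀ _ hmy]
    rw [e, hm, ← mul_sum]
    have e2 : ∀ i ∈ range J, eAdd (α * (y : ℝ) ^ (k + 1) * ((x ^ (k + 1) + q * i : ℕ) : ℝ)) =
        eAdd (q * β * i * (y : ℝ) ^ (k + 1)) *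
          eAdd (α * ((x : ℝ) ^ (k + 1) * (y : ℝ) ^ (k + 1))) := by
      intro i _
      rw [← eAdd_add, ← eAdd_add_int (q * β * i * (y : ℝ) ^ (k + 1) +
        α * ((x : ℝ) ^ (k + 1) * (y : ℝ) ^ (k + 1))) (a * i * (y : ℤ) ^ (k + 1))]
      congr 1
      rw [hα]
      push_cast
      field_simp
      ring
    rw [sum_congr rfl e2, ← sum_mul]
    ring
  have h1 : ∀ x : ℕ, ‖∑ y ∈ T, v y * eAdd (α * ((x : ℝ) ^ (k + 1) * (y : ℝ) ^ (k + 1)))‖ ^ 2 ≤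
      1 / J * ∑ i ∈ range J, ‖G (x ^ (k + 1) + q * i)‖ ^ 2 := by
    intro x
    rw [key x, norm_mul, mul_pow]
    have h2 : ‖∑ i ∈ range J, G (x ^ (k + 1) + q * i)‖ ^ 2 ≤
        J * ∑ i ∈ range J, ‖G (x ^ (k + 1) + q * i)‖ ^ 2 := by
      calc _ ≤ (∑ i ∈ range J, ‖G (x ^ (k + 1) + q * i)‖) ^ 2 := by
            gcongr; exact norm_sum_le _ _
        _ ≤ _ := by
            have := sq_sum_le_card_mul_sum_sq (s := range J)
              (f := fun i => ‖G (x ^ (k + 1) + q * i)‖)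
            rwa [card_range] at this
    have h3 : ‖(1 / J : ℂ)‖ = 1 / J := by simp
    rw [h3]
    calc _ ≤ (1 / (J : ℝ)) ^ 2 * (J * ∑ i ∈ range J, ‖G (x ^ (k + 1) + q * i)‖ ^ 2) := by gcongr
      _ = _ := by field_simp
  have h2 := sum_sum_range_pow_add_mul_le (k := k) (J := J) hq hX hS hco (g := fun z => ‖G z‖ ^ 2)
    (fun z => by positivity)
  have h3 := sum_range_norm_sq_le T (fun y => α * (y : ℝ) ^ (k + 1)) w
    ((2 * X) ^ (k + 1) + q * J) (B := B) (by
      intro y₁ hy₁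
      refine le_trans (le_of_eq ?_) (hB y₁ hy₁)
      refine sum_congr rfl fun y _ => ?_
      congr 1
      push_cast
      ring)
  have h4 : ∑ y ∈ T, ‖w y‖ ^ 2 ≤ 4 * ∑ y ∈ T, ‖v y‖ ^ 2 := by
    rw [mul_sum]; exact sum_le_sum hwv
  have h5 : 1 / (J : ℝ) * ((rootCount (k + 1) q * (J / X ^ k + 1) : ℕ) : ℝ) ≤
      rootCount (k + 1) q * (1 / X ^ k + 1 / J) := by
    push_cast
    have h6 : ((J / X ^ k : ℕ) : ℝ) ≤ J / (X : ℝ) ^ k := by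
      have := Nat.cast_div_le (α := ℝ) (m := J) (n := X ^ k)
      exact_mod_cast this
    calc _ ≤ 1 / (J : ℝ) * (rootCount (k + 1) q * (J / (X : ℝ) ^ k + 1)) := by gcongr
      _ = _ := by
        have : (X : ℝ) ≠ 0 := by positivity
        field_simp
  calc _ ≤ ∑ x ∈ S, 1 / (J : ℝ) * ∑ i ∈ range J, ‖G (x ^ (k + 1) + q * i)‖ ^ 2 :=
        sum_le_sum fun x _ => h1 x
    _ = 1 / (J : ℝ) * ∑ x ∈ S, ∑ i ∈ range J, ‖G (x ^ (k + 1) + q * i)‖ ^ 2 := by rw [mul_sum]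
    _ ≤ 1 / (J : ℝ) * ((rootCount (k + 1) q * (J / X ^ k + 1) : ℕ) *
        (3 / 2 * B * ∑ y ∈ T, ‖w y‖ ^ 2)) := by
        refine mul_le_mul_of_nonneg_left (h2.trans ?_) (by positivity)
        exact mul_le_mul_of_nonneg_left h3 (by positivity)
    _ ≤ 1 / (J : ℝ) * ((rootCount (k + 1) q * (J / X ^ k + 1) : ℕ) *
        (3 / 2 * B * (4 * ∑ y ∈ T, ‖v y‖ ^ 2))) := by gcongr
    _ = (1 / (J : ℝ) * ((rootCount (k + 1) q * (J / X ^ k + 1) : ℕ) : ℝ)) *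
        (6 * B * ∑ y ∈ T, ‖v y‖ ^ 2) := by ring
    _ ≤ rootCount (k + 1) q * (1 / X ^ k + 1 / J) * (6 * B * ∑ y ∈ T, ‖v y‖ ^ 2) := by
        refine mul_le_mul_of_nonneg_right h5 ?_
        have : 0 ≤ ∑ y ∈ T, ‖v y‖ ^ 2 := sum_nonneg fun _ _ => by positivity
        positivity
    _ = _ := by ring

theorem sum_norm_sq_major_le {k q X Y : ℕ} {a : ℤ} {α β R : ℝ} (hk : 1 ≤ k) (hq : 1 ≤ q)
    (hY : 1 ≤ Y) (hYX : Y ≤ X) (hc : IsCoprime a (q : ℤ)) (hα : α = a / q + β)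
    (hR : R = q * (1 + |β| * ((X : ℝ) * Y) ^ (k + 1))) (hRX : 2 ^ (k + 5) * R ≤ (X : ℝ) ^ 2)
    {S T : Finset ℕ} (hS : S ⊆ Ico X (2 * X)) (hSco : ∀ x ∈ S, x.Coprime q)
    (hT : T ⊆ Ico Y (2 * Y)) (hTco : ∀ x ∈ T, x.Coprime q) (v : ℕ → ℂ) :
    ∑ x ∈ S, ‖∑ y ∈ T, v y * eAdd (α * ((x : ℝ) ^ (k + 1) * (y : ℝ) ^ (k + 1)))‖ ^ 2 ≤
      6 * 2 ^ (2 * k + 10) * rootCount (k + 1) q ^ 2 * lg Y *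
        ((X + R) * (R * Y / X ^ 2 + 1 + Y / R)) * ∑ y ∈ T, ‖v y‖ ^ 2 := by
  have : NeZero q := ⟨by omega⟩
  have hq1 : (1 : ℝ) ≤ q := by exact_mod_cast hq
  have hX : 1 ≤ X := hY.trans hYX
  have hX1 : (1 : ℝ) ≤ X := by exact_mod_cast hX
  have hY1 : (1 : ℝ) ≤ Y := by exact_mod_cast hY
  have hX0 : (0 : ℝ) < X := by linarith
  have hY0 : (0 : ℝ) < Y := by linarith
  have hρ : (1 : ℝ) ≤ rootCount (k + 1) q := by exact_mod_cast one_le_rootCount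
  set ρ : ℝ := ((rootCount (k + 1) q : ℕ) : ℝ) with hρdef
  have hl := one_le_lg Y
  have hβ : 0 ≤ |β| * ((X : ℝ) * Y) ^ (k + 1) := by positivity
  have hqR : (q : ℝ) ≤ R := by rw [hR]; exact le_mul_of_one_le_right (by linarith) (by linarith)
  have hR1 : 1 ≤ R := hq1.trans hqR
  have hR0 : 0 < R := by linarith
  have hβR : q * |β| * ((X : ℝ) * Y) ^ (k + 1) ≤ R := by rw [hR]; nlinarith
  have hX2 : (X : ℝ) ^ 2 ≤ X ^ (k + 1) := pow_le_pow_right₀ hX1 (by omega)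
  have hp : (0 : ℝ) < 2 ^ (k + 5) := by positivity
  set t : ℝ := (X : ℝ) ^ (k + 1) / (2 ^ (k + 5) * R) with ht
  have ht1 : 1 ≤ t := by rw [ht, one_le_div (by positivity)]; linarith
  have htR : t * (2 ^ (k + 5) * R) = (X : ℝ) ^ (k + 1) := by
    rw [ht, div_mul_cancel₀ _ (by positivity)]
  set J : ℕ := ⌊t⌋₊ with hJ
  have hJ1 : 1 ≤ J := by rw [hJ]; exact Nat.one_le_floor_iff t |>.2 ht1
  have hJt : (J : ℝ) ≤ t := Nat.floor_le (by linarith)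
  have htJ : t ≤ 2 * J := by
    have h1 := Nat.lt_floor_add_one t
    have h2 : (1 : ℝ) ≤ J := by exact_mod_cast hJ1
    rw [← hJ] at h1
    linarith
  have hJ0 : (0 : ℝ) < J := by exact_mod_cast hJ1
  have hqJ : (q : ℝ) * J ≤ X ^ (k + 1) := by
    have h1 : (1 : ℝ) ≤ 2 ^ (k + 5) := one_le_pow₀ (by norm_num)
    calc (q : ℝ) * J ≤ R * t := by gcongr
      _ ≤ t * (2 ^ (k + 5) * R) := by nlinarith [mul_pos hR0 (by linarith : 0 < t)]
      _ = _ := htR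
  have h2Y : q * J * |β| * (2 * (Y : ℝ)) ^ (k + 1) ≤ 1 / 16 := by
    have h1 : q * t * |β| * (2 * (Y : ℝ)) ^ (k + 1) * (2 ^ (k + 5) * R) ≤
        1 / 16 * (2 ^ (k + 5) * R) := by
      calc q * t * |β| * (2 * (Y : ℝ)) ^ (k + 1) * (2 ^ (k + 5) * R)
          = q * |β| * 2 ^ (k + 1) * (Y : ℝ) ^ (k + 1) * (t * (2 ^ (k + 5) * R)) := by
            rw [mul_pow]; ring
        _ = 2 ^ (k + 1) * (q * |β| * ((X : ℝ) * Y) ^ (k + 1)) := by rw [htR, mul_pow]; ring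
        _ ≤ 2 ^ (k + 1) * R := by gcongr
        _ = _ := by ring
    have h2 := le_of_mul_le_mul_right h1 (by positivity)
    refine le_trans ?_ h2
    gcongr
  set Z : ℕ := (2 * X) ^ (k + 1) + q * J with hZ
  have hZc : (Z : ℝ) = 2 ^ (k + 1) * (X : ℝ) ^ (k + 1) + q * J := by
    rw [hZ]; push_cast; rw [mul_pow]
  have h2k : (1 : ℝ) ≤ 2 ^ (k + 1) := one_le_pow₀ (by norm_num)
  have hXk : (0 : ℝ) < (X : ℝ) ^ (k + 1) := by positivity
  have hZ1 : (X : ℝ) ^ (k + 1) ≤ Z := by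
    rw [hZc]; nlinarith [mul_nonneg (by linarith : (0 : ℝ) ≤ q) hJ0.le]
  have hZ2 : (Z : ℝ) ≤ 2 ^ (k + 2) * (X : ℝ) ^ (k + 1) := by
    rw [hZc, pow_succ 2 (k + 1)]; nlinarith
  set B : ℝ := 2 ^ (k + 4) * ρ * lg Y * (R * Y + X ^ (k + 1) * (1 + Y / R)) with hBdef
  have hB0 : 0 ≤ B := by positivity
  have hB : ∀ y₁ ∈ T, ∑ y ∈ T, bd (Z : ℝ)
      (α * (((y : ℤ) ^ (k + 1) - (y₁ : ℤ) ^ (k + 1) : ℤ) : ℝ)) ≤ B := by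
    intro y₁ hy₁
    refine (sum_bd_pow_sub_le hq hY hc hα ?_ (Nat.cast_nonneg Z) hT hTco hy₁).trans ?_
    · have h1 : (1 : ℝ) ≤ J := by exact_mod_cast hJ1
      have h2 : q * |β| * (2 * (Y : ℝ)) ^ (k + 1) * 1 ≤ q * |β| * (2 * (Y : ℝ)) ^ (k + 1) * J := by
        gcongr
      linarith
    · have h1 : (Z : ℝ) * Y / (q * (1 + Z * |β| * Y ^ (k + 1))) ≤
          2 ^ (k + 2) * (X : ℝ) ^ (k + 1) * (Y / R) := by
        rw [mul_div_assoc', hR]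
        refine div_le_div₀ (by positivity) ?_ (by positivity) ?_
        · gcongr
        · rw [mul_pow]
          have : |β| * ((X : ℝ) ^ (k + 1) * Y ^ (k + 1)) ≤ Z * |β| * Y ^ (k + 1) := by
            calc _ = (X : ℝ) ^ (k + 1) * |β| * Y ^ (k + 1) := by ring
              _ ≤ _ := by gcongr
          gcongr
      rw [← hρdef]
      have h3 : (Z : ℝ) + 2 * lg Y * (Z * Y / (q * (1 + Z * |β| * Y ^ (k + 1)))) ≤
          2 * lg Y * (2 ^ (k + 2) * (X : ℝ) ^ (k + 1) * (1 + Y / R)) := by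
        have h4 := mul_le_mul_of_nonneg_left h1 (by positivity : 0 ≤ 2 * lg Y)
        have h5 : (Z : ℝ) ≤ 2 * lg Y * (2 ^ (k + 2) * (X : ℝ) ^ (k + 1)) :=
          hZ2.trans (le_mul_of_one_le_left (by positivity) (by linarith))
        linarith
      have h6 : (2 : ℝ) * q * Y ≤ 2 ^ (k + 4) * ρ * lg Y * (R * Y) := by
        have h7 : (2 : ℝ) ≤ 2 ^ (k + 4) := by
          calc (2 : ℝ) = 2 ^ 1 := by norm_num
            _ ≤ _ := pow_le_pow_right₀ (by norm_num) (by omega)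
        calc (2 : ℝ) * q * Y = 2 * 1 * 1 * (q * Y) := by ring
          _ ≤ _ := by gcongr
      have h8 := mul_le_mul_of_nonneg_left h3 (by positivity : 0 ≤ 2 * ρ)
      calc _ ≤ 2 ^ (k + 4) * ρ * lg Y * (R * Y) +
            2 * ρ * (2 * lg Y * (2 ^ (k + 2) * (X : ℝ) ^ (k + 1) * (1 + Y / R))) :=
            add_le_add h6 h8
        _ = B := by rw [hBdef]; ring
  have h1 := sum_norm_sq_pow_le hq hX hJ1 hα hS hSco (T := T) (fun y hy => ?_) hB hB0 v
  · refine h1.trans (mul_le_mul_of_nonneg_right ?_ (sum_nonneg fun _ _ => by positivity))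
    have h2 : 1 / (J : ℝ) ≤ 2 ^ (k + 6) * (R / X ^ (k + 1)) := by
      rw [mul_div_assoc', div_le_div_iff₀ hJ0 hXk, one_mul, ← htR]
      calc t * (2 ^ (k + 5) * R) ≤ 2 * J * (2 ^ (k + 5) * R) := by gcongr
        _ = _ := by ring
    have h3 : 1 / (X : ℝ) ^ k ≤ 2 ^ (k + 6) * (X / X ^ (k + 1)) := by
      rw [pow_succ (X : ℝ) k, mul_comm ((X : ℝ) ^ k), ← div_div, div_self hX0.ne']
      exact le_mul_of_one_le_left (by positivity) (one_le_pow₀ (by norm_num))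
    have h4 : R * Y / (X : ℝ) ^ (k + 1) ≤ R * Y / X ^ 2 := by gcongr
    calc _ ≤ 6 * ρ * (2 ^ (k + 6) * (X / X ^ (k + 1)) + 2 ^ (k + 6) * (R / X ^ (k + 1))) * B := by
          gcongr
      _ = 6 * 2 ^ (2 * k + 10) * ρ ^ 2 * lg Y *
          ((X + R) * (R * Y / (X : ℝ) ^ (k + 1) + 1 + Y / R)) := by
          rw [hBdef, show 2 * k + 10 = (k + 6) + (k + 4) by omega, pow_add]
          field_simp
          ring
      _ ≤ _ := by gcongr
  · have h3 : (y : ℝ) ≤ 2 * Y := by exact_mod_cast (mem_Ico.1 (hT hy)).2.le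
    refine le_trans ?_ h2Y
    gcongr

theorem sum_range_eAdd_div {P : ℕ} (hP : 1 ≤ P) {y z : ℕ} (hy : y < P) (hz : z < P) :
    ∑ r ∈ range P, eAdd (((y : ℝ) - z) / P * r) = if y = z then (P : ℂ) else 0 := by
  have hP0 : (P : ℝ) ≠ 0 := by positivity
  have h1 : ∑ r ∈ range P, eAdd (((y : ℝ) - z) / P * r) =
      ∑ r ∈ range P, eAdd (((y : ℝ) - z) / P) ^ r := by
    refine sum_congr rfl fun i _ => ?_
    rw [mul_comm, eAdd_nat_mul]
  rw [h1]
  split_ifs with h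
  · subst h
    simp [eAdd_zero]
  · have hnd : ¬ (P : ℤ) ∣ (y : ℤ) - z := by
      intro hd
      have h2 := Int.eq_zero_of_abs_lt_dvd hd (by rw [abs_lt]; omega)
      omega
    have h3 := one_div_le_distInt_div hP hnd
    have h4 := four_mul_distInt_le (((y : ℝ) - z) / P)
    push_cast at h3
    have h5 : (0 : ℝ) < 1 / P := by positivity
    have h6 : eAdd (((y : ℝ) - z) / P) - 1 ≠ 0 := by
      rw [← norm_pos_iff]; linarith
    have h7 := geom_sum_mul (eAdd (((y : ℝ) - z) / P)) P
    rw [← eAdd_nat_mul, mul_div_cancel₀ _ hP0] at h7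
    have h8 : eAdd ((y : ℝ) - z) = 1 := by
      have := eAdd_int ((y : ℤ) - z)
      push_cast at this
      exact this
    rw [h8, sub_self] at h7
    exact (mul_eq_zero.1 h7).resolve_right h6

/-- Completion: initial segments of a sum are controlled by twisted complete sums. -/
theorem exists_prefix_weights {P : ℕ} (hP : 1 ≤ P) : ∃ l : ℕ → ℝ, (∀ r, 0 ≤ l r) ∧
    ∑ r ∈ range P, l r ≤ 96 * lg P ∧ ∀ T ⊆ range P, ∀ (c : ℕ → ℂ) (t : ℕ),
      ‖∑ y ∈ T with y < t, c y‖ ≤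
        ∑ r ∈ range P, l r * ‖∑ y ∈ T, c y * eAdd ((r : ℝ) / P * y)‖ := by
  have hP0 : (0 : ℝ) < P := by exact_mod_cast hP
  have hPc : (P : ℂ) ≠ 0 := by exact_mod_cast hP0.ne'
  have hlP := one_le_lg P
  refine ⟨fun r => 3 / (2 * P) * bd P ((r : ℝ) / P), fun r => ?_, ?_, ?_⟩
  · have := bd_nonneg hP0.le ((r : ℝ) / P)
    positivity
  · have h1 : ∑ r ∈ range P, bd P ((r : ℝ) / P) = ∑ r ∈ Icc 1 P, bd P ((1 : ℝ) / P * r) := by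
      have e : ∀ r : ℕ, bd P ((1 : ℝ) / P * r) = bd P ((r : ℝ) / P) := fun r => by
        rw [one_div_mul_eq_div]
      rw [sum_congr rfl fun r _ => e r]
      obtain ⟨n, rfl⟩ : ∃ n, P = n + 1 := ⟨P - 1, by omega⟩
      have h2 : bd ((n + 1 : ℕ) : ℝ) (((n + 1 : ℕ) : ℝ) / ((n + 1 : ℕ) : ℝ)) =
          bd ((n + 1 : ℕ) : ℝ) (((0 : ℕ) : ℝ) / ((n + 1 : ℕ) : ℝ)) := by
        rw [div_self hP0.ne']
        have h3 : distInt 1 = 0 := by simpa using distInt_int 1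
        have h4 : distInt 0 = 0 := distInt_zero
        simp [bd, h3, h4]
      have h5 := sum_Ico_succ_top (show 1 ≤ n + 1 by omega)
        (fun r : ℕ => bd ((n + 1 : ℕ) : ℝ) ((r : ℝ) / ((n + 1 : ℕ) : ℝ)))
      rw [sum_range_eq_add_Ico _ (Nat.succ_pos n), ← h2, ← Ico_add_one_right_eq_Icc, h5, add_comm]
    rw [← mul_sum, h1]
    have h3 : ∑ r ∈ Icc 1 P, bd P ((1 : ℝ) / P * r) ≤ 16 * (P / P + 1) * (P + P * lg P) := by
      refine IsApprox.sum_bd_le (b := 1) ⟨hP, ?_, ?_⟩ P hP0.le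
      · exact isCoprime_one_left
      · simp
    rw [div_self hP0.ne'] at h3
    calc _ ≤ 3 / (2 * (P : ℝ)) * (16 * (1 + 1) * (P * lg P + P * lg P)) := by
          refine mul_le_mul_of_nonneg_left (h3.trans ?_) (by positivity)
          have : (P : ℝ) ≤ P * lg P := le_mul_of_one_le_right hP0.le hlP
          gcongr
      _ = 96 * lg P := by field_simp; ring
  · intro T hT c t
    have key : ∑ y ∈ T with y < t, c y = ∑ r ∈ range P,
        (1 / P * ∑ z ∈ range (min t P), eAdd (-((r : ℝ) / P) * z)) *
          ∑ y ∈ T, c y * eAdd ((r : ℝ) / P * y) := by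
      have h1 : ∀ y ∈ T, (if y < t then c y else 0) = 1 / P * c y * ∑ z ∈ range (min t P),
          ∑ r ∈ range P, eAdd (((y : ℝ) - z) / P * r) := by
        intro y hy
        have hyP := mem_range.1 (hT hy)
        rw [sum_congr rfl fun z hz => sum_range_eAdd_div hP hyP
          (lt_of_lt_of_le (mem_range.1 hz) (min_le_right _ _)), sum_ite_eq]
        simp only [mem_range, lt_min_iff, hyP, and_true]
        split_ifs
        · field_simp
        · simp
      rw [sum_filter, sum_congr rfl h1]
      simp only [mul_sum, sum_mul]
      rw [sum_congr rfl fun y _ => sum_comm, sum_comm]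
      refine sum_congr rfl fun r _ => ?_
      refine sum_congr rfl fun y _ => ?_
      refine sum_congr rfl fun z _ => ?_
      rw [show ((y : ℝ) - z) / P * r = -((r : ℝ) / P) * z + (r : ℝ) / P * y by ring, eAdd_add]
      ring
    rw [key]
    refine (norm_sum_le _ _).trans (sum_le_sum fun r _ => ?_)
    rw [norm_mul]
    refine mul_le_mul_of_nonneg_right ?_ (norm_nonneg _)
    rw [norm_mul]
    have h2 := norm_sum_range_eAdd_le (-((r : ℝ) / P)) (min t P)
    have h3 : bd ((min t P : ℕ) : ℝ) (-((r : ℝ) / P)) ≤ bd P ((r : ℝ) / P) := by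
      rw [bd_neg]
      exact bd_mono (Nat.cast_nonneg _) (by exact_mod_cast min_le_right _ _) _
    have h4 : ‖(1 / P : ℂ)‖ = 1 / P := by simp
    rw [h4]
    calc _ ≤ 1 / (P : ℝ) * (3 / 2 * bd P ((r : ℝ) / P)) := by gcongr; linarith
      _ = _ := by ring

theorem norm_sq_box_le {k q N' X Y : ℕ} {a : ℤ} {α β R : ℝ} (hk : 1 ≤ k) (hq : 1 ≤ q)
    (hY : 1 ≤ Y) (hYX : Y ≤ X) (hc : IsCoprime a (q : ℤ)) (hα : α = a / q + β)
    (hR : R = q * (1 + |β| * ((X : ℝ) * Y) ^ (k + 1))) (hRX : 2 ^ (k + 5) * R ≤ (X : ℝ) ^ 2)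
    (u v : ℕ → ℂ) :
    ‖∑ x ∈ Ico X (2 * X), ∑ y ∈ Ico Y (2 * Y), u x * v y *
        (if x * y ≤ N' ∧ (x * y).Coprime q then eAdd (α * ((x * y : ℕ) : ℝ) ^ (k + 1)) else 0)‖ ^ 2
      ≤ (96 * lg (2 * Y)) ^ 2 * ((∑ x ∈ Ico X (2 * X), ‖u x‖ ^ 2) *
        (6 * 2 ^ (2 * k + 10) * rootCount (k + 1) q ^ 2 * lg Y *
          ((X + R) * (R * Y / X ^ 2 + 1 + Y / R)) * ∑ y ∈ Ico Y (2 * Y), ‖v y‖ ^ 2)) := by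
  have hX : 1 ≤ X := hY.trans hYX
  obtain ⟨l, hl0, hl, hpre⟩ := exists_prefix_weights (P := 2 * Y) (by omega)
  set S := (Ico X (2 * X)).filter (fun x => x.Coprime q) with hS
  set T := (Ico Y (2 * Y)).filter (fun x => x.Coprime q) with hT
  have hTP : T ⊆ range (2 * Y) := fun y hy =>
    mem_range.2 (mem_Ico.1 ((mem_filter.1 hy).1)).2
  set A := ∑ x ∈ Ico X (2 * X), ‖u x‖ ^ 2 with hA
  set V := ∑ y ∈ Ico Y (2 * Y), ‖v y‖ ^ 2 with hV
  set W : ℝ := 6 * 2 ^ (2 * k + 10) * rootCount (k + 1) q ^ 2 * lg Y *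
    ((X + R) * (R * Y / X ^ 2 + 1 + Y / R)) with hW
  have hR0 : 0 ≤ R := by rw [hR]; positivity
  have hlY := lg_pos Y
  have hW0 : 0 ≤ W := by positivity
  have hA0 : 0 ≤ A := sum_nonneg fun _ _ => by positivity
  have hV0 : 0 ≤ V := sum_nonneg fun _ _ => by positivity
  set g : ℕ → ℕ → ℝ := fun r x => ‖∑ y ∈ T, (v y * eAdd ((r : ℝ) / (2 * Y : ℕ) * y)) *
    eAdd (α * ((x : ℝ) ^ (k + 1) * (y : ℝ) ^ (k + 1)))‖ with hg
  have h1 : ∀ r, ∑ x ∈ S, g r x ^ 2 ≤ W * V := by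
    intro r
    refine (sum_norm_sq_major_le hk hq hY hYX hc hα hR hRX (filter_subset _ _)
      (fun x hx => (mem_filter.1 hx).2) (filter_subset _ _)
      (fun x hx => (mem_filter.1 hx).2) _).trans ?_
    refine mul_le_mul_of_nonneg_left ?_ hW0
    refine (sum_le_sum_of_subset_of_nonneg (filter_subset _ _) fun _ _ _ => by positivity).trans ?_
    refine le_of_eq (sum_congr rfl fun y _ => ?_)
    rw [norm_mul, norm_eAdd, mul_one]
  have h2 : ∀ r, ∑ x ∈ S, ‖u x‖ * g r x ≤ √(A * (W * V)) := by
    intro r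
    refine Real.le_sqrt_of_sq_le ?_
    refine (sum_mul_sq_le_sq_mul_sq _ _ _).trans ?_
    refine mul_le_mul ?_ (h1 r) (sum_nonneg fun _ _ => by positivity) hA0
    exact sum_le_sum_of_subset_of_nonneg (filter_subset _ _) fun _ _ _ => by positivity
  have h3 : ‖∑ x ∈ Ico X (2 * X), ∑ y ∈ Ico Y (2 * Y), u x * v y *
        (if x * y ≤ N' ∧ (x * y).Coprime q then eAdd (α * ((x * y : ℕ) : ℝ) ^ (k + 1)) else 0)‖
      ≤ ∑ x ∈ S, ‖u x‖ * ∑ r ∈ range (2 * Y), l r * g r x := by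
    have e : ∀ x ∈ Ico X (2 * X), (∑ y ∈ Ico Y (2 * Y), u x * v y *
        (if x * y ≤ N' ∧ (x * y).Coprime q then eAdd (α * ((x * y : ℕ) : ℝ) ^ (k + 1)) else 0)) =
        if x.Coprime q then u x * ∑ y ∈ T with y < N' / x + 1, v y *
          eAdd (α * ((x : ℝ) ^ (k + 1) * (y : ℝ) ^ (k + 1))) else 0 := by
      intro x hx
      have hx1 : 0 < x := by have := mem_Ico.1 hx; omega
      split_ifs with hxq
      · rw [mul_sum, hT, filter_filter, sum_filter]
        refine sum_congr rfl fun y _ => ?_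
        have : (x * y ≤ N' ∧ (x * y).Coprime q) ↔ (y.Coprime q ∧ y < N' / x + 1) := by
          rw [Nat.coprime_mul_iff_left, Nat.lt_succ_iff, Nat.le_div_iff_mul_le hx1, mul_comm y x]
          tauto
        simp only [this]
        split_ifs
        · rw [mul_assoc]; push_cast; rw [mul_pow]
        · rw [mul_zero]
      · refine sum_eq_zero fun y _ => ?_
        rw [if_neg, mul_zero]
        rintro ⟨_, h⟩
        exact hxq (Nat.coprime_mul_iff_left.1 h).1
    rw [sum_congr rfl e, ← sum_filter]
    refine (norm_sum_le _ _).trans (sum_le_sum fun x _ => ?_)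
    rw [norm_mul]
    refine mul_le_mul_of_nonneg_left ?_ (norm_nonneg _)
    refine (hpre T hTP _ _).trans (le_of_eq ?_)
    refine sum_congr rfl fun r _ => ?_
    rw [hg]
    congr 2
    exact sum_congr rfl fun y _ => by ring
  have h4 : ∑ x ∈ S, ‖u x‖ * ∑ r ∈ range (2 * Y), l r * g r x ≤
      96 * lg (2 * Y) * √(A * (W * V)) := by
    calc _ = ∑ r ∈ range (2 * Y), l r * ∑ x ∈ S, ‖u x‖ * g r x := by
          simp only [mul_sum]
          rw [sum_comm]
          exact sum_congr rfl fun r _ => sum_congr rfl fun x _ => by ring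
      _ ≤ ∑ r ∈ range (2 * Y), l r * √(A * (W * V)) :=
          sum_le_sum fun r _ => mul_le_mul_of_nonneg_left (h2 r) (hl0 r)
      _ ≤ _ := by
          rw [← sum_mul]
          exact mul_le_mul_of_nonneg_right hl (Real.sqrt_nonneg _)
  calc _ ≤ (96 * lg (2 * Y) * √(A * (W * V))) ^ 2 := by
        gcongr; exact h3.trans h4
    _ = _ := by rw [mul_pow, Real.sq_sqrt (by positivity)]

theorem mul_box_factor_le {X Y N R R' σ K : ℝ} (hY : 1 ≤ Y) (hYX : Y ≤ X) (hXY : X * Y ≤ N)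
    (hR' : 1 ≤ R') (hRR : R' ≤ R) (hRN : R ^ (11 / 6 : ℝ) ≤ N) (hX : X ≤ 2 * N * R ^ (-(5 / 9) : ℝ))
    (hσ0 : 0 ≤ σ) (hσ : σ ≤ R' ^ (1 / 18 : ℝ)) (hK : 4 ≤ K)
    (hRK : R ≤ R' * (N / (X * Y)) ^ K) :
    σ * (X * Y) * ((X + R') * (R' * Y / X ^ 2 + 1 + Y / R')) ≤ 8 * (N * R ^ (-1 / K)) ^ 2 := by
  have hX1 : 1 ≤ X := hY.trans hYX
  have hR1 : 1 ≤ R := hR'.trans hRR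
  have hR0 : 0 < R := by linarith
  have hR'0 : 0 < R' := by linarith
  have hX0 : 0 < X := by linarith
  have hY0 : 0 < Y := by linarith
  have hXY0 : 0 < X * Y := by positivity
  have hN0 : 0 < N := hXY0.trans_le hXY
  have hsq : (N * R ^ (-1 / K)) ^ 2 = N ^ 2 * R ^ (-2 / K) := by
    rw [mul_pow, ← Real.rpow_natCast (R ^ (-1 / K)), ← Real.rpow_mul hR0.le]
    congr 2; push_cast; ring
  rw [hsq]
  have hE : N ^ 2 * R ^ (-(1 / 2) : ℝ) ≤ N ^ 2 * R ^ (-2 / K) := by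
    refine mul_le_mul_of_nonneg_left (Real.rpow_le_rpow_of_exponent_le hR1 ?_) (by positivity)
    rw [neg_div, neg_le_neg_iff, div_le_div_iff₀ (by linarith) (by norm_num)]
    linarith
  have hσR : σ ≤ R ^ (1 / 18 : ℝ) := hσ.trans (Real.rpow_le_rpow (by linarith) hRR (by norm_num))
  have hRpos : 0 < R ^ (-(1 / 2) : ℝ) := by positivity
  -- the two kinds of power savings
  have hA : R ^ (1 / 18 : ℝ) * (R * N) ≤ N ^ 2 * R ^ (-(1 / 2) : ℝ) := by
    have h1 : R ^ (1 / 18 : ℝ) * R = R ^ (14 / 9 : ℝ) * R ^ (-(1 / 2) : ℝ) := by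
      rw [← Real.rpow_add_one hR0.ne', ← Real.rpow_add hR0]; norm_num
    have h2 : R ^ (14 / 9 : ℝ) ≤ N :=
      (Real.rpow_le_rpow_of_exponent_le hR1 (by norm_num)).trans hRN
    calc _ = R ^ (14 / 9 : ℝ) * R ^ (-(1 / 2) : ℝ) * N := by rw [← h1]; ring
      _ ≤ N * R ^ (-(1 / 2) : ℝ) * N := by gcongr
      _ = _ := by ring
  have hB : R ^ (1 / 18 : ℝ) * (N * (2 * N * R ^ (-(5 / 9) : ℝ))) =
      2 * (N ^ 2 * R ^ (-(1 / 2) : ℝ)) := by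
    have h1 : R ^ (1 / 18 : ℝ) * R ^ (-(5 / 9) : ℝ) = R ^ (-(1 / 2) : ℝ) := by
      rw [← Real.rpow_add hR0]; norm_num
    rw [← h1]; ring
  have hYN : Y ≤ N ^ (1 / 2 : ℝ) := by
    rw [← Real.sqrt_eq_rpow]
    refine Real.le_sqrt_of_sq_le ?_
    nlinarith
  have hD : R ^ (1 / 18 : ℝ) * (R ^ 2 * N ^ (1 / 2 : ℝ)) ≤ N ^ 2 * R ^ (-(1 / 2) : ℝ) := by
    have h1 : R ^ (1 / 18 : ℝ) * R ^ 2 = R ^ (23 / 9 : ℝ) * R ^ (-(1 / 2) : ℝ) := by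
      rw [← Real.rpow_natCast, ← Real.rpow_add hR0, ← Real.rpow_add hR0]; norm_num
    have h2 : R ^ (23 / 9 : ℝ) ≤ N ^ (3 / 2 : ℝ) := by
      calc R ^ (23 / 9 : ℝ) ≤ R ^ ((11 / 6 : ℝ) * (3 / 2)) :=
            Real.rpow_le_rpow_of_exponent_le hR1 (by norm_num)
        _ = (R ^ (11 / 6 : ℝ)) ^ (3 / 2 : ℝ) := Real.rpow_mul hR0.le _ _
        _ ≤ _ := Real.rpow_le_rpow (by positivity) hRN (by norm_num)
    have h3 : N ^ (3 / 2 : ℝ) * N ^ (1 / 2 : ℝ) = N ^ 2 := by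
      rw [← Real.rpow_add hN0, ← Real.rpow_natCast]; norm_num
    calc _ = R ^ (23 / 9 : ℝ) * R ^ (-(1 / 2) : ℝ) * N ^ (1 / 2 : ℝ) := by rw [← h1]; ring
      _ ≤ N ^ (3 / 2 : ℝ) * R ^ (-(1 / 2) : ℝ) * N ^ (1 / 2 : ℝ) := by gcongr
      _ = N ^ (3 / 2 : ℝ) * N ^ (1 / 2 : ℝ) * R ^ (-(1 / 2) : ℝ) := by ring
      _ = _ := by rw [h3]
  have hC : σ * ((X * Y) ^ 2 / R') ≤ N ^ 2 * R ^ (-2 / K) := by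
    have h1 : σ / R' ≤ R' ^ (-2 / K) := by
      calc σ / R' ≤ R' ^ (1 / 18 : ℝ) / R' := by gcongr
        _ = R' ^ (1 / 18 - 1 : ℝ) := (Real.rpow_sub_one hR'0.ne' _).symm
        _ ≤ _ := by
          refine Real.rpow_le_rpow_of_exponent_le hR' ?_
          rw [neg_div, le_neg, div_le_iff₀ (by linarith)]
          linarith
    have h2 : R ^ (2 / K) ≤ R' ^ (2 / K) * (N / (X * Y)) ^ 2 := by
      calc R ^ (2 / K) ≤ (R' * (N / (X * Y)) ^ K) ^ (2 / K) :=
            Real.rpow_le_rpow hR0.le hRK (div_nonneg (by norm_num) (by linarith))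
        _ = _ := by
          rw [Real.mul_rpow (by positivity) (by positivity), ← Real.rpow_mul (by positivity),
            mul_div_cancel₀ _ (by linarith : K ≠ 0), ← Real.rpow_natCast (N / (X * Y)) 2]
          norm_num
    rw [neg_div] at h1 ⊢
    rw [Real.rpow_neg hR'0.le] at h1
    rw [Real.rpow_neg hR0.le]
    have h3 : 0 < R ^ (2 / K) := by positivity
    have h4 : 0 < R' ^ (2 / K) := by positivity
    calc σ * ((X * Y) ^ 2 / R') = σ / R' * (X * Y) ^ 2 := by ring
      _ ≤ (R' ^ (2 / K))⁻¹ * (X * Y) ^ 2 := by gcongr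
      _ ≤ N ^ 2 * (R ^ (2 / K))⁻¹ := by
        rw [inv_mul_eq_div, ← div_eq_mul_inv, div_le_div_iff₀ h4 h3]
        calc (X * Y) ^ 2 * R ^ (2 / K) ≤ (X * Y) ^ 2 * (R' ^ (2 / K) * (N / (X * Y)) ^ 2) := by
              gcongr
          _ = _ := by field_simp
  have e : σ * (X * Y) * ((X + R') * (R' * Y / X ^ 2 + 1 + Y / R')) =
      σ * (R' * (Y * Y)) + σ * (X * Y * X) + σ * ((X * Y) ^ 2 / R') + σ * (R' ^ 2 * Y * (Y / X)) +
        σ * (R' * (X * Y)) + σ * (X * Y * Y) := by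
    field_simp
    ring
  have t1 : σ * (R' * (X * Y)) ≤ N ^ 2 * R ^ (-(1 / 2) : ℝ) := by
    refine le_trans ?_ hA
    gcongr
  have t2 : σ * (X * Y * X) ≤ 2 * (N ^ 2 * R ^ (-(1 / 2) : ℝ)) := by
    rw [← hB]
    gcongr
  have t3 : σ * (R' * (Y * Y)) ≤ σ * (R' * (X * Y)) := by gcongr
  have t4 : σ * (X * Y * Y) ≤ σ * (X * Y * X) := by gcongr
  have t5 : σ * (R' ^ 2 * Y * (Y / X)) ≤ N ^ 2 * R ^ (-(1 / 2) : ℝ) := by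
    refine le_trans ?_ hD
    have h1 : Y / X ≤ 1 := by rw [div_le_one hX0]; exact hYX
    calc σ * (R' ^ 2 * Y * (Y / X)) ≤ R ^ (1 / 18 : ℝ) * (R ^ 2 * N ^ (1 / 2 : ℝ) * 1) := by gcongr
      _ = _ := by ring
  rw [e]
  linarith

theorem sum_Ico_tau_le {X N : ℕ} (hX : 1 ≤ X) (hXN : X ≤ N) (B : ℕ) :
    ∑ x ∈ Ico X (2 * X), tau x ^ B ≤ 2 * X * (2 * lg N) ^ 2 ^ B := by
  have h1 : lg (2 * X) ≤ 2 * lg N := (lg_two_mul_le X).trans (by linarith [lg_mono hXN])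
  have h2 := lg_pos (2 * X)
  calc _ ≤ ∑ x ∈ Icc 1 (2 * X), tau x ^ B := by
        refine sum_le_sum_of_subset_of_nonneg ?_ fun n _ _ => by
          have := tau_nonneg n
          positivity
        intro x hx
        rw [mem_Ico] at hx
        rw [mem_Icc]; omega
    _ ≤ _ := sum_tau_pow_le B (2 * X)
    _ ≤ _ := by push_cast; gcongr

theorem norm_sum_box_le_trivial {N X Y : ℕ} (hX : 1 ≤ X) (hXN : X ≤ N) (hY : 1 ≤ Y) (hYN : Y ≤ N)
    {u v : ℕ → ℂ} {F : ℕ → ℕ → ℂ} (hu : ∀ n ≥ 1, ‖u n‖ ≤ tau n) (hv : ∀ n ≥ 1, ‖v n‖ ≤ tau n)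
    (hF : ∀ x y, ‖F x y‖ ≤ 1) :
    ‖∑ x ∈ Ico X (2 * X), ∑ y ∈ Ico Y (2 * Y), u x * v y * F x y‖ ≤
      64 * lg N ^ 4 * (X * Y) := by
  have h1 := sum_Ico_tau_le hX hXN 1
  have h2 := sum_Ico_tau_le hY hYN 1
  simp only [pow_one] at h1 h2
  have h0 := lg_pos N
  calc _ ≤ ∑ x ∈ Ico X (2 * X), ∑ y ∈ Ico Y (2 * Y), tau x * tau y := by
        refine (norm_sum_le _ _).trans (sum_le_sum fun x hx => ?_)
        refine (norm_sum_le _ _).trans (sum_le_sum fun y hy => ?_)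
        rw [mem_Ico] at hx hy
        rw [norm_mul, norm_mul, ← mul_one (tau x * tau y)]
        refine mul_le_mul (mul_le_mul (hu x (by omega)) (hv y (by omega)) (norm_nonneg _)
          (tau_nonneg _)) (hF x y) (norm_nonneg _) (mul_nonneg (tau_nonneg _) (tau_nonneg _))
    _ = (∑ x ∈ Ico X (2 * X), tau x) * ∑ y ∈ Ico Y (2 * Y), tau y := by rw [sum_mul_sum]
    _ ≤ (2 * X * (2 * lg N) ^ 2) * (2 * Y * (2 * lg N) ^ 2) :=
        mul_le_mul h1 h2 (sum_nonneg fun _ _ => tau_nonneg _) (by positivity)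
    _ = _ := by ring

set_option maxHeartbeats 800000 in
theorem exists_major_box_of_le (k : ℕ) (hk : 1 ≤ k) : ∃ C : ℕ, ∀ (N N' X Y q : ℕ) (a : ℤ)
    (α β R : ℝ), 1 ≤ q → IsCoprime a (q : ℤ) → α = a / q + β →
    R = q * (1 + |β| * (N : ℝ) ^ (k + 1)) → R ^ (11 / 6 : ℝ) ≤ N → 1 ≤ Y → Y ≤ X → X * Y ≤ N →
    (X : ℝ) ≤ 2 * N * R ^ (-(5 / 9) : ℝ) → ∀ u v : ℕ → ℂ,
    (∀ n ≥ 1, ‖u n‖ ≤ tau n) → (∀ n ≥ 1, ‖v n‖ ≤ tau n) →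
    ‖∑ x ∈ Ico X (2 * X), ∑ y ∈ Ico Y (2 * Y), u x * v y *
        (if x * y ≤ N' ∧ (x * y).Coprime q then eAdd (α * ((x * y : ℕ) : ℝ) ^ (k + 1)) else 0)‖
      ≤ pl C (lg N) * (N * R ^ (-(1 : ℝ) / (2 ^ k) ^ 2)) := by
  obtain ⟨B, hB⟩ : ∃ B : ℕ, B = 72 * (k + 1) := ⟨_, rfl⟩
  obtain ⟨f, hf⟩ : ∃ f : ℕ, f = 2 ^ B * (4 * (k + 1)) := ⟨_, rfl⟩
  obtain ⟨c, hc⟩ : ∃ c : ℝ, c = 192 ^ 2 * 4 * 256 * 6 * 2 ^ (2 * k + 10) * 8 := ⟨_, rfl⟩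
  obtain ⟨C, hC⟩ := exists_pl_const c (f + 11)
  refine ⟨C, fun N N' X Y q a α β R hq hco hα hR hRN hY hYX hXY hX u v hu hv => ?_⟩
  set K : ℝ := (2 ^ k) ^ 2 with hKdef
  have hX1 : 1 ≤ X := hY.trans hYX
  have hXN : X ≤ N := (Nat.le_mul_of_pos_right X hY).trans hXY
  have hYN : Y ≤ N := hYX.trans hXN
  have hN1 : 1 ≤ N := hX1.trans hXN
  have hY1r : (1 : ℝ) ≤ Y := by exact_mod_cast hY
  have hYXr : (Y : ℝ) ≤ X := by exact_mod_cast hYX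
  have hX1r : (1 : ℝ) ≤ X := by exact_mod_cast hX1
  have hXYr : (X : ℝ) * Y ≤ N := by exact_mod_cast hXY
  have hN1r : (1 : ℝ) ≤ N := by exact_mod_cast hN1
  have hq1 : (1 : ℝ) ≤ q := by exact_mod_cast hq
  have hL := one_le_lg N
  set L := lg N with hLdef
  set R' : ℝ := q * (1 + |β| * ((X : ℝ) * Y) ^ (k + 1)) with hR'
  have hβ0 : 0 ≤ |β| * ((X : ℝ) * Y) ^ (k + 1) := by positivity
  have hqR' : (q : ℝ) ≤ R' := le_mul_of_one_le_right (by linarith) (by linarith)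
  have hR'1 : 1 ≤ R' := hq1.trans hqR'
  have hRR : R' ≤ R := by rw [hR, hR']; gcongr
  have hR1 : 1 ≤ R := hR'1.trans hRR
  have hR0 : 0 < R := by linarith
  have h2k : (2 : ℝ) ≤ 2 ^ k := le_self_pow₀ (by norm_num) (by omega)
  have hK4 : 4 ≤ K := by rw [hKdef]; nlinarith
  have hRle : R ≤ N * R ^ (-(1 : ℝ) / K) := by
    calc R = R ^ (11 / 6 : ℝ) * R ^ (-(5 / 6) : ℝ) := by
          rw [← Real.rpow_add hR0]; norm_num
      _ ≤ N * R ^ (-(1 : ℝ) / K) := by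
          refine mul_le_mul hRN (Real.rpow_le_rpow_of_exponent_le hR1 ?_) (by positivity)
            (by linarith)
          rw [neg_div, neg_le_neg_iff, div_le_iff₀ (by linarith)]
          linarith
  set E := (N : ℝ) * R ^ (-(1 : ℝ) / K) with hE
  have hE0 : 0 ≤ E := by positivity
  have hpk : (1 : ℝ) ≤ 2 ^ (2 * k + 10) := one_le_pow₀ (by norm_num)
  have hc1 : 1 ≤ c := by rw [hc]; nlinarith
  have hLf : 1 ≤ L ^ (f + 11) := one_le_pow₀ hL
  rcases lt_or_ge ((X : ℝ) * Y) (2 ^ (k + 5) * R') with hcase | hcase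
  · refine (norm_sum_box_le_trivial (N := N) hX1 hXN hY hYN hu hv (F := fun x y =>
      if x * y ≤ N' ∧ (x * y).Coprime q then eAdd (α * ((x * y : ℕ) : ℝ) ^ (k + 1)) else 0)
      (fun x y => ?_)).trans ?_
    · split_ifs
      · rw [norm_eAdd]
      · rw [norm_zero]; exact zero_le_one
    · refine le_trans ?_ (mul_le_mul_of_nonneg_right (hC L hL) hE0)
      have h1 : (X : ℝ) * Y ≤ 2 ^ (k + 5) * E :=
        hcase.le.trans (by gcongr; exact hRR.trans hRle)
      have h2 : (64 : ℝ) * 2 ^ (k + 5) ≤ c := by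
        have : (2 : ℝ) ^ (k + 5) ≤ 2 ^ (2 * k + 10) :=
          pow_le_pow_right₀ (by norm_num) (by omega)
        rw [hc]; nlinarith
      have h3 : L ^ 4 ≤ L ^ (f + 11) := pow_le_pow_right₀ hL (by omega)
      calc 64 * L ^ 4 * (X * Y) ≤ 64 * L ^ 4 * (2 ^ (k + 5) * E) := by gcongr
        _ = 64 * 2 ^ (k + 5) * L ^ 4 * E := by ring
        _ ≤ c * L ^ (f + 11) * E := by gcongr
  · have hbox := norm_sq_box_le (N' := N') hk hq hY hYX hco hα hR'
      (hcase.trans (by nlinarith)) u v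
    set S := ‖∑ x ∈ Ico X (2 * X), ∑ y ∈ Ico Y (2 * Y), u x * v y *
        (if x * y ≤ N' ∧ (x * y).Coprime q then eAdd (α * ((x * y : ℕ) : ℝ) ^ (k + 1)) else 0)‖
    set W : ℝ := (X + R') * (R' * Y / X ^ 2 + 1 + Y / R') with hW
    have hW0 : 0 ≤ W := by positivity
    have hqN : q ≤ N := by
      have : (q : ℝ) ≤ N := by
        refine (hqR'.trans hRR).trans (le_trans ?_ hRN)
        calc R = R ^ (1 : ℝ) := (Real.rpow_one R).symm
          _ ≤ _ := Real.rpow_le_rpow_of_exponent_le hR1 (by norm_num)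
      exact_mod_cast this
    set σ : ℝ := (q : ℝ) ^ (1 / 18 : ℝ) with hσ
    have hσ0 : 0 ≤ σ := by positivity
    have hρ : (rootCount (k + 1) q : ℝ) ^ 2 ≤ σ * L ^ f := by
      have h1 := rootCount_le_tau_pow (k := k + 1) (by omega) hq
      have h2 := tau_le_rpow (B := B) (by omega) hq
      have h3 : lg q ≤ L := lg_mono hqN
      have h4 := lg_pos q
      have h5 := tau_nonneg q
      calc (rootCount (k + 1) q : ℝ) ^ 2 ≤ (tau q ^ (2 * (k + 1))) ^ 2 := by gcongr
        _ = tau q ^ (4 * (k + 1)) := by rw [← pow_mul]; congr 1; ring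
        _ ≤ ((q : ℝ) ^ (1 / B : ℝ) * L ^ 2 ^ B) ^ (4 * (k + 1)) := by
            refine pow_le_pow_left₀ h5 (h2.trans ?_) _
            gcongr
        _ = σ * L ^ f := by
            rw [mul_pow, ← pow_mul, ← hf, hσ, ← Real.rpow_natCast, ← Real.rpow_mul (by positivity)]
            congr 2
            rw [hB]; push_cast; field_simp; norm_num
    have hA : ∑ x ∈ Ico X (2 * X), ‖u x‖ ^ 2 ≤ 2 * X * (2 * L) ^ 4 := by
      refine le_trans (sum_le_sum fun x hx => ?_) (sum_Ico_tau_le hX1 hXN 2)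
      have := hu x (by rw [mem_Ico] at hx; omega)
      gcongr
    have hV : ∑ y ∈ Ico Y (2 * Y), ‖v y‖ ^ 2 ≤ 2 * Y * (2 * L) ^ 4 := by
      refine le_trans (sum_le_sum fun x hx => ?_) (sum_Ico_tau_le hY hYN 2)
      have := hv x (by rw [mem_Ico] at hx; omega)
      gcongr
    have hl2Y : lg (2 * Y) ≤ 2 * L := (lg_two_mul_le Y).trans (by linarith [lg_mono hYN])
    have hlY : lg Y ≤ L := lg_mono hYN
    have hl2Y0 := lg_pos (2 * Y)
    have hlY0 := lg_pos Y
    have hRK : R ≤ R' * ((N : ℝ) / (X * Y)) ^ K := by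
      have hXY0 : (0 : ℝ) < X * Y := by positivity
      have hg : 1 ≤ (N : ℝ) / (X * Y) := by rw [one_le_div hXY0]; exact hXYr
      set g := (N : ℝ) / (X * Y) with hgdef
      have hNg : (N : ℝ) = X * Y * g := by rw [hgdef]; field_simp
      have h1 : g ^ (k + 1) ≤ g ^ K := by
        rw [← Real.rpow_natCast]
        refine Real.rpow_le_rpow_of_exponent_le hg ?_
        have h3 : k + 1 ≤ 2 ^ k := Nat.lt_two_pow_self
        have h4 : ((k + 1 : ℕ) : ℝ) ≤ 2 ^ k := by exact_mod_cast h3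
        rw [hKdef]; nlinarith
      have h2 : 1 ≤ g ^ (k + 1) := one_le_pow₀ hg
      calc R = q * (1 + |β| * ((X : ℝ) * Y) ^ (k + 1) * g ^ (k + 1)) := by
            rw [hR, hNg, mul_pow _ g]; ring
        _ ≤ q * (1 * g ^ (k + 1) + |β| * ((X : ℝ) * Y) ^ (k + 1) * g ^ (k + 1)) := by
            gcongr; linarith
        _ = R' * g ^ (k + 1) := by rw [hR']; ring
        _ ≤ R' * g ^ K := by gcongr
    have hmain := mul_box_factor_le hY1r hYXr hXYr hR'1 hRR hRN hX hσ0
      (Real.rpow_le_rpow (by positivity) hqR' (by norm_num)) hK4 hRK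
    rw [← hW, ← hE] at hmain
    have hS2 : S ^ 2 ≤ (c * L ^ (f + 11) * E) ^ 2 := by
      calc S ^ 2 ≤ (96 * (2 * L)) ^ 2 * (2 * X * (2 * L) ^ 4 *
            (6 * 2 ^ (2 * k + 10) * (σ * L ^ f) * L * W * (2 * Y * (2 * L) ^ 4))) := by
            refine hbox.trans ?_
            gcongr
        _ = c / 8 * L ^ (f + 11) * (σ * (X * Y) * W) := by rw [hc]; ring
        _ ≤ c / 8 * L ^ (f + 11) * (8 * E ^ 2) := by gcongr
        _ = c * L ^ (f + 11) * E ^ 2 := by ring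
        _ ≤ (c * L ^ (f + 11)) ^ 2 * E ^ 2 := by
            gcongr
            exact le_self_pow₀ (one_le_mul_of_one_le_of_one_le hc1 hLf) (by norm_num)
        _ = _ := by ring
    have hS : S ≤ c * L ^ (f + 11) * E := le_of_sq_le_sq hS2 (by positivity)
    exact hS.trans (mul_le_mul_of_nonneg_right (hC L hL) hE0)

theorem exists_major_box (k : ℕ) (hk : 1 ≤ k) : ∃ C : ℕ, ∀ (N N' X Y q : ℕ) (a : ℤ)
    (α β R : ℝ), 1 ≤ q → IsCoprime a (q : ℤ) → α = a / q + β →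
    R = q * (1 + |β| * (N : ℝ) ^ (k + 1)) → R ^ (11 / 6 : ℝ) ≤ N → 1 ≤ X → 1 ≤ Y → X * Y ≤ N →
    (X : ℝ) ≤ 2 * N * R ^ (-(5 / 9) : ℝ) → (Y : ℝ) ≤ 2 * N * R ^ (-(5 / 9) : ℝ) →
    ∀ u v : ℕ → ℂ, (∀ n ≥ 1, ‖u n‖ ≤ tau n) → (∀ n ≥ 1, ‖v n‖ ≤ tau n) →
    ‖∑ x ∈ Ico X (2 * X), ∑ y ∈ Ico Y (2 * Y), u x * v y *
        (if x * y ≤ N' ∧ (x * y).Coprime q then eAdd (α * ((x * y : ℕ) : ℝ) ^ (k + 1)) else 0)‖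
      ≤ pl C (lg N) * (N * R ^ (-(1 : ℝ) / (2 ^ k) ^ 2)) := by
  obtain ⟨C, hC⟩ := exists_major_box_of_le k hk
  refine ⟨C, fun N N' X Y q a α β R hq hco hα hR hRN hX hY hXY hXR hYR u v hu hv => ?_⟩
  rcases le_total Y X with h | h
  · exact hC N N' X Y q a α β R hq hco hα hR hRN hY h hXY hXR u v hu hv
  · have := hC N N' Y X q a α β R hq hco hα hR hRN hX h (by rwa [mul_comm]) hYR v u hv hu
    rw [sum_comm] at this
    refine (le_of_eq (congrArg norm (sum_congr rfl fun x _ => sum_congr rfl fun y _ => ?_))).trans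
      this
    rw [mul_comm (u x), Nat.mul_comm x y]

theorem exists_major_typeII (k : ℕ) (hk : 1 ≤ k) : ∃ C : ℕ, ∀ (N N' U q : ℕ) (a : ℤ)
    (α β R : ℝ), 1 ≤ q → IsCoprime a (q : ℤ) → α = a / q + β →
    R = q * (1 + |β| * (N : ℝ) ^ (k + 1)) → R ^ (11 / 6 : ℝ) ≤ N → N' ≤ N →
    R ^ (5 / 9 : ℝ) ≤ U → ∀ M, U < 2 * M → M * (U + 1) ≤ N → ∀ u v : ℕ → ℂ,
    (∀ n ≥ 1, ‖u n‖ ≤ tau n) → (∀ n ≥ 1, ‖v n‖ ≤ tau n) →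
    ‖∑ m ∈ Ico M (2 * M), ∑ n ∈ Icc 1 (N / m), u m * v n *
        (if m * n ≤ N' ∧ (m * n).Coprime q then eAdd (α * ((m * n : ℕ) : ℝ) ^ (k + 1)) else 0)‖
      ≤ 2 * lg N * (pl C (lg N) * (N * R ^ (-(1 : ℝ) / (2 ^ k) ^ 2))) := by
  obtain ⟨C, hC⟩ := exists_major_box k hk
  refine ⟨C, fun N N' U q a α β R hq hco hα hR hRN hN' hRU M hUM hMU u v hu hv => ?_⟩
  have hq1 : (1 : ℝ) ≤ q := by exact_mod_cast hq
  have hR1 : 1 ≤ R := by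
    rw [hR]
    have : 0 ≤ |β| * (N : ℝ) ^ (k + 1) := by positivity
    nlinarith
  have hR0 : 0 < R := by linarith
  have hM : 1 ≤ M := by omega
  have hN1 : 1 ≤ N := le_trans (Nat.mul_pos hM (Nat.succ_pos U)) hMU
  have hE0 : 0 ≤ pl C (lg N) * (N * R ^ (-(1 : ℝ) / (2 ^ k) ^ 2)) :=
    mul_nonneg (pl_nonneg C (one_le_lg N)) (by positivity)
  set F : ℕ → ℂ := fun n =>
    if n ≤ N' ∧ n.Coprime q then eAdd (α * ((n : ℕ) : ℝ) ^ (k + 1)) else 0 with hF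
  have hF0 : ∀ n, N < n → F n = 0 := fun n hn => by
    rw [hF]; exact if_neg fun h => by omega
  set A : ℕ → ℂ := fun n => ∑ m ∈ Ico M (2 * M), u m * v n * F (m * n) with hA
  have hA0 : ∀ n, N / M < n → A n = 0 := fun n hn => by
    refine sum_eq_zero fun m hm => ?_
    rw [mem_Ico] at hm
    rw [hF0, mul_zero]
    rw [Nat.div_lt_iff_lt_mul hM] at hn
    calc N < n * M := hn
      _ ≤ n * m := Nat.mul_le_mul_left _ hm.1
      _ = m * n := mul_comm _ _
  have hswap : ∑ m ∈ Ico M (2 * M), ∑ n ∈ Icc 1 (N / m), u m * v n * F (m * n) =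
      ∑ n ∈ Icc 1 (N / M), A n := by
    have h : ∑ n ∈ Icc 1 (N / M), A n =
        ∑ m ∈ Ico M (2 * M), ∑ n ∈ Icc 1 (N / M), u m * v n * F (m * n) := sum_comm
    rw [h]
    refine sum_congr rfl fun m hm => ?_
    rw [mem_Ico] at hm
    refine sum_subset (Icc_subset_Icc_right (Nat.div_le_div_left hm.1 hM)) fun n hn hn' => ?_
    rw [mem_Icc] at hn hn'
    have h1 : N / m < n := by omega
    rw [Nat.div_lt_iff_lt_mul (by omega)] at h1
    rw [hF0 _ (by linarith [mul_comm m n]), mul_zero]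
  have hcancel : R ^ (5 / 9 : ℝ) * R ^ (-(5 / 9) : ℝ) = 1 := by
    rw [← Real.rpow_add hR0]; norm_num
  have hinv : 0 < R ^ (-(5 / 9) : ℝ) := by positivity
  have key : ∀ Z : ℕ, (Z : ℝ) * U ≤ 2 * N → (Z : ℝ) ≤ 2 * N * R ^ (-(5 / 9) : ℝ) := by
    intro Z hZ
    have : (Z : ℝ) * R ^ (5 / 9 : ℝ) ≤ 2 * N := le_trans (by gcongr) hZ
    calc (Z : ℝ) = Z * R ^ (5 / 9 : ℝ) * R ^ (-(5 / 9) : ℝ) := by rw [mul_assoc, hcancel, mul_one]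
      _ ≤ _ := by gcongr
  change ‖∑ m ∈ Ico M (2 * M), ∑ n ∈ Icc 1 (N / m), u m * v n * F (m * n)‖ ≤ _
  rw [hswap]
  refine (norm_sum_dyadic_le (N / M) A hA0 (B := pl C (lg N) *
    (N * R ^ (-(1 : ℝ) / (2 ^ k) ^ 2))) fun i => ?_).trans ?_
  · rcases le_or_gt (M * 2 ^ i) N with h | h
    · rw [hA, sum_comm]
      refine hC N N' M (2 ^ i) q a α β R hq hco hα hR hRN hM Nat.one_le_two_pow h
        (key _ ?_) (key _ ?_) u v hu hv
      · have : M * U ≤ 2 * N := by nlinarith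
        exact_mod_cast this
      · have : 2 ^ i * U ≤ 2 * N := by
          calc 2 ^ i * U ≤ 2 ^ i * (2 * M) := Nat.mul_le_mul_left _ hUM.le
            _ ≤ 2 * N := by linarith
        exact_mod_cast this
    · rw [sum_eq_zero, norm_zero]
      · exact hE0
      · intro n hn
        rw [mem_Ico] at hn
        refine hA0 n ?_
        rw [Nat.div_lt_iff_lt_mul hM]
        calc N < M * 2 ^ i := h
          _ ≤ M * n := Nat.mul_le_mul_left _ hn.1
          _ = n * M := mul_comm _ _
  · have := lg_mono (Nat.div_le_self N M)
    gcongr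

theorem exists_major_vonMangoldt (k : ℕ) (hk : 1 ≤ k) : ∃ C : ℕ, ∀ (N N' q : ℕ) (a : ℤ)
    (α β R : ℝ), 1 ≤ q → IsCoprime a (q : ℤ) → α = a / q + β →
    R = q * (1 + |β| * (N : ℝ) ^ (k + 1)) → 8 * (k + 1).factorial * R ^ (11 / 6 : ℝ) ≤ N →
    N' ≤ N →
    ‖∑ n ∈ Icc 1 N, (ArithmeticFunction.vonMangoldt n : ℂ) *
        (if n ≤ N' ∧ n.Coprime q then eAdd (α * (n : ℝ) ^ (k + 1)) else 0)‖
      ≤ pl C (lg N) * (N * R ^ (-(1 : ℝ) / (2 ^ k) ^ 2)) := by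
  obtain ⟨C₁, hC₁⟩ := exists_major_typeI k hk
  obtain ⟨C₂, hC₂⟩ := exists_major_typeII k hk
  obtain ⟨D₀, hD₀⟩ := exists_pl_const 2 1
  obtain ⟨D₁, hD₁⟩ := exists_pl_const 3 1
  obtain ⟨D₂, hD₂⟩ := exists_pl_const 8 3
  refine ⟨D₀ + (D₁ * C₁ + D₁ + C₁) + 1 + (D₂ * C₂ + D₂ + C₂) + 1,
    fun N N' q a α β R hq hco hα hR hRN hN' => ?_⟩
  have hL := one_le_lg N
  set E := (N : ℝ) * R ^ (-(1 : ℝ) / (2 ^ k) ^ 2) with hE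
  have hq1 : (1 : ℝ) ≤ q := by exact_mod_cast hq
  have hR1 : 1 ≤ R := by
    rw [hR]
    have : 0 ≤ |β| * (N : ℝ) ^ (k + 1) := by positivity
    nlinarith
  have hR0 : 0 < R := by linarith
  have hE0 : 0 ≤ E := by positivity
  have hfac : (2 : ℝ) ≤ (k + 1).factorial := by
    have : Nat.factorial 2 ≤ (k + 1).factorial := Nat.factorial_le (by omega)
    exact_mod_cast this
  have hRp : 0 < R ^ (11 / 6 : ℝ) := by positivity
  have hRN16 : 16 * R ^ (11 / 6 : ℝ) ≤ N := le_trans (by nlinarith) hRN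
  have hR59 : 1 ≤ R ^ (5 / 9 : ℝ) := Real.one_le_rpow hR1 (by norm_num)
  set U : ℕ := ⌈R ^ (5 / 9 : ℝ)⌉₊ with hU
  have hU1 : R ^ (5 / 9 : ℝ) ≤ U := Nat.le_ceil _
  have hU2 : (U : ℝ) ≤ 2 * R ^ (5 / 9 : ℝ) := by
    have := Nat.ceil_lt_add_one (a := R ^ (5 / 9 : ℝ)) (by positivity)
    linarith
  have hUpos : 1 ≤ U := by
    have : (1 : ℝ) ≤ U := hR59.trans hU1
    exact_mod_cast this
  have hUN : U ^ 2 * (U + 1) ≤ N := by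
    have h1 : (U : ℝ) ^ 2 * (U + 1) ≤ N := by
      calc (U : ℝ) ^ 2 * (U + 1) ≤ (2 * R ^ (5 / 9 : ℝ)) ^ 2 * (3 * R ^ (5 / 9 : ℝ)) := by
            gcongr; linarith
        _ = 12 * (R ^ (5 / 9 : ℝ)) ^ 3 := by ring
        _ = 12 * R ^ (15 / 9 : ℝ) := by
            rw [← Real.rpow_natCast, ← Real.rpow_mul hR0.le]; norm_num
        _ ≤ 12 * R ^ (11 / 6 : ℝ) := by
            gcongr 12 * ?_
            exact Real.rpow_le_rpow_of_exponent_le hR1 (by norm_num)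
        _ ≤ N := by linarith
    exact_mod_cast h1
  have hK : (1 : ℝ) ≤ (2 ^ k) ^ 2 := one_le_pow₀ (one_le_pow₀ (by norm_num))
  have hUE : (U : ℝ) ≤ 2 * E := by
    have h1 : R ^ (-(1 : ℝ)) ≤ R ^ (-(1 : ℝ) / (2 ^ k) ^ 2) := by
      refine Real.rpow_le_rpow_of_exponent_le hR1 ?_
      rw [neg_div, neg_le_neg_iff, div_le_iff₀ (by linarith)]
      linarith
    have h2 : R ^ (5 / 9 : ℝ) ≤ E := by
      calc R ^ (5 / 9 : ℝ) ≤ R ^ (11 / 6 + -1 : ℝ) :=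
            Real.rpow_le_rpow_of_exponent_le hR1 (by norm_num)
        _ = R ^ (11 / 6 : ℝ) * R ^ (-1 : ℝ) := Real.rpow_add hR0 _ _
        _ ≤ E := mul_le_mul (by linarith) h1 (by positivity) (by positivity)
    linarith
  have hp2 := pl_nonneg C₂ hL
  have hp1 := pl_nonneg C₁ hL
  have hmain := norm_sum_vonMangoldt_le (N := N) (U := U)
    (F := fun n : ℕ => if n ≤ N' ∧ n.Coprime q then eAdd (α * (n : ℝ) ^ (k + 1)) else 0)
    (B₁ := pl C₁ (lg N) * E) (B₂ := 2 * lg N * (pl C₂ (lg N) * E))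
    (fun n => by
      split_ifs
      · rw [norm_eAdd]
      · rw [norm_zero]; exact zero_le_one) (by positivity) hUpos hUN
    (fun t => hC₁ N N' U q a α β R hq hco hα hR hRN hU2 t)
    (fun M h1 h2 u v hu hv => hC₂ N N' U q a α β R hq hco hα hR (by linarith) hN' hU1 M h1 h2
      u v hu hv)
  refine hmain.trans ?_
  have e0 := hD₀ (lg N) hL
  have e1 := hD₁ (lg N) hL
  have e2 := hD₂ (lg N) hL
  have m1 := pl_mul_le D₁ C₁ hL
  have m2 := pl_mul_le D₂ C₂ hL
  have a1 := pl_add_le D₀ (D₁ * C₁ + D₁ + C₁) hL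
  have a2 := pl_add_le (D₀ + (D₁ * C₁ + D₁ + C₁) + 1) (D₂ * C₂ + D₂ + C₂) hL
  have h1 : lg N * U ≤ pl D₀ (lg N) * E := by
    calc lg N * U ≤ lg N * (2 * E) := by gcongr
      _ = 2 * lg N ^ 1 * E := by ring
      _ ≤ _ := by gcongr
  have h2 : 3 * lg N * (pl C₁ (lg N) * E) ≤ pl (D₁ * C₁ + D₁ + C₁) (lg N) * E := by
    calc 3 * lg N * (pl C₁ (lg N) * E) = 3 * lg N ^ 1 * pl C₁ (lg N) * E := by ring
      _ ≤ pl D₁ (lg N) * pl C₁ (lg N) * E := by gcongr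
      _ ≤ _ := by gcongr
  have h3 : 4 * lg N ^ 2 * (2 * lg N * (pl C₂ (lg N) * E)) ≤
      pl (D₂ * C₂ + D₂ + C₂) (lg N) * E := by
    calc 4 * lg N ^ 2 * (2 * lg N * (pl C₂ (lg N) * E)) = 8 * lg N ^ 3 * pl C₂ (lg N) * E := by
          ring
      _ ≤ pl D₂ (lg N) * pl C₂ (lg N) * E := by gcongr
      _ ≤ _ := by gcongr
  calc _ ≤ pl D₀ (lg N) * E + pl (D₁ * C₁ + D₁ + C₁) (lg N) * E +
        pl (D₂ * C₂ + D₂ + C₂) (lg N) * E := by linarith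
    _ = (pl D₀ (lg N) + pl (D₁ * C₁ + D₁ + C₁) (lg N) + pl (D₂ * C₂ + D₂ + C₂) (lg N)) * E := by
        ring
    _ ≤ _ := mul_le_mul_of_nonneg_right (by linarith) hE0

/-- Partial summation: an Abel-type identity in increment form. -/
theorem sum_Icc_mul_eq_abel (w : ℕ → ℝ) (g : ℕ → ℂ) (s m : ℕ) (hm : s ≤ m) :
    ∑ n ∈ Icc s m, (w n : ℂ) * g n = w m * ∑ n ∈ Icc s m, g n +
      ∑ n ∈ Ico s m, ((w n - w (n + 1) : ℝ) : ℂ) * ∑ l ∈ Icc s n, g l := by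
  induction m, hm using Nat.le_induction with
  | base => simp
  | succ m hm ih =>
    rw [← insert_Icc_right_eq_Icc_add_one (by omega : s ≤ m + 1), sum_insert (by simp),
      sum_insert (by simp), ih, sum_Ico_succ_top hm]
    push_cast
    ring

theorem norm_sum_mul_le_of_antitone {w : ℕ → ℝ} {g : ℕ → ℂ} {s m : ℕ} {T : ℝ} (hm : s ≤ m)
    (hw : ∀ n, s ≤ n → w (n + 1) ≤ w n) (hw0 : ∀ n, s ≤ n → 0 ≤ w n)
    (hT : ∀ n ≤ m, ‖∑ l ∈ Icc s n, g l‖ ≤ T) :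
    ‖∑ n ∈ Icc s m, (w n : ℂ) * g n‖ ≤ w s * T := by
  rw [sum_Icc_mul_eq_abel w g s m hm]
  have h1 : ‖(w m : ℂ) * ∑ n ∈ Icc s m, g n‖ ≤ w m * T := by
    rw [norm_mul, Complex.norm_real, Real.norm_of_nonneg (hw0 m hm)]
    exact mul_le_mul_of_nonneg_left (hT m le_rfl) (hw0 m hm)
  have h2 : ‖∑ n ∈ Ico s m, ((w n - w (n + 1) : ℝ) : ℂ) * ∑ l ∈ Icc s n, g l‖ ≤
      ∑ n ∈ Ico s m, (w n - w (n + 1)) * T := by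
    refine (norm_sum_le _ _).trans (sum_le_sum fun n hn => ?_)
    rw [mem_Ico] at hn
    have h := sub_nonneg.2 (hw n hn.1)
    rw [norm_mul, Complex.norm_real, Real.norm_of_nonneg h]
    exact mul_le_mul_of_nonneg_left (hT n hn.2.le) h
  have h3 : ∑ n ∈ Ico s m, (w n - w (n + 1)) = w s - w m := by
    rw [← neg_inj, ← sum_neg_distrib, neg_sub, ← sum_Ico_sub w hm]
    exact sum_congr rfl fun n _ => by ring
  rw [← sum_mul, h3] at h2
  refine (norm_add_le _ _).trans ?_
  linarith

theorem sum_Icc_vonMangoldt_not_prime_le (N : ℕ) (hN : 1 ≤ N) :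
    ∑ n ∈ Icc 1 N with ¬ n.Prime, ArithmeticFunction.vonMangoldt n ≤
      2 * lg N * (N : ℝ) ^ (1 / 2 : ℝ) := by
  have h := Chebyshev.psi_sub_theta_le (x := N) (by exact_mod_cast hN)
  rw [Chebyshev.psi_sub_theta_eq_sum_not_prime, Nat.floor_natCast, Real.sqrt_eq_rpow] at h
  have h1 : Ioc 0 N = Icc 1 N := by ext x; simp [Nat.succ_le_iff]
  rw [h1] at h
  have h2 : 0 ≤ (N : ℝ) ^ (1 / 2 : ℝ) := by positivity
  have h3 : Real.log N ≤ lg N := by unfold lg; linarith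
  nlinarith

theorem sum_log_prime_not_coprime_le (N q : ℕ) (hq : 1 ≤ q) :
    ∑ n ∈ Icc 1 N with n.Prime ∧ ¬ n.Coprime q, Real.log n ≤ Real.log q := by
  have h1 : ∑ n ∈ Icc 1 N with n.Prime ∧ ¬ n.Coprime q, Real.log n ≤
      ∑ n ∈ q.primeFactors, Real.log n := by
    refine sum_le_sum_of_subset_of_nonneg (fun n hn => ?_) fun n _ _ => Real.log_natCast_nonneg n
    rw [mem_filter] at hn
    rw [Nat.mem_primeFactors]
    exact ⟨hn.2.1, by_contra fun h => hn.2.2 ((Nat.Prime.coprime_iff_not_dvd hn.2.1).2 h),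
      by omega⟩
  refine h1.trans ?_
  have hpos : ∀ n ∈ q.primeFactors, (n : ℝ) ≠ 0 := fun n hn => by
    exact_mod_cast (Nat.prime_of_mem_primeFactors hn).ne_zero
  rw [← Real.log_prod hpos, ← Nat.cast_prod]
  refine Real.log_le_log ?_ ?_
  · exact_mod_cast Nat.pos_of_ne_zero (prod_ne_zero_iff.2 fun n hn =>
      (Nat.prime_of_mem_primeFactors hn).ne_zero)
  · exact_mod_cast Nat.le_of_dvd hq (Nat.prod_primeFactors_dvd q)

theorem norm_primePowerExpSum_le {k N : ℕ} {α T : ℝ} (hN : 2 ≤ N)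
    (hT : ∀ n ≤ N, ‖∑ p ∈ Icc 1 n with p.Prime, (Real.log p : ℂ) * eAdd (α * (p : ℝ) ^ k)‖ ≤ T) :
    ‖primePowerExpSum k N α‖ ≤ 2 * T := by
  set g : ℕ → ℂ := fun p => if p.Prime then (Real.log p : ℂ) * eAdd (α * (p : ℝ) ^ k) else 0
    with hg
  have hsum : ∀ n : ℕ, ∑ p ∈ Icc 1 n with p.Prime, (Real.log p : ℂ) * eAdd (α * (p : ℝ) ^ k) =
      ∑ p ∈ Icc 2 n, g p := by
    intro n
    rw [hg, ← sum_filter]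
    refine sum_congr ?_ fun _ _ => rfl
    ext p
    rw [mem_filter, mem_filter, mem_Icc, mem_Icc]
    exact ⟨fun h => ⟨⟨h.2.two_le, h.1.2⟩, h.2⟩, fun h => ⟨⟨by omega, h.1.2⟩, h.2⟩⟩
  have heq : primePowerExpSum k N α = ∑ n ∈ Icc 2 N, ((1 / Real.log n : ℝ) : ℂ) * g n := by
    unfold primePowerExpSum
    have h1 : (range (N + 1)).filter Nat.Prime = (Icc 2 N).filter Nat.Prime := by
      ext p
      rw [mem_filter, mem_filter, mem_range, mem_Icc]
      exact ⟨fun h => ⟨⟨h.2.two_le, by omega⟩, h.2⟩, fun h => ⟨by omega, h.2⟩⟩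
    rw [h1, sum_filter]
    refine sum_congr rfl fun p hp => ?_
    rw [hg]
    dsimp only
    split_ifs with hpp
    · have : (Real.log p : ℂ) ≠ 0 := by
        have := Real.log_pos (x := p) (by exact_mod_cast hpp.one_lt)
        exact_mod_cast this.ne'
      rw [Complex.ofReal_div, Complex.ofReal_one, ← mul_assoc, one_div_mul_cancel this, one_mul]
    · rw [mul_zero]
  have hlog : ∀ n : ℕ, 2 ≤ n → 0 < Real.log n := fun n hn =>
    Real.log_pos (by exact_mod_cast (by omega : 1 < n))
  have hT0 : 0 ≤ T := (norm_nonneg _).trans (hT 0 (Nat.zero_le _))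
  rw [heq]
  refine (norm_sum_mul_le_of_antitone (w := fun n : ℕ => 1 / Real.log n) (T := T) hN
    (fun n hn => ?_) (fun n hn => ?_) fun n hn => ?_).trans ?_
  · refine one_div_le_one_div_of_le (hlog n hn) (Real.log_le_log ?_ ?_)
    · exact_mod_cast (by omega : 0 < n)
    · exact_mod_cast n.le_succ
  · have := hlog n hn
    positivity
  · rw [← hsum]; exact hT n hn
  · refine mul_le_mul_of_nonneg_right ?_ hT0
    have := Real.log_two_gt_d9
    rw [Nat.cast_ofNat, div_le_iff₀ (by linarith)]
    linarith

/-- Passing from a von Mangoldt sum restricted to integers coprime to `q` to a sum over primes. -/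
theorem norm_sum_log_prime_le {N n q : ℕ} (hn : n ≤ N) (hN : 1 ≤ N) (hq : 1 ≤ q) (hqN : q ≤ N)
    {e : ℕ → ℂ} (he : ∀ m, ‖e m‖ ≤ 1) {B : ℝ}
    (hB : ‖∑ m ∈ Icc 1 N, (ArithmeticFunction.vonMangoldt m : ℂ) *
      (if m ≤ n ∧ m.Coprime q then e m else 0)‖ ≤ B) :
    ‖∑ p ∈ Icc 1 n with p.Prime, (Real.log p : ℂ) * e p‖ ≤
      B + 3 * lg N * (N : ℝ) ^ (1 / 2 : ℝ) := by
  have hext : ∑ p ∈ Icc 1 n with p.Prime, (Real.log p : ℂ) * e p =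
      ∑ m ∈ Icc 1 N, if m ≤ n ∧ m.Prime then (Real.log m : ℂ) * e m else 0 := by
    rw [← sum_filter]
    refine sum_congr ?_ fun _ _ => rfl
    ext p
    rw [mem_filter, mem_filter, mem_Icc, mem_Icc]
    exact ⟨fun h => ⟨⟨h.1.1, by omega⟩, h.1.2, h.2⟩, fun h => ⟨⟨h.1.1, h.2.1⟩, h.2.2⟩⟩
  have hdiff : ‖∑ p ∈ Icc 1 n with p.Prime, (Real.log p : ℂ) * e p -
      ∑ m ∈ Icc 1 N, (ArithmeticFunction.vonMangoldt m : ℂ) *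
        (if m ≤ n ∧ m.Coprime q then e m else 0)‖ ≤
      ∑ m ∈ Icc 1 N, ((if ¬ m.Prime then ArithmeticFunction.vonMangoldt m else 0) +
        (if m.Prime ∧ ¬ m.Coprime q then Real.log m else 0)) := by
    rw [hext, ← sum_sub_distrib]
    refine (norm_sum_le _ _).trans (sum_le_sum fun m hm => ?_)
    have hΛ : 0 ≤ ArithmeticFunction.vonMangoldt m := ArithmeticFunction.vonMangoldt_nonneg
    have hlog : 0 ≤ Real.log m := Real.log_natCast_nonneg m
    have hmul : ∀ x : ℝ, 0 ≤ x → ‖(x : ℂ) * e m‖ ≤ x := fun x hx => by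
      rw [norm_mul, Complex.norm_real, Real.norm_of_nonneg hx]
      exact mul_le_of_le_one_right hx (he m)
    by_cases hp : m.Prime
    · rw [ArithmeticFunction.vonMangoldt_apply_prime hp]
      have hl := hmul _ hlog
      generalize Real.log m = x at hlog hl
      rcases Classical.propComplete (m.Coprime q) with hc | hc <;> by_cases hmn : m ≤ n <;>
        simp only [hp, hc, hmn, and_true, and_false, true_and, false_and, neg_zero,
          not_true_eq_false, not_false_eq_true, if_true, if_false, mul_zero, sub_self, sub_zero,
          zero_sub, norm_zero, norm_neg, add_zero, zero_add, le_refl] <;>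
        first | exact hl | exact hlog
    · have hl := hmul _ hΛ
      rcases Classical.propComplete (m.Coprime q) with hc | hc <;> by_cases hmn : m ≤ n <;>
        simp only [hp, hc, hmn, and_true, and_false, true_and, false_and, neg_zero,
          not_true_eq_false, not_false_eq_true, if_true, if_false, mul_zero, sub_self, sub_zero,
          zero_sub, norm_zero, norm_neg, add_zero, zero_add, le_refl] <;>
        first | exact hl | exact hΛ
  rw [sum_add_distrib, ← sum_filter, ← sum_filter] at hdiff
  have h1 := sum_Icc_vonMangoldt_not_prime_le N hN
  have h2 := sum_log_prime_not_coprime_le N q hq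
  have h3 : Real.log q ≤ lg N := by
    have : Real.log q ≤ Real.log N :=
      Real.log_le_log (by exact_mod_cast hq) (by exact_mod_cast hqN)
    unfold lg; linarith
  have h4 : (1 : ℝ) ≤ (N : ℝ) ^ (1 / 2 : ℝ) :=
    Real.one_le_rpow (by exact_mod_cast hN) (by norm_num)
  have h5 := lg_pos N
  have h6 : lg N ≤ lg N * (N : ℝ) ^ (1 / 2 : ℝ) := le_mul_of_one_le_right h5.le h4
  have h7 := norm_le_norm_add_norm_sub' (∑ p ∈ Icc 1 n with p.Prime, (Real.log p : ℂ) * e p)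
    (∑ m ∈ Icc 1 N, (ArithmeticFunction.vonMangoldt m : ℂ) *
        (if m ≤ n ∧ m.Coprime q then e m else 0))
  linarith

theorem inv_le_of_two_approx {α β R P : ℝ} {a a₀ : ℤ} {q q₀ : ℕ} (hq : 1 ≤ q) (hq₀ : 1 ≤ q₀)
    (hco₀ : IsCoprime a₀ (q₀ : ℤ)) (hP : 0 < P)
    (hα : α = a / q + β) (hR : R = q * (1 + |β| * P)) (h₀ : |α - a₀ / q₀| ≤ 1 / (q₀ : ℝ) ^ 2) :
    R⁻¹ ≤ 2 * ((q₀ : ℝ)⁻¹ + q₀ * P⁻¹) := by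
  have hq' : (0 : ℝ) < q := by exact_mod_cast hq
  have hq₀' : (0 : ℝ) < q₀ := by exact_mod_cast hq₀
  have hqR : (q : ℝ) ≤ R := by
    rw [hR]; exact le_mul_of_one_le_right hq'.le (le_add_of_nonneg_right (by positivity))
  have hR0 : 0 < R := by linarith
  have hi1 : 0 < (q₀ : ℝ)⁻¹ := by positivity
  have hi2 : 0 < q₀ * P⁻¹ := by positivity
  rcases le_or_gt (q₀ : ℝ) (2 * q) with h | h
  · have : R⁻¹ ≤ ((q₀ : ℝ) / 2)⁻¹ := inv_anti₀ (by positivity) (by linarith)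
    rw [inv_div, div_eq_mul_inv] at this
    linarith
  · have hne : a * q₀ - a₀ * q ≠ 0 := by
      intro h0
      have h1 : (q₀ : ℤ) ∣ a₀ * q := ⟨a, by linarith⟩
      have h2 : (q₀ : ℤ) ∣ q := hco₀.symm.dvd_of_dvd_mul_left h1
      have h3 : q₀ ≤ q := Nat.le_of_dvd hq (by exact_mod_cast h2)
      have h4 : (q₀ : ℝ) ≤ q := by exact_mod_cast h3
      linarith
    have h1 : (1 : ℝ) ≤ |(a : ℝ) * q₀ - a₀ * q| := by
      have := Int.one_le_abs hne
      exact_mod_cast this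
    have h2 : 1 / ((q : ℝ) * q₀) ≤ |β| + 1 / (q₀ : ℝ) ^ 2 := by
      have h3 : (a : ℝ) / q - a₀ / q₀ = (a * q₀ - a₀ * q) / (q * q₀) := by field_simp
      have h4 : 1 / ((q : ℝ) * q₀) ≤ |(a : ℝ) / q - a₀ / q₀| := by
        rw [h3, abs_div, abs_of_pos (mul_pos hq' hq₀')]
        gcongr
      have h5 : (a : ℝ) / q - a₀ / q₀ = -β + (α - a₀ / q₀) := by rw [hα]; ring
      rw [h5] at h4
      have := abs_add_le (-β) (α - a₀ / q₀)
      rw [abs_neg] at this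
      linarith
    have h3 : 1 / (q₀ : ℝ) ^ 2 ≤ 1 / (2 * (q * q₀)) := by
      refine one_div_le_one_div_of_le (by positivity) ?_
      nlinarith
    have h4 : 1 / (2 * ((q : ℝ) * q₀)) = 1 / ((q : ℝ) * q₀) / 2 := by
      rw [div_div, mul_comm (2 : ℝ)]
    have h5 : 1 / ((q : ℝ) * q₀) / 2 ≤ |β| := by linarith
    have h6 : P / (2 * q₀) ≤ R := by
      calc P / (2 * q₀) = q * (1 / ((q : ℝ) * q₀) / 2 * P) := by field_simp
        _ ≤ q * (1 + |β| * P) := by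
            refine mul_le_mul_of_nonneg_left ?_ hq'.le
            have := mul_le_mul_of_nonneg_right h5 hP.le
            linarith
        _ = R := hR.symm
    have h7 : R⁻¹ ≤ (P / (2 * q₀))⁻¹ := inv_anti₀ (by positivity) h6
    rw [inv_div, div_eq_mul_inv] at h7
    linarith

theorem sum_Icc_restrict {N n : ℕ} (hn : n ≤ N) (w : ℕ → ℂ) (e : ℕ → ℂ) :
    ∑ m ∈ Icc 1 N, w m * (if m ≤ n ∧ m.Coprime 1 then e m else 0) =
      ∑ m ∈ Icc 1 n, w m * e m := by
  simp only [Nat.coprime_one_right_eq_true, and_true, mul_ite, mul_zero]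
  rw [← sum_filter]
  refine sum_congr ?_ fun _ _ => rfl
  ext p
  rw [mem_filter, mem_Icc, mem_Icc]
  omega

theorem mul_rpow_le_of_le {x R b : ℝ} (hx : 1 ≤ x) (hb : 0 ≤ b) (hR : 0 ≤ R)
    (hRx : R ≤ 2 * x ^ (1 / 2 + 1 / 40 : ℝ)) (hbx : b * 4 ≤ x ^ (9 / 240 : ℝ)) :
    b * R ^ (11 / 6 : ℝ) ≤ x := by
  have hx0 : 0 < x := by linarith
  have h4 : (2 : ℝ) ^ (11 / 6 : ℝ) ≤ 4 := by
    calc (2 : ℝ) ^ (11 / 6 : ℝ) ≤ 2 ^ (2 : ℝ) :=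
          Real.rpow_le_rpow_of_exponent_le (by norm_num) (by norm_num)
      _ = 4 := by norm_num
  have hR' : R ^ (11 / 6 : ℝ) ≤ 4 * x ^ (231 / 240 : ℝ) := by
    calc R ^ (11 / 6 : ℝ) ≤ (2 * x ^ (1 / 2 + 1 / 40 : ℝ)) ^ (11 / 6 : ℝ) :=
          Real.rpow_le_rpow hR hRx (by norm_num)
      _ = (2 : ℝ) ^ (11 / 6 : ℝ) * x ^ (231 / 240 : ℝ) := by
          rw [Real.mul_rpow (by norm_num) (by positivity), ← Real.rpow_mul hx0.le]
          norm_num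
      _ ≤ _ := mul_le_mul_of_nonneg_right h4 (by positivity)
  calc b * R ^ (11 / 6 : ℝ) ≤ b * (4 * x ^ (231 / 240 : ℝ)) := mul_le_mul_of_nonneg_left hR' hb
    _ = b * 4 * x ^ (231 / 240 : ℝ) := by ring
    _ ≤ x ^ (9 / 240 : ℝ) * x ^ (231 / 240 : ℝ) :=
        mul_le_mul_of_nonneg_right hbx (by positivity)
    _ = x := by rw [← Real.rpow_add hx0]; norm_num

set_option maxHeartbeats 600000 in
theorem exists_primePowerExpSum_bound (j : ℕ) (hj : 1 ≤ j) : ∃ C : ℕ,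
    ∀ᶠ N : ℕ in Filter.atTop, ∀ (α : ℝ) (a₀ : ℤ) (q₀ : ℕ), 1 ≤ q₀ → IsCoprime a₀ (q₀ : ℤ) →
      |α - a₀ / q₀| ≤ 1 / (q₀ : ℝ) ^ 2 →
      ‖primePowerExpSum (j + 1) N α‖ ≤ pl C (lg N) * (N * ((q₀ : ℝ)⁻¹ + (N : ℝ) ^ (-(1 : ℝ) / 2) +
        q₀ * ((N : ℝ) ^ (j + 1))⁻¹) ^ ((1 : ℝ) / (2 ^ j) ^ 2)) := by
  obtain ⟨C₁, hC₁⟩ := exists_minor_arc_bound j hj (ω := 1 / 40) (by norm_num) (by norm_num)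
  obtain ⟨C₂, hC₂⟩ := exists_major_vonMangoldt j hj
  obtain ⟨D, hD⟩ := exists_pl_const 6 1
  obtain ⟨E₁, hE₁⟩ := exists_pl_affine 0 4 C₁
  obtain ⟨E₂, hE₂⟩ := exists_pl_affine 0 4 C₂
  obtain ⟨E, hE⟩ : ∃ E, E = E₁ + E₂ := ⟨_, rfl⟩
  refine ⟨E + D + 1, ?_⟩
  filter_upwards [hC₁, eventually_le_rpow (ε := 9 / 240) (by norm_num)
    (8 * ((j + 1).factorial : ℝ) * 4), Filter.eventually_ge_atTop 2]
    with N hB hfac hN α a₀ q₀ hq₀ hco₀ h₀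
  have hL := one_le_lg N
  have hN1 : (1 : ℝ) ≤ N := by exact_mod_cast (by omega : 1 ≤ N)
  have hN0 : (0 : ℝ) < N := by linarith
  obtain ⟨s, hs⟩ : ∃ s : ℝ, s = (1 : ℝ) / (2 ^ j) ^ 2 := ⟨_, rfl⟩
  have hK : (1 : ℝ) ≤ (2 ^ j) ^ 2 := one_le_pow₀ (one_le_pow₀ (by norm_num))
  have hs0 : 0 ≤ s := by rw [hs]; positivity
  have hs1 : s ≤ 1 := by rw [hs, div_le_one (by linarith)]; exact hK
  set P : ℝ := (N : ℝ) ^ (j + 1) with hP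
  have hP0 : 0 < P := by positivity
  set V : ℝ := (N : ℝ) ^ (1 / 2 + 1 / 40 : ℝ) with hV
  have hV1 : 1 ≤ V := Real.one_le_rpow hN1 (by norm_num)
  have hVN : V ≤ N := by
    calc V ≤ (N : ℝ) ^ (1 : ℝ) := Real.rpow_le_rpow_of_exponent_le hN1 (by norm_num)
      _ = N := Real.rpow_one _
  have hNP : (N : ℝ) ≤ P := le_self_pow₀ hN1 (by omega)
  set Δ : ℝ := (q₀ : ℝ)⁻¹ + (N : ℝ) ^ (-(1 : ℝ) / 2) + q₀ * P⁻¹ with hΔ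
  have hq₀' : (0 : ℝ) < q₀ := by exact_mod_cast hq₀
  have hh0 : 0 < (N : ℝ) ^ (-(1 : ℝ) / 2) := by positivity
  have hΔ1 : (N : ℝ) ^ (-(1 : ℝ) / 2) ≤ Δ := by
    have h1 : 0 < (q₀ : ℝ)⁻¹ := by positivity
    have h2 : 0 < q₀ * P⁻¹ := by positivity
    rw [hΔ]; linarith
  have hΔ2 : (q₀ : ℝ)⁻¹ + q₀ * P⁻¹ ≤ Δ := by rw [hΔ]; linarith
  have hΔ0 : 0 < Δ := by linarith
  have hΔs : (N : ℝ) ^ (-(1 : ℝ) / 2) ≤ Δ ^ s := by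
    calc (N : ℝ) ^ (-(1 : ℝ) / 2) ≤ ((N : ℝ) ^ (-(1 : ℝ) / 2)) ^ s := by
          rw [← Real.rpow_mul hN0.le]
          refine Real.rpow_le_rpow_of_exponent_le hN1 ?_
          linarith
      _ ≤ Δ ^ s := Real.rpow_le_rpow hh0.le hΔ1 hs0
  have hsqrt : (N : ℝ) ^ (1 / 2 : ℝ) ≤ N * Δ ^ s := by
    calc (N : ℝ) ^ (1 / 2 : ℝ) = (N : ℝ) ^ (1 + -(1 : ℝ) / 2) := by norm_num
      _ = N * (N : ℝ) ^ (-(1 : ℝ) / 2) := by rw [Real.rpow_add hN0, Real.rpow_one]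
      _ ≤ _ := by gcongr
  have hX0 : 0 ≤ N * Δ ^ s := by positivity
  rw [← hs]
  have hplD := hD (lg N) hL
  have hadd := pl_add_le E D hL
  have hpl1 := pl_nonneg C₁ hL
  have hpl2 := pl_nonneg C₂ hL
  have finish : ∀ (C' : ℕ) (q : ℕ), 1 ≤ q → q ≤ N → 4 * pl C' (lg N) ≤ pl E (lg N) →
      (∀ n ≤ N, ‖∑ m ∈ Icc 1 N, (ArithmeticFunction.vonMangoldt m : ℂ) *
        (if m ≤ n ∧ m.Coprime q then eAdd (α * (m : ℝ) ^ (j + 1)) else 0)‖ ≤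
        pl C' (lg N) * (2 * (N * Δ ^ s))) →
      ‖primePowerExpSum (j + 1) N α‖ ≤ pl (E + D + 1) (lg N) * (N * Δ ^ s) := by
    intro C' q hq hqN hC' hb
    have h1 := norm_primePowerExpSum_le (k := j + 1) (α := α) hN fun n hn =>
      norm_sum_log_prime_le (N := N) hn (by omega) hq hqN
        (e := fun m : ℕ => eAdd (α * (m : ℝ) ^ (j + 1))) (fun m => (norm_eAdd _).le) (hb n hn)
    refine h1.trans ?_
    have h2 : lg N * (N : ℝ) ^ (1 / 2 : ℝ) ≤ lg N * (N * Δ ^ s) := by gcongr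
    calc 2 * (pl C' (lg N) * (2 * (N * Δ ^ s)) + 3 * lg N * (N : ℝ) ^ (1 / 2 : ℝ)) ≤
          (4 * pl C' (lg N) + 6 * lg N ^ 1) * (N * Δ ^ s) := by rw [pow_one]; nlinarith
      _ ≤ _ := mul_le_mul_of_nonneg_right (by linarith) hX0
  have hQ1 : 1 ≤ P / V := by rw [le_div_iff₀ (by linarith)]; linarith
  obtain ⟨x, hx1, hx2⟩ := Real.exists_rat_abs_sub_le_and_den_le α (n := ⌊P / V⌋₊)
    (Nat.floor_pos.2 hQ1)
  obtain ⟨q, hqdef⟩ : ∃ q, q = x.den := ⟨_, rfl⟩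
  obtain ⟨a, hadef⟩ : ∃ a, a = x.num := ⟨_, rfl⟩
  have hq : 1 ≤ q := by rw [hqdef]; exact x.den_pos
  have hco : IsCoprime a (q : ℤ) := by
    rw [hqdef, hadef, Int.isCoprime_iff_gcd_eq_one]; exact x.reduced
  have hqr : (1 : ℝ) ≤ q := by exact_mod_cast hq
  rw [Rat.cast_def, ← hqdef, ← hadef] at hx1
  rw [← hqdef] at hx2
  have hqQ : (q : ℝ) ≤ P / V := (Nat.cast_le.2 hx2).trans (Nat.floor_le (by positivity))
  have happ : |α - a / q| ≤ 1 / (P / V * q) := by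
    refine hx1.trans (one_div_le_one_div_of_le (by positivity) ?_)
    have := (Nat.lt_floor_add_one (P / V)).le
    gcongr
  rcases le_or_gt V q with hqV | hqV
  · refine finish C₁ 1 le_rfl (by omega) ?_ fun n hn => ?_
    · have := hE₁ (lg N) hL
      have h2 : pl E₁ (lg N) ≤ pl E (lg N) := pl_mono (by omega) hL
      linarith
    · rw [sum_Icc_restrict hn]
      refine (hB α a q ⟨hq, hco, happ.trans (one_div_le_one_div_of_le (by positivity) ?_)⟩ hqV ?_
        n hn).trans ?_
      · rw [sq]; gcongr
      · rwa [le_div_iff₀ (by linarith)] at hqQ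
      · refine mul_le_mul_of_nonneg_left ?_ hpl1
        have : (N : ℝ) ^ (-(1 : ℝ) / (2 * (2 ^ j) ^ 2)) ≤ Δ ^ s := by
          calc (N : ℝ) ^ (-(1 : ℝ) / (2 * (2 ^ j) ^ 2)) = ((N : ℝ) ^ (-(1 : ℝ) / 2)) ^ s := by
                rw [← Real.rpow_mul hN0.le, hs, div_mul_div_comm, mul_one]
            _ ≤ _ := Real.rpow_le_rpow hh0.le hΔ1 hs0
        have h3 : (N : ℝ) * (N : ℝ) ^ (-(1 : ℝ) / (2 * (2 ^ j) ^ 2)) ≤ N * Δ ^ s := by gcongr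
        linarith
  · obtain ⟨β, hβ⟩ : ∃ β, β = α - a / q := ⟨_, rfl⟩
    have hα : α = a / q + β := by rw [hβ]; ring
    obtain ⟨R, hR⟩ : ∃ R, R = q * (1 + |β| * P) := ⟨_, rfl⟩
    have hRV : R ≤ 2 * V := by
      rw [← hβ] at happ
      have : q * (|β| * P) ≤ V := by
        calc q * (|β| * P) ≤ q * (1 / (P / V * q) * P) := by gcongr
          _ = V := by field_simp
      rw [hR]; linarith
    have hR1 : 1 ≤ R := by
      rw [hR]
      have : 0 ≤ |β| * P := by positivity
      nlinarith
    have hR0 : 0 < R := by linarith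
    have hcond : 8 * (j + 1).factorial * R ^ (11 / 6 : ℝ) ≤ N := by
      exact mul_rpow_le_of_le hN1 (by positivity) hR0.le hRV hfac
    have hqN : q ≤ N := by
      have : (q : ℝ) ≤ N := by linarith
      exact_mod_cast this
    have hRs : R ^ (-(1 : ℝ) / (2 ^ j) ^ 2) ≤ 2 * Δ ^ s := by
      have h1 := inv_le_of_two_approx hq hq₀ hco₀ hP0 hα hR h₀
      have h2 : R⁻¹ ≤ 2 * Δ := by linarith
      calc R ^ (-(1 : ℝ) / (2 ^ j) ^ 2) = (R⁻¹) ^ s := by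
            rw [neg_div, ← hs, Real.rpow_neg hR0.le, Real.inv_rpow hR0.le]
        _ ≤ (2 * Δ) ^ s := Real.rpow_le_rpow (by positivity) h2 hs0
        _ = 2 ^ s * Δ ^ s := Real.mul_rpow (by norm_num) hΔ0.le
        _ ≤ 2 ^ (1 : ℝ) * Δ ^ s := by
            gcongr
            norm_num
        _ = _ := by rw [Real.rpow_one]
    refine finish C₂ q hq hqN ?_ fun n hn => ?_
    · have := hE₂ (lg N) hL
      have h2 : pl E₂ (lg N) ≤ pl E (lg N) := pl_mono (by omega) hL
      linarith
    · refine (hC₂ N n q a α β R hq hco hα hR hcond hn).trans ?_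
      refine mul_le_mul_of_nonneg_left ?_ hpl2
      calc (N : ℝ) * R ^ (-(1 : ℝ) / (2 ^ j) ^ 2) ≤ N * (2 * Δ ^ s) := by gcongr
        _ = _ := by ring

theorem norm_primePowerExpSum_le_self (k N : ℕ) (α : ℝ) : ‖primePowerExpSum k N α‖ ≤ N := by
  unfold primePowerExpSum
  refine (norm_sum_le _ _).trans ?_
  simp only [norm_eAdd, sum_const, nsmul_eq_mul, mul_one]
  have h : (range (N + 1)).filter Nat.Prime ⊆ Icc 1 N := fun p hp => by
    rw [mem_filter, mem_range] at hp
    rw [mem_Icc]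
    exact ⟨hp.2.one_le, by omega⟩
  have := card_le_card h
  rw [Nat.card_Icc, Nat.add_sub_cancel] at this
  exact_mod_cast this

theorem harman_exponential_sum_bound :
    ∀ k : ℕ, 2 ≤ k → ∃ c : ℝ, 0 < c ∧ ∃ C : ℝ, 0 < C ∧
      ∀ N : ℕ, 2 ≤ N → ∀ α : ℝ, ∀ a : ℤ, ∀ q : ℕ,
        1 ≤ q → q ≤ N ^ k → Int.gcd a q = 1 → |(q : ℝ) * α - (a : ℝ)| < 1 / q →
          ‖primePowerExpSum k N α‖ ≤ C * (N : ℝ) * Real.log N ^ c *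
            ((q : ℝ)⁻¹ + (N : ℝ) ^ (-(1:ℝ)/2) + (q : ℝ) * (N : ℝ) ^ (-(k : ℝ)))
              ^ ((4 : ℝ) ^ (1 - (k : ℝ))) := by
  intro k hk
  obtain ⟨j, rfl⟩ : ∃ j, k = j + 1 := ⟨k - 1, by omega⟩
  obtain ⟨C, hC⟩ := exists_primePowerExpSum_bound j (by omega)
  obtain ⟨N₀, hN₀⟩ := Filter.eventually_atTop.1 hC
  obtain ⟨D, hD⟩ : ∃ D : ℝ, D = (C + 1 + N₀) * 3 ^ (C + 1) := ⟨_, rfl⟩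
  refine ⟨((C + 1 : ℕ) : ℝ), by positivity, D, by rw [hD]; positivity, ?_⟩
  intro N hN α a q hq _ hco hα
  have hN2 : (2 : ℝ) ≤ N := by exact_mod_cast hN
  have hN1 : (1 : ℝ) ≤ N := by linarith
  have hN0 : (0 : ℝ) < N := by linarith
  have hq0 : (0 : ℝ) < q := by exact_mod_cast hq
  have hs : (4 : ℝ) ^ (1 - ((j + 1 : ℕ) : ℝ)) = 1 / (2 ^ j) ^ 2 := by
    have h4 : ((2 : ℝ) ^ j) ^ 2 = 4 ^ j := by rw [← pow_mul, mul_comm, pow_mul]; norm_num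
    have h1 : 1 - ((j + 1 : ℕ) : ℝ) = -(j : ℝ) := by push_cast; ring
    rw [h4, h1, Real.rpow_neg (by norm_num), Real.rpow_natCast, one_div]
  have hK : (1 : ℝ) ≤ (2 ^ j) ^ 2 := one_le_pow₀ (one_le_pow₀ (by norm_num))
  rw [hs, Real.rpow_neg hN0.le, Real.rpow_natCast, Real.rpow_natCast]
  obtain ⟨s, hs'⟩ : ∃ s : ℝ, s = (1 : ℝ) / (2 ^ j) ^ 2 := ⟨_, rfl⟩
  have hs0 : 0 ≤ s := by rw [hs']; positivity
  have hs1 : s ≤ 1 := by rw [hs', div_le_one (by linarith)]; exact hK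
  have happ : |α - a / q| ≤ 1 / (q : ℝ) ^ 2 := by
    have h1 : α - a / q = (q * α - a) / q := by field_simp
    rw [h1, abs_div, abs_of_pos hq0, div_le_iff₀ hq0]
    refine hα.le.trans (le_of_eq ?_)
    field_simp
  have hmain : N₀ ≤ N → _ := fun h => hN₀ N h α a q hq (Int.isCoprime_iff_gcd_eq_one.2 hco) happ
  rw [← hs'] at hmain ⊢
  set Δ : ℝ := (q : ℝ)⁻¹ + (N : ℝ) ^ (-(1 : ℝ) / 2) + q * ((N : ℝ) ^ (j + 1))⁻¹ with hΔ
  have hh0 : 0 < (N : ℝ) ^ (-(1 : ℝ) / 2) := by positivity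
  have hΔ1 : (N : ℝ) ^ (-(1 : ℝ) / 2) ≤ Δ := by
    have h1 : 0 < (q : ℝ)⁻¹ := by positivity
    have h2 : 0 < q * ((N : ℝ) ^ (j + 1))⁻¹ := by positivity
    rw [hΔ]; linarith
  have hΔ0 : 0 < Δ := by linarith
  have hΔs : (N : ℝ)⁻¹ ≤ Δ ^ s := by
    calc (N : ℝ)⁻¹ = (N : ℝ) ^ (-1 : ℝ) := (Real.rpow_neg_one _).symm
      _ ≤ ((N : ℝ) ^ (-(1 : ℝ) / 2)) ^ s := by
          rw [← Real.rpow_mul hN0.le]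
          refine Real.rpow_le_rpow_of_exponent_le hN1 ?_
          linarith
      _ ≤ Δ ^ s := Real.rpow_le_rpow hh0.le hΔ1 hs0
  have hlog : 1 ≤ 2 * Real.log N := by
    have h1 := Real.log_two_gt_d9
    have h2 : Real.log 2 ≤ Real.log N := Real.log_le_log (by norm_num) hN2
    linarith
  have hlg : lg N ≤ 3 * Real.log N := by unfold lg; linarith
  have hlgp : lg N ^ (C + 1) ≤ 3 ^ (C + 1) * Real.log N ^ (C + 1) := by
    rw [← mul_pow]
    exact pow_le_pow_left₀ (lg_pos N).le hlg _
  have hlog0 : 0 ≤ Real.log N := by linarith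
  set W : ℝ := Real.log N ^ (C + 1) with hW
  have hW0 : 0 ≤ W := by positivity
  have hpl : pl C (lg N) ≤ (C + 1) * (3 ^ (C + 1) * W) := by
    unfold pl
    refine mul_le_mul_of_nonneg_left (le_trans ?_ hlgp) (by positivity)
    exact pow_le_pow_right₀ (one_le_lg N) C.le_succ
  have hX0 : 0 ≤ N * Δ ^ s := by positivity
  rcases le_or_gt N₀ N with h | h
  · calc ‖primePowerExpSum (j + 1) N α‖ ≤ pl C (lg N) * (N * Δ ^ s) := hmain h
      _ ≤ (C + 1) * (3 ^ (C + 1) * W) * (N * Δ ^ s) := mul_le_mul_of_nonneg_right hpl hX0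
      _ ≤ (C + 1 + N₀) * (3 ^ (C + 1) * W) * (N * Δ ^ s) :=
          mul_le_mul_of_nonneg_right (mul_le_mul_of_nonneg_right
            (le_add_of_nonneg_right (by positivity)) (by positivity)) hX0
      _ = D * N * W * Δ ^ s := by rw [hD]; ring
  · have hNN : (N : ℝ) ≤ N₀ := by exact_mod_cast h.le
    have h1 : 1 ≤ N * Δ ^ s := by
      calc (1 : ℝ) = N * (N : ℝ)⁻¹ := (mul_inv_cancel₀ hN0.ne').symm
        _ ≤ _ := mul_le_mul_of_nonneg_left hΔs hN0.le
    have h2 : 1 ≤ 3 ^ (C + 1) * W := (one_le_pow₀ (one_le_lg N)).trans hlgp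
    calc ‖primePowerExpSum (j + 1) N α‖ ≤ N := norm_primePowerExpSum_le_self _ _ _
      _ ≤ N₀ * 1 * 1 := by linarith
      _ ≤ (C + 1 + N₀) * (3 ^ (C + 1) * W) * (N * Δ ^ s) := by
          gcongr
          exact le_add_of_nonneg_left (by positivity)
      _ = D * N * W * Δ ^ s := by rw [hD]; ring
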